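/- For every indecomposable representation M of a Dynkin quiver Q and every dimension vector e, the quiver Grassmannian Gr_e(M) has no odd-degree cohomology; in particular its Euler characteristic χ(Gr_e(M)) is nonnegative. -/

import Mathlib

/-!
STATEMENT 14: For every indecomposable representation M of a Dynkin quiver Q over ℂ
and every dimension vector e, the quiver Grassmannian `Gr_e(M)` has no odd-degree
cohomology (with rational coefficients); in particular its Euler characteristic
`χ(Gr_e(M))` is nonnegative.

Quiver Grassmannians carry the classical topology; cohomology is singular cohomology
with rational coefficients; a quiver is Dynkin iff its Tits form is positive
definite; indecomposability is expressed via idempotent endomorphisms.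
-/

noncomputable section
open Matrix

variable {V A : Type}

/-- A complex representation of the quiver `(V, A, s, t)` of dimension vector `d`. -/
abbrev QRep (s t : A → V) (d : V → ℕ) : Type :=
  ∀ a : A, Matrix (Fin (d (t a))) (Fin (d (s a))) ℂ

/-- The quiver Grassmannian `Gr_e(M)`: families of subspaces `N i ⊆ ℂ^{d i}` of
dimension `e i` with `M_a (N (s a)) ⊆ N (t a)` for every arrow. -/
def SubRep (s t : A → V) {d : V → ℕ} (M : QRep s t d) (e : V → ℕ) : Type :=
  {N : ∀ i : V, Submodule ℂ (Fin (d i) → ℂ) //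
    (∀ i, Module.finrank ℂ (N i) = e i) ∧
    ∀ a : A, (N (s a)).map (M a).mulVecLin ≤ N (t a)}

/-- The map `Φ^M_N`, whose cokernel is `Ext¹_Q(N,M)`. -/
def PhiFun (s t : A → V) {e d : V → ℕ} (N : QRep s t e) (M : QRep s t d) :
    (∀ i : V, Matrix (Fin (d i)) (Fin (e i)) ℂ) →
      (∀ a : A, Matrix (Fin (d (t a))) (Fin (e (s a))) ℂ) :=
  fun f a => M a * f (s a) - f (t a) * N a

/-- `Ext¹_Q(N, M) = 0`, expressed as surjectivity of `Φ^M_N` (whose cokernel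
computes `Ext¹` via the standard resolution over the path algebra). -/
def ExtVanish (s t : A → V) {e d : V → ℕ} (N : QRep s t e) (M : QRep s t d) : Prop :=
  Function.Surjective (PhiFun s t N M)

/-- A representation is rigid if `Ext¹_Q(M, M) = 0`. -/
def Rigid (s t : A → V) {d : V → ℕ} (M : QRep s t d) : Prop :=
  ExtVanish s t M M

/-- The Euler form `⟨x,y⟩ = Σ_i x i * y i − Σ_a x (s a) * y (t a)` of the quiver. -/
def eulerForm [Fintype V] [Fintype A] (s t : A → V) (x y : V → ℤ) : ℤ :=
  (∑ i : V, x i * y i) - ∑ a : A, x (s a) * y (t a)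

/-- The quiver is Dynkin (disjoint union of simply-laced Dynkin diagrams), i.e. its
Tits form is positive definite. -/
def IsDynkin [Fintype V] [Fintype A] (s t : A → V) : Prop :=
  ∀ x : V → ℤ, x ≠ 0 → 0 < eulerForm s t x x

/-- Morphisms of representations `X → Y`, given by matrices `φ i` with
`Y_a φ_{s a} = φ_{t a} X_a`. -/
def RHom (s t : A → V) {dX dY : V → ℕ} (X : QRep s t dX) (Y : QRep s t dY) : Type :=
  {φ : ∀ i : V, Matrix (Fin (dY i)) (Fin (dX i)) ℂ //
    ∀ a : A, Y a * φ (s a) = φ (t a) * X a}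

/-- A representation is indecomposable: nonzero, and its only idempotent
endomorphisms are 0 and 1. -/
def Indec (s t : A → V) {d : V → ℕ} (M : QRep s t d) : Prop :=
  (∃ i, 0 < d i) ∧
  ∀ φ : RHom s t M M, (∀ i, φ.1 i * φ.1 i = φ.1 i) →
    (∀ i, φ.1 i = 0) ∨ (∀ i, φ.1 i = 1)

/-- The direct sum of two representations. -/
def dsum (s t : A → V) {d e : V → ℕ} (M : QRep s t d) (N : QRep s t e) :
    QRep s t (fun i => d i + e i) :=
  fun a => Matrix.reindex finSumFinEquiv finSumFinEquiv
    (Matrix.fromBlocks (M a) 0 0 (N a))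

/-- `0 → X → Y → Z → 0` is a short exact sequence of representations. -/
def IsSES (s t : A → V) {dX dY dZ : V → ℕ}
    {X : QRep s t dX} {Y : QRep s t dY} {Z : QRep s t dZ}
    (f : RHom s t X Y) (g : RHom s t Y Z) : Prop :=
  (∀ i, Function.Injective (f.1 i).mulVecLin) ∧
  (∀ i, Function.Surjective (g.1 i).mulVecLin) ∧
  ∀ i, LinearMap.range (f.1 i).mulVecLin = LinearMap.ker (g.1 i).mulVecLin

/-- A morphism of representations is a split epimorphism. -/
def IsSplitEpi (s t : A → V) {dX dY : V → ℕ}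
    {X : QRep s t dX} {Y : QRep s t dY} (h : RHom s t X Y) : Prop :=
  ∃ r : RHom s t Y X, ∀ i, h.1 i * r.1 i = 1

/-- `0 → T → E → M → 0` is an almost split (Auslander–Reiten) sequence: it is a
non-split short exact sequence, T and M are indecomposable, and every morphism
`X → M` which is not a split epimorphism factors through `E`. -/
def IsAlmostSplit (s t : A → V) {dT dE dM : V → ℕ}
    {T : QRep s t dT} {E : QRep s t dE} {M : QRep s t dM}
    (f : RHom s t T E) (g : RHom s t E M) : Prop :=
  IsSES s t f g ∧ ¬ IsSplitEpi s t g ∧ Indec s t T ∧ Indec s t M ∧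
  ∀ (x : V → ℕ) (X : QRep s t x) (h : RHom s t X M), ¬ IsSplitEpi s t h →
    ∃ u : RHom s t X E, ∀ i, g.1 i * u.1 i = h.1 i

/-- Coordinates for a tuple of `(d i) × (e i)` matrices. -/
abbrev Coord (d e : V → ℕ) : Type := (Σ i : V, Fin (d i) × Fin (e i)) → ℂ

/-- The `i`-th matrix encoded by a coordinate vector. -/
def matOf {d e : V → ℕ} (F : Coord (V := V) d e) (i : V) :
    Matrix (Fin (d i)) (Fin (e i)) ℂ :=
  fun p q => F ⟨i, (p, q)⟩

/-- The "Stiefel-type" variety of tuples of injective linear maps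
`ℂ^{e i} → ℂ^{d i}` whose images form a subrepresentation of `M`. -/
def StQ (s t : A → V) {d : V → ℕ} (M : QRep s t d) (e : V → ℕ) : Type :=
  {F : Coord (V := V) d e //
    (∀ i, Function.Injective (matOf F i).mulVecLin) ∧
    ∀ a : A, (LinearMap.range (matOf F (s a)).mulVecLin).map (M a).mulVecLin ≤
      LinearMap.range (matOf F (t a)).mulVecLin}

/-- The canonical surjection from the Stiefel-type variety onto the quiver
Grassmannian, sending a tuple of injective maps to the tuple of their images. -/
def toSub (s t : A → V) {d : V → ℕ} (M : QRep s t d) (e : V → ℕ) :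
    StQ s t M e → SubRep s t M e := fun F =>
  ⟨fun i => LinearMap.range (matOf F.1 i).mulVecLin,
   fun i => by
     rw [LinearMap.finrank_range_of_inj (F.2.1 i)]
     exact Module.finrank_fin_fun ℂ,
   F.2.2⟩

/-- The classical (Euclidean) topology on the quiver Grassmannian, as the quotient
topology from the space of injective tuples with its Euclidean topology. -/
instance (s t : A → V) {d : V → ℕ} (M : QRep s t d) (e : V → ℕ) :
    TopologicalSpace (SubRep s t M e) :=
  TopologicalSpace.coinduced (toSub s t M e)
    (TopologicalSpace.induced Subtype.val inferInstance)

open CategoryTheory in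
/-- The singular chain complex of a topological space with rational coefficients. -/
def singComplex (X : Type) [TopologicalSpace X] : ChainComplex (ModuleCat ℚ) ℕ :=
  (AlgebraicTopology.alternatingFaceMapComplex (ModuleCat ℚ)).obj
    (((CategoryTheory.SimplicialObject.whiskering _ _).obj (ModuleCat.free ℚ)).obj
      (TopCat.toSSet.obj (TopCat.of X)))

/-- Singular homology with rational coefficients. -/
def Hsing (n : ℕ) (X : Type) [TopologicalSpace X] : ModuleCat ℚ :=
  (singComplex X).homology n

/-- Singular cohomology with rational coefficients (over a field, the dual of
singular homology by universal coefficients). -/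
abbrev Hcoh (n : ℕ) (X : Type) [TopologicalSpace X] : Type :=
  Module.Dual ℚ (Hsing n X)

/-- The topological Euler characteristic `χ(X) = Σ (−1)ⁱ dim Hⁱ(X, ℚ)`. -/
def eulerChar (X : Type) [TopologicalSpace X] : ℤ :=
  finsum fun n : ℕ => (-1 : ℤ) ^ n * (Module.finrank ℚ (Hcoh n X) : ℤ)

namespace QG
set_option linter.unusedSectionVars false
set_option linter.unusedVariables false
open Matrix renaming mul_assoc → mulA, zero_mul → mzero_mul, one_mul → mone_mul, mul_zero → mmul_zero, mul_one → mmul_one, mul_smul → mmul_smul, sub_mul → msub_mul, mul_add → mmul_add, add_mul → madd_mul, smul_mul → msmul_mul, mul_sub → mmul_sub, mul_apply → mmul_apply, one_apply → mone_apply, add_apply → madd_apply, sub_apply → msub_apply, neg_mul → mneg_mul, mul_neg → mmul_neg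
open LinearMap renaming comp_apply → lcomp_apply, congr_fun → lcongr_fun, id → lid, sub_apply → lsub_apply, add_apply → ladd_apply, id_apply → lid_apply, smul_apply → lsmul_apply, range → lrange, ker → lker
open Finsupp renaming single → fsingle
open ContinuousMap renaming id → cid, const → cconst
open Subtype renaming ext → sext
open TensorProduct renaming map → tpmap, map_tmul → tpmap_tmul, induction_on → tensor_induction
open Function (update update_of_ne update_self Injective)
open Continuous (subtype_mk prodMk)
open Finset (sum_congr mul_sum mem_univ sum_mul sum_add_distrib sum_nonneg sum_apply sum_comm)
open Finsupp (lmapDomain mapDomain_single)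
open ContinuousMap (Homotopic HomotopyEquiv)
open Topology (IsEmbedding IsOpenEmbedding)
open Module (finrank finBasis Basis)
open List (ofFn)
open Sum (inl inr inl_injective inr_injective)
local notation "Mat" n:max => Matrix n n ℂ

section
/-- A rational vector space with a square-zero differential and a compatible parity
involution: the total space of a chain complex, remembering only the parity of degrees. -/
structure DMod where
  X : Type
  [grp : AddCommGroup X]
  [mod : Module ℚ X]
  d : X →ₗ[ℚ] X
  ε : X →ₗ[ℚ] X
  dd : ∀ x, d (d x) = 0
  εε : ∀ x, ε (ε x) = x
  dε : ∀ x, d (ε x) = - ε (d x)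

attribute [instance] DMod.grp DMod.mod
attribute [simp] DMod.dd DMod.εε DMod.dε

/-- Morphisms of differential modules. -/
structure DHom (M N : DMod) where
  f : M.X →ₗ[ℚ] N.X
  hd : ∀ x, f (M.d x) = N.d (f x)
  hε : ∀ x, f (M.ε x) = N.ε (f x)

attribute [simp] DHom.hd DHom.hε

namespace DMod

/-- `x` is a boundary. -/
def Bd (M : DMod) (x : M.X) : Prop := ∃ y, M.d y = x

/-- The odd part of the homology vanishes. -/
def OV (M : DMod) : Prop := ∀ x, M.d x = 0 → M.Bd (x - M.ε x)

variable {M : DMod}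

lemma Bd.add {x y : M.X} (hx : M.Bd x) (hy : M.Bd y) : M.Bd (x + y) := by
  obtain ⟨a, rfl⟩ := hx; obtain ⟨b, rfl⟩ := hy; exact ⟨a + b, by simp⟩

lemma Bd.sub {x y : M.X} (hx : M.Bd x) (hy : M.Bd y) : M.Bd (x - y) := by
  obtain ⟨a, rfl⟩ := hx; obtain ⟨b, rfl⟩ := hy; exact ⟨a - b, by simp⟩

lemma Bd.smul {x : M.X} (c : ℚ) (hx : M.Bd x) : M.Bd (c • x) := by
  obtain ⟨a, rfl⟩ := hx; exact ⟨c • a, by simp⟩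

lemma Bd.eps {x : M.X} (hx : M.Bd x) : M.Bd (M.ε x) := by
  obtain ⟨a, rfl⟩ := hx; exact ⟨- M.ε a, by simp⟩

lemma Bd.zero : M.Bd 0 := ⟨0, by simp⟩

lemma OV.odd (h : M.OV) {x : M.X} (hx : M.d x = 0) (ho : M.ε x = -x) : M.Bd x := by
  have h1 := (h x hx).smul (1/2)
  rw [ho, sub_neg_eq_add, ← two_smul ℚ x, smul_smul] at h1
  norm_num at h1
  exact h1

lemma OV.of_odd (h : ∀ x, M.d x = 0 → M.ε x = -x → M.Bd x) : M.OV := fun x hx =>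
  h _ (by simp [hx]) (by simp)

end DMod

namespace DHom
open DMod

variable {M N K : DMod}

/-- Composition. -/
def comp (g : DHom N K) (f : DHom M N) : DHom M K :=
  ⟨g.f ∘ₗ f.f, fun x => by simp, fun x => by simp⟩

@[simp] lemma comp_f (g : DHom N K) (f : DHom M N) (x : M.X) : (g.comp f).f x = g.f (f.f x) := rfl

/-- The map on homology is injective. -/
def Inj (f : DHom M N) : Prop := ∀ x, M.d x = 0 → N.Bd (f.f x) → M.Bd x

/-- The map on homology is surjective. -/
def Surj (f : DHom M N) : Prop := ∀ y, N.d y = 0 → ∃ x, M.d x = 0 ∧ N.Bd (y - f.f x)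

/-- Quasi-isomorphism. -/
def QI (f : DHom M N) : Prop := f.Inj ∧ f.Surj

lemma bd (f : DHom M N) {x : M.X} (h : M.Bd x) : N.Bd (f.f x) := by
  obtain ⟨a, rfl⟩ := h; exact ⟨f.f a, by simp⟩

/-- The two maps agree on homology. -/
def HEqv (f g : DHom M N) : Prop := ∀ x, M.d x = 0 → N.Bd (f.f x - g.f x)

lemma HEqv.symm {f g : DHom M N} (h : f.HEqv g) : g.HEqv f := fun x hx => by
  have := (h x hx).smul (-1); simpa using this

lemma Inj.congr {f g : DHom M N} (h : f.HEqv g) (hf : f.Inj) : g.Inj := fun x hx hb =>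
  hf x hx (by simpa using (h x hx).add hb)

lemma Surj.congr {f g : DHom M N} (h : f.HEqv g) (hf : f.Surj) : g.Surj := fun y hy => by
  obtain ⟨x, hx, hb⟩ := hf y hy
  exact ⟨x, hx, by simpa using hb.add (h x hx)⟩

lemma QI.congr {f g : DHom M N} (h : f.HEqv g) (hf : f.QI) : g.QI :=
  ⟨hf.1.congr h, hf.2.congr h⟩

lemma HEqv.of_eq {f g : DHom M N} (h : ∀ x, f.f x = g.f x) : f.HEqv g := fun x _ => by
  rw [h, sub_self]; exact Bd.zero

lemma Inj.comp {g : DHom N K} {f : DHom M N} (hg : g.Inj) (hf : f.Inj) : (g.comp f).Inj :=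
  fun x hx hb => hf x hx (hg _ (by rw [← f.hd, hx, map_zero]) hb)

lemma Surj.comp {g : DHom N K} {f : DHom M N} (hg : g.Surj) (hf : f.Surj) : (g.comp f).Surj := by
  intro z hz
  obtain ⟨y, hy, hb⟩ := hg z hz
  obtain ⟨x, hx, hb'⟩ := hf y hy
  refine ⟨x, hx, ?_⟩
  have := hb.add (g.bd hb')
  simpa using this

lemma QI.comp {g : DHom N K} {f : DHom M N} (hg : g.QI) (hf : f.QI) : (g.comp f).QI :=
  ⟨hg.1.comp hf.1, hg.2.comp hf.2⟩

lemma Inj.of_comp {g : DHom N K} {f : DHom M N} (h : (g.comp f).Inj) : f.Inj :=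
  fun x hx hb => h x hx (g.bd hb)

lemma Surj.of_comp {g : DHom N K} {f : DHom M N} (h : (g.comp f).Surj) : g.Surj := fun z hz => by
  obtain ⟨x, hx, hb⟩ := h z hz
  exact ⟨f.f x, by rw [← f.hd, hx, map_zero], hb⟩

lemma QI.of_comp_left {g : DHom N K} {f : DHom M N} (h : (g.comp f).QI) (hg : g.QI) : f.QI := by
  refine ⟨h.1.of_comp, fun y hy => ?_⟩
  obtain ⟨x, hx, hb⟩ := h.2 (g.f y) (by rw [← g.hd, hy, map_zero])
  refine ⟨x, hx, hg.1 _ (by simp [hy, ← f.hd, hx]) ?_⟩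
  simpa using hb

lemma QI.of_comp_right {g : DHom N K} {f : DHom M N} (h : (g.comp f).QI) (hf : f.QI) : g.QI := by
  refine ⟨fun y hy hb => ?_, h.2.of_comp⟩
  obtain ⟨x, hx, hb'⟩ := hf.2 y hy
  have h1 : M.Bd x := h.1 x hx (by simpa using hb.sub (g.bd hb'))
  simpa using hb'.add (f.bd h1)

lemma QI.of_inv {f : DHom M N} {g : DHom N M} (h1 : ∀ x, M.d x = 0 → M.Bd (x - g.f (f.f x)))
    (h2 : ∀ x, N.d x = 0 → N.Bd (x - f.f (g.f x))) : f.QI :=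
  ⟨fun x hx hb => by simpa using (h1 x hx).add (g.bd hb),
    fun y hy => ⟨g.f y, by rw [← g.hd, hy, map_zero], h2 y hy⟩⟩

lemma QI.ov_iff {f : DHom M N} (h : f.QI) : M.OV ↔ N.OV := by
  constructor
  · intro hM y hy
    obtain ⟨x, hx, hb⟩ := h.2 y hy
    have := ((hb.sub hb.eps).add (f.bd (hM x hx)))
    convert this using 1
    simp; abel
  · intro hN x hx
    refine h.1 _ (by simp [hx]) ?_
    have := hN (f.f x) (by rw [← f.hd, hx, map_zero])
    simpa using this

end DHom

namespace DMod
open DHom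

/-- The mapping cone. -/
@[reducible] def cone {M N : DMod} (f : DHom M N) : DMod where
  X := N.X × M.X
  d := LinearMap.prod (N.d ∘ₗ LinearMap.fst ℚ _ _ + f.f ∘ₗ LinearMap.snd ℚ _ _)
    (-(M.d ∘ₗ LinearMap.snd ℚ _ _))
  ε := LinearMap.prod (N.ε ∘ₗ LinearMap.fst ℚ _ _) (-(M.ε ∘ₗ LinearMap.snd ℚ _ _))
  dd := fun x => by ext <;> simp
  εε := fun x => by ext <;> simp
  dε := fun x => by ext <;> simp [add_comm]

variable {M N M' N' : DMod}

@[simp] lemma cone_d (f : DHom M N) (n : N.X) (m : M.X) :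
    (cone f).d (n, m) = ((N.d n + f.f m, -M.d m) : N.X × M.X) := rfl

@[simp] lemma cone_ε (f : DHom M N) (n : N.X) (m : M.X) :
    (cone f).ε (n, m) = ((N.ε n, -M.ε m) : N.X × M.X) := rfl

/-- The map of cones induced by a commutative square. -/
def coneMap {f : DHom M N} {f' : DHom M' N'} (α : DHom M M') (β : DHom N N')
    (h : ∀ x, β.f (f.f x) = f'.f (α.f x)) : DHom (cone f) (cone f') where
  f := LinearMap.prodMap β.f α.f
  hd := fun x => by simp_all
  hε := fun x => by simp_all

@[simp] lemma coneMap_f {f : DHom M N} {f' : DHom M' N'} (α : DHom M M') (β : DHom N N')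
    (h : ∀ x, β.f (f.f x) = f'.f (α.f x)) (n : N.X) (m : M.X) :
    (coneMap α β h).f (n, m) = ((β.f n, α.f m) : N'.X × M'.X) := rfl

lemma cone_cycle {f : DHom M N} {n : N.X} {m : M.X} :
    (cone f).d (n, m) = 0 ↔ N.d n = -f.f m ∧ M.d m = 0 := by
  rw [cone_d, show ((0 : (cone f).X)) = ((0, 0) : N.X × M.X) from rfl, Prod.mk.injEq, neg_eq_zero,
    add_eq_zero_iff_eq_neg]

lemma cone_bd {f : DHom M N} {n : N.X} {m : M.X} :
    (cone f).Bd (n, m) ↔ ∃ u v, N.d u + f.f v = n ∧ -M.d v = m := by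
  constructor
  · rintro ⟨⟨u, v⟩, h⟩
    rw [cone_d, Prod.mk.injEq] at h
    exact ⟨u, v, h⟩
  · rintro ⟨u, v, rfl, rfl⟩
    exact ⟨(u, v), rfl⟩

lemma coneMap_qi {f : DHom M N} {f' : DHom M' N'} {α : DHom M M'} {β : DHom N N'}
    (h : ∀ x, β.f (f.f x) = f'.f (α.f x)) (hα : α.QI) (hβ : β.QI) : (coneMap α β h).QI := by
  constructor
  · rintro ⟨n, m⟩ hc hb
    rw [cone_cycle] at hc
    rw [coneMap_f, cone_bd] at hb
    rw [cone_bd]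
    obtain ⟨v, w, h1, h2⟩ := hb
    obtain ⟨x, hx⟩ := hα.1 m hc.2 ⟨-w, by rw [map_neg, h2]⟩
    obtain ⟨y, hy, z, hz⟩ := hα.2 (α.f x + w) (by
      rw [map_add, ← α.hd, hx, ← h2]; simp)
    obtain ⟨u, hu⟩ := hβ.1 (n - f.f (y - x)) (by
      rw [map_sub, ← f.hd, map_sub, hy, hx, hc.1]; simp) ⟨v + f'.f z, by
        have hw : w = M'.d z + α.f y - α.f x := by rw [hz]; abel
        rw [map_sub, ← h1, h, hw]; simp; abel⟩
    exact ⟨u, y - x, by rw [hu]; abel, by rw [map_sub, hy, hx]; abel⟩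
  · rintro ⟨n', m'⟩ hc
    rw [cone_cycle] at hc
    obtain ⟨m, hm, w, hw⟩ := hα.2 m' hc.2
    have e : m' = M'.d w + α.f m := by rw [hw]; abel
    obtain ⟨n0, hn0⟩ := hβ.1 (-f.f m) (by simp [← f.hd, hm]) ⟨n' + f'.f w, by
      rw [map_add, hc.1, e, map_neg, h]; simp⟩
    obtain ⟨n1, hn1, v, hv⟩ := hβ.2 (n' + f'.f w - β.f n0) (by
      rw [map_sub, map_add, hc.1, e, ← β.hd, hn0, map_neg, h]; simp)
    refine ⟨(n0 + n1, m), cone_cycle.2 ⟨by rw [map_add, hn0, hn1, add_zero], hm⟩, ?_⟩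
    rw [coneMap_f]
    refine cone_bd.2 ⟨v, -w, ?_, ?_⟩
    · rw [hv, map_neg, map_add]; change _ = n' - (β.f n0 + β.f n1); abel
    · rw [map_neg, hw, neg_neg]

lemma qi_of_coneMap {f : DHom M N} {f' : DHom M' N'} {α : DHom M M'} {β : DHom N N'}
    (h : ∀ x, β.f (f.f x) = f'.f (α.f x)) (hα : α.QI) (hc : (coneMap α β h).QI) : β.QI := by
  constructor
  · rintro n hn ⟨v', hv'⟩
    obtain ⟨u, y, h1, h2⟩ := cone_bd.1 (hc.1 (n, 0) (cone_cycle.2 (by simp [hn]))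
      (cone_bd.2 ⟨v', 0, by simp [hv'], by simp⟩))
    have hy : M.d y = 0 := by simpa using h2
    obtain ⟨⟨n1, m1⟩, hcy, hb⟩ := hc.2 (-(v' - β.f u), α.f y) (cone_cycle.2 ⟨by
      have hfy : f.f y = n - N.d u := by rw [← h1]; abel
      rw [← h, hfy]; simp [hv'], by simp [← α.hd, hy]⟩)
    rw [cone_cycle] at hcy
    obtain ⟨v'', w'', _, h4⟩ := cone_bd.1 hb
    obtain ⟨x, hx⟩ := hα.1 (y - m1) (by simp [hy, hcy.2]) ⟨-w'', by rw [map_neg, h4, map_sub]; rfl⟩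
    refine ⟨u - n1 + f.f x, ?_⟩
    rw [map_add, map_sub, hcy.1, ← f.hd, hx, ← h1, map_sub]; abel
  · intro n' hn'
    obtain ⟨⟨n, m⟩, hcy, hb⟩ := hc.2 (n', 0) (cone_cycle.2 (by simp [hn']))
    rw [cone_cycle] at hcy
    obtain ⟨v', w', h3, h4⟩ := cone_bd.1 hb
    have h4' : M'.d w' = α.f m := by aesop
    obtain ⟨x, hx⟩ := hα.1 m hcy.2 ⟨w', h4'⟩
    obtain ⟨y, hy, z, hz⟩ := hα.2 (w' - α.f x) (by rw [map_sub, h4', ← α.hd, hx, sub_self])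
    refine ⟨n + f.f (x + y), by rw [map_add, hcy.1, ← f.hd, map_add, hx, hy]; simp, v' + f'.f z, ?_⟩
    have h3' : N'.d v' + f'.f w' = n' - β.f n := h3
    have hw : w' = M'.d z + α.f y + α.f x := by rw [hz]; abel
    rw [map_add, ← f'.hd, map_add, h, map_add, map_add]
    rw [hw, map_add, map_add] at h3'
    rw [← sub_sub, ← h3']; abel

/-- A commutative square whose total complex is acyclic. -/
def HoCart {A B₁ B₂ C : DMod} {a₁ : DHom A B₁} {a₂ : DHom A B₂} {c₁ : DHom B₁ C} {c₂ : DHom B₂ C}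
    (h : ∀ x, c₁.f (a₁.f x) = c₂.f (a₂.f x)) : Prop :=
  (coneMap (f := a₁) (f' := c₂) a₂ c₁ h).QI

lemma HoCart.qi {A B₁ B₂ C A' B₁' B₂' C' : DMod}
    {a₁ : DHom A B₁} {a₂ : DHom A B₂} {c₁ : DHom B₁ C} {c₂ : DHom B₂ C}
    {h : ∀ x, c₁.f (a₁.f x) = c₂.f (a₂.f x)} (H : HoCart h)
    {a₁' : DHom A' B₁'} {a₂' : DHom A' B₂'} {c₁' : DHom B₁' C'} {c₂' : DHom B₂' C'}
    {h' : ∀ x, c₁'.f (a₁'.f x) = c₂'.f (a₂'.f x)} (H' : HoCart h')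
    {θ : DHom A A'} {θ₁ : DHom B₁ B₁'} {θ₂ : DHom B₂ B₂'} {η : DHom C C'}
    (e₁ : ∀ x, θ₁.f (a₁.f x) = a₁'.f (θ.f x)) (e₂ : ∀ x, θ₂.f (a₂.f x) = a₂'.f (θ.f x))
    (e₃ : ∀ x, η.f (c₁.f x) = c₁'.f (θ₁.f x)) (e₄ : ∀ x, η.f (c₂.f x) = c₂'.f (θ₂.f x))
    (hθ : θ.QI) (h₁ : θ₁.QI) (h₂ : θ₂.QI) : η.QI := by
  refine qi_of_coneMap (f := c₂) (f' := c₂') (α := θ₂) e₄ h₂ ?_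
  refine QI.of_comp_right (f := coneMap (f := a₁) (f' := c₂) a₂ c₁ h) ?_ H
  refine QI.congr (HEqv.of_eq ?_) (QI.comp H' (coneMap_qi e₁ hθ h₁))
  rintro ⟨n, m⟩
  exact Prod.ext (e₃ n).symm (e₂ m).symm

lemma OV.even_inj {f : DHom M N} (h : (cone f).OV) {z : M.X} (hz : M.d z = 0) (he : M.ε z = z)
    (hb : N.Bd (f.f z)) : M.Bd z := by
  obtain ⟨y, hy⟩ := hb
  have h2 : N.d ((1/2 : ℚ) • (y - N.ε y)) = f.f z := by
    rw [map_smul, map_sub, N.dε, hy, ← f.hε, he, sub_neg_eq_add, ← two_smul ℚ, smul_smul]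
    norm_num
  obtain ⟨u, v, -, hv⟩ := cone_bd.1 (h.odd (x := ((1/2 : ℚ) • (y - N.ε y), -z))
    (cone_cycle.2 ⟨by rw [h2, map_neg, neg_neg], by simp [hz]⟩) (by
      rw [cone_ε]; ext
      · change N.ε _ = -((1/2 : ℚ) • (y - N.ε y)); rw [map_smul, map_sub, N.εε, ← smul_neg]; simp
      · change -M.ε (-z) = - -z; simp [he]))
  exact ⟨v, neg_injective hv⟩

lemma OV.cone_of_even_inj {f : DHom M N} (hN : N.OV)
    (h : ∀ z, M.d z = 0 → M.ε z = z → N.Bd (f.f z) → M.Bd z) : (cone f).OV := by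
  refine OV.of_odd ?_
  rintro ⟨n, m⟩ hc ho
  rw [cone_cycle] at hc
  have ho1 : N.ε n = -n := congrArg Prod.fst ho
  have ho2 : M.ε m = m := by simp_all
  obtain ⟨w, hw⟩ := h m hc.2 ho2 ⟨-n, by rw [map_neg, hc.1, neg_neg]⟩
  set w' := (1/2 : ℚ) • (w - M.ε w) with hw'
  have hdw : M.d w' = m := by
    rw [hw', map_smul, map_sub, M.dε, hw, ho2, sub_neg_eq_add, ← two_smul ℚ, smul_smul]; norm_num
  have hεw : M.ε w' = -w' := by rw [hw', map_smul, map_sub, M.εε, ← smul_neg, neg_sub]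
  obtain ⟨y, hy⟩ := hN.odd (x := n + f.f w') (by rw [map_add, hc.1, ← f.hd, hdw]; simp)
    (by rw [map_add, ho1, ← f.hε, hεw, map_neg]; abel)
  exact cone_bd.2 ⟨y, -w', by rw [hy, map_neg]; abel, by rw [map_neg, hdw, neg_neg]⟩

/-- If `M → N` is injective on homology then odd vanishing passes from `N` to the cone. -/
lemma OV.cone_of_inj {f : DHom M N} (hN : N.OV) (h : f.Inj) : (cone f).OV :=
  hN.cone_of_even_inj fun z hz _ hb => h z hz hb

/-- Finite powers. -/
@[reducible] def pow (M : DMod) (n : ℕ) : DMod where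
  X := Fin n → M.X
  d := LinearMap.pi fun i => M.d ∘ₗ LinearMap.proj i
  ε := LinearMap.pi fun i => M.ε ∘ₗ LinearMap.proj i
  dd := fun x => by ext; simp
  εε := fun x => by ext; simp
  dε := fun x => by ext; simp

@[simp] lemma pow_d (M : DMod) (n : ℕ) (x : (M.pow n).X) (i : Fin n) :
    (M.pow n).d x i = M.d (x i) := rfl

@[simp] lemma pow_ε (M : DMod) (n : ℕ) (x : (M.pow n).X) (i : Fin n) :
    (M.pow n).ε x i = M.ε (x i) := rfl

lemma pow_cycle {n : ℕ} {x : (M.pow n).X} : (M.pow n).d x = 0 ↔ ∀ i, M.d (x i) = 0 :=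
  ⟨fun h i => congrFun h i, fun h => funext h⟩

lemma pow_bd {n : ℕ} {x : (M.pow n).X} : (M.pow n).Bd x ↔ ∀ i, M.Bd (x i) := by
  constructor
  · rintro ⟨y, rfl⟩ i
    exact ⟨y i, rfl⟩
  · intro h
    choose y hy using h
    exact ⟨y, funext hy⟩

/-- Functoriality of finite powers. -/
def powMap (f : DHom M N) (n : ℕ) : DHom (M.pow n) (N.pow n) where
  f := LinearMap.pi fun i => f.f ∘ₗ LinearMap.proj i
  hd := fun x => by funext i; change f.f (M.d (x i)) = N.d (f.f (x i)); simp
  hε := fun x => by funext i; change f.f (M.ε (x i)) = N.ε (f.f (x i)); simp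

@[simp] lemma powMap_f (f : DHom M N) (n : ℕ) (x : (M.pow n).X) (i : Fin n) :
    (powMap f n).f x i = f.f (x i) := rfl

lemma HoCart.pow {A B₁ B₂ C : DMod} {a₁ : DHom A B₁} {a₂ : DHom A B₂} {c₁ : DHom B₁ C}
    {c₂ : DHom B₂ C} {h : ∀ x, c₁.f (a₁.f x) = c₂.f (a₂.f x)} (H : HoCart h) (n : ℕ) :
    HoCart (a₁ := powMap a₁ n) (a₂ := powMap a₂ n) (c₁ := powMap c₁ n) (c₂ := powMap c₂ n)
      (fun x => funext fun i => h (x i)) := by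
  constructor
  · rintro ⟨x, y⟩ hc hb
    rw [cone_cycle] at hc
    obtain ⟨u, v, h1, h2⟩ := cone_bd.1 hb
    have : ∀ i, (cone a₁).Bd (x i, y i) := fun i =>
      H.1 _ (cone_cycle.2 ⟨congrFun hc.1 i, congrFun hc.2 i⟩)
        (cone_bd.2 ⟨u i, v i, congrFun h1 i, congrFun h2 i⟩)
    choose u' v' e1 e2 using fun i => cone_bd.1 (this i)
    exact cone_bd.2 ⟨u', v', funext e1, funext e2⟩
  · rintro ⟨x, y⟩ hc
    rw [cone_cycle] at hc
    have := fun i => H.2 (x i, y i) (cone_cycle.2 ⟨congrFun hc.1 i, congrFun hc.2 i⟩)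
    choose z hz hb using this
    refine ⟨(fun i => (z i).1, fun i => (z i).2), cone_cycle.2
      ⟨funext fun i => (cone_cycle.1 (hz i)).1, funext fun i => (cone_cycle.1 (hz i)).2⟩, ?_⟩
    choose u' v' e1 e2 using fun i => cone_bd.1 (hb i)
    exact cone_bd.2 ⟨u', v', funext e1, funext e2⟩

/-- The homology vanishes. -/
def Acyc (M : DMod) : Prop := ∀ x, M.d x = 0 → M.Bd x

lemma acyc_cone_iff {f : DHom M N} : (cone f).Acyc ↔ f.QI := by
  constructor
  · intro h
    refine ⟨fun x hx ⟨y, hy⟩ => ?_, fun y hy => ?_⟩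
    · obtain ⟨u, v, -, hv⟩ := cone_bd.1 (h (y, -x) (cone_cycle.2 (by simp [hx, hy])))
      exact ⟨v, neg_injective hv⟩
    · obtain ⟨u, v, hu, hv⟩ := cone_bd.1 (h (y, 0) (cone_cycle.2 (by simp [hy])))
      exact ⟨v, by simpa using hv, u, by rw [← hu]; abel⟩
  · rintro h ⟨n, m⟩ hc
    rw [cone_cycle] at hc
    obtain ⟨x, hx⟩ := h.1 m hc.2 ⟨-n, by rw [map_neg, hc.1, neg_neg]⟩
    obtain ⟨y, hy, z, hz⟩ := h.2 (n + f.f x) (by rw [map_add, hc.1, ← f.hd, hx, neg_add_cancel])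
    exact cone_bd.2 ⟨z, y - x, by rw [hz, map_sub]; abel, by rw [map_sub, hy, hx]; abel⟩

lemma ov_pow (h : M.OV) (n : ℕ) : (M.pow n).OV := fun x hx =>
  pow_bd.2 fun i => h _ (pow_cycle.1 hx i)

end DMod

open DMod DHom

/-- The geometric simplex with `m` vertices. -/
abbrev Δ (m : ℕ) : Type := stdSimplex ℝ (Fin m)

/-- Convex combination inside a simplex. -/
def Δ.comb {m k : ℕ} (t : Δ m) (u : Fin m → Δ k) : Δ k :=
  ⟨fun j => ∑ i, t.1 i * (u i).1 j, fun j => sum_nonneg fun i _ =>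
    mul_nonneg (t.2.1 i) ((u i).2.1 j), by
    rw [sum_comm]
    simp_rw [← mul_sum, (u _).2.2, mul_one]
    exact t.2.2⟩

/-- The vertices of a simplex. -/
def Δ.vert {m : ℕ} (i : Fin m) : Δ m := ⟨Pi.single i 1, single_mem_stdSimplex ℝ i⟩

/-- A topological space with convex combinations. -/
class Conv (S : Type) [TopologicalSpace S] where
  comb : ∀ {m : ℕ}, Δ m → (Fin m → S) → S
  cont : ∀ {m : ℕ} (v : Fin m → S), Continuous fun t => comb t v
  assoc : ∀ {m k : ℕ} (t : Δ m) (u : Fin m → Δ k) (v : Fin k → S),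
    comb t (fun i => comb (u i) v) = comb (Δ.comb t u) v
  vert : ∀ {m : ℕ} (v : Fin m → S) (i : Fin m), comb (Δ.vert i) v = v i

instance (k : ℕ) : Conv (Δ k) where
  comb := Δ.comb
  cont v := by
    refine subtype_mk (continuous_pi fun j => ?_) _
    exact continuous_finsetSum _ fun i _ =>
      ((continuous_apply i).comp continuous_subtype_val).mul continuous_const
  assoc t u v := by
    apply sext; funext j
    simp only [Δ.comb, mul_sum, sum_mul]
    rw [sum_comm]
    simp_rw [mul_assoc]
  vert v i := by
    apply sext; funext j
    simp [Δ.comb, Δ.vert, Pi.single_apply]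

/-- Convex combination in the unit interval. -/
instance : Conv unitInterval where
  comb t v := ⟨∑ i, t.1 i * (v i).1, by
    have := (convex_Icc (0 : ℝ) 1).sum_mem (t := Finset.univ) (w := t.1) (z := fun i => (v i).1)
      (fun i _ => t.2.1 i) t.2.2 (fun i _ => (v i).2)
    simpa using this⟩
  cont v := by
    refine subtype_mk ?_ _
    exact continuous_finsetSum _ fun i _ =>
      ((continuous_apply i).comp continuous_subtype_val).mul continuous_const
  assoc t u v := by
    apply sext
    simp only [Δ.comb, mul_sum, sum_mul]
    rw [sum_comm]
    simp_rw [mul_assoc]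
  vert v i := by
    apply sext
    simp [Δ.vert, Pi.single_apply]

instance {S T : Type} [TopologicalSpace S] [TopologicalSpace T] [Conv S] [Conv T] :
    Conv (S × T) where
  comb t v := (Conv.comb t fun i => (v i).1, Conv.comb t fun i => (v i).2)
  cont _ := (Conv.cont _).prodMk (Conv.cont _)
  assoc t u _ := Prod.ext (Conv.assoc t u _) (Conv.assoc t u _)
  vert _ i := Prod.ext (Conv.vert _ i) (Conv.vert _ i)

variable {S T U X Y : Type} [TopologicalSpace S] [Conv S] [TopologicalSpace T] [Conv T]
  [TopologicalSpace U] [Conv U] [TopologicalSpace X] [TopologicalSpace Y]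

/-- Maps preserving convex combinations. -/
def Affine (φ : S → T) : Prop :=
  ∀ {m : ℕ} (t : Δ m) (v : Fin m → S), φ (Conv.comb t v) = Conv.comb t fun i => φ (v i)

/-- The affine simplex with given vertices. -/
def affT {m : ℕ} (v : Fin m → S) : C(Δ m, S) := ⟨fun t => Conv.comb t v, Conv.cont v⟩

lemma affT_affine {m : ℕ} (v : Fin m → S) : Affine (affT v) := fun t u =>
  (Conv.assoc t u v).symm

@[simp] lemma affT_vert {m : ℕ} (v : Fin m → S) (i : Fin m) : affT v (Δ.vert i) = v i :=
  Conv.vert v i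

lemma affT_comp {φ : C(S, T)} (hφ : Affine φ) {m : ℕ} (v : Fin m → S) :
    φ.comp (affT v) = affT (fun i => φ (v i)) := ContinuousMap.ext fun t => hφ t v

lemma affT_id {m : ℕ} : affT (Δ.vert (m := m)) = cid _ := by
  ext t j
  change ∑ i, t.1 i * (Δ.vert i).1 j = t.1 j
  simp [Δ.vert, Pi.single_apply]

/-! ### Chains of ordered lists -/

section lists
variable {S T : Type}

/-- Chains of lists. -/
abbrev LC (S : Type) : Type := List S →₀ ℚ

/-- The chain of a single list. -/
abbrev L (l : List S) : LC S := fsingle l 1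

/-- Linear extension. -/
abbrev lin {α M : Type} [AddCommGroup M] [Module ℚ M] (f : α → M) : (α →₀ ℚ) →ₗ[ℚ] M :=
  Finsupp.linearCombination ℚ f

lemma lin_L {α M : Type} [AddCommGroup M] [Module ℚ M] (f : α → M) (a : α) :
    lin f (fsingle a 1) = f a := by simp [lin]

lemma lin_ext {α M : Type} [AddCommGroup M] [Module ℚ M] {f g : (α →₀ ℚ) →ₗ[ℚ] M}
    (h : ∀ a, f (fsingle a 1) = g (fsingle a 1)) : f = g :=
  Finsupp.lhom_ext' fun a => LinearMap.ext_ring (h a)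

namespace LC

/-- Adding a vertex in front. -/
def cons {S : Type} (v : S) : LC S →ₗ[ℚ] LC S := lin fun l => L (v :: l)

@[simp] lemma cons_L (v : S) (l : List S) : cons v (L l) = L (v :: l) := lin_L _ _

/-- The boundary of a list. -/
def bd {S : Type} : List S → LC S
  | [] => 0
  | v :: l => L l - cons v (bd l)

/-- The augmented boundary operator. -/
def d {S : Type} : LC S →ₗ[ℚ] LC S := lin bd

@[simp] lemma d_nil : d (L ([] : List S)) = 0 := lin_L _ _
lemma d_L_cons (v : S) (l : List S) : d (L (v :: l)) = L l - cons v (d (L l)) := by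
  simp [d, bd]

lemma d_cons (v : S) (c : LC S) : d (cons v c) = c - cons v (d c) := by
  have : d ∘ₗ cons v = lid - cons v ∘ₗ d := lin_ext fun l => by
    simp [d_L_cons]
  exact lcongr_fun this c

@[simp] lemma dd (c : LC S) : d (d c) = 0 := by
  have : d ∘ₗ d = (0 : LC S →ₗ[ℚ] LC S) := lin_ext fun l => by
    induction l with
    | nil => simp
    | cons v l ih =>
      have ih' : d (d (L l)) = 0 := ih
      simp [d_L_cons, d_cons, ih']
  exact lcongr_fun this c

/-- The sign operator. -/
def sg {S : Type} : LC S →ₗ[ℚ] LC S := lin fun l => (-1 : ℚ) ^ (l.length + 1) • L l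

lemma sg_L (l : List S) : sg (L l) = (-1 : ℚ) ^ (l.length + 1) • L l := lin_L _ _

lemma sg_cons (v : S) (c : LC S) : sg (cons v c) = - cons v (sg c) := by
  have : sg ∘ₗ cons v = - (cons v ∘ₗ sg) := lin_ext fun l => by
    simp only [lcomp_apply, cons_L, LinearMap.neg_apply, sg_L, map_smul, List.length_cons]
    rw [pow_succ _ (l.length + 1)]; simp
  exact lcongr_fun this c

lemma d_sg (c : LC S) : d (sg c) = - sg (d c) := by
  have : d ∘ₗ sg = - ((sg : LC S →ₗ[ℚ] LC S) ∘ₗ d) := lin_ext fun l => by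
    induction l with
    | nil => simp [sg_L]
    | cons v l ih =>
      have ih' : d (sg (L l)) = - sg (d (L l)) := ih
      have h1 : sg (L (v :: l)) = - cons v (sg (L l)) := by rw [← cons_L, sg_cons]
      simp only [lcomp_apply, LinearMap.neg_apply, h1, map_neg, d_cons, ih', d_L_cons,
        map_sub, sg_cons]
  exact lcongr_fun this c

/-- Functoriality. -/
def map {S T : Type} (φ : S → T) : LC S →ₗ[ℚ] LC T := lin fun l => L (l.map φ)

@[simp] lemma map_L (φ : S → T) (l : List S) : map φ (L l) = L (l.map φ) := lin_L _ _

lemma map_cons (φ : S → T) (v : S) (c : LC S) : map φ (cons v c) = cons (φ v) (map φ c) := by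
  have : map φ ∘ₗ cons v = cons (φ v) ∘ₗ map φ := lin_ext fun l => by simp
  exact lcongr_fun this c

lemma map_d (φ : S → T) (c : LC S) : map φ (d c) = d (map φ c) := by
  have : map φ ∘ₗ d = d ∘ₗ map φ := lin_ext fun l => by
    induction l with
    | nil => simp
    | cons v l ih =>
      have ih' : map φ (d (L l)) = d (map φ (L l)) := ih
      simp [d_L_cons, map_cons, ih']
  exact lcongr_fun this c

end LC

lemma exists_ofFn (l : List S) : ∃ (m : ℕ) (v : Fin m → S), l = ofFn v :=
  ⟨l.length, l.get, (List.ofFn_get l).symm⟩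

end lists

/-! ### Singular chains -/

/-- Singular simplices. -/
abbrev Simp (X : Type) [TopologicalSpace X] : Type := Σ n : ℕ, C(Δ (n + 1), X)

/-- The chain given by an affine simplex in the domain of `σ`. -/
def realT (σ : C(S, X)) : (Σ m, Fin m → S) → (Simp X →₀ ℚ)
  | ⟨0, _⟩ => 0
  | ⟨n + 1, v⟩ => fsingle ⟨n, σ.comp (affT v)⟩ 1

/-- The singular chain given by a chain of lists in the domain of `σ`. -/
def R (σ : C(S, X)) : LC S →ₗ[ℚ] (Simp X →₀ ℚ) := lin fun l => realT σ (List.equivSigmaTuple l)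

lemma R_ofFn (σ : C(S, X)) {m : ℕ} (v : Fin m → S) :
    R σ (L (ofFn v)) = realT σ ⟨m, v⟩ := by
  rw [R, lin_L]
  exact congrArg _ (List.equivSigmaTuple.right_inv ⟨m, v⟩)

@[simp] lemma R_nil (σ : C(S, X)) : R σ (L []) = 0 := by
  rw [R, lin_L]; rfl

/-- The list of vertices of a simplex. -/
def ι (n : ℕ) : List (Δ n) := ofFn Δ.vert

lemma R_ι {n : ℕ} (σ : C(Δ (n + 1), X)) : R σ (L (ι (n + 1))) = fsingle ⟨n, σ⟩ 1 := by
  rw [ι, R_ofFn, realT, affT_id]; rfl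

lemma R_comp (σ : C(T, X)) {φ : C(S, T)} (hφ : Affine φ) (c : LC S) :
    R (σ.comp φ) c = R σ (LC.map φ c) := by
  have : R (σ.comp φ) = R σ ∘ₗ LC.map φ := lin_ext fun l => by
    obtain ⟨m, v, rfl⟩ := exists_ofFn l
    rw [lcomp_apply, LC.map_L, List.map_ofFn, R_ofFn, R_ofFn]
    cases m with
    | zero => rfl
    | succ m => simp only [realT]; rw [ContinuousMap.comp_assoc, affT_comp hφ]; rfl
  exact lcongr_fun this c

lemma map_affT_ι {m : ℕ} (v : Fin m → S) : LC.map (affT v) (L (ι m)) = L (ofFn v) := by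
  rw [LC.map_L, ι, List.map_ofFn]; congr 2; funext i; simp

/-- The extension to singular chains of a functional on the universal simplices. -/
def ext {M : Type} [AddCommGroup M] [Module ℚ M] (F : ∀ n : ℕ, C(Δ (n + 1), X) → M) :
    (Simp X →₀ ℚ) →ₗ[ℚ] M := lin fun s => F s.1 s.2

/-- A functional on universal simplices which is compatible with affine maps. -/
lemma ext_R {M : Type} [AddCommGroup M] [Module ℚ M] (F : ∀ n : ℕ, C(Δ (n + 1), X) → M)
    (G : LC S →ₗ[ℚ] M) (σ : C(S, X)) (h0 : G (L []) = 0)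
    (h : ∀ (n : ℕ) (v : Fin (n + 1) → S), F n (σ.comp (affT v)) = G (L (ofFn v)))
    (c : LC S) : ext F (R σ c) = G c := by
  have : ext F ∘ₗ R σ = G := lin_ext fun l => by
    obtain ⟨m, v, rfl⟩ := exists_ofFn l
    rw [lcomp_apply, R_ofFn]
    cases m with
    | zero => simp only [realT, map_zero]; rw [← h0]; rfl
    | succ m => simp only [realT]; rw [ext, lin_L, h]
  exact lcongr_fun this c

/-- The boundary operator on singular chains. -/
def dC : (Simp X →₀ ℚ) →ₗ[ℚ] (Simp X →₀ ℚ) := ext fun n σ => R σ (LC.d (L (ι (n + 1))))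

lemma dC_R (σ : C(S, X)) (c : LC S) : dC (R σ c) = R σ (LC.d c) :=
  ext_R _ (R σ ∘ₗ LC.d) σ (by simp) (fun n v => by
    rw [R_comp σ (affT_affine v), LC.map_d, map_affT_ι]; rfl) c

lemma C_induct {M : Type} [AddCommGroup M] [Module ℚ M] {f g : (Simp X →₀ ℚ) →ₗ[ℚ] M}
    (h : ∀ (n : ℕ) (σ : C(Δ (n + 1), X)), f (R σ (L (ι (n + 1)))) = g (R σ (L (ι (n + 1))))) :
    f = g := lin_ext fun ⟨n, σ⟩ => by rw [← R_ι]; exact h n σ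

/-- The sign operator on singular chains. -/
def εC : (Simp X →₀ ℚ) →ₗ[ℚ] (Simp X →₀ ℚ) :=
  ext fun n σ => (-1 : ℚ) ^ n • fsingle ⟨n, σ⟩ 1

lemma εC_R (σ : C(S, X)) (c : LC S) : εC (R σ c) = R σ (LC.sg c) :=
  ext_R _ (R σ ∘ₗ LC.sg) σ (by simp [LC.sg_L]) (fun n v => by
    rw [lcomp_apply, LC.sg_L, map_smul, R_ofFn, List.length_ofFn, pow_add]
    rw [realT, Finsupp.smul_single, Finsupp.smul_single, pow_succ]; simp) c

/-- Singular chains. -/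
@[reducible] def C (X : Type) [TopologicalSpace X] : DMod where
  X := Simp X →₀ ℚ
  d := dC
  ε := εC
  dd := fun x => by
    have : dC ∘ₗ dC = (0 : (Simp X →₀ ℚ) →ₗ[ℚ] (Simp X →₀ ℚ)) := C_induct fun n σ => by
      simp [dC_R]
    exact lcongr_fun this x
  εε := fun x => by
    have : εC ∘ₗ εC = (lid : (Simp X →₀ ℚ) →ₗ[ℚ] (Simp X →₀ ℚ)) :=
      C_induct fun n σ => by
        simp only [lcomp_apply, εC_R, LC.sg_L, map_smul, smul_smul, ← pow_add, lid_apply]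
        rw [Even.neg_one_pow ⟨_, rfl⟩, one_smul]
    exact lcongr_fun this x
  dε := fun x => by
    have : dC ∘ₗ εC = - ((εC : (Simp X →₀ ℚ) →ₗ[ℚ] (Simp X →₀ ℚ)) ∘ₗ dC) :=
      C_induct fun n σ => by
        simp [dC_R, εC_R, LC.d_sg]
    exact lcongr_fun this x

/-- Functoriality of singular chains. -/
def push (f : C(X, Y)) : (Simp X →₀ ℚ) →ₗ[ℚ] (Simp Y →₀ ℚ) :=
  ext fun n σ => fsingle ⟨n, f.comp σ⟩ 1

lemma push_single (f : C(X, Y)) (n : ℕ) (σ : C(Δ (n + 1), X)) :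
    push f (fsingle ⟨n, σ⟩ 1) = fsingle ⟨n, f.comp σ⟩ 1 := lin_L _ _

lemma push_R (f : C(X, Y)) (σ : C(S, X)) (c : LC S) : push f (R σ c) = R (f.comp σ) c :=
  ext_R _ (R (f.comp σ)) σ (by simp) (fun n v => by
    rw [R_ofFn]; rfl) c

/-- The map of singular chains induced by a continuous map. -/
def Cm (f : C(X, Y)) : DHom (C X) (C Y) where
  f := push f
  hd := fun x => by
    have : push f ∘ₗ dC = dC ∘ₗ push f := C_induct fun n σ => by simp [dC_R, push_R]
    exact lcongr_fun this x
  hε := fun x => by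
    have : push f ∘ₗ εC = εC ∘ₗ push f := C_induct fun n σ => by simp [εC_R, push_R]
    exact lcongr_fun this x

lemma Cm_R (f : C(X, Y)) (σ : C(S, X)) (c : LC S) : (Cm f).f (R σ c) = R (f.comp σ) c :=
  push_R f σ c

lemma Cm_comp {Z : Type} [TopologicalSpace Z] (g : C(Y, Z)) (f : C(X, Y)) (x : (C X).X) :
    (Cm (g.comp f)).f x = (Cm g).f ((Cm f).f x) := by
  have : (Cm (g.comp f)).f = (Cm g).f ∘ₗ (Cm f).f := C_induct fun n σ => by
    rw [lcomp_apply, Cm_R, Cm_R, Cm_R]; rfl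
  exact lcongr_fun this x

lemma Cm_id (x : (C X).X) : (Cm (cid X)).f x = x := by
  have : (Cm (cid X)).f = lid := C_induct fun n σ => by
    rw [Cm_R]; rfl
  exact lcongr_fun this x

/-- The unit interval. -/
abbrev UI : Type := unitInterval

/-! ### Homotopy invariance -/

namespace LC

lemma hom_ext {S M : Type} [AddCommGroup M] [Module ℚ M] {f g : LC S →ₗ[ℚ] M}
    (h : ∀ l, f (L l) = g (L l)) : f = g := lin_ext h

/-- The prism over a list. -/
def prL {S : Type} : List S → LC (UI × S)
  | [] => 0
  | v :: l => L ((0, v) :: (1, v) :: l.map fun x => ((1 : UI), x)) - cons (0, v) (prL l)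

/-- The prism operator. -/
def pr {S : Type} : LC S →ₗ[ℚ] LC (UI × S) := lin prL

lemma pr_nil {S : Type} : pr (L ([] : List S)) = 0 := lin_L _ _

lemma pr_cons {S : Type} (v : S) (c : LC S) : pr (cons v c) =
    cons (0, v) (cons (1, v) (map (fun x => (1, x)) c)) - cons (0, v) (pr c) := by
  have : pr ∘ₗ cons v = cons (0, v) ∘ₗ cons (1, v) ∘ₗ map (fun x => ((1 : UI), x)) -
      cons (0, v) ∘ₗ pr := lin_ext fun l => by simp [pr, prL]
  exact lcongr_fun this c

lemma d_pr {S : Type} (c : LC S) :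
    d (pr c) + pr (d c) = map (fun x => (1, x)) c - map (fun x => (0, x)) c := by
  have : d ∘ₗ pr + pr ∘ₗ d = map (fun x : S => ((1 : UI), x)) - map (fun x => (0, x)) :=
    hom_ext fun l => by
      induction l with
      | nil => simp [pr_nil]
      | cons v l ih =>
        have ih' : d (pr (L l)) = map (fun x : S => ((1 : UI), x)) (L l) -
          map (fun x => (0, x)) (L l) - pr (d (L l)) := eq_sub_of_add_eq ih
        simp only [ladd_apply, lcomp_apply, lsub_apply]
        rw [← cons_L, pr_cons, map_sub, d_cons, d_cons, d_cons, d_cons, ih', map_sub pr, pr_cons,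
          map_cons, map_cons, map_d]
        simp only [map_sub]
        abel
  exact lcongr_fun this c

lemma map_pr {S T : Type} (φ : S → T) (c : LC S) :
    map (fun x => (x.1, φ x.2)) (pr c) = pr (map φ c) := by
  have : map (fun x : UI × S => (x.1, φ x.2)) ∘ₗ pr = pr ∘ₗ map φ := hom_ext fun l => by
    induction l with
    | nil => simp [pr_nil]
    | cons v l ih =>
      have ih' : map (fun x : UI × S => (x.1, φ x.2)) (pr (L l)) = pr (map φ (L l)) := ih
      rw [lcomp_apply, lcomp_apply, ← cons_L, pr_cons, map_cons, pr_cons, map_sub,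
        map_cons, map_cons, map_cons, ih']
      simp
      rfl
  exact lcongr_fun this c

end LC

/-- The homotopy operator on singular chains. -/
def prC (H : C(UI × X, Y)) : (Simp X →₀ ℚ) →ₗ[ℚ] (Simp Y →₀ ℚ) :=
  ext fun n σ => R (H.comp ((cid UI).prodMap σ)) (LC.pr (L (ι (n + 1))))

lemma prC_R (H : C(UI × X, Y)) (σ : C(S, X)) (c : LC S) :
    prC H (R σ c) = R (H.comp ((cid UI).prodMap σ)) (LC.pr c) :=
  ext_R _ (R (H.comp ((cid UI).prodMap σ)) ∘ₗ LC.pr) σ (by simp [LC.pr_nil])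
    (fun n v => by
      have : (cid UI).prodMap (σ.comp (affT v)) =
        ((cid UI).prodMap σ).comp ((cid UI).prodMap (affT v)) := rfl
      rw [this, ← ContinuousMap.comp_assoc, R_comp, lcomp_apply, ← map_affT_ι, ← LC.map_pr]
      · rfl
      · intro m t u
        exact Prod.ext rfl (affT_affine v t _)) c

lemma homotopy_HEqv {f g : C(X, Y)} (h : Homotopic f g) : (Cm f).HEqv (Cm g) := by
  obtain ⟨H⟩ := h
  refine HEqv.symm fun x hx => ⟨prC H.toContinuousMap x, ?_⟩
  have : dC ∘ₗ prC H.toContinuousMap + prC H.toContinuousMap ∘ₗ dC = (Cm g).f - (Cm f).f :=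
    C_induct fun n σ => by
      have e1 : Affine (ContinuousMap.mk (fun x : Δ (n + 1) => ((1 : UI), x)) (by fun_prop)) := by
        intro m t v
        refine Prod.ext (sext ?_) rfl
        change (1 : ℝ) = ∑ i, t.1 i * 1
        simp [t.2.2]
      have e0 : Affine (ContinuousMap.mk (fun x : Δ (n + 1) => ((0 : UI), x)) (by fun_prop)) := by
        intro m t v
        refine Prod.ext (sext ?_) rfl
        change (0 : ℝ) = ∑ i, t.1 i * 0
        simp
      rw [ladd_apply, lcomp_apply, lcomp_apply, lsub_apply,
        prC_R, dC_R, dC_R, prC_R, ← map_add, LC.d_pr, map_sub, Cm_R, Cm_R]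
      congr 1
      · refine (R_comp _ e1 _).symm.trans ?_
        refine congrArg (fun τ => R τ (L (ι (n + 1)))) (?_ : _ = g.comp σ)
        ext x; simp
      · refine (R_comp _ e0 _).symm.trans ?_
        refine congrArg (fun τ => R τ (L (ι (n + 1)))) (?_ : _ = f.comp σ)
        ext x; simp
  have h2 := lcongr_fun this x
  have hx' : dC x = 0 := hx
  simp only [ladd_apply, lcomp_apply, hx', map_zero, add_zero] at h2
  exact h2

lemma QI_of_homotopy_inverse (f : C(X, Y)) (g : C(Y, X))
    (h1 : Homotopic (g.comp f) (cid X))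
    (h2 : Homotopic (f.comp g) (cid Y)) : (Cm f).QI :=
  QI.of_inv (g := Cm g)
    (fun x hx => by
      have := (homotopy_HEqv h1).symm x hx
      rwa [Cm_comp, Cm_id] at this)
    (fun x hx => by
      have := (homotopy_HEqv h2).symm x hx
      rwa [Cm_comp, Cm_id] at this)

lemma QI_of_homeo (f : X ≃ₜ Y) : (Cm (f : C(X, Y))).QI :=
  QI_of_homotopy_inverse _ (f.symm : C(Y, X))
    (by rw [show (f.symm : C(Y, X)).comp (f : C(X, Y)) = cid X by ext; simp])
    (by rw [show (f : C(X, Y)).comp (f.symm : C(Y, X)) = cid Y by ext; simp])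

/-! ### The augmentation -/

lemma C_subsingleton [IsEmpty X] : Subsingleton (C X).X := by
  have : IsEmpty (Simp X) := ⟨fun s => isEmptyElim (s.2 (Δ.vert 0))⟩
  exact inferInstanceAs (Subsingleton (Simp X →₀ ℚ))

/-- The ground field as a differential module. -/
@[reducible] def QQ : DMod where
  X := ℚ
  d := 0
  ε := lid
  dd := fun x => rfl
  εε := fun x => rfl
  dε := fun x => by simp

/-- The coefficient of the empty list. -/
def LC.co {S : Type} : LC S →ₗ[ℚ] ℚ := Finsupp.lapply []

lemma LC.co_L {S : Type} (l : List S) : LC.co (L l) = if l.length = 0 then 1 else 0 := by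
  classical
  simp [LC.co, Finsupp.single_apply, List.length_eq_zero_iff]

lemma LC.co_cons {S : Type} (v : S) (c : LC S) : LC.co (LC.cons v c) = 0 := by
  have : LC.co ∘ₗ LC.cons v = 0 := lin_ext fun l => by simp [LC.co_L]
  exact lcongr_fun this c

/-- The augmentation. -/
def augC : (Simp X →₀ ℚ) →ₗ[ℚ] ℚ := ext fun n σ => if n = 0 then 1 else 0

lemma augC_R (σ : C(S, X)) (c : LC S) : augC (R σ c) = LC.co (LC.d c) :=
  ext_R _ (LC.co ∘ₗ LC.d) σ (by simp) (fun n v => by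
    rw [List.ofFn_succ, lcomp_apply, LC.d_L_cons, map_sub, LC.co_cons, LC.co_L]
    simp) c

/-- The augmentation as a morphism. -/
def aug (X : Type) [TopologicalSpace X] : DHom (C X) QQ where
  f := augC
  hd := fun x => by
    have : augC ∘ₗ dC = (0 : (Simp X →₀ ℚ) →ₗ[ℚ] ℚ) := C_induct fun n σ => by
      rw [lcomp_apply, dC_R, augC_R]; simp
    exact lcongr_fun this x
  hε := fun x => by
    have : augC ∘ₗ εC = (augC : (Simp X →₀ ℚ) →ₗ[ℚ] ℚ) := C_induct fun n σ => by
      rw [lcomp_apply, εC_R, augC_R, augC_R, LC.d_sg, map_neg]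
      rw [ι, List.ofFn_succ, LC.d_L_cons, map_sub LC.sg, map_sub LC.co, map_sub LC.co, LC.sg_cons,
        map_neg, LC.co_cons, LC.co_cons, LC.sg_L, map_smul, LC.co_L, List.length_ofFn]
      split_ifs with h
      · rw [h]; simp
      · simp
    exact lcongr_fun this x

lemma aug_push (f : C(X, Y)) (x : (C X).X) : (aug Y).f ((Cm f).f x) = (aug X).f x := by
  have : (aug Y).f ∘ₗ (Cm f).f = (aug X).f := C_induct fun n σ => by
    rw [lcomp_apply, Cm_R]
    exact (augC_R _ _).trans (augC_R _ _).symm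
  exact lcongr_fun this x

/-- The class of a point. -/
def ptC (x : X) : (C X).X := fsingle ⟨0, cconst _ x⟩ 1

lemma ptC_eq (x : X) : ptC x = R (cconst (Δ 1) x) (L (ι 1)) := (R_ι _).symm

lemma d_ptC (x : X) : (C X).d (ptC x) = 0 := by
  rw [ptC_eq]
  refine (dC_R _ _).trans ?_
  rw [ι, List.ofFn_succ, LC.d_L_cons]
  simp

lemma aug_ptC (x : X) : (aug X).f (ptC x) = 1 := (lin_L _ _).trans (by simp)

lemma aug_QI_unit : (aug Unit).QI := by
  let v : Δ 1 := Δ.vert 0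
  let s : (Simp Unit →₀ ℚ) →ₗ[ℚ] (Simp Unit →₀ ℚ) := ext fun n σ =>
    R (cconst (Δ 1) ()) (LC.cons v (LC.map (fun _ => v) (L (ι (n + 1)))))
  have hR : ∀ (m : ℕ) (c : LC (Δ m)), R (cconst (Δ m) ()) c =
      R (cconst (Δ 1) ()) (LC.map (fun _ => v) c) := fun m c => by
    refine R_comp (cconst (Δ 1) ()) (φ := cconst (Δ m) v) ?_ c
    intro m t u
    exact sext (funext fun j => by
      change v.1 j = ∑ i, t.1 i * v.1 j
      rw [← sum_mul, t.2.2, one_mul])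
  have hs : ∀ (m : ℕ) (c : LC (Δ m)), s (R (cconst (Δ m) ()) c) =
      R (cconst (Δ 1) ()) (LC.cons v (LC.map (fun _ => v) c)) - LC.co c • ptC () :=
    fun m c => ext_R (S := Δ m) _
      (R (cconst (Δ 1) ()) ∘ₗ (LC.cons v ∘ₗ LC.map (fun _ => v)) -
        LC.co.smulRight (ptC ())) _ (by
        simp only [lsub_apply, lcomp_apply, LC.map_L, LC.cons_L,
          LinearMap.smulRight_apply, LC.co_L, List.map_nil, List.length_nil, if_true, one_smul]
        rw [ptC_eq, sub_eq_zero]; rfl) (fun n u => by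
        simp only [lsub_apply, lcomp_apply, LC.map_L,
          LinearMap.smulRight_apply, LC.co_L, List.length_ofFn, ι]
        simp [List.map_ofFn, Function.comp_def]) c
  have key : ∀ x, dC (s x) + s (dC x) = x - augC x • ptC () := by
    have : dC ∘ₗ s + s ∘ₗ dC = lid - augC.smulRight (ptC ()) := C_induct fun n σ => by
      have hσ : σ = cconst _ () := rfl
      rw [ladd_apply, lcomp_apply, lcomp_apply, lsub_apply,
        dC_R, hσ, hs, hs, map_sub, dC_R, LC.d_cons, map_smul, LinearMap.smulRight_apply, augC_R,
        LC.co_L, map_sub (R _), ← LC.map_d, lid_apply, hR (n + 1)]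
      simp [ι]
    exact lcongr_fun this
  constructor
  · rintro x hx ⟨y, hy⟩
    have hx' : dC x = 0 := hx
    have hy' : augC x = 0 := hy.symm
    refine ⟨s x, ?_⟩
    have := key x
    rw [hx', hy', map_zero] at this
    simpa using this
  · intro q _
    exact ⟨q • ptC (), by rw [map_smul, d_ptC, smul_zero], 0, by
      have h1 : augC (ptC ()) = 1 := aug_ptC ()
      change (0 : ℚ) = q - augC (q • ptC ())
      rw [map_smul, h1]; simp⟩

lemma aug_QI [ContractibleSpace X] : (aug X).QI := by
  obtain ⟨e⟩ := ContractibleSpace.hequiv_unit X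
  have h : (Cm e.toFun).QI := QI_of_homotopy_inverse e.toFun e.invFun e.left_inv e.right_inv
  exact QI.congr (HEqv.of_eq fun x => aug_push e.toFun x) (aug_QI_unit.comp h)

lemma OV_QQ : QQ.OV := fun x _ => by
  change QQ.Bd (x - x)
  rw [sub_self]; exact Bd.zero

lemma OV_contractible [ContractibleSpace X] : (C X).OV := aug_QI.ov_iff.2 OV_QQ

lemma OV_empty [IsEmpty X] : (C X).OV := fun x _ => ⟨0, C_subsingleton.elim _ _⟩

/-! ### Barycentric subdivision -/

/-- The barycenter. -/
def Δ.bary (m : ℕ) : Δ (m + 1) := ⟨fun _ => 1 / (m + 1), fun _ => by positivity, by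
  simp; field_simp⟩

namespace LC

/-- Chains supported on a set of lists. -/
abbrev on {S : Type} (p : Set (List S)) : Submodule ℚ (LC S) := Finsupp.supported ℚ ℚ p

lemma L_mem_on {S : Type} {p : Set (List S)} {l : List S} (h : l ∈ p) : L l ∈ on p :=
  Finsupp.single_mem_supported ℚ 1 h

lemma on_le {S : Type} {p : Set (List S)} {N : Submodule ℚ (LC S)}
    (h : ∀ l ∈ p, L l ∈ N) : on p ≤ N := by
  rw [on, Finsupp.supported_eq_span_single, Submodule.span_le]
  rintro _ ⟨l, hl, rfl⟩
  exact h l hl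

lemma on_map {S M : Type} [AddCommGroup M] [Module ℚ M] {p : Set (List S)} {N : Submodule ℚ M}
    (f : LC S →ₗ[ℚ] M) (h : ∀ l ∈ p, f (L l) ∈ N) {c : LC S} (hc : c ∈ on p) : f c ∈ N :=
  on_le (N := N.comap f) h hc

lemma eqOn {S M : Type} [AddCommGroup M] [Module ℚ M] {p : Set (List S)}
    {f g : LC S →ₗ[ℚ] M} (h : ∀ l ∈ p, f (L l) = g (L l)) {c : LC S} (hc : c ∈ on p) :
    f c = g c :=
  on_le (N := LinearMap.eqLocus f g) h hc

lemma d_on {S : Type} {m : ℕ} (l : List S) (hl : l.length = m + 1) :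
    d (L l) ∈ on {l' | l'.length = m ∧ l' ⊆ l} := by
  induction l generalizing m with
  | nil => simp at hl
  | cons v l ih =>
    rw [d_L_cons]
    have hl' : l.length = m := by simpa using hl
    refine Submodule.sub_mem _ (L_mem_on ⟨hl', List.subset_cons_self _ _⟩) ?_
    cases m with
    | zero => rw [List.length_eq_zero_iff] at hl'; subst hl'; simp
    | succ m =>
      refine on_map (cons v) (fun l' h' => ?_) (ih hl')
      rw [cons_L]
      exact L_mem_on ⟨by simp [h'.1], List.cons_subset_cons v h'.2⟩

lemma d_on_len {S : Type} {m : ℕ} {c : LC S} (hc : c ∈ on {l | l.length = m + 1}) :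
    d c ∈ on {l | l.length = m} :=
  on_map d (fun l hl => Finsupp.supported_mono (fun _ h => h.1) (d_on l hl)) hc

/-- Adding the barycenter of a tuple. -/
def barT : (Σ m, Fin m → S) → LC S →ₗ[ℚ] LC S
  | ⟨0, _⟩ => 0
  | ⟨m + 1, v⟩ => cons (Conv.comb (Δ.bary m) v)

/-- Applying `K` to a list and then adding the barycenter of the list. -/
def next (K : LC S →ₗ[ℚ] LC S) : LC S →ₗ[ℚ] LC S :=
  lin fun l => barT (List.equivSigmaTuple l) (K (L l))

lemma next_ofFn (K : LC S →ₗ[ℚ] LC S) {m : ℕ} (v : Fin (m + 1) → S) :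
    next K (L (ofFn v)) = cons (Conv.comb (Δ.bary m) v) (K (L (ofFn v))) := by
  rw [next, lin_L]
  rw [show List.equivSigmaTuple (ofFn v) = ⟨m + 1, v⟩ from
    List.equivSigmaTuple.right_inv ⟨m + 1, v⟩]
  rfl

/-- Subdivision of lists of given length. -/
def SdF : ℕ → LC S →ₗ[ℚ] LC S
  | 0 => lid
  | k + 1 => next (SdF k ∘ₗ d)

/-- The homotopy between subdivision and the identity on lists of given length. -/
def hF : ℕ → LC S →ₗ[ℚ] LC S
  | 0 => 0
  | k + 1 => next (lid - hF k ∘ₗ d)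

lemma exists_ofFn_len {S : Type} {m : ℕ} {l : List S} (h : l.length = m) :
    ∃ v : Fin m → S, l = ofFn v := by
  subst h
  exact ⟨l.get, (List.ofFn_get l).symm⟩

lemma SdF_zero : (SdF 0 : LC S →ₗ[ℚ] LC S) = lid := rfl

lemma hF_zero : (hF 0 : LC S →ₗ[ℚ] LC S) = 0 := rfl

lemma SdF_succ (k : ℕ) : (SdF (k + 1) : LC S →ₗ[ℚ] LC S) = next (SdF k ∘ₗ d) := rfl

lemma hF_succ (k : ℕ) : (hF (k + 1) : LC S →ₗ[ℚ] LC S) = next (lid - hF k ∘ₗ d) := rfl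

attribute [irreducible] SdF hF

lemma d_SdF (k : ℕ) {c : LC S} (hc : c ∈ on {l | l.length = k + 1}) :
    d (SdF (k + 1) c) = SdF k (d c) := by
  induction k generalizing c with
  | zero =>
    have key : ∀ l ∈ {l : List S | l.length = 0 + 1},
        (d ∘ₗ SdF (0 + 1)) (L l) = (SdF 0 ∘ₗ d) (L l) := fun l hl => by
      obtain ⟨v, rfl⟩ := exists_ofFn_len hl
      rw [lcomp_apply, SdF_succ, next_ofFn, d_cons]
      simp [SdF_zero]
    simpa only [lcomp_apply] using eqOn key hc
  | succ k ih =>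
    have key : ∀ l ∈ {l : List S | l.length = k + 1 + 1},
        (d ∘ₗ SdF (k + 1 + 1)) (L l) = (SdF (k + 1) ∘ₗ d) (L l) := fun l hl => by
      have h0 : d (L l) ∈ on {l : List S | l.length = k + 1} :=
        d_on_len (L_mem_on (p := {l : List S | l.length = k + 1 + 1}) hl)
      have h1 := ih h0
      rw [dd, map_zero] at h1
      obtain ⟨v, rfl⟩ := exists_ofFn_len hl
      rw [lcomp_apply, SdF_succ (k + 1), next_ofFn, d_cons, lcomp_apply, h1, map_zero, sub_zero]
    simpa only [lcomp_apply] using eqOn key hc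

lemma d_hF (k : ℕ) {c : LC S} (hc : c ∈ on {l | l.length = k + 1}) :
    d (hF (k + 1) c) = c - SdF (k + 1) c - hF k (d c) := by
  induction k generalizing c with
  | zero =>
    have key : ∀ l ∈ {l : List S | l.length = 0 + 1}, (d ∘ₗ hF (0 + 1)) (L l) =
        (lid - SdF (0 + 1) - hF 0 ∘ₗ d : LC S →ₗ[ℚ] LC S) (L l) := fun l hl => by
      obtain ⟨v, rfl⟩ := exists_ofFn_len hl
      rw [lcomp_apply, hF_succ, next_ofFn, d_cons, lsub_apply,
        lsub_apply, lsub_apply, SdF_succ, next_ofFn]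
      simp [SdF_zero, hF_zero]
    simpa only [lcomp_apply, lsub_apply, lid_apply] using eqOn key hc
  | succ k ih =>
    have key : ∀ l ∈ {l : List S | l.length = k + 1 + 1},
        (d ∘ₗ hF (k + 1 + 1)) (L l) =
          (lid - SdF (k + 1 + 1) - hF (k + 1) ∘ₗ d : LC S →ₗ[ℚ] LC S) (L l) := fun l hl => by
      have h0 : d (L l) ∈ on {l : List S | l.length = k + 1} :=
        d_on_len (L_mem_on (p := {l : List S | l.length = k + 1 + 1}) hl)
      have h1 := ih h0
      rw [dd, map_zero, sub_zero] at h1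
      obtain ⟨v, rfl⟩ := exists_ofFn_len hl
      rw [lcomp_apply, hF_succ (k + 1), next_ofFn, d_cons, lsub_apply,
        lsub_apply, lsub_apply, lid_apply, lcomp_apply,
        map_sub d, h1, SdF_succ (k + 1), next_ofFn, lcomp_apply, map_sub]
      simp only [map_sub]
      abel
    simpa only [lcomp_apply, lsub_apply, lid_apply] using eqOn key hc

lemma map_next {φ : S → T} (hφ : Affine φ) {K : LC S →ₗ[ℚ] LC S} {K' : LC T →ₗ[ℚ] LC T}
    (hK : ∀ c, map φ (K c) = K' (map φ c)) (c : LC S) : map φ (next K c) = next K' (map φ c) := by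
  have : map φ ∘ₗ next K = next K' ∘ₗ map φ := hom_ext fun l => by
    obtain ⟨m, v, rfl⟩ := exists_ofFn l
    cases m with
    | zero =>
      rw [lcomp_apply, lcomp_apply, map_L, next, next, lin_L, lin_L]
      exact map_zero _
    | succ m =>
      rw [lcomp_apply, lcomp_apply, map_L, List.map_ofFn, next_ofFn, next_ofFn,
        map_cons, hK, hφ, map_L, List.map_ofFn]
      rfl
  exact lcongr_fun this c

lemma map_SdF {φ : S → T} (hφ : Affine φ) (k : ℕ) (c : LC S) :
    map φ (SdF k c) = SdF k (map φ c) := by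
  induction k generalizing c with
  | zero => rw [SdF_zero, SdF_zero]; rfl
  | succ k ih => rw [SdF_succ, SdF_succ]; exact map_next hφ (fun c => by simp [ih, map_d]) c

lemma map_hF {φ : S → T} (hφ : Affine φ) (k : ℕ) (c : LC S) :
    map φ (hF k c) = hF k (map φ c) := by
  induction k generalizing c with
  | zero => simp [hF_zero]
  | succ k ih => rw [hF_succ, hF_succ]; exact map_next hφ (fun c => by simp [ih, map_d]) c

/-- Barycentric subdivision. -/
def Sd : LC S →ₗ[ℚ] LC S := lin fun l => SdF l.length (L l)

/-- The homotopy between subdivision and the identity. -/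
def hS : LC S →ₗ[ℚ] LC S := lin fun l => hF l.length (L l)

lemma Sd_eq {m : ℕ} {c : LC S} (hc : c ∈ on {l | l.length = m}) : Sd c = SdF m c :=
  eqOn (fun l hl => by rw [Sd, lin_L, show l.length = m from hl]) hc

lemma hS_eq {m : ℕ} {c : LC S} (hc : c ∈ on {l | l.length = m}) : hS c = hF m c :=
  eqOn (fun l hl => by rw [hS, lin_L, show l.length = m from hl]) hc

lemma L_len {S : Type} (l : List S) : L l ∈ on {l' : List S | l'.length = l.length} :=
  L_mem_on rfl

lemma d_Sd (c : LC S) : d (Sd c) = Sd (d c) := by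
  have : d ∘ₗ Sd = Sd ∘ₗ (d : LC S →ₗ[ℚ] LC S) := hom_ext fun l => by
    rw [lcomp_apply, lcomp_apply, Sd_eq (L_len l)]
    cases l with
    | nil => simp [SdF_zero]
    | cons v l => rw [List.length_cons, d_SdF _ (L_len (v :: l)), Sd_eq (d_on_len (L_len (v :: l)))]
  exact lcongr_fun this c

lemma d_hS (c : LC S) : d (hS c) + hS (d c) = c - Sd c := by
  have : d ∘ₗ hS + hS ∘ₗ d = (lid : LC S →ₗ[ℚ] LC S) - Sd := hom_ext fun l => by
    rw [ladd_apply, lcomp_apply, lcomp_apply, lsub_apply, Sd_eq (L_len l), hS_eq (L_len l)]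
    cases l with
    | nil => simp [SdF_zero, hF_zero]
    | cons v l =>
      rw [List.length_cons, d_hF _ (L_len (v :: l)), hS_eq (d_on_len (L_len (v :: l)))]
      simp
  exact lcongr_fun this c

lemma map_Sd {φ : S → T} (hφ : Affine φ) (c : LC S) : map φ (Sd c) = Sd (map φ c) := by
  have : map φ ∘ₗ Sd = Sd ∘ₗ map φ := hom_ext fun l => by
    rw [lcomp_apply, lcomp_apply, Sd_eq (L_len l), map_L, Sd_eq (L_len _),
      List.length_map, map_SdF hφ, map_L]
  exact lcongr_fun this c

lemma map_hS {φ : S → T} (hφ : Affine φ) (c : LC S) : map φ (hS c) = hS (map φ c) := by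
  have : map φ ∘ₗ hS = hS ∘ₗ map φ := hom_ext fun l => by
    rw [lcomp_apply, lcomp_apply, hS_eq (L_len l), map_L, hS_eq (L_len _),
      List.length_map, map_hF hφ, map_L]
  exact lcongr_fun this c

lemma Sd_nil : Sd (L ([] : List S)) = L [] := by
  rw [Sd, lin_L, List.length_nil, SdF_zero]; rfl

lemma hS_nil : hS (L ([] : List S)) = 0 := by
  rw [hS, lin_L, List.length_nil, hF_zero]; rfl

/-! ### Mesh estimates -/

lemma dist_comb {m k : ℕ} (t : Δ m) (v : Fin m → Δ k) (z : Δ k) :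
    dist (Conv.comb t v) z ≤ ∑ i, t.1 i * dist (v i) z := by
  refine (dist_pi_le_iff (sum_nonneg fun i _ => mul_nonneg (t.2.1 i) dist_nonneg)).2
    fun j => ?_
  have : (Conv.comb t v).1 j - z.1 j = ∑ i, t.1 i * ((v i).1 j - z.1 j) := by
    simp_rw [mul_sub, Finset.sum_sub_distrib, ← sum_mul, t.2.2, one_mul]
    rfl
  rw [Real.dist_eq, this]
  refine (Finset.abs_sum_le_sum_abs _ _).trans (Finset.sum_le_sum fun i _ => ?_)
  rw [abs_mul, abs_of_nonneg (t.2.1 i)]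
  refine mul_le_mul_of_nonneg_left ?_ (t.2.1 i)
  rw [← Real.dist_eq]
  exact dist_le_pi_dist (v i).1 z.1 j

/-- Membership in every closed ball containing the list. -/
def BH {k : ℕ} (l : List (Δ k)) (x : Δ k) : Prop :=
  ∀ z B, (∀ y ∈ l, dist y z ≤ B) → dist x z ≤ B

lemma BH_comb {m k : ℕ} (t : Δ m) (v : Fin m → Δ k) : BH (ofFn v) (Conv.comb t v) := by
  intro z B h
  refine (dist_comb t v z).trans ?_
  calc ∑ i, t.1 i * dist (v i) z ≤ ∑ i, t.1 i * B := Finset.sum_le_sum fun i _ =>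
        mul_le_mul_of_nonneg_left (h _ ((List.mem_ofFn' _ _).2 ⟨i, rfl⟩)) (t.2.1 i)
    _ = B := by rw [← sum_mul, t.2.2, one_mul]

/-- The mutual distances are bounded by `D`. -/
def Mesh {k : ℕ} (D : ℝ) (l : List (Δ k)) : Prop := ∀ x ∈ l, ∀ y ∈ l, dist x y ≤ D

lemma dist_bary {m n k : ℕ} (hm : m ≤ n) (v : Fin (m + 1) → Δ k) {D : ℝ} (hD : 0 ≤ D)
    (h : Mesh D (ofFn v)) (j : Fin (m + 1)) :
    dist (v j) (Conv.comb (Δ.bary m) v) ≤ (n / (n + 1) : ℝ) * D := by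
  rw [dist_comm]
  refine (dist_comb _ v _).trans ?_
  have h1 : ∀ i, (Δ.bary m).1 i * dist (v i) (v j) ≤ 1 / (m + 1) * (if i = j then 0 else D) := by
    intro i
    refine mul_le_mul_of_nonneg_left ?_ ((Δ.bary m).2.1 i)
    split_ifs with hij
    · simp [hij]
    · exact h _ ((List.mem_ofFn' _ _).2 ⟨i, rfl⟩) _ ((List.mem_ofFn' _ _).2 ⟨j, rfl⟩)
  refine (Finset.sum_le_sum fun i _ => h1 i).trans ?_
  have h2 : ∑ i : Fin (m + 1), (if i = j then (0 : ℝ) else D) = m * D := by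
    have : ∀ i : Fin (m + 1), (if i = j then (0 : ℝ) else D) = D - if i = j then D else 0 := by
      intro i; split_ifs <;> simp
    simp_rw [this, Finset.sum_sub_distrib]
    simp; ring
  rw [← mul_sum, h2, ← mul_assoc]
  refine mul_le_mul_of_nonneg_right ?_ hD
  have hmn : (m : ℝ) ≤ n := by exact_mod_cast hm
  rw [div_mul_eq_mul_div, one_mul, div_le_div_iff₀ (by positivity) (by positivity)]
  nlinarith

lemma SdF_mesh {n k : ℕ} {D : ℝ} (hD : 0 ≤ D) (m : ℕ) (hm : m ≤ n + 1) (l : List (Δ k))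
    (hl : l.length = m) (h : Mesh D l) :
    SdF m (L l) ∈ on {l' | l'.length = m ∧ (∀ x ∈ l', BH l x) ∧ Mesh ((n / (n + 1) : ℝ) * D) l'} := by
  induction m generalizing l with
  | zero =>
    rw [List.length_eq_zero_iff] at hl
    subst hl
    rw [SdF_zero]
    exact Finsupp.single_mem_supported ℚ 1 ⟨rfl, by simp, by simp [Mesh]⟩
  | succ m ih =>
    obtain ⟨v, rfl⟩ := exists_ofFn_len hl
    rw [SdF_succ, next_ofFn]
    refine on_map (cons _ ∘ₗ SdF m) (p := {l' | l'.length = m ∧ l' ⊆ ofFn v})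
      (fun l' hl' => ?_) (d_on _ hl)
    have h2 := ih (by omega) l' hl'.1 fun x hx y hy => h x (hl'.2 hx) y (hl'.2 hy)
    refine on_map (cons _) (fun l'' hl'' => ?_) h2
    rw [cons_L]
    obtain ⟨h3, h4, h5⟩ := hl''
    have hb : ∀ x ∈ l'', BH (ofFn v) x := fun x hx z B hB =>
      h4 x hx z B fun y hy => hB y (hl'.2 hy)
    have hd : ∀ x ∈ l'', dist x (Conv.comb (Δ.bary m) v) ≤ (n / (n + 1) : ℝ) * D := fun x hx =>
      hb x hx _ _ fun y hy => by
        obtain ⟨j, rfl⟩ := (List.mem_ofFn' _ _).1 hy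
        exact dist_bary (by omega) v hD h j
    refine L_mem_on ?_
    refine ⟨by simp [h3], fun x hx => ?_, fun x hx y hy => ?_⟩
    · rcases List.mem_cons.1 hx with rfl | hx
      · exact BH_comb _ v
      · exact hb x hx
    · rcases List.mem_cons.1 hx with rfl | hx <;> rcases List.mem_cons.1 hy with rfl | hy
      · rw [dist_self]; positivity
      · rw [dist_comm]; exact hd y hy
      · exact hd x hx
      · exact h5 x hx y hy

lemma Sd_mesh {n k : ℕ} {D : ℝ} (hD : 0 ≤ D) {c : LC (Δ k)}
    (hc : c ∈ on {l | l.length = n + 1 ∧ Mesh D l}) :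
    Sd c ∈ on {l | l.length = n + 1 ∧ Mesh ((n / (n + 1) : ℝ) * D) l} :=
  on_map Sd (fun l hl => by
    rw [Sd_eq (L_mem_on (p := {l' : List (Δ k) | l'.length = n + 1}) hl.1)]
    have h1 : {l' : List (Δ k) | l'.length = n + 1 ∧ (∀ x ∈ l', BH l x) ∧
        Mesh ((n / (n + 1) : ℝ) * D) l'} ⊆ {l | l.length = n + 1 ∧ Mesh ((n / (n + 1) : ℝ) * D) l} :=
      fun _ h => ⟨h.1, h.2.2⟩
    exact Finsupp.supported_mono h1 (SdF_mesh hD _ le_rfl l hl.1 hl.2)) hc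

lemma Sd_iter_mesh {n : ℕ} {δ : ℝ} (hδ : 0 < δ) :
    ∃ j : ℕ, (Sd^[j] (L (ι (n + 1)))) ∈ on {l | l.length = n + 1 ∧ Mesh (δ / 2) l} := by
  have h0 : ∀ x y : Δ (n + 1), dist x y ≤ 1 := fun x y => by
    refine (dist_pi_le_iff zero_le_one).2 fun j => ?_
    have h1 := x.2.1 j; have h2 := y.2.1 j
    have h3 : x.1 j ≤ 1 := by
      rw [← x.2.2]; exact Finset.single_le_sum (fun i _ => x.2.1 i) (mem_univ j)
    have h4 : y.1 j ≤ 1 := by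
      rw [← y.2.2]; exact Finset.single_le_sum (fun i _ => y.2.1 i) (mem_univ j)
    rw [Real.dist_eq, abs_le]
    constructor <;> linarith
  have h1 : ∀ j : ℕ, (Sd^[j] (L (ι (n + 1)))) ∈
      on {l | l.length = n + 1 ∧ Mesh ((n / (n + 1) : ℝ) ^ j) l} := fun j => by
    induction j with
    | zero =>
      refine L_mem_on ?_
      exact ⟨by simp [ι], fun x _ y _ => by simpa using h0 x y⟩
    | succ j ih =>
      rw [Function.iterate_succ_apply', pow_succ']
      exact Sd_mesh (by positivity) ih
  obtain ⟨j, hj⟩ := exists_pow_lt_of_lt_one (half_pos hδ)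
    (show (n / (n + 1) : ℝ) < 1 by rw [div_lt_one (by positivity)]; linarith)
  have h2 : {l : List (Δ (n + 1)) | l.length = n + 1 ∧ Mesh ((n / (n + 1) : ℝ) ^ j) l} ⊆
      {l | l.length = n + 1 ∧ Mesh (δ / 2) l} :=
    fun l h => ⟨h.1, fun x hx y hy => (h.2 x hx y hy).trans hj.le⟩
  exact ⟨j, Finsupp.supported_mono h2 (h1 j)⟩

end LC

/-! ### Excision -/

/-- Subdivision of singular chains. -/
def SdC : (Simp X →₀ ℚ) →ₗ[ℚ] (Simp X →₀ ℚ) := ext fun n σ => R σ (LC.Sd (L (ι (n + 1))))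

lemma SdC_R (σ : C(S, X)) (c : LC S) : SdC (R σ c) = R σ (LC.Sd c) :=
  ext_R _ (R σ ∘ₗ LC.Sd) σ (by simp [LC.Sd_nil]) (fun n v => by
    rw [R_comp σ (affT_affine v), LC.map_Sd (affT_affine v), map_affT_ι]; rfl) c

/-- The subdivision homotopy of singular chains. -/
def hC : (Simp X →₀ ℚ) →ₗ[ℚ] (Simp X →₀ ℚ) := ext fun n σ => R σ (LC.hS (L (ι (n + 1))))

lemma hC_R (σ : C(S, X)) (c : LC S) : hC (R σ c) = R σ (LC.hS c) :=
  ext_R _ (R σ ∘ₗ LC.hS) σ (by simp [LC.hS_nil]) (fun n v => by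
    rw [R_comp σ (affT_affine v), LC.map_hS (affT_affine v), map_affT_ι]; rfl) c

lemma d_SdC (x : (C X).X) : (C X).d (SdC x) = SdC ((C X).d x) := by
  have : dC ∘ₗ SdC = SdC ∘ₗ (dC : (C X).X →ₗ[ℚ] (C X).X) := C_induct fun n σ => by
    simp [dC_R, SdC_R, LC.d_Sd]
  exact lcongr_fun this x

lemma d_hC (x : (C X).X) : (C X).d (hC x) + hC ((C X).d x) = x - SdC x := by
  have : dC ∘ₗ hC + hC ∘ₗ dC = lid - (SdC : (C X).X →ₗ[ℚ] (C X).X) :=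
    C_induct fun n σ => by
      rw [ladd_apply, lcomp_apply, lcomp_apply, lsub_apply,
        dC_R, SdC_R, hC_R, hC_R, dC_R, ← map_add, LC.d_hS, map_sub]
      rfl
  exact lcongr_fun this x

lemma Cm_SdC (f : C(X, Y)) (x : (C X).X) : (Cm f).f (SdC x) = SdC ((Cm f).f x) := by
  have : (Cm f).f ∘ₗ SdC = SdC ∘ₗ (Cm f).f := C_induct fun n σ => by
    rw [lcomp_apply, SdC_R, Cm_R, lcomp_apply, Cm_R, SdC_R]
  exact lcongr_fun this x

lemma Cm_hC (f : C(X, Y)) (x : (C X).X) : (Cm f).f (hC x) = hC ((Cm f).f x) := by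
  have : (Cm f).f ∘ₗ hC = hC ∘ₗ (Cm f).f := C_induct fun n σ => by
    rw [lcomp_apply, hC_R, Cm_R, lcomp_apply, Cm_R, hC_R]
  exact lcongr_fun this x

/-- The homotopy between iterated subdivision and the identity. -/
def hCi : ℕ → (Simp X →₀ ℚ) →ₗ[ℚ] (Simp X →₀ ℚ)
  | 0 => 0
  | k + 1 => hCi k + hC ∘ₗ (SdC ^ k)

lemma d_SdCi (k : ℕ) (x : (C X).X) : (C X).d ((SdC ^ k) x) = (SdC ^ k) ((C X).d x) := by
  induction k with
  | zero => rfl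
  | succ k ih => rw [pow_succ', Module.End.mul_apply, Module.End.mul_apply, d_SdC, ih]

lemma d_hCi (k : ℕ) (x : (C X).X) : (C X).d (hCi k x) + hCi k ((C X).d x) = x - (SdC ^ k) x := by
  induction k with
  | zero => simp [hCi]
  | succ k ih =>
    have h1 := d_hC ((SdC ^ k) x)
    rw [d_SdCi] at h1
    simp only [hCi, ladd_apply, lcomp_apply, map_add]
    rw [pow_succ', Module.End.mul_apply]
    rw [add_add_add_comm]
    refine (congrArg₂ (· + ·) ih h1).trans ?_
    abel

lemma Cm_SdCi (f : C(X, Y)) (k : ℕ) (x : (C X).X) :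
    (Cm f).f ((SdC ^ k) x) = (SdC ^ k) ((Cm f).f x) := by
  induction k with
  | zero => rfl
  | succ k ih => rw [pow_succ', pow_succ', Module.End.mul_apply, Module.End.mul_apply, Cm_SdC, ih]

lemma Cm_hCi (f : C(X, Y)) (k : ℕ) (x : (C X).X) :
    (Cm f).f (hCi k x) = hCi k ((Cm f).f x) := by
  induction k with
  | zero => simp [hCi]
  | succ k ih =>
    simp only [hCi, ladd_apply, lcomp_apply, map_add, ih]
    rw [Cm_hC, Cm_SdCi]

/-- Singular chains with image in a set. -/
abbrev chains (P : Set X) : Submodule ℚ (Simp X →₀ ℚ) :=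
  Finsupp.supported ℚ ℚ {s | Set.range s.2 ⊆ P}

lemma single_mem_chains {P : Set X} {n : ℕ} {σ : C(Δ (n + 1), X)} (h : Set.range σ ⊆ P) :
    fsingle ⟨n, σ⟩ 1 ∈ chains P := Finsupp.single_mem_supported ℚ 1 h

lemma Cm_injective {f : C(X, Y)} (hf : Injective f) : Injective (Cm f).f := by
  let F : Simp X → Simp Y := fun s => ⟨s.1, f.comp s.2⟩
  have hF : Injective F := by
    rintro ⟨n, σ⟩ ⟨m, τ⟩ h
    obtain ⟨rfl, h2⟩ := Sigma.mk.inj h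
    have h3 : f.comp σ = f.comp τ := eq_of_heq h2
    have : σ = τ := ContinuousMap.ext fun x => hf (DFunLike.congr_fun h3 x)
    rw [this]
  have : (Cm f).f = lmapDomain ℚ ℚ F := C_induct fun n σ => by
    rw [R_ι]
    refine (push_single f n σ).trans ?_
    rw [Finsupp.lmapDomain_apply, mapDomain_single]
  rw [this]
  exact Finsupp.mapDomain_injective hF

lemma chains_le_range {f : C(X, Y)} (hf : IsEmbedding f) :
    chains (Set.range f) ≤ lrange (Cm f).f := by
  rw [chains, Finsupp.supported_eq_span_single, Submodule.span_le]
  rintro _ ⟨⟨n, σ⟩, hσ, rfl⟩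
  have hc : ∀ x, ∃ y, f y = σ x := fun x => hσ ⟨x, rfl⟩
  choose g hg using hc
  have hgc : Continuous g := by
    rw [hf.continuous_iff]
    exact (show f ∘ g = σ from funext hg) ▸ σ.continuous
  refine ⟨fsingle ⟨n, ⟨g, hgc⟩⟩ 1, (push_single f n _).trans ?_⟩
  congr 2
  exact ContinuousMap.ext hg

lemma range_le_chains {f : C(X, Y)} {P : Set Y} (hP : Set.range f ⊆ P) (x : (C X).X) :
    (Cm f).f x ∈ chains P := by
  have : (⊤ : Submodule ℚ (Simp X →₀ ℚ)) ≤ (chains P).comap (Cm f).f := by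
    rw [← Finsupp.supported_univ, Finsupp.supported_eq_span_single, Submodule.span_le]
    rintro _ ⟨⟨n, σ⟩, -, rfl⟩
    change push f _ ∈ chains P
    rw [push_single]
    refine single_mem_chains ?_
    rintro _ ⟨t, rfl⟩
    exact hP ⟨_, rfl⟩
  exact this (Submodule.mem_top)

lemma mem_range_of_both {A B : Type} [TopologicalSpace A] [TopologicalSpace B] {a : C(A, X)}
    {b : C(B, X)} {c : C(Y, X)} (hc : IsEmbedding c)
    (h : Set.range a ∩ Set.range b ⊆ Set.range c) {x : (C A).X} {y : (C B).X}
    (hxy : (Cm a).f x = (Cm b).f y) : ∃ z, (Cm c).f z = (Cm a).f x := by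
  refine chains_le_range hc ?_
  have h1 := range_le_chains (f := a) subset_rfl x
  have h2 := range_le_chains (f := b) subset_rfl y
  rw [← hxy] at h2
  have h3 := Submodule.mem_inf.2 ⟨h1, h2⟩
  rw [chains, chains, ← Finsupp.supported_inter] at h3
  have h4 : {s : Simp X | Set.range s.2 ⊆ Set.range a} ∩ {s : Simp X | Set.range s.2 ⊆ Set.range b} ⊆
      {s : Simp X | Set.range s.2 ⊆ Set.range c} := fun s hs t ht => h ⟨hs.1 ht, hs.2 ht⟩
  exact Finsupp.supported_mono h4 h3

lemma small_single {U V : Set X} (hU : IsOpen U) (hV : IsOpen V) (h : U ∪ V = Set.univ)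
    (n : ℕ) (σ : C(Δ (n + 1), X)) :
    ∃ k, (SdC ^ k) (fsingle ⟨n, σ⟩ 1) ∈ chains U ⊔ chains V := by
  obtain ⟨δ, hδ, hb⟩ := lebesgue_number_lemma_of_metric (s := (Set.univ : Set (Δ (n + 1))))
    (c := fun b : Bool => cond b (σ ⁻¹' U) (σ ⁻¹' V)) isCompact_univ
    (by rintro (_ | _); exacts [hV.preimage σ.continuous, hU.preimage σ.continuous])
    (fun x _ => by
      rcases (h.symm ▸ Set.mem_univ (σ x) : σ x ∈ U ∪ V) with h | h
      exacts [Set.mem_iUnion.2 ⟨true, h⟩, Set.mem_iUnion.2 ⟨false, h⟩])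
  obtain ⟨k, hk⟩ := LC.Sd_iter_mesh hδ
  refine ⟨k, ?_⟩
  have e : ∀ j : ℕ, (SdC ^ j) (R σ (L (ι (n + 1)))) = R σ (LC.Sd^[j] (L (ι (n + 1)))) := fun j => by
    induction j with
    | zero => rfl
    | succ j ih => rw [pow_succ', Module.End.mul_apply, ih, SdC_R, Function.iterate_succ_apply']
  rw [← R_ι, e]
  refine LC.on_map (R σ) (fun l hl => ?_) hk
  obtain ⟨hl, hM⟩ := hl
  obtain ⟨v, rfl⟩ := LC.exists_ofFn_len hl
  rw [R_ofFn, realT]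
  have hball : ∀ t, affT v t ∈ Metric.ball (v 0) δ := fun t => by
    refine (LC.BH_comb t v (v 0) (δ / 2) fun y hy => hM _ hy _ ?_).trans_lt (half_lt_self hδ)
    exact (List.mem_ofFn' _ _).2 ⟨0, rfl⟩
  obtain ⟨b, hb'⟩ := hb (v 0) trivial
  cases b
  · refine Submodule.mem_sup_right (single_mem_chains ?_)
    rintro _ ⟨t, rfl⟩
    exact hb' (hball t)
  · refine Submodule.mem_sup_left (single_mem_chains ?_)
    rintro _ ⟨t, rfl⟩
    exact hb' (hball t)

lemma SdC_chains {P : Set X} {x : (C X).X} (hx : x ∈ chains P) : SdC x ∈ chains P := by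
  let f : C(P, X) := ⟨Subtype.val, continuous_subtype_val⟩
  have hr : Set.range f = P := Subtype.range_val
  obtain ⟨y, rfl⟩ := chains_le_range IsEmbedding.subtypeVal (hr.symm ▸ hx)
  rw [← Cm_SdC]
  exact range_le_chains hr.subset _

lemma SdCi_small {U V : Set X} (k : ℕ) {x : (C X).X} (hx : x ∈ chains U ⊔ chains V) :
    (SdC ^ k) x ∈ chains U ⊔ chains V := by
  induction k with
  | zero => exact hx
  | succ k ih =>
    rw [pow_succ', Module.End.mul_apply]
    obtain ⟨y, hy, z, hz, h⟩ := Submodule.mem_sup.1 ih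
    rw [← h, map_add]
    exact Submodule.add_mem_sup (SdC_chains hy) (SdC_chains hz)

lemma small_chain {U V : Set X} (hU : IsOpen U) (hV : IsOpen V) (h : U ∪ V = Set.univ)
    (x : (C X).X) : ∃ k, (SdC ^ k) x ∈ chains U ⊔ chains V := by
  induction x using Finsupp.induction_linear with
  | zero => exact ⟨0, Submodule.zero_mem _⟩
  | add x y hx hy =>
    obtain ⟨j, hj⟩ := hx
    obtain ⟨k, hk⟩ := hy
    refine ⟨j + k, ?_⟩
    rw [map_add]
    refine Submodule.add_mem _ ?_ ?_
    · rw [add_comm, pow_add, Module.End.mul_apply]; exact SdCi_small k hj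
    · rw [pow_add, Module.End.mul_apply]; exact SdCi_small j hk
  | single s q =>
    obtain ⟨k, hk⟩ := small_single hU hV h s.1 s.2
    refine ⟨k, ?_⟩
    have : fsingle s q = q • fsingle s 1 := by simp
    rw [this, map_smul]
    exact Submodule.smul_mem _ _ hk

/-- The Mayer–Vietoris square of an open cover. -/
lemma hoCart_open {A B₁ B₂ : Type} [TopologicalSpace A] [TopologicalSpace B₁] [TopologicalSpace B₂]
    (a₁ : C(A, B₁)) (a₂ : C(A, B₂)) (c₁ : C(B₁, X)) (c₂ : C(B₂, X))
    (hc : c₁.comp a₁ = c₂.comp a₂) (ha : IsEmbedding (c₁.comp a₁))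
    (h₁ : IsOpenEmbedding c₁) (h₂ : IsOpenEmbedding c₂)
    (hU : Set.range c₁ ∪ Set.range c₂ = Set.univ)
    (hI : Set.range c₁ ∩ Set.range c₂ ⊆ Set.range (c₁.comp a₁)) :
    HoCart (a₁ := Cm a₁) (a₂ := Cm a₂) (c₁ := Cm c₁) (c₂ := Cm c₂)
      (fun x => by rw [← Cm_comp, ← Cm_comp, hc]) := by
  have i₁ := Cm_injective h₁.injective
  have i₂ := Cm_injective h₂.injective
  have j₁ := Cm_injective (Injective.of_comp (f := c₁) ha.injective)
  have j₂ := Cm_injective (Injective.of_comp (f := c₂)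
    (by
      have : Injective (c₂.comp a₂) := hc ▸ ha.injective
      exact this))
  have common : ∀ (x : (C B₁).X) (y : (C B₂).X), (Cm c₁).f x = (Cm c₂).f y →
      ∃ z, (Cm a₁).f z = x ∧ (Cm a₂).f z = y := fun x y hxy => by
    obtain ⟨z, hz⟩ := mem_range_of_both ha hI hxy
    refine ⟨z, i₁ ?_, i₂ ?_⟩
    · rw [← Cm_comp, hz]
    · rw [← Cm_comp, ← hc, hz, hxy]
  have split : ∀ x : (C X).X, ∃ k u v, (SdC ^ k) x = (Cm c₁).f u + (Cm c₂).f v := fun x => by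
    obtain ⟨k, hk⟩ := small_chain h₁.isOpen_range h₂.isOpen_range hU x
    obtain ⟨y, hy, z, hz, h⟩ := Submodule.mem_sup.1 hk
    obtain ⟨u, rfl⟩ := chains_le_range h₁.isEmbedding hy
    obtain ⟨v, rfl⟩ := chains_le_range h₂.isEmbedding hz
    exact ⟨k, u, v, h.symm⟩
  constructor
  · rintro ⟨n, m⟩ hcy hb
    rw [cone_cycle] at hcy
    obtain ⟨v, w, hv, hw⟩ := cone_bd.1 hb
    have hv : (C X).d v + (Cm c₂).f w = (Cm c₁).f n := hv
    have hw : -(C B₂).d w = (Cm a₂).f m := hw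
    obtain ⟨k, u₀, z₀, hs⟩ := split v
    have hS : (Cm c₁).f ((SdC ^ k) n - (C B₁).d u₀) = (Cm c₂).f ((SdC ^ k) w + (C B₂).d z₀) := by
      rw [map_sub, map_add, Cm_SdCi, Cm_SdCi, (Cm c₁).hd, (Cm c₂).hd, ← hv, map_add, ← d_SdCi, hs,
        map_add]
      abel
    obtain ⟨y, hy₁, hy₂⟩ := common _ _ hS
    have hn := d_hCi k n
    rw [hcy.1, map_neg, ← Cm_hCi] at hn
    refine cone_bd.2 ⟨hCi k n + u₀, y - hCi k m, ?_, ?_⟩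
    · rw [map_add, map_sub, hy₁]
      have : (C B₁).d (hCi k n) = n - (SdC ^ k) n + (Cm a₁).f (hCi k m) := by rw [← hn]; abel
      rw [this]; abel
    · refine j₂ ?_
      have hm := d_hCi k m
      rw [hcy.2, map_zero, add_zero] at hm
      rw [map_neg, map_sub, hm, (Cm a₂).f.map_sub, (Cm a₂).hd, hy₂, map_add, DMod.dd, add_zero,
        d_SdCi, neg_eq_iff_eq_neg.1 hw, map_neg, map_sub, Cm_SdCi]
      abel
  · rintro ⟨x, b⟩ hcy
    rw [cone_cycle] at hcy
    obtain ⟨k, n₀, w₀, hs⟩ := split x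
    have hS : (Cm c₁).f (-(C B₁).d n₀) = (Cm c₂).f ((C B₂).d w₀ + (SdC ^ k) b) := by
      have : (C X).d ((SdC ^ k) x) = (C X).d ((Cm c₁).f n₀ + (Cm c₂).f w₀) := by rw [hs]
      rw [d_SdCi, hcy.1, map_neg, ← Cm_SdCi, map_add] at this
      rw [map_neg, map_add, (Cm c₁).hd, (Cm c₂).hd]
      rw [neg_eq_iff_add_eq_zero, ← add_assoc, ← this]
      abel
    obtain ⟨m, hm₁, hm₂⟩ := common _ _ hS
    refine ⟨(n₀, m), cone_cycle.2 ⟨by rw [hm₁, neg_neg], j₁ ?_⟩, ?_⟩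
    · rw [(Cm a₁).hd, hm₁, map_neg, DMod.dd, neg_zero, map_zero]
    · have hx := d_hCi k x
      rw [hcy.1, map_neg, ← Cm_hCi] at hx
      have hb := d_hCi k b
      rw [hcy.2, map_zero, add_zero] at hb
      refine cone_bd.2 ⟨hCi k x, w₀ - hCi k b, ?_, ?_⟩
      · change _ = x - (Cm c₁).f n₀
        have h3 : (C X).d (hCi k x) = x - (SdC ^ k) x + (Cm c₂).f (hCi k b) := by rw [← hx]; abel
        rw [h3, hs, map_sub]; abel
      · change _ = b - (Cm a₂).f m
        rw [hm₂, map_sub, hb]; abel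

open scoped TensorProduct

/-! ### Tensor products -/

/-- The tensor product of differential modules. -/
@[reducible] def tens (N M : DMod) : DMod where
  X := N.X ⊗[ℚ] M.X
  d := tpmap N.d lid + tpmap N.ε M.d
  ε := tpmap N.ε M.ε
  dd := fun x => by
    induction x using tensor_induction with
    | zero => simp
    | tmul a b => simp [TensorProduct.neg_tmul]
    | add x y hx hy => rw [map_add, map_add, hx, hy, add_zero]
  εε := fun x => by
    induction x using tensor_induction with
    | zero => simp
    | tmul a b => simp
    | add x y hx hy => rw [map_add, map_add, hx, hy]
  dε := fun x => by
    induction x using tensor_induction with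
    | zero => simp
    | tmul a b => simp [TensorProduct.neg_tmul, TensorProduct.tmul_neg, add_comm]
    | add x y hx hy => simp only [map_add, hx, hy, neg_add] at *

variable {M M' N N' : DMod}

lemma tens_d (n : N.X) (m : M.X) :
    (tens N M).d (n ⊗ₜ m) = N.d n ⊗ₜ m + N.ε n ⊗ₜ M.d m := rfl

lemma tens_ε (n : N.X) (m : M.X) : (tens N M).ε (n ⊗ₜ m) = N.ε n ⊗ₜ M.ε m := rfl

/-- Functoriality of the tensor product. -/
def tmap (g : DHom N N') (f : DHom M M') : DHom (tens N M) (tens N' M') where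
  f := tpmap g.f f.f
  hd := fun x => by
    induction x using tensor_induction with
    | zero => simp
    | tmul a b => simp
    | add x y hx hy => rw [map_add, map_add, hx, hy, map_add, map_add]
  hε := fun x => by
    induction x using tensor_induction with
    | zero => simp
    | tmul a b => simp
    | add x y hx hy => rw [map_add, map_add, hx, hy, map_add, map_add]

lemma tmap_tmul (g : DHom N N') (f : DHom M M') (n : N.X) (m : M.X) :
    (tmap g f).f (n ⊗ₜ m) = g.f n ⊗ₜ f.f m := rfl

/-- The identity morphism. -/
def hid (M : DMod) : DHom M M := ⟨lid, fun _ => rfl, fun _ => rfl⟩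

/-- An acyclic module has a contraction. -/
lemma DMod.Acyc.contraction (h : M.Acyc) : ∃ s : M.X →ₗ[ℚ] M.X, ∀ x, M.d (s x) + s (M.d x) = x := by
  obtain ⟨W, hW⟩ := Submodule.exists_isCompl (lker M.d)
  have hr : lrange M.d = lker M.d := by aesop
  let e : W →ₗ[ℚ] lker M.d :=
    (M.d ∘ₗ W.subtype).codRestrict _ fun w => by simp
  have he : Function.Bijective e := by
    constructor
    · intro a b hab
      have h1 : M.d (a - b : M.X) = 0 := by
        rw [map_sub, sub_eq_zero]; exact congrArg Subtype.val hab
      have h2 : (a - b : M.X) ∈ lker M.d ⊓ W := ⟨h1, W.sub_mem a.2 b.2⟩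
      rw [hW.inf_eq_bot, Submodule.mem_bot, sub_eq_zero] at h2
      exact sext h2
    · rintro ⟨x, hx⟩
      obtain ⟨y, hy⟩ := h x hx
      obtain ⟨a, ha, b, hb, hab⟩ := Submodule.mem_sup.1
        (hW.sup_eq_top.symm ▸ Submodule.mem_top : y ∈ lker M.d ⊔ W)
      refine ⟨⟨b, hb⟩, sext ?_⟩
      change M.d b = x
      rw [← hy, ← hab, map_add, LinearMap.mem_ker.1 ha, zero_add]
  let E := LinearEquiv.ofBijective e he
  let p := Submodule.projectionOnto _ _ hW
  have hE : ∀ z : lker M.d, M.d (E.symm z : M.X) = z := fun z =>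
    congrArg Subtype.val (E.apply_symm_apply z)
  refine ⟨W.subtype ∘ₗ E.symm.toLinearMap ∘ₗ p, fun x => ?_⟩
  obtain ⟨a, ha, b, hb, rfl⟩ := Submodule.mem_sup.1
        (hW.sup_eq_top.symm ▸ Submodule.mem_top : x ∈ lker M.d ⊔ W)
  have ha' : M.d a = 0 := ha
  have h1 : p (a + b) = ⟨a, ha⟩ := by
    rw [map_add, show p a = ⟨a, ha⟩ from Submodule.projectionOnto_apply_left hW ⟨a, ha⟩,
      show p b = 0 from Submodule.projectionOnto_apply_right hW ⟨b, hb⟩, add_zero]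
  have h2 : p (M.d (a + b)) = e ⟨b, hb⟩ := by
    have h3 : M.d (a + b) = (e ⟨b, hb⟩ : M.X) := by rw [map_add, ha', zero_add]; rfl
    rw [h3]
    exact Submodule.projectionOnto_apply_left hW _
  simp only [lcomp_apply, h1, h2]
  have h4 : E.symm.toLinearMap (e ⟨b, hb⟩) = ⟨b, hb⟩ := E.symm_apply_apply ⟨b, hb⟩
  rw [h4]
  exact congrArg (· + b) (hE ⟨a, ha⟩)

lemma DMod.Acyc.tens (h : M.Acyc) (N : DMod) : (tens N M).Acyc := by
  obtain ⟨s, hs⟩ := h.contraction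
  have key : ∀ x : (QG.tens N M).X, (QG.tens N M).d (tpmap N.ε s x) +
      tpmap N.ε s ((QG.tens N M).d x) = x := fun x => by
    induction x using tensor_induction with
    | zero => simp
    | tmul a b =>
      rw [tpmap_tmul, tens_d, tens_d, map_add, tpmap_tmul,
        tpmap_tmul, N.dε, N.εε, TensorProduct.neg_tmul]
      have h2 : a ⊗ₜ[ℚ] b = a ⊗ₜ[ℚ] M.d (s b) + a ⊗ₜ[ℚ] s (M.d b) := by
        rw [← TensorProduct.tmul_add, hs]
      rw [h2]
      abel
    | add x y hx hy =>
      refine Eq.trans ?_ (congrArg₂ (· + ·) hx hy)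
      simp only [map_add]
      abel
  intro x hx
  refine ⟨tpmap N.ε s x, ?_⟩
  have := key x
  rwa [hx, map_zero, add_zero] at this

/-- The comparison between the tensor product with a cone and the cone of the tensor product. -/
def tensCone (N : DMod) (f : DHom M M') : DHom (tens N (cone f)) (cone (tmap (hid N) f)) where
  f := LinearMap.prod (tpmap lid (LinearMap.fst ℚ _ _))
    (tpmap N.ε (LinearMap.snd ℚ _ _))
  hd := fun x => by
    induction x using tensor_induction with
    | zero => simp
    | tmul a b =>
      obtain ⟨y, x⟩ := b
      rw [tens_d, map_add]
      ext
      · simp [tmap, hid, TensorProduct.tmul_add]; abel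
      · simp [tmap, hid, TensorProduct.tmul_neg, TensorProduct.neg_tmul]; abel
    | add x y hx hy => rw [map_add, map_add, hx, hy, map_add, map_add]
  hε := fun x => by
    induction x using tensor_induction with
    | zero => simp
    | tmul a b =>
      obtain ⟨y, x⟩ := b
      ext
      · simp
      · simp [TensorProduct.tmul_neg]
    | add x y hx hy => rw [map_add, map_add, hx, hy, map_add, map_add]

lemma tensCone_tmul (f : DHom M M') (n : N.X) (y : M'.X) (x : M.X) :
    (tensCone N f).f (n ⊗ₜ (y, x)) = (n ⊗ₜ y, N.ε n ⊗ₜ x) := rfl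

lemma tensCone_bij (f : DHom M M') : Function.Bijective (tensCone N f).f := by
  let g : N.X ⊗[ℚ] M'.X × N.X ⊗[ℚ] M.X →ₗ[ℚ] N.X ⊗[ℚ] (M'.X × M.X) :=
    LinearMap.coprod (tpmap lid (LinearMap.inl ℚ _ _))
      (tpmap N.ε (LinearMap.inr ℚ _ _))
  refine Function.bijective_iff_has_inverse.2 ⟨g, fun x => ?_, fun x => ?_⟩
  · induction x using tensor_induction with
    | zero => simp
    | tmul a b =>
      obtain ⟨y, x⟩ := b
      rw [tensCone_tmul]
      simp [g, ← TensorProduct.tmul_add]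
    | add x y hx hy => rw [map_add, map_add, hx, hy]
  · obtain ⟨u, v⟩ := x
    have h1 : (tensCone N f).f (g (u, 0)) = (u, 0) := by
      induction u using tensor_induction with
      | zero => exact (congrArg _ (map_zero g)).trans (map_zero _)
      | tmul a b =>
        simp only [g, LinearMap.coprod_apply, tpmap_tmul, map_zero, zero_add, add_zero,
          lid_apply, LinearMap.inl_apply, LinearMap.inr_apply]
        refine (tensCone_tmul _ _ _ _).trans ?_
        simp
      | add x y hx hy =>
        have : ((x + y, 0) : N.X ⊗[ℚ] M'.X × N.X ⊗[ℚ] M.X) = (x, 0) + (y, 0) := by simp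
        rw [this, map_add, map_add, hx, hy]
    have h2 : (tensCone N f).f (g (0, v)) = (0, v) := by
      induction v using tensor_induction with
      | zero => exact (congrArg _ (map_zero g)).trans (map_zero _)
      | tmul a b =>
        simp only [g, LinearMap.coprod_apply, tpmap_tmul, map_zero, zero_add, add_zero,
          lid_apply, LinearMap.inl_apply, LinearMap.inr_apply]
        refine (tensCone_tmul _ _ _ _).trans ?_
        simp
      | add x y hx hy =>
        have : ((0, x + y) : N.X ⊗[ℚ] M'.X × N.X ⊗[ℚ] M.X) = (0, x) + (0, y) := by simp
        rw [this, map_add, map_add, hx, hy]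
    have : ((u, v) : N.X ⊗[ℚ] M'.X × N.X ⊗[ℚ] M.X) = (u, 0) + (0, v) := by simp
    rw [this, map_add, map_add, h1, h2]

lemma QI_of_bijective {f : DHom M N} (hf : Function.Bijective f.f) : f.QI := by
  constructor
  · rintro x hx ⟨y, hy⟩
    obtain ⟨z, rfl⟩ := hf.2 y
    exact ⟨z, hf.1 (by rw [f.hd, hy])⟩
  · intro y hy
    obtain ⟨z, rfl⟩ := hf.2 y
    exact ⟨z, hf.1 (by rw [f.hd, hy, map_zero]), by rw [sub_self]; exact Bd.zero⟩

lemma Acyc_of_QI {f : DHom M N} (hf : f.QI) : M.Acyc ↔ N.Acyc := by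
  constructor
  · intro h y hy
    obtain ⟨x, hx, hb⟩ := hf.2 y hy
    simpa using hb.add (f.bd (h x hx))
  · intro h x hx
    exact hf.1 x hx (h _ (by rw [← f.hd, hx, map_zero]))

lemma DHom.QI.tmap_right {f : DHom M M'} (hf : f.QI) (N : DMod) : (tmap (hid N) f).QI := by
  rw [← acyc_cone_iff] at hf ⊢
  exact (Acyc_of_QI (QI_of_bijective (tensCone_bij f))).1 (hf.tens N)

lemma DMod.HoCart.tens {A B₁ B₂ C : DMod} {a₁ : DHom A B₁} {a₂ : DHom A B₂} {c₁ : DHom B₁ C}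
    {c₂ : DHom B₂ C} {h : ∀ x, c₁.f (a₁.f x) = c₂.f (a₂.f x)} (H : HoCart h) (N : DMod)
    (h' : ∀ x, (tmap (hid N) c₁).f ((tmap (hid N) a₁).f x) =
      (tmap (hid N) c₂).f ((tmap (hid N) a₂).f x)) : HoCart h' := by
  refine QI.of_comp_right (f := tensCone N a₁) ?_ (QI_of_bijective (tensCone_bij a₁))
  refine QI.congr (HEqv.of_eq ?_)
    (QI.comp (QI_of_bijective (tensCone_bij c₂)) (DHom.QI.tmap_right H N))
  intro x
  rw [comp_f, comp_f]
  induction x using tensor_induction with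
  | zero => simp only [map_zero]
  | tmul a b =>
    obtain ⟨y, x⟩ := b
    rfl
  | add x y hx hy => simp only [map_add, hx, hy]

lemma tens_square {A B₁ B₂ C : DMod} {a₁ : DHom A B₁} {a₂ : DHom A B₂} {c₁ : DHom B₁ C}
    {c₂ : DHom B₂ C} (h : ∀ x, c₁.f (a₁.f x) = c₂.f (a₂.f x)) (N : DMod) :
    ∀ x, (tmap (hid N) c₁).f ((tmap (hid N) a₁).f x) =
      (tmap (hid N) c₂).f ((tmap (hid N) a₂).f x) := fun x => by
  induction x using tensor_induction with
  | zero => simp only [map_zero]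
  | tmul a b => rw [tmap_tmul, tmap_tmul, tmap_tmul, tmap_tmul, h]
  | add x y hx hy => simp only [map_add, hx, hy]

/-- The unit isomorphism. -/
def tensUnit (N : DMod) : DHom (tens N QQ) N where
  f := (TensorProduct.rid ℚ N.X).toLinearMap
  hd := fun x => by
    induction x using tensor_induction with
    | zero => simp
    | tmul a b => simp
    | add x y hx hy => simp only [map_add, hx, hy]
  hε := fun x => by
    induction x using tensor_induction with
    | zero => simp
    | tmul a b => simp
    | add x y hx hy => simp only [map_add, hx, hy]

lemma tensUnit_tmul (n : N.X) (q : ℚ) : (tensUnit N).f (n ⊗ₜ q) = q • n := rfl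

lemma tensUnit_QI (N : DMod) : (tensUnit N).QI :=
  QI_of_bijective (TensorProduct.rid ℚ N.X).bijective

/-! ### The Alexander–Whitney map -/

namespace LC
variable {S T : Type}

/-- The Alexander–Whitney diagonal of a list. -/
def aw : List S → LC S ⊗[ℚ] LC S
  | [] => 0
  | v :: l => L [v] ⊗ₜ L (v :: l) + tpmap (cons v) lid (aw l)

/-- The Alexander–Whitney diagonal. -/
def AW : LC S →ₗ[ℚ] LC S ⊗[ℚ] LC S := lin aw

lemma AW_nil : AW (L ([] : List S)) = 0 := lin_L _ _

lemma AW_L_cons (v : S) (l : List S) : AW (L (v :: l)) =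
    L [v] ⊗ₜ L (v :: l) + tpmap (cons v) lid (AW (L l)) := by
  rw [AW, lin_L, lin_L]; rfl

lemma AW_cons (v : S) (c : LC S) : AW (cons v c) =
    L [v] ⊗ₜ cons v c + tpmap (cons v) lid (AW c) := by
  have : AW ∘ₗ cons v = TensorProduct.mk ℚ _ _ (L [v]) ∘ₗ cons v +
      tpmap (cons v) lid ∘ₗ AW := hom_ext fun l => by
    simp only [lcomp_apply, ladd_apply, cons_L]
    exact AW_L_cons v l
  exact lcongr_fun this c

lemma map_cons_D (v : S) (x : LC S ⊗[ℚ] LC S) :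
    (tpmap d lid + tpmap sg d :
      LC S ⊗[ℚ] LC S →ₗ[ℚ] LC S ⊗[ℚ] LC S) (tpmap (cons v) lid x) =
    x - tpmap (cons v) lid
      ((tpmap d lid + tpmap sg d :
        LC S ⊗[ℚ] LC S →ₗ[ℚ] LC S ⊗[ℚ] LC S) x) := by
  induction x using tensor_induction with
  | zero => simp
  | tmul a b =>
    simp only [ladd_apply, tpmap_tmul, lid_apply, d_cons, sg_cons,
      map_add, TensorProduct.sub_tmul, TensorProduct.neg_tmul]
    abel
  | add x y hx hy => simp only [map_add] at *; rw [hx, hy]; abel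

lemma D_AW (c : LC S) :
    (tpmap d lid + tpmap sg d :
      LC S ⊗[ℚ] LC S →ₗ[ℚ] LC S ⊗[ℚ] LC S) (AW c) =
    AW (d c) + L [] ⊗ₜ c + sg c ⊗ₜ L [] := by
  have : (tpmap d lid + tpmap sg d :
      LC S ⊗[ℚ] LC S →ₗ[ℚ] LC S ⊗[ℚ] LC S) ∘ₗ AW = AW ∘ₗ d + TensorProduct.mk ℚ _ _ (L []) +
      (TensorProduct.mk ℚ _ _).flip (L []) ∘ₗ sg := hom_ext fun l => by
    simp only [lcomp_apply, ladd_apply (M := LC S), TensorProduct.mk_apply, LinearMap.flip_apply]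
    induction l with
    | nil => rw [AW_nil, map_zero, d_nil, map_zero, sg_L]; simp [TensorProduct.neg_tmul]
    | cons v l ih =>
      rw [AW_L_cons, map_add, map_cons_D, ih]
      rw [show L (v :: l) = cons v (L l) from (cons_L v l).symm, d_cons, sg_cons, map_sub, AW_cons,
        ladd_apply, tpmap_tmul, tpmap_tmul]
      rw [show L [v] = cons v (L []) from (cons_L v []).symm, d_cons, sg_cons, d_nil, map_zero,
        sg_L, d_cons]
      simp only [map_add, tpmap_tmul, lid_apply, TensorProduct.neg_tmul,
        TensorProduct.tmul_sub, List.length_nil, zero_add, pow_one, neg_smul, one_smul,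
        neg_neg, map_neg, sub_zero]
      abel
  exact lcongr_fun this c

lemma AW_sg (c : LC S) : tpmap sg sg (AW c) = AW (sg c) := by
  have : tpmap sg sg ∘ₗ AW = AW ∘ₗ (sg : LC S →ₗ[ℚ] LC S) := hom_ext fun l => by
    simp only [lcomp_apply]
    induction l with
    | nil => rw [AW_nil, sg_L, map_smul, AW_nil]; simp
    | cons v l ih =>
      have h1 : ∀ x : LC S ⊗[ℚ] LC S, tpmap sg sg
          (tpmap (cons v) lid x) =
          - tpmap (cons v) lid (tpmap sg sg x) := fun x => by
        induction x using tensor_induction with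
        | zero => simp
        | tmul a b => simp [sg_cons, TensorProduct.neg_tmul]
        | add x y hx hy => simp only [map_add, hx, hy, neg_add]
      rw [AW_L_cons, map_add, h1, ih, tpmap_tmul]
      rw [show L (v :: l) = cons v (L l) from (cons_L v l).symm, sg_cons, map_neg, AW_cons, sg_L]
      simp [TensorProduct.tmul_neg]
      abel
  exact lcongr_fun this c

lemma AW_map (φ : S → T) (c : LC S) :
    tpmap (map φ) (map φ) (AW c) = AW (map φ c) := by
  have : tpmap (map φ) (map φ) ∘ₗ AW = AW ∘ₗ map φ := hom_ext fun l => by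
    simp only [lcomp_apply]
    induction l with
    | nil => rw [AW_nil, map_L, List.map_nil, AW_nil, map_zero]
    | cons v l ih =>
      have h1 : ∀ x : LC S ⊗[ℚ] LC S, tpmap (map φ) (map φ)
          (tpmap (cons v) lid x) =
          tpmap (cons (φ v)) lid (tpmap (map φ) (map φ) x) :=
        fun x => by
          induction x using tensor_induction with
          | zero => simp
          | tmul a b => simp [map_cons]
          | add x y hx hy => simp only [map_add, hx, hy]
      rw [AW_L_cons, map_add, h1, ih, map_L φ l, map_L φ (v :: l), List.map_cons, AW_L_cons,
        tpmap_tmul, map_L, map_L]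
      rfl
  exact lcongr_fun this c

lemma co_AW (l : List S) :
    TensorProduct.rid ℚ (LC S) (tpmap lid (co ∘ₗ d) (AW (L l))) =
      L l - if l = [] then L [] else 0 := by
  induction l with
  | nil => simp [AW_nil]
  | cons v l ih =>
    have h1 : ∀ x : LC S ⊗[ℚ] LC S, TensorProduct.rid ℚ (LC S)
        (tpmap lid (co ∘ₗ d) (tpmap (cons v) lid x)) =
        cons v (TensorProduct.rid ℚ (LC S) (tpmap lid (co ∘ₗ d) x)) :=
      fun x => by
        induction x using tensor_induction with
        | zero => simp
        | tmul a b => simp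
        | add x y hx hy => simp only [map_add, hx, hy]
    rw [AW_L_cons, map_add, map_add, h1, ih, tpmap_tmul, TensorProduct.rid_tmul,
      lcomp_apply, d_L_cons, map_sub, co_cons, co_L]
    cases l with
    | nil => simp
    | cons w l => simp

end LC

variable {Z : Type} [TopologicalSpace Z]

/-- The Alexander–Whitney diagonal of singular chains. -/
def awC : (Simp X →₀ ℚ) →ₗ[ℚ] (Simp X →₀ ℚ) ⊗[ℚ] (Simp X →₀ ℚ) :=
  ext fun n σ => tpmap (R σ) (R σ) (LC.AW (L (ι (n + 1))))

lemma awC_R (σ : C(S, X)) (c : LC S) : awC (R σ c) = tpmap (R σ) (R σ) (LC.AW c) :=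
  ext_R _ (tpmap (R σ) (R σ) ∘ₗ LC.AW) σ (by simp [LC.AW_nil]) (fun n v => by
    rw [lcomp_apply, ← map_affT_ι, ← LC.AW_map]
    change _ = (tpmap (R σ) (R σ) ∘ₗ tpmap _ _) _
    rw [← TensorProduct.map_comp]
    congr 2 <;> exact LC.hom_ext fun l => R_comp σ (affT_affine v) _) c

/-- The diagonal as a morphism. -/
def aw (X : Type) [TopologicalSpace X] : DHom (C X) (tens (C X) (C X)) where
  f := awC
  hd := fun x => by
    have : awC ∘ₗ (C X).d = (tens (C X) (C X)).d ∘ₗ awC := C_induct fun n σ => by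
      have h : ∀ y : LC (Δ (n + 1)) ⊗[ℚ] LC (Δ (n + 1)), (tens (C X) (C X)).d
          (tpmap (R σ) (R σ) y) = tpmap (R σ) (R σ)
            ((tpmap LC.d lid + tpmap LC.sg LC.d :
        LC (Δ (n + 1)) ⊗[ℚ] LC (Δ (n + 1)) →ₗ[ℚ] LC (Δ (n + 1)) ⊗[ℚ] LC (Δ (n + 1))) y) :=
        fun y => by
          induction y using tensor_induction with
          | zero => simp
          | tmul a b =>
            rw [tpmap_tmul, tens_d, ladd_apply, map_add]
            simp only [tpmap_tmul, lid_apply]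
            rw [← dC_R, ← dC_R, ← εC_R]
          | add x y hx hy => rw [map_add, map_add, hx, hy, map_add, map_add]
      rw [lcomp_apply, lcomp_apply, awC_R, h, LC.D_AW]
      refine (congrArg awC (dC_R σ _)).trans ?_
      rw [awC_R]
      simp
    exact lcongr_fun this x
  hε := fun x => by
    have : awC ∘ₗ (C X).ε = (tens (C X) (C X)).ε ∘ₗ awC := C_induct fun n σ => by
      have h : ∀ y : LC (Δ (n + 1)) ⊗[ℚ] LC (Δ (n + 1)), (tens (C X) (C X)).ε
          (tpmap (R σ) (R σ) y) = tpmap (R σ) (R σ)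
            (tpmap LC.sg LC.sg y) :=
        fun y => by
          induction y using tensor_induction with
          | zero => simp
          | tmul a b =>
            rw [tpmap_tmul, tens_ε]
            simp only [tpmap_tmul]
            rw [← εC_R, ← εC_R]
          | add x y hx hy => rw [map_add, map_add, hx, hy, map_add, map_add]
      rw [lcomp_apply, lcomp_apply, awC_R, h, LC.AW_sg]
      refine (congrArg awC (εC_R σ _)).trans ?_
      rw [awC_R]
    exact lcongr_fun this x

lemma aw_nat (f : C(X, Y)) (x : (C X).X) :
    (tmap (Cm f) (Cm f)).f ((aw X).f x) = (aw Y).f ((Cm f).f x) := by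
  have : (tmap (Cm f) (Cm f)).f ∘ₗ (aw X).f = (aw Y).f ∘ₗ (Cm f).f := C_induct fun n σ => by
    rw [lcomp_apply, lcomp_apply, Cm_R]
    refine (congrArg _ (awC_R σ _)).trans (Eq.trans ?_ (awC_R _ _).symm)
    rw [← lcomp_apply, tmap, ← TensorProduct.map_comp]
    congr 2 <;> exact LC.hom_ext fun l => Cm_R f σ _
  exact lcongr_fun this x

/-- The Alexander–Whitney map of a product. -/
def AWp (X Y : Type) [TopologicalSpace X] [TopologicalSpace Y] :
    DHom (C (X × Y)) (tens (C X) (C Y)) :=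
  (tmap (Cm ContinuousMap.fst) (Cm ContinuousMap.snd)).comp (aw (X × Y))

lemma tmap_comp {M₁ M₂ M₃ N₁ N₂ N₃ : DMod} (g' : DHom N₂ N₃) (f' : DHom M₂ M₃) (g : DHom N₁ N₂)
    (f : DHom M₁ M₂) (x : (tens N₁ M₁).X) :
    (tmap g' f').f ((tmap g f).f x) = (tmap (g'.comp g) (f'.comp f)).f x := by
  induction x using tensor_induction with
  | zero => simp only [map_zero]
  | tmul a b => rfl
  | add x y hx hy => simp only [map_add, hx, hy]

lemma tmap_congr {g g' : DHom N N'} {f f' : DHom M M'} (hg : ∀ x, g.f x = g'.f x)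
    (hf : ∀ x, f.f x = f'.f x) (x : (tens N M).X) : (tmap g f).f x = (tmap g' f').f x := by
  induction x using tensor_induction with
  | zero => simp only [map_zero]
  | tmul a b => rw [tmap_tmul, tmap_tmul, hg, hf]
  | add x y hx hy => simp only [map_add, hx, hy]

lemma AWp_nat {X' Y' : Type} [TopologicalSpace X'] [TopologicalSpace Y'] (f : C(X, X'))
    (g : C(Y, Y')) (x : (C (X × Y)).X) :
    (tmap (Cm f) (Cm g)).f ((AWp X Y).f x) = (AWp X' Y').f ((Cm (f.prodMap g)).f x) := by
  rw [AWp, AWp, comp_f, comp_f, ← aw_nat, tmap_comp, tmap_comp]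
  refine tmap_congr (fun y => ?_) (fun y => ?_) _
  · rw [comp_f, comp_f, ← Cm_comp, ← Cm_comp]; rfl
  · rw [comp_f, comp_f, ← Cm_comp, ← Cm_comp]; rfl

lemma AWp_aug (x : (C (X × Y)).X) :
    (tensUnit (C X)).f ((tmap (hid _) (aug Y)).f ((AWp X Y).f x)) =
      (Cm ContinuousMap.fst).f x := by
  have : (tensUnit (C X)).f ∘ₗ (tmap (hid _) (aug Y)).f ∘ₗ (AWp X Y).f =
      (Cm ContinuousMap.fst).f := C_induct fun n σ => by
    have h : ∀ y : LC (Δ (n + 1)) ⊗[ℚ] LC (Δ (n + 1)), (tensUnit (C X)).f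
        ((tmap (hid _) (aug Y)).f ((tmap (Cm ContinuousMap.fst) (Cm ContinuousMap.snd)).f
          (tpmap (R σ) (R σ) y))) = R (ContinuousMap.fst.comp σ)
          (TensorProduct.rid ℚ _ (tpmap lid (LC.co ∘ₗ LC.d) y)) := fun y => by
      induction y using tensor_induction with
      | zero => simp
      | tmul a b =>
        rw [tpmap_tmul, tmap_tmul, tmap_tmul, Cm_R, Cm_R, tensUnit_tmul,
          tpmap_tmul, TensorProduct.rid_tmul, map_smul]
        congr 1
        exact augC_R _ _
      | add x y hx hy => simp only [map_add, hx, hy]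
    rw [lcomp_apply, lcomp_apply, AWp, comp_f]
    refine (congrArg (fun z => (tensUnit (C X)).f ((tmap (hid _) (aug Y)).f
      ((tmap (Cm ContinuousMap.fst) (Cm ContinuousMap.snd)).f z))) (awC_R σ _)).trans ?_
    rw [h, LC.co_AW, Cm_R]
    simp [ι]
  exact lcongr_fun this x

open scoped TensorProduct

/-! ### Mayer–Vietoris arguments -/

section MV
variable {X Y B : Type} [TopologicalSpace X] [TopologicalSpace Y] [TopologicalSpace B]

lemma open_cover_induction (Pr : Set X → Prop) (h0 : Pr ∅)
    (hMV : ∀ U V, IsOpen U → IsOpen V → Pr U → Pr V → Pr (U ∩ V) → Pr (U ∪ V))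
    {κ : Type} (s : Finset κ) (W : κ → Set X) (hW : ∀ i, IsOpen (W i))
    (h : ∀ t ⊆ s, t.Nonempty → Pr (⋂ i ∈ t, W i)) : Pr (⋃ i ∈ s, W i) := by
  classical
  induction s using Finset.induction_on generalizing W with
  | empty => simpa using h0
  | insert a s ha ih =>
    rw [Finset.set_biUnion_insert]
    refine hMV _ _ (hW a) (isOpen_biUnion fun i _ => hW i) ?_ ?_ ?_
    · simpa using h {a} (by simp) (by simp)
    · exact ih W hW fun t ht => h t (ht.trans (Finset.subset_insert _ _))
    · have : W a ∩ ⋃ i ∈ s, W i = ⋃ i ∈ s, (W a ∩ W i) := by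
        simp only [Set.inter_iUnion]
      rw [this]
      refine ih _ (fun i => (hW a).inter (hW i)) fun t ht hn => ?_
      have h2 := h (insert a t) (Finset.insert_subset_insert _ ht) (by simp)
      rw [Finset.set_biInter_insert, Set.inter_comm] at h2
      convert h2 using 1
      ext x
      simp only [Set.mem_iInter, Set.mem_inter_iff]
      obtain ⟨i, hi⟩ := hn
      exact ⟨fun hx => ⟨fun j hj => (hx j hj).2, (hx i hi).1⟩, fun hx j hj => ⟨hx.2, hx.1 j hj⟩⟩

/-- Inclusion of subspaces. -/
def incl {U V : Set X} (h : U ⊆ V) : C(U, V) := ⟨Set.inclusion h, continuous_inclusion h⟩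

lemma isOpenEmbedding_incl {U V : Set X} (h : U ⊆ V) (hU : IsOpen U) :
    IsOpenEmbedding (incl h) :=
  ⟨IsEmbedding.inclusion h, by
    rw [show Set.range (incl h) = Subtype.val ⁻¹' U from Set.range_inclusion h]
    exact hU.preimage continuous_subtype_val⟩

lemma hoCart_sets {U V : Set X} (hU : IsOpen U) (hV : IsOpen V) :
    HoCart (a₁ := Cm (incl (Set.inter_subset_left (s := U) (t := V))))
      (a₂ := Cm (incl (Set.inter_subset_right (s := U) (t := V))))
      (c₁ := Cm (incl (Set.subset_union_left (s := U) (t := V))))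
      (c₂ := Cm (incl (Set.subset_union_right (s := U) (t := V))))
      (fun x => by rw [← Cm_comp, ← Cm_comp]; rfl) := by
  refine hoCart_open (incl (Set.inter_subset_left (s := U) (t := V)))
    (incl (Set.inter_subset_right (s := U) (t := V)))
    (incl (Set.subset_union_left (s := U) (t := V)))
    (incl (Set.subset_union_right (s := U) (t := V))) rfl ?_ (isOpenEmbedding_incl _ hU) (isOpenEmbedding_incl _ hV) ?_ ?_
  · exact IsEmbedding.inclusion (Set.inter_subset_left.trans Set.subset_union_left)
  · ext ⟨x, hx⟩
    simp only [Set.mem_union, Set.mem_range, Set.mem_univ, iff_true]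
    exact hx.imp (fun h => ⟨⟨x, h⟩, rfl⟩) (fun h => ⟨⟨x, h⟩, rfl⟩)
  · rintro _ ⟨⟨x, rfl⟩, ⟨y, hy⟩⟩
    have hy' : (y : X) = x := congrArg Subtype.val hy
    exact ⟨⟨x, x.2, hy' ▸ y.2⟩, rfl⟩

/-- Spaces satisfying the Künneth theorem with any other factor. -/
def Kun (Y : Type) [TopologicalSpace Y] : Prop :=
  ∀ (B : Type) [TopologicalSpace B], (AWp B Y).QI

lemma QI_prodMap (f : C(X, Y)) (g : C(Y, X)) (h₁ : (g.comp f).Homotopic (.id X))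
    (h₂ : (f.comp g).Homotopic (.id Y)) (B : Type) [TopologicalSpace B] :
    (Cm ((cid B).prodMap f)).QI :=
  QI_of_homotopy_inverse _ ((cid B).prodMap g)
    ((Homotopic.refl (.id B)).prodMap h₁)
    ((Homotopic.refl (.id B)).prodMap h₂)

lemma Kun.of_equiv (h : Kun X) (f : C(X, Y)) (g : C(Y, X)) (h₁ : (g.comp f).Homotopic (.id X))
    (h₂ : (f.comp g).Homotopic (.id Y)) : Kun Y := fun B _ => by
  refine QI.of_comp_right (f := Cm ((cid B).prodMap f)) ?_ (QI_prodMap f g h₁ h₂ B)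
  refine QI.congr (HEqv.of_eq fun x => ?_)
    (((QI_of_homotopy_inverse f g h₁ h₂).tmap_right (C B)).comp (h B))
  rw [comp_f, comp_f, ← AWp_nat]
  exact tmap_congr (fun y => (Cm_id y).symm) (fun _ => rfl) _

lemma Kun.of_homeo (h : Kun X) (e : X ≃ₜ Y) : Kun Y :=
  h.of_equiv (e : C(X, Y)) (e.symm : C(Y, X))
    (by simpa using Homotopic.refl _) (by simpa using Homotopic.refl _)

lemma Kun_contractible [ContractibleSpace Y] : Kun Y := fun B _ => by
  obtain ⟨e⟩ := ContractibleSpace.hequiv_unit Y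
  have h1 : (Cm (ContinuousMap.fst : C(B × Y, B))).QI := by
    have h2 := QI_prodMap e.toFun e.invFun e.left_inv e.right_inv B
    have h3 := QI_of_homeo (Homeomorph.prodUnique B Unit)
    refine QI.congr (HEqv.of_eq fun x => ?_) (h3.comp h2)
    rw [comp_f, ← Cm_comp]; rfl
  refine QI.of_comp_left (g := (tensUnit (C B)).comp (tmap (hid _) (aug Y))) ?_
    ((tensUnit_QI _).comp (aug_QI.tmap_right _))
  exact QI.congr (HEqv.of_eq fun x => (AWp_aug x).symm) h1

lemma Kun_empty [IsEmpty Y] : Kun Y := fun B _ => by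
  have h1 : Subsingleton (C (B × Y)).X := C_subsingleton
  have h2 : Subsingleton (C Y).X := C_subsingleton
  have h3 : Subsingleton (tens (C B) (C Y)).X := by
    have : ∀ x : (C B).X ⊗[ℚ] (C Y).X, x = 0 := fun x => by
      induction x using tensor_induction with
      | zero => rfl
      | tmul a b => rw [h2.elim b 0, TensorProduct.tmul_zero]
      | add x y hx hy => rw [hx, hy, add_zero]
    exact ⟨fun x y => (this x).trans (this y).symm⟩
  exact ⟨fun x _ _ => ⟨0, h1.elim _ _⟩, fun y _ => ⟨0, h1.elim _ _, 0, h3.elim _ _⟩⟩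

lemma Kun_union {U V : Set Y} (hU : IsOpen U) (hV : IsOpen V) (h₁ : Kun U) (h₂ : Kun V)
    (h₃ : Kun (U ∩ V : Set Y)) : Kun (U ∪ V : Set Y) := fun B _ => by
  have H := (hoCart_sets hU hV).tens (C B)
    (tens_square (fun x => by rw [← Cm_comp, ← Cm_comp]; rfl) _)
  have e : ∀ {S T : Set Y} (h : S ⊆ T) (x : (C (B × S)).X), (AWp B T).f
      ((Cm ((cid B).prodMap (incl h))).f x) =
      (tmap (hid _) (Cm (incl h))).f ((AWp B S).f x) := fun h x => by
    rw [← AWp_nat]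
    exact tmap_congr (fun y => Cm_id y) (fun _ => rfl) _
  have H' := hoCart_open
    ((cid B).prodMap (incl (Set.inter_subset_left (s := U) (t := V))))
    ((cid B).prodMap (incl (Set.inter_subset_right (s := U) (t := V))))
    ((cid B).prodMap (incl (Set.subset_union_left (s := U) (t := V))))
    ((cid B).prodMap (incl (Set.subset_union_right (s := U) (t := V)))) rfl
    (IsEmbedding.id.prodMap (IsEmbedding.inclusion
      (Set.inter_subset_left.trans Set.subset_union_left)))
    (IsOpenEmbedding.id.prodMap (isOpenEmbedding_incl _ hU))
    (IsOpenEmbedding.id.prodMap (isOpenEmbedding_incl _ hV)) (by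
      ext ⟨b, x, hx⟩
      simp only [Set.mem_union, Set.mem_range, Set.mem_univ, iff_true]
      exact hx.imp (fun h => ⟨(b, ⟨x, h⟩), rfl⟩) (fun h => ⟨(b, ⟨x, h⟩), rfl⟩)) (by
      rintro _ ⟨⟨x, rfl⟩, ⟨y, hy⟩⟩
      have hy' : (y.2 : Y) = x.2 := congrArg (fun z => (z.2 : Y)) hy
      exact ⟨(x.1, ⟨x.2, x.2.2, hy' ▸ y.2.2⟩), rfl⟩)
  exact H'.qi H (fun x => e _ x) (fun x => e _ x) (fun x => e _ x) (fun x => e _ x)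
    (h₃ B) (h₁ B) (h₂ B)

lemma Kun_cover {κ : Type} (s : Finset κ) (W : κ → Set Y) (hW : ∀ i, IsOpen (W i))
    (h : ∀ t ⊆ s, t.Nonempty → Kun (⋂ i ∈ t, W i : Set Y)) : Kun (⋃ i ∈ s, W i : Set Y) :=
  open_cover_induction (fun U : Set Y => Kun U) (Kun_empty (Y := (∅ : Set Y)))
    (fun U V hU hV h₁ h₂ h₃ => Kun_union hU hV h₁ h₂ h₃) s W hW h

end MV

end

open DMod DHom

/-! ### One-dimensional homology -/

section Line
variable {M N A B C : DMod}

lemma Bd_of_eq {x y : M.X} (hy : M.Bd y) (h : x = y) : M.Bd x := h ▸ hy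

/-- The homology is one-dimensional, with parity operator acting by `p`. -/
def Line (M : DMod) (p : ℚ) : Prop :=
  ∃ x, M.d x = 0 ∧ M.Bd (M.ε x - p • x) ∧ ¬ M.Bd x ∧ ∀ z, M.d z = 0 → ∃ q : ℚ, M.Bd (z - q • x)

lemma Line.map {f : DHom M N} (hf : f.QI) {p : ℚ} (h : Line M p) : Line N p := by
  obtain ⟨x, hx, he, hn, hg⟩ := h
  refine ⟨f.f x, by rw [← f.hd, hx, map_zero], ?_, fun hb => hn (hf.1 x hx hb), fun z hz => ?_⟩
  · have := f.bd he
    rwa [map_sub, f.hε, map_smul] at this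
  · obtain ⟨y, hy, hb⟩ := hf.2 z hz
    obtain ⟨q, hq⟩ := hg y hy
    refine ⟨q, Bd_of_eq (hb.add (f.bd hq)) ?_⟩
    rw [map_sub, map_smul]; abel

lemma Line.comap {f : DHom M N} (hf : f.QI) {p : ℚ} (h : Line N p) : Line M p := by
  obtain ⟨y, hy, he, hn, hg⟩ := h
  obtain ⟨x, hx, hb⟩ := hf.2 y hy
  have key : ∀ q : ℚ, N.Bd (q • y - q • f.f x) := fun q => by
    rw [← smul_sub]; exact hb.smul q
  refine ⟨x, hx, hf.1 _ (by simp [hx]) ?_, fun h => hn ?_, fun z hz => ?_⟩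
  · refine Bd_of_eq ((he.sub hb.eps).add (key p)) ?_
    rw [map_sub, map_sub, f.hε, map_smul]; abel
  · exact Bd_of_eq (hb.add (f.bd h)) (by abel)
  · obtain ⟨q, hq⟩ := hg (f.f z) (by rw [← f.hd, hz, map_zero])
    refine ⟨q, hf.1 _ (by simp [hz, hx]) (Bd_of_eq (hq.add (key q)) ?_)⟩
    rw [map_sub, map_smul]; abel

lemma Line_QQ : Line QQ 1 := by
  refine ⟨(1 : ℚ), rfl, ⟨0, ?_⟩, ?_, fun z _ => ⟨z, 0, ?_⟩⟩
  · change (0 : ℚ) = 1 - 1 • 1; simp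
  · rintro ⟨y, hy⟩
    have hy' : (0 : ℚ) = 1 := hy
    simp at hy'
  · change (0 : ℚ) = z - z • (1 : ℚ); simp

lemma Line.cone_of_subsingleton [Subsingleton A.X] (f : DHom A B) {p : ℚ} (h : Line B p) :
    Line (cone f) p := by
  have h0 : ∀ a : A.X, a = 0 := fun a => Subsingleton.elim _ _
  have hbd : ∀ b : B.X, (cone f).Bd (b, 0) ↔ B.Bd b := fun b => by
    rw [cone_bd]
    constructor
    · rintro ⟨u, v, h1, -⟩
      exact ⟨u, by rw [← h1, h0 v, map_zero, add_zero]⟩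
    · rintro ⟨u, hu⟩
      exact ⟨u, 0, by rw [map_zero, add_zero, hu], by simp⟩
  obtain ⟨x, hx, he, hn, hg⟩ := h
  refine ⟨(x, 0), cone_cycle.2 (by simp [hx]), ?_, fun h => hn ((hbd x).1 h), ?_⟩
  · have := (hbd _).2 he
    refine Bd_of_eq this (Prod.ext rfl (h0 _))
  · rintro ⟨z, a⟩ hz
    rw [cone_cycle, h0 a, map_zero, neg_zero] at hz
    obtain ⟨q, hq⟩ := hg z hz.1
    exact ⟨q, Bd_of_eq ((hbd _).2 hq) (Prod.ext rfl (h0 _))⟩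

lemma Line.shift {f : DHom A B} {g : DHom B C} (h : (g.comp f).QI) {p : ℚ}
    (hl : Line (cone f) p) : Line (cone g) (-p) := by
  have inj : ∀ a, A.d a = 0 → C.Bd (g.f (f.f a)) → A.Bd a := h.1
  have bdg : ∀ n m, (cone g).d (n, m) = 0 → B.Bd m → (cone g).Bd (n, m) := by
    rintro n _ hc ⟨v, rfl⟩
    rw [cone_cycle] at hc
    obtain ⟨a, ha, c, hc'⟩ := h.2 (n + g.f v) (by rw [map_add, hc.1, ← g.hd]; simp)
    exact cone_bd.2 ⟨c, f.f a - v, by rw [hc', map_sub]; simp, by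
      rw [map_sub, ← f.hd, ha]; simp⟩
  have bdf : ∀ b : B.X, C.Bd (g.f b) → (cone f).Bd (b, 0) → B.Bd b := by
    rintro b hb hbd
    obtain ⟨u, v, h1, h2⟩ := cone_bd.1 hbd
    obtain ⟨w, hw⟩ := inj v (neg_eq_zero.1 h2) (Bd_of_eq (hb.sub ⟨g.f u, rfl⟩) (by
      rw [← h1, map_add, ← g.hd]; abel))
    exact ⟨u + f.f w, by rw [map_add, ← f.hd, hw, h1]⟩
  obtain ⟨⟨b₀, a₀⟩, hx, he, hn, hg⟩ := hl
  rw [cone_cycle] at hx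
  obtain ⟨α, hα⟩ := inj a₀ hx.2 ⟨-g.f b₀, by rw [map_neg, ← g.hd, hx.1]; simp⟩
  have hb₁ : B.d (b₀ + f.f α) = 0 := by rw [map_add, hx.1, ← f.hd, hα]; simp
  obtain ⟨a', ha', c, hc⟩ := h.2 (g.f (b₀ + f.f α)) (by rw [← g.hd, hb₁, map_zero])
  obtain ⟨b, hb⟩ : ∃ b, b = b₀ + f.f α - f.f a' := ⟨_, rfl⟩
  have hdb : B.d b = 0 := by rw [hb, map_sub, hb₁, ← f.hd, ha']; simp
  have hgb : C.d c = g.f b := by rw [hc, hb, map_sub]; rfl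
  have hrel : (cone f).Bd ((b, 0) - (b₀, a₀)) := by
    refine cone_bd.2 ⟨0, α - a', ?_, ?_⟩
    · change _ = b - b₀
      rw [map_sub, hb, map_zero]; abel
    · change _ = 0 - a₀
      rw [map_sub, hα, ha']; abel
  have hεb : B.Bd (B.ε b - p • b) := by
    refine bdf _ ?_ ?_
    · refine ⟨-C.ε c - p • c, ?_⟩
      rw [map_sub, map_sub, map_neg, C.dε, map_smul, map_smul, g.hε, hgb]; simp
    · have h3 := (hrel.eps.sub (hrel.smul p)).add he
      refine Bd_of_eq h3 ?_
      rw [map_sub, smul_sub, cone_ε, cone_ε]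
      refine Prod.ext ?_ ?_
      · change B.ε b - p • b = (B.ε b - B.ε b₀ - (p • b - p • b₀) + (B.ε b₀ - p • b₀)); abel
      · change (0 : A.X) = (-A.ε 0 - -A.ε a₀ - (p • 0 - p • a₀) + (-A.ε a₀ - p • a₀))
        rw [map_zero, smul_zero]; abel
  have hcy : (cone g).d (-c, b) = 0 := cone_cycle.2 ⟨by rw [map_neg, hgb], hdb⟩
  refine ⟨(-c, b), hcy, ?_, ?_, ?_⟩
  · refine bdg _ _ ?_ ?_
    · change (cone g).d ((cone g).ε (-c, b) - (-p) • (-c, b)) = 0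
      rw [map_sub, DMod.dε, map_smul, hcy]; simp
    · refine Bd_of_eq (hεb.smul (-1)) ?_
      change -B.ε b - (-p) • b = _
      rw [neg_smul, neg_smul, one_smul]; abel
  · intro hbd
    obtain ⟨u, v, -, h2⟩ := cone_bd.1 hbd
    refine hn (Bd_of_eq (Bd.sub (y := (b, 0) - (b₀, a₀)) (x := (b, 0))
      (cone_bd.2 ⟨-v, 0, by rw [map_neg, h2]; simp, by simp⟩) hrel) (by abel))
  · rintro ⟨n, m⟩ hz
    have hz' := cone_cycle.1 hz
    obtain ⟨q, hq⟩ := hg (m, 0) (cone_cycle.2 (by simp [hz'.2]))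
    refine ⟨q, bdg _ _ ?_ (bdf _ ?_ ?_)⟩
    · change (cone g).d ((n, m) - q • (-c, b)) = 0
      rw [map_sub, map_smul, hcy, hz]; simp
    · refine ⟨-n - q • c, ?_⟩
      change _ = g.f (m - q • b)
      rw [map_sub, map_sub, map_neg, hz'.1, map_smul, map_smul, hgb]; simp
    · refine Bd_of_eq (hq.sub (hrel.smul q)) ?_
      refine Prod.ext ?_ ?_
      · change m - q • b = m - q • b₀ - q • (b - b₀)
        rw [smul_sub]; abel
      · change (0 : A.X) = 0 - q • a₀ - q • (0 - a₀)
        simp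

end Line

/-! ### Punctured vector spaces -/

section Punctured
variable {X Y : Type} [TopologicalSpace X] [TopologicalSpace Y]

lemma QI_contractible [ContractibleSpace X] [ContractibleSpace Y] (f : C(X, Y)) : (Cm f).QI :=
  QI.of_comp_left (g := aug Y)
    (QI.congr (HEqv.of_eq fun x => (aug_push f x).symm) aug_QI) aug_QI

lemma homotopic_of {f g : C(X, Y)} (H : UI × X → Y) (hH : Continuous H) (h0 : ∀ x, H (0, x) = f x)
    (h1 : ∀ x, H (1, x) = g x) : f.Homotopic g := ⟨⟨⟨H, hH⟩, h0, h1⟩⟩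

lemma Cm_sq {X' Y' : Type} [TopologicalSpace X'] [TopologicalSpace Y'] {f : C(X, Y)}
    {f' : C(X', Y')} {α : C(X, X')} {β : C(Y, Y')} (h : ∀ x, β (f x) = f' (α x)) (x : (C X).X) :
    (Cm β).f ((Cm f).f x) = (Cm f').f ((Cm α).f x) := by
  rw [← Cm_comp, ← Cm_comp, show β.comp f = f'.comp α from ContinuousMap.ext h]

lemma pair_qi {X' Y' : Type} [TopologicalSpace X'] [TopologicalSpace Y'] {f : C(X, Y)}
    {f' : C(X', Y')} {α : C(X, X')} {β : C(Y, Y')} (h : ∀ x, β (f x) = f' (α x))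
    (hα : (Cm α).QI) (hβ : (Cm β).QI) :
    ∃ F : DHom (cone (Cm f)) (cone (Cm f')), F.QI :=
  ⟨_, coneMap_qi (f := Cm f) (f' := Cm f') (α := Cm α) (β := Cm β) (Cm_sq h) hα hβ⟩

lemma pair_homeo {X' Y' : Type} [TopologicalSpace X'] [TopologicalSpace Y'] {f : C(X, Y)}
    {f' : C(X', Y')} (a : X ≃ₜ X') (b : Y ≃ₜ Y') (h : ∀ x, b (f x) = f' (a x)) :
    ∃ F : DHom (cone (Cm f)) (cone (Cm f')), F.QI :=
  pair_qi (α := ⟨a, a.continuous⟩) (β := ⟨b, b.continuous⟩) h (QI_of_homeo a) (QI_of_homeo b)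

/-- The inclusion of the complement of the origin. -/
def punc (E : Type) [TopologicalSpace E] [Zero E] : C({x : E // x ≠ 0}, E) :=
  ⟨Subtype.val, continuous_subtype_val⟩

lemma Line_punc_congr {E F : Type} [TopologicalSpace E] [TopologicalSpace F] [Zero E] [Zero F]
    (e : E ≃ₜ F) (he : e 0 = 0) {p : ℚ} (h : Line (cone (Cm (punc E))) p) :
    Line (cone (Cm (punc F))) p := by
  have hiff : ∀ x, x ≠ 0 ↔ e x ≠ 0 := fun x => by
    rw [not_iff_not, ← he, e.injective.eq_iff]
  obtain ⟨Φ, hΦ⟩ := pair_homeo (f := punc E) (f' := punc F) (e.subtype hiff) e (fun x => rfl)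
  exact h.map hΦ

variable {E : Type} [TopologicalSpace E] [AddCommGroup E] [Module ℝ E] [ContinuousSMul ℝ E]
  [IsTopologicalAddGroup E] [T1Space E]

/-- The part of the punctured space away from a half line. -/
def halfSpace (E : Type) [Zero E] (s : ℝ) : Set (E × ℝ) := {x | x.1 ≠ 0 ∨ 0 < s * x.2}

lemma isOpen_halfSpace (s : ℝ) : IsOpen (halfSpace E s) :=
  (isOpen_compl_singleton.preimage continuous_fst).union
    (isOpen_lt continuous_const (continuous_const.mul continuous_snd))

lemma contractible_halfSpace {s : ℝ} (hs : s ≠ 0) : ContractibleSpace (halfSpace E s) := by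
  have h0 : ((0 : E), s) ∈ halfSpace E s := Or.inr (mul_self_pos.2 hs)
  refine StarConvex.contractibleSpace (x := ((0 : E), s)) ?_ ⟨_, h0⟩
  rintro ⟨x, t⟩ hx a b ha hb hab
  simp only [Prod.smul_mk, smul_zero, Prod.mk_add_mk, zero_add]
  have h1 := mul_self_pos.2 hs
  rcases eq_or_lt_of_le hb with rfl | hb'
  · right
    simp only [add_zero] at hab
    simp [hab, h1]
  · rcases hx with hx | hx
    · exact Or.inl (smul_ne_zero hb'.ne' hx)
    · right
      simp only [smul_eq_mul] at hx ⊢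
      nlinarith [mul_pos hb' hx, mul_nonneg ha h1.le]

lemma mem_halfSpace_union (x : E × ℝ) :
    x ∈ (halfSpace E 1 ∪ halfSpace E (-1) : Set (E × ℝ)) ↔ x ≠ 0 := by
  obtain ⟨x, t⟩ := x
  rw [Ne, Prod.mk_eq_zero, not_and_or]
  constructor
  · rintro ((h | h) | (h | h))
    · exact Or.inl h
    · right; rintro rfl; simp at h
    · exact Or.inl h
    · right; rintro rfl; simp at h
  · rintro (h | h)
    · exact Or.inl (Or.inl h)
    · rcases lt_or_gt_of_ne h with h | h
      · exact Or.inr (Or.inr (by simpa using h))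
      · exact Or.inl (Or.inr (by simpa using h))

lemma ne_of_mem_halfSpace_inter (x : (halfSpace E 1 ∩ halfSpace E (-1) : Set (E × ℝ))) :
    x.1.1 ≠ 0 := by
  obtain ⟨⟨x, t⟩, h1, h2⟩ := x
  intro h0
  have h0 : x = 0 := h0
  have h1' : 0 < 1 * t := h1.resolve_left (fun h => h h0)
  have h2' : 0 < (-1) * t := h2.resolve_left (fun h => h h0)
  linarith

/-- The punctured space as a slice of the intersection of the half spaces. -/
def puncSlice (E : Type) [TopologicalSpace E] [Zero E] :
    C({x : E // x ≠ 0}, (halfSpace E 1 ∩ halfSpace E (-1) : Set (E × ℝ))) :=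
  ⟨fun x => ⟨(x, 1), Or.inl x.2, Or.inl x.2⟩, by fun_prop⟩

lemma puncSlice_qi : (Cm (puncSlice E)).QI := by
  refine QI_of_homotopy_inverse _ ⟨fun x => ⟨x.1.1, ne_of_mem_halfSpace_inter x⟩, by fun_prop⟩
    (Homotopic.refl _)
    (homotopic_of (fun y => ⟨(y.2.1.1, (1 - (y.1 : ℝ)) * 1 + (y.1 : ℝ) * y.2.1.2),
      Or.inl (ne_of_mem_halfSpace_inter y.2), Or.inl (ne_of_mem_halfSpace_inter y.2)⟩)
      (subtype_mk (by fun_prop) _) ?_ ?_)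
  · intro x; apply sext; simp [puncSlice]
  · intro x; apply sext; simp

lemma Line_punc_inter {p : ℚ} (h : Line (cone (Cm (punc E))) p) :
    Line (cone (Cm (incl (Set.inter_subset_left (s := halfSpace E 1) (t := halfSpace E (-1)))))) p := by
  have := contractible_halfSpace (E := E) one_ne_zero
  have : ContractibleSpace E := RealTopologicalVectorSpace.contractibleSpace
  obtain ⟨F, hF⟩ := pair_qi (f := punc E)
    (f' := incl (Set.inter_subset_left (s := halfSpace E 1) (t := halfSpace E (-1))))
    (α := puncSlice E) (β := ⟨fun x => ⟨(x, 1), Or.inr (by simp)⟩, by fun_prop⟩) (fun x => rfl)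
    puncSlice_qi (QI_contractible _)
  exact h.map hF

lemma Line_punc_union {p : ℚ} (h : Line (cone (Cm (incl
      (Set.subset_union_right (s := halfSpace E 1) (t := halfSpace E (-1)))))) p) :
    Line (cone (Cm (punc (E × ℝ)))) (-p) := by
  have := contractible_halfSpace (E := E) (s := -1) (by norm_num)
  have : ContractibleSpace (E × ℝ) := RealTopologicalVectorSpace.contractibleSpace
  let g : C((halfSpace E 1 ∪ halfSpace E (-1) : Set (E × ℝ)), E × ℝ) :=
    ⟨Subtype.val, continuous_subtype_val⟩
  have h3 : Line (cone (Cm g)) (-p) := by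
    refine h.shift (g := Cm g) (QI.congr (HEqv.of_eq fun x => ?_)
      (QI_contractible (g.comp (incl Set.subset_union_right))))
    rw [comp_f, Cm_comp]
  obtain ⟨F, hF⟩ := pair_homeo (f := g) (f' := punc (E × ℝ))
    ((Homeomorph.refl _).subtype mem_halfSpace_union) (Homeomorph.refl _) (fun x => rfl)
  exact h3.map hF

lemma Line_punc_prod {p : ℚ} (h : Line (cone (Cm (punc E))) p) :
    Line (cone (Cm (punc (E × ℝ)))) (-p) :=
  Line_punc_union ((Line_punc_inter h).map
    (hoCart_sets (isOpen_halfSpace 1) (isOpen_halfSpace (-1))))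

lemma Line_punc_fin (n : ℕ) : Line (cone (Cm (punc (Fin n → ℝ)))) ((-1) ^ n) := by
  induction n with
  | zero =>
    have : IsEmpty {x : Fin 0 → ℝ // x ≠ 0} := ⟨fun x => x.2 (Subsingleton.elim _ _)⟩
    have : Subsingleton (C {x : Fin 0 → ℝ // x ≠ 0}).X := C_subsingleton
    have : ContractibleSpace (Fin 0 → ℝ) := RealTopologicalVectorSpace.contractibleSpace
    exact Line.cone_of_subsingleton _ (by simpa using Line_QQ.comap aug_QI)
  | succ n ih =>
    have e : ((Fin n → ℝ) × ℝ) ≃L[ℝ] (Fin (n + 1) → ℝ) :=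
      ContinuousLinearEquiv.ofFinrankEq (by simp)
    rw [pow_succ, mul_neg_one]
    exact Line_punc_congr e.toHomeomorph e.map_zero (Line_punc_prod ih)

lemma Line_punc [FiniteDimensional ℝ E] [T2Space E] :
    Line (cone (Cm (punc E))) ((-1) ^ finrank ℝ E) := by
  have e : (Fin (finrank ℝ E) → ℝ) ≃L[ℝ] E := ContinuousLinearEquiv.ofFinrankEq (by simp)
  exact Line_punc_congr e.toHomeomorph e.map_zero (Line_punc_fin _)

end Punctured

/-! ### Projective spaces as spaces of rank one projections -/

variable {B B' I J K K' : Type} [TopologicalSpace B] [TopologicalSpace B'] [Fintype I] [Fintype J]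
  [Fintype K] [Fintype K'] [DecidableEq I] [DecidableEq J] [DecidableEq K] [DecidableEq K']

section CP

/-- Orthogonal projections onto a line. -/
structure IsPt (p : Mat K) : Prop where
  herm : pᴴ = p
  tr : p.trace = 1
  rank : ∀ X, p * X * p = (p * X).trace • p

/-- The complex projective space. -/
abbrev CP (K : Type) [Fintype K] : Type := {p : Mat K // IsPt p}

/-- The partially defined action of matrices on lines. -/
def act (A : Matrix J K ℂ) (p : Mat K) : Mat J :=
  (A * p * Aᴴ).trace⁻¹ • (A * p * Aᴴ)

variable {p : Mat K}

lemma IsPt.idem (h : IsPt p) : p * p = p := by simpa [h.tr] using h.rank 1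

lemma IsPt.ne (h : IsPt p) : p ≠ 0 := fun h0 => by simpa [h0] using h.tr

lemma IsPt.conj_eq (h : IsPt p) (A : Matrix J K ℂ) : A * p * Aᴴ = (A * p) * (A * p)ᴴ := by
  rw [conjTranspose_mul, h.herm, mulA A p (p * Aᴴ), ← mulA p p, h.idem, ← mulA]

open ComplexOrder in
lemma mul_herm_trace_eq_zero {A : Matrix J K ℂ} : (A * Aᴴ).trace = 0 ↔ A = 0 :=
  trace_mul_conjTranspose_self_eq_zero_iff

lemma IsPt.trace_ne (h : IsPt p) {A : Matrix J K ℂ} (hA : A * p ≠ 0) :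
    (A * p * Aᴴ).trace ≠ 0 := by
  rw [h.conj_eq]
  exact fun h0 => hA (mul_herm_trace_eq_zero.1 h0)

lemma IsPt.smul_trace (h : IsPt p) (A : Matrix J K ℂ) :
    p * (Aᴴ * (A * p)) = (A * p * Aᴴ).trace • p := by
  rw [show p * (Aᴴ * (A * p)) = p * (Aᴴ * A) * p by simp only [mulA], h.rank,
    mulA A, Matrix.trace_mul_comm A, mulA]

lemma IsPt.act (h : IsPt p) {A : Matrix J K ℂ} (hA : A * p ≠ 0) : IsPt (act A p) := by
  have h0 := h.trace_ne hA
  obtain ⟨c, hc⟩ : ∃ c, c = (A * p * Aᴴ).trace := ⟨_, rfl⟩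
  have hM : (A * p * Aᴴ)ᴴ = A * p * Aᴴ := by
    simp only [conjTranspose_mul, conjTranspose_conjTranspose, h.herm, mulA]
  have hstar : star c = c := by
    rw [hc, ← trace_conjTranspose, hM]
  refine ⟨?_, ?_, fun X => ?_⟩
  · rw [QG.act, conjTranspose_smul, hM, ← hc, star_inv₀, hstar]
  · rw [QG.act, trace_smul, smul_eq_mul, inv_mul_cancel₀ h0]
  · have e1 : (A * p * Aᴴ) * X * (A * p * Aᴴ) = ((A * p * Aᴴ) * X).trace • (A * p * Aᴴ) := by
      have := h.rank (Aᴴ * X * A)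
      rw [show (A * p * Aᴴ) * X * (A * p * Aᴴ) = A * (p * (Aᴴ * X * A) * p) * Aᴴ by
        simp only [mulA], this, mmul_smul, msmul_mul]
      congr 1
      rw [show A * p * Aᴴ * X = A * (p * Aᴴ * X) by simp only [mulA], Matrix.trace_mul_comm A]
      simp only [mulA]
    rw [QG.act, msmul_mul, msmul_mul, mmul_smul, e1, trace_smul, smul_eq_mul,
      smul_smul, smul_smul, smul_smul]
    congr 1; ring

lemma act_smul (B : Matrix J K ℂ) {c : ℂ} (hc : c ≠ 0) (x : Mat K) :
    act B (c • x) = act B x := by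
  rw [act, act, mmul_smul, msmul_mul, trace_smul, smul_eq_mul, smul_smul, mul_inv,
    mul_right_comm, inv_mul_cancel₀ hc, one_mul]

lemma smul_act (B : Matrix J K ℂ) {c : ℂ} (hc : c ≠ 0) (x : Mat K) :
    act (c • B) x = act B x := by
  have : act (c • B) x = act B ((c * star c) • x) := by
    simp only [act, conjTranspose_smul, mmul_smul, msmul_mul, smul_smul, mul_comm]
  rw [this, act_smul _ (mul_ne_zero hc (star_ne_zero.2 hc))]

lemma act_act (B : Matrix I J ℂ) {A : Matrix J K ℂ} (h : IsPt p) (hA : A * p ≠ 0) :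
    act B (act A p) = act (B * A) p := by
  rw [act.eq_1 A, act_smul _ (inv_ne_zero (h.trace_ne hA))]
  simp only [act, conjTranspose_mul, mulA]

lemma act_eq (h : IsPt p) {A : Mat K} (hA : A * p = p) : act A p = p := by
  have : A * p * Aᴴ = p := by rw [h.conj_eq, hA, h.herm, h.idem]
  rw [act, this, h.tr, inv_one, one_smul]

lemma act_congr (h : IsPt p) {A B : Matrix J K ℂ} (hA : A * p = B * p) : act A p = act B p := by
  rw [act, act, h.conj_eq, h.conj_eq, hA]

lemma mul_act (B : Matrix I J ℂ) (A : Matrix J K ℂ) (p : Mat K) :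
    B * act A p = (A * p * Aᴴ).trace⁻¹ • (B * A * p * Aᴴ) := by
  rw [act, mmul_smul]; simp only [mulA]

lemma mul_act_ne (h : IsPt p) {B : Matrix I J ℂ} {A : Matrix J K ℂ} (hBA : B * A * p ≠ 0) :
    B * act A p ≠ 0 := by
  have hA : A * p ≠ 0 := fun h0 => hBA (by rw [mulA, h0, mmul_zero])
  rw [mul_act]
  refine smul_ne_zero (inv_ne_zero (h.trace_ne hA)) fun h0 => hBA ?_
  have := congrArg (fun M => M * (A * p)) h0
  simp only [mzero_mul] at this
  rw [show B * A * p * Aᴴ * (A * p) = B * A * (p * (Aᴴ * (A * p))) by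
    simp only [mulA], h.smul_trace, mmul_smul] at this
  exact (smul_eq_zero.1 this).resolve_left (h.trace_ne hA)

lemma mul_act_eq {B : Mat J} {A : Matrix J K ℂ} (h : B * (A * p) = A * p) :
    B * act A p = act A p := by
  rw [act, mmul_smul, ← mulA, h]

lemma mul_ne_of_mul_ne {B : Matrix I J ℂ} {A : Matrix J K ℂ} (h : B * A * p ≠ 0) : A * p ≠ 0 :=
  fun h0 => h (by rw [mulA, h0, mmul_zero])

lemma isometry_mul_ne (h : IsPt p) {A : Matrix J K ℂ} (hA : Aᴴ * A = 1) : A * p ≠ 0 :=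
  mul_ne_of_mul_ne (B := Aᴴ) (by rw [hA, mone_mul]; exact h.ne)

section cont
variable {X : Type} [TopologicalSpace X]

lemma continuous_act {A : X → Matrix J K ℂ} {P : X → Mat K} (hA : Continuous A)
    (hP : Continuous P) (hp : ∀ x, IsPt (P x)) (h : ∀ x, A x * P x ≠ 0) :
    Continuous fun x => act (A x) (P x) := by
  have h1 : Continuous fun x => A x * P x * (A x)ᴴ :=
    (hA.matrix_mul hP).matrix_mul hA.matrix_conjTranspose
  exact (h1.matrix_trace.inv₀ fun x => (hp x).trace_ne (h x)).smul h1

end cont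

/-- The map of projective spaces induced by an injective matrix. -/
def actMap (A : Matrix J K ℂ) (hA : Aᴴ * A = 1) : C(CP K, CP J) :=
  ⟨fun p => ⟨act A p.1, p.2.act (isometry_mul_ne p.2 hA)⟩,
    subtype_mk (continuous_act continuous_const continuous_subtype_val
      (fun p => p.2) fun p => isometry_mul_ne p.2 hA) _⟩

lemma isPt_one : IsPt (1 : Mat Unit) := by
  refine ⟨by simp, by simp, fun X => ?_⟩
  ext i j
  simp [Matrix.trace, Matrix.diag]

lemma unit_mat (X : Mat Unit) : X = X.trace • 1 := by
  ext i j; simp [Matrix.trace, Matrix.diag]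

end CP

/-! ### The cell structure of projective spaces -/

section Cell

/-- An orthogonal splitting of a line. -/
structure IsSplit (I : Matrix K J ℂ) (e : Matrix K Unit ℂ) : Prop where
  II : Iᴴ * I = 1
  ee : eᴴ * e = 1
  Ie : Iᴴ * e = 0
  one : I * Iᴴ + e * eᴴ = 1

variable {I : Matrix K J ℂ} {e : Matrix K Unit ℂ}

lemma IsSplit.eI (h : IsSplit I e) : eᴴ * I = 0 := by
  simpa using congrArg conjTranspose h.Ie

/-- The lines on which a matrix does not vanish. -/
def nz {L : Type} (A : Matrix L K ℂ) : Set (CP K) := {p | A * p.1 ≠ 0}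

lemma isOpen_nz {L : Type} (A : Matrix L K ℂ) : IsOpen (nz A) :=
  isOpen_compl_singleton.preimage (continuous_const.matrix_mul continuous_subtype_val)

lemma IsSplit.union (h : IsSplit I e) : (nz eᴴ ∪ nz Iᴴ : Set (CP K)) = Set.univ := by
  ext p
  simp only [Set.mem_union, Set.mem_univ, iff_true]
  by_contra! hp
  simp only [nz, Set.mem_ofPred_eq, not_not] at hp
  refine p.2.ne ?_
  rw [← mone_mul p.1, ← h.one, madd_mul, mulA, mulA, hp.1, hp.2]
  simp

/-- The big cell retracts onto the hyperplane at infinity. -/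
def toCell (h : IsSplit I e) : C(CP J, (nz Iᴴ : Set (CP K))) :=
  ⟨fun p => ⟨actMap I h.II p, mul_act_ne p.2 (by rw [h.II, mone_mul]; exact p.2.ne)⟩,
    (actMap I h.II).continuous.subtype_mk _⟩

lemma toCell_equiv (h : IsSplit I e) : ∃ g : C((nz Iᴴ : Set (CP K)), CP J),
    (g.comp (toCell h)).Homotopic (.id _) ∧ ((toCell h).comp g).Homotopic (.id _) := by
  have hD : ∀ (t : UI) (p : (nz Iᴴ : Set (CP K))),
      Iᴴ * (I * Iᴴ + (t : ℂ) • (e * eᴴ)) * p.1.1 ≠ 0 := fun t p => by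
    rw [mmul_add, mmul_smul, ← mulA, h.II, ← mulA, h.Ie]
    simp only [mone_mul, mzero_mul, smul_zero, add_zero]
    exact p.2
  let g : C((nz Iᴴ : Set (CP K)), CP J) := ⟨fun p => ⟨act Iᴴ p.1.1, p.1.2.act p.2⟩,
    subtype_mk (continuous_act continuous_const (by fun_prop) (fun p => p.1.2)
      fun p => p.2) _⟩
  refine ⟨g, ?_, homotopic_of (fun x =>
    ⟨⟨act (I * Iᴴ + (x.1 : ℂ) • (e * eᴴ)) x.2.1.1, x.2.1.2.act (mul_ne_of_mul_ne (hD x.1 x.2))⟩,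
      mul_act_ne x.2.1.2 (hD x.1 x.2)⟩) ?_ ?_ ?_⟩
  · rw [show g.comp (toCell h) = .id _ from ?_]
    ext1 p
    refine sext ?_
    change act Iᴴ (act I p.1) = p.1
    rw [act_act _ p.2 (isometry_mul_ne p.2 h.II), h.II, act_eq p.2 (mone_mul _)]
  · exact subtype_mk (subtype_mk (continuous_act
      (A := fun x : UI × (nz Iᴴ : Set (CP K)) => I * Iᴴ + (x.1 : ℂ) • (e * eᴴ))
      (P := fun x => x.2.1.1) (by fun_prop) (by fun_prop)
      (fun x => x.2.1.2) fun x => mul_ne_of_mul_ne (hD x.1 x.2)) _) _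
  · intro p
    refine sext (sext ?_)
    change act (I * Iᴴ + ((0 : ℝ) : ℂ) • (e * eᴴ)) p.1.1 = act I (act Iᴴ p.1.1)
    rw [act_act _ p.1.2 p.2]; simp
  · intro p
    refine sext (sext ?_)
    change act (I * Iᴴ + ((1 : ℝ) : ℂ) • (e * eᴴ)) p.1.1 = p.1.1
    simp only [Complex.ofReal_one, one_smul, h.one]
    exact act_eq p.1.2 (mone_mul _)

lemma toCell_qi (h : IsSplit I e) : (Cm (toCell h)).QI :=
  let ⟨g, h1, h2⟩ := toCell_equiv h
  QI_of_homotopy_inverse _ g h1 h2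

lemma IsPt.eq_one {p : Mat Unit} (h : IsPt p) : p = 1 := by
  rw [unit_mat p, h.tr, one_smul]

lemma contractible_cell (h : IsSplit I e) : ContractibleSpace (nz eᴴ : Set (CP K)) := by
  have hD : ∀ (t : UI) (p : (nz eᴴ : Set (CP K))),
      eᴴ * (e * eᴴ + (1 - t : ℂ) • (I * Iᴴ)) * p.1.1 ≠ 0 := fun t p => by
    rw [mmul_add, mmul_smul, ← mulA, h.ee, ← mulA, h.eI]
    simp only [mone_mul, mzero_mul, smul_zero, add_zero]
    exact p.2
  have h1 : eᴴ * act e 1 ≠ 0 :=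
    mul_act_ne isPt_one (by rw [h.ee, mone_mul]; exact isPt_one.ne)
  rw [contractible_iff_id_nullhomotopic]
  refine ⟨⟨⟨act e 1, isPt_one.act (isometry_mul_ne isPt_one h.ee)⟩, h1⟩, homotopic_of (fun x =>
    ⟨⟨act (e * eᴴ + (1 - x.1 : ℂ) • (I * Iᴴ)) x.2.1.1, x.2.1.2.act (mul_ne_of_mul_ne (hD x.1 x.2))⟩,
      mul_act_ne x.2.1.2 (hD x.1 x.2)⟩) ?_ ?_ ?_⟩
  · exact subtype_mk (subtype_mk (continuous_act
      (A := fun x : UI × (nz eᴴ : Set (CP K)) => e * eᴴ + (1 - x.1 : ℂ) • (I * Iᴴ))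
      (P := fun x => x.2.1.1) (by fun_prop) (by fun_prop)
      (fun x => x.2.1.2) fun x => mul_ne_of_mul_ne (hD x.1 x.2)) _) _
  · intro p
    refine sext (sext ?_)
    change act (e * eᴴ + (1 - ((0 : ℝ) : ℂ)) • (I * Iᴴ)) p.1.1 = p.1.1
    simp only [Complex.ofReal_zero, sub_zero, one_smul, add_comm (e * eᴴ), h.one]
    exact act_eq p.1.2 (mone_mul _)
  · intro p
    refine sext (sext ?_)
    change act (e * eᴴ + (1 - ((1 : ℝ) : ℂ)) • (I * Iᴴ)) p.1.1 = act e 1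
    rw [Complex.ofReal_one, sub_self, zero_smul, add_zero, ← act_act _ p.1.2 p.2,
      (p.1.2.act p.2).eq_one]

lemma affine_mul_ne (h : IsSplit I e) (x : Matrix J Unit ℂ) :
    eᴴ * (I * x + e) * (1 : Mat Unit) ≠ 0 := by
  rw [mmul_one, mmul_add, ← mulA, h.eI, h.ee, mzero_mul, zero_add]
  exact isPt_one.ne

/-- The affine chart of projective space. -/
def chart (h : IsSplit I e) : C(Matrix J Unit ℂ, (nz eᴴ : Set (CP K))) :=
  ⟨fun x => ⟨⟨act (I * x + e) 1, isPt_one.act (mul_ne_of_mul_ne (affine_mul_ne h x))⟩,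
    mul_act_ne isPt_one (affine_mul_ne h x)⟩,
    subtype_mk (subtype_mk (continuous_act (by fun_prop) continuous_const
      (fun _ => isPt_one) fun x => mul_ne_of_mul_ne (affine_mul_ne h x)) _) _⟩

lemma chart_inv (h : IsSplit I e) (x : Matrix J Unit ℂ) :
    (eᴴ * (chart h x).1.1 * e).trace⁻¹ • (Iᴴ * (chart h x).1.1 * e) = x := by
  have h0 := isPt_one.trace_ne (mul_ne_of_mul_ne (affine_mul_ne h x))
  change (eᴴ * act (I * x + e) 1 * e).trace⁻¹ • (Iᴴ * act (I * x + e) 1 * e) = x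
  have e1 : (I * x + e)ᴴ * e = 1 := by
    rw [conjTranspose_add, conjTranspose_mul, madd_mul, mulA, h.Ie, h.ee]; simp
  have e2 : eᴴ * (I * x + e) = 1 := by
    rw [mmul_add, ← mulA, h.eI, h.ee]; simp
  have e3 : Iᴴ * (I * x + e) = x := by
    rw [mmul_add, ← mulA, h.II, h.Ie]; simp
  obtain ⟨v, hv⟩ : ∃ v, v = I * x + e := ⟨_, rfl⟩
  rw [← hv] at h0 e1 e2 e3 ⊢
  rw [mul_act, mul_act, msmul_mul, msmul_mul, mulA, mulA _ vᴴ, e1, e2, e3, trace_smul, smul_smul]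
  simp only [mmul_one, mone_mul, trace_one, Fintype.card_unit, Nat.cast_one,
    smul_eq_mul, mul_one, inv_inv]
  rw [mmul_one] at h0
  rw [mul_inv_cancel₀ h0, one_smul, mulA, e1, mmul_one]

lemma trace_cell_ne {p : CP K} (hp : p ∈ nz eᴴ) : (eᴴ * p.1 * e).trace ≠ 0 := by
  have := p.2.trace_ne hp
  rwa [conjTranspose_conjTranspose] at this

lemma chart_surj (h : IsSplit I e) (p : (nz eᴴ : Set (CP K))) :
    (chart h ((eᴴ * p.1.1 * e).trace⁻¹ • (Iᴴ * p.1.1 * e))) = p := by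
  have h0 := trace_cell_ne p.2
  refine sext (sext ?_)
  obtain ⟨c, hc⟩ : ∃ c, c = (eᴴ * p.1.1 * e).trace := ⟨_, rfl⟩
  change act (I * _ + e) 1 = _
  rw [← hc] at h0 ⊢
  have e1 : I * (c⁻¹ • (Iᴴ * p.1.1 * e)) + e = c⁻¹ • (p.1.1 * e) := by
    have : p.1.1 * e = I * (Iᴴ * p.1.1 * e) + c • e := by
      have h2 : eᴴ * p.1.1 * e = c • (1 : Mat Unit) := by rw [hc]; exact unit_mat _
      have h3 : c • e = e * (eᴴ * p.1.1 * e) := by rw [h2, mmul_smul, mmul_one]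
      rw [h3]
      conv_lhs => rw [← mone_mul p.1.1, ← h.one]
      simp only [madd_mul, mulA]
    rw [this, smul_add, smul_smul, inv_mul_cancel₀ h0, one_smul, mmul_smul]
  rw [e1, smul_act _ (inv_ne_zero h0), act]
  have e2 : p.1.1 * e * (1 : Mat Unit) * (p.1.1 * e)ᴴ = c • p.1.1 := by
    rw [mmul_one, conjTranspose_mul, p.1.2.herm,
      show p.1.1 * e * (eᴴ * p.1.1) = p.1.1 * (e * eᴴ) * p.1.1 by simp only [mulA],
      p.1.2.rank, hc, mulA eᴴ, Matrix.trace_mul_comm eᴴ, mulA]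
  rw [e2, trace_smul, p.1.2.tr, smul_smul, smul_eq_mul, mul_one, inv_mul_cancel₀ h0, one_smul]

lemma chart_mem (h : IsSplit I e) (x : Matrix J Unit ℂ) :
    (chart h x).1 ∈ nz Iᴴ ↔ x ≠ 0 := by
  constructor
  · rintro hp rfl
    refine hp ?_
    change Iᴴ * act (I * 0 + e) 1 = 0
    rw [mmul_zero, zero_add, mul_act, h.Ie]; simp
  · intro hx h0
    refine hx ?_
    rw [← chart_inv h x, h0]; simp

/-- The affine chart as a homeomorphism. -/
def chartHomeo (h : IsSplit I e) : Matrix J Unit ℂ ≃ₜ (nz eᴴ : Set (CP K)) where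
  toFun := chart h
  invFun p := (eᴴ * p.1.1 * e).trace⁻¹ • (Iᴴ * p.1.1 * e)
  left_inv := chart_inv h
  right_inv := chart_surj h
  continuous_toFun := (chart h).continuous
  continuous_invFun := by
    have : Continuous fun p : (nz eᴴ : Set (CP K)) => (eᴴ * p.1.1 * e).trace := by fun_prop
    exact (this.inv₀ fun p => trace_cell_ne p.2).smul (by fun_prop)

lemma chart_symm_ne (h : IsSplit I e) (p : (nz eᴴ : Set (CP K))) (hp : p.1 ∈ nz Iᴴ) :
    (chartHomeo h).symm p ≠ 0 := by
  rw [← chart_mem h, show chart h ((chartHomeo h).symm p) = p from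
    (chartHomeo h).apply_symm_apply _]
  exact hp

/-- The intersection of the two open pieces is a punctured affine space. -/
def chartPunc (h : IsSplit I e) :
    {x : Matrix J Unit ℂ // x ≠ 0} ≃ₜ (nz eᴴ ∩ nz Iᴴ : Set (CP K)) where
  toFun x := ⟨(chart h x.1).1, (chart h x.1).2, (chart_mem h x.1).2 x.2⟩
  invFun p := ⟨(chartHomeo h).symm ⟨p.1, p.2.1⟩, chart_symm_ne h _ p.2.2⟩
  left_inv x := sext ((chartHomeo h).symm_apply_apply x.1)
  right_inv p := sext (congrArg (fun y => y.1)
    ((chartHomeo h).apply_symm_apply ⟨p.1, p.2.1⟩))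
  continuous_toFun := subtype_mk (continuous_subtype_val.comp
    ((chart h).continuous.comp continuous_subtype_val)) _
  continuous_invFun := subtype_mk ((chartHomeo h).symm.continuous.comp
    (subtype_mk continuous_subtype_val _)) _

theorem Line_actMap (h : IsSplit I e) : Line (cone (Cm (actMap I h.II))) 1 := by
  have h1 : Line (cone (Cm (punc (Matrix J Unit ℂ)))) 1 := by
    have := Line_punc (E := Matrix J Unit ℂ)
    rwa [Module.finrank_matrix, Complex.finrank_real_complex, mul_comm, pow_mul,
      neg_one_sq, one_pow] at this
  obtain ⟨F, hF⟩ := pair_homeo (f := punc (Matrix J Unit ℂ))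
    (f' := incl (Set.inter_subset_left (s := nz eᴴ) (t := nz Iᴴ)))
    (chartPunc h) (chartHomeo h) (fun x => rfl)
  have h2 := (h1.map hF).map (hoCart_sets (isOpen_nz eᴴ) (isOpen_nz Iᴴ))
  let b : CP K ≃ₜ (nz eᴴ ∪ nz Iᴴ : Set (CP K)) :=
    (Homeomorph.Set.univ _).symm.trans (Homeomorph.setCongr h.union.symm)
  obtain ⟨G, hG⟩ := pair_qi (f := actMap I h.II)
    (f' := incl (Set.subset_union_right (s := nz eᴴ) (t := nz Iᴴ))) (α := toCell h)
    (β := ⟨b, b.continuous⟩) (fun x => rfl) (toCell_qi h) (QI_of_homeo b)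
  exact h2.comap hG

end Cell

/-! ### Bases of homology and dual classes -/

section Classes
variable {A B M N : DMod}

/-- A finite family of maps as a map to a power. -/
def tup {n : ℕ} (h : Fin n → DHom M N) : DHom M (N.pow n) where
  f := LinearMap.pi fun i => (h i).f
  hd := fun x => by funext i; exact (h i).hd x
  hε := fun x => by funext i; exact (h i).hε x

@[simp] lemma tup_f {n : ℕ} (h : Fin n → DHom M N) (x : M.X) (i : Fin n) :
    (tup h).f x i = (h i).f x := rfl

lemma Line.basis_step {f : DHom A B} (hl : Line (cone f) 1) (hA : A.OV) :
    ∃ y : B.X, B.d y = 0 ∧ B.ε y = y ∧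
      (∀ a, ∀ q : ℚ, A.d a = 0 → B.Bd (f.f a + q • y) → A.Bd a ∧ q = 0) ∧
      (∀ b, B.d b = 0 → ∃ a, ∃ q : ℚ, A.d a = 0 ∧ B.Bd (b - (f.f a + q • y))) := by
  obtain ⟨⟨b₀, a₀⟩, hx, he, hn, hg⟩ := hl
  rw [cone_cycle] at hx
  obtain ⟨u, v, h1, h2⟩ := cone_bd.1 (show (cone f).Bd (B.ε b₀ - (1 : ℚ) • b₀,
    -A.ε a₀ - (1 : ℚ) • a₀) from he)
  obtain ⟨α, hα⟩ : A.Bd a₀ := by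
    refine Bd_of_eq (((hA a₀ hx.2).add ⟨v, rfl⟩).smul (1/2)) ?_
    rw [← neg_eq_iff_eq_neg.2 (neg_eq_iff_eq_neg.1 (neg_neg (A.d v))), h2]
    rw [one_smul, neg_sub, sub_neg_eq_add, sub_add_add_cancel, ← two_smul ℚ, smul_smul]
    norm_num
  obtain ⟨y, hy⟩ : ∃ y, y = b₀ + f.f α := ⟨_, rfl⟩
  have hdy : B.d y = 0 := by rw [hy, map_add, hx.1, ← f.hd, hα]; simp
  have hrel : (cone f).Bd ((y, 0) - (b₀, a₀)) := by
    refine cone_bd.2 ⟨0, α, ?_, ?_⟩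
    · change _ = y - b₀
      rw [hy, map_zero]; abel
    · change _ = 0 - a₀
      rw [hα]; abel
  obtain ⟨y', hy'⟩ : ∃ y', y' = (1/2 : ℚ) • (y + B.ε y) := ⟨_, rfl⟩
  have hdy' : B.d y' = 0 := by rw [hy', map_smul, map_add, B.dε, hdy]; simp
  have hεy' : B.ε y' = y' := by rw [hy', map_smul, map_add, B.εε, add_comm]
  have hrel' : (cone f).Bd ((y', 0) - (b₀, a₀)) := by
    have h3 := ((hrel.eps.add hrel).add he).smul (1/2 : ℚ)
    refine Bd_of_eq h3 ?_
    rw [map_sub, cone_ε, cone_ε]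
    refine Prod.ext ?_ ?_
    · change y' - b₀ = (1/2 : ℚ) • (B.ε y - B.ε b₀ + (y - b₀) + (B.ε b₀ - (1 : ℚ) • b₀))
      rw [hy', one_smul, show B.ε y - B.ε b₀ + (y - b₀) + (B.ε b₀ - b₀) =
        (y + B.ε y) - (2 : ℚ) • b₀ by rw [two_smul]; abel, smul_sub, smul_smul]
      norm_num
    · change (0 : A.X) - a₀ = (1/2 : ℚ) • (-A.ε 0 - -A.ε a₀ + (0 - a₀) + (-A.ε a₀ - (1 : ℚ) • a₀))
      rw [map_zero, one_smul, show -0 - -A.ε a₀ + (0 - a₀) + (-A.ε a₀ - a₀) =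
        -((2 : ℚ) • a₀) by rw [two_smul]; abel, smul_neg, smul_smul]
      norm_num
  have hn' : ∀ q : ℚ, (cone f).Bd (q • y', 0) → q = 0 := fun q hq => by
    by_contra h0
    refine hn (Bd_of_eq ((hq.smul q⁻¹).sub hrel') ?_)
    refine Prod.ext ?_ ?_
    · change b₀ = q⁻¹ • q • y' - (y' - b₀)
      rw [smul_smul, inv_mul_cancel₀ h0, one_smul]; abel
    · change a₀ = q⁻¹ • (0 : A.X) - (0 - a₀)
      simp
  have hg' : ∀ n m, (cone f).d (n, m) = 0 → ∃ q : ℚ, (cone f).Bd (n - q • y', m) := by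
    intro n m h
    obtain ⟨q, hq⟩ := hg _ h
    refine ⟨q, Bd_of_eq (hq.sub (hrel'.smul q)) (Prod.ext ?_ ?_)⟩
    · change n - q • y' = n - q • b₀ - q • (y' - b₀)
      rw [smul_sub]; abel
    · change m = m - q • a₀ - q • (0 - a₀)
      simp
  refine ⟨y', hdy', hεy', ?_, ?_⟩
  · rintro a q ha ⟨b, hb⟩
    have hq : q = 0 := hn' q (cone_bd.2 ⟨b, -a, by rw [hb, map_neg]; abel, by simp [ha]⟩)
    subst hq
    obtain ⟨r, hr⟩ := hg' b (-a) (cone_cycle.2 ⟨by rw [hb]; simp, by simp [ha]⟩)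
    obtain ⟨u, v, -, h4⟩ := cone_bd.1 hr
    exact ⟨⟨v, neg_injective h4⟩, rfl⟩
  · intro b hb
    obtain ⟨q, hq⟩ := hg' b 0 (cone_cycle.2 (by simp [hb]))
    obtain ⟨u, v, h3, h4⟩ := cone_bd.1 hq
    exact ⟨v, q, neg_eq_zero.1 h4, u, by rw [← sub_sub, sub_right_comm, ← h3]; abel⟩

/-- A family of cycles of even parity. -/
structure IsEv {n : ℕ} (w : Fin n → M.X) : Prop where
  d : ∀ i, M.d (w i) = 0
  ε : ∀ i, M.ε (w i) = w i

/-- The family generates the homology. -/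
def Gen {n : ℕ} (w : Fin n → M.X) : Prop := ∀ x, M.d x = 0 → ∃ c : Fin n → ℚ, M.Bd (x - ∑ i, c i • w i)

/-- The family is linearly independent in homology. -/
def Ind {n : ℕ} (w : Fin n → M.X) : Prop := ∀ c : Fin n → ℚ, M.Bd (∑ i, c i • w i) → c = 0

lemma IsEv.ov {n : ℕ} {w : Fin n → M.X} (h : IsEv w) (hg : Gen w) : M.OV := fun x hx => by
  obtain ⟨c, hc⟩ := hg x hx
  refine Bd_of_eq (hc.sub hc.eps) ?_
  simp only [map_sub, map_sum, map_smul, h.ε]; abel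

lemma IsEv.exists_dual {n : ℕ} {z : Fin n → M.X} (h : IsEv z) (hi : Ind z) :
    ∃ φ : Fin n → DHom M QQ, ∀ i j, (φ j).f (z i) = if i = j then (1 : ℚ) else 0 := by
  let S : Submodule ℚ M.X := lrange M.d ⊔ lrange (M.ε - lid)
  have hli : LinearIndependent ℚ fun i => S.mkQ (z i) := by
    rw [Fintype.linearIndependent_iff]
    intro c hc
    have hc' : ∑ i, c i • z i ∈ S := by
      rw [← Submodule.ker_mkQ S, LinearMap.mem_ker, ← hc]; simp
    obtain ⟨_, ⟨a, rfl⟩, _, ⟨b, rfl⟩, hab⟩ := Submodule.mem_sup.1 hc'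
    refine congrFun (hi c ⟨(1/2 : ℚ) • (a - M.ε a), ?_⟩)
    have h1 : M.ε (∑ i, c i • z i) = ∑ i, c i • z i := by simp [h.ε]
    have h2 : ∑ i, c i • z i = (1/2 : ℚ) • (∑ i, c i • z i + M.ε (∑ i, c i • z i)) := by
      rw [h1, ← two_smul ℚ, smul_smul]; norm_num
    rw [h2, ← hab, map_smul, map_sub, M.dε]
    congr 1
    simp only [map_add, lsub_apply, lid_apply, map_sub, M.εε]
    have := M.dε a
    rw [show M.ε (M.d a) = -M.d (M.ε a) by rw [this, neg_neg], M.dε]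
    abel
  choose φ hφ using fun j => LinearMap.exists_extend ((Basis.span hli).coord j)
  refine ⟨fun j => ⟨φ j ∘ₗ S.mkQ, fun x => ?_, fun x => ?_⟩, fun i j => ?_⟩
  · have : S.mkQ (M.d x) = 0 := by
      rw [← LinearMap.mem_ker, Submodule.ker_mkQ]
      exact Submodule.mem_sup_left ⟨x, rfl⟩
    rw [lcomp_apply, this, map_zero]; rfl
  · have : S.mkQ (M.ε x) = S.mkQ x := by
      rw [← sub_eq_zero, ← map_sub, ← LinearMap.mem_ker, Submodule.ker_mkQ]
      exact Submodule.mem_sup_right ⟨x, rfl⟩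
    rw [lcomp_apply, this]; rfl
  · have h1 : S.mkQ (z i) = (Submodule.span ℚ (Set.range fun i => S.mkQ (z i))).subtype
        (Basis.span hli i) := by
      rw [Submodule.subtype_apply, Basis.span_apply]
    change φ j (S.mkQ (z i)) = _
    rw [h1, ← lcomp_apply, hφ, Basis.coord_apply, Basis.repr_self, Finsupp.single_apply]

lemma QQ_bd {q : QQ.X} (h : QQ.Bd q) : q = 0 := by
  obtain ⟨_, h⟩ := h; exact h.symm

lemma QI_tup_QQ {n : ℕ} {w : Fin n → M.X} (h : IsEv w) (hg : Gen w) (φ : Fin n → DHom M QQ)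
    (hφ : ∀ i j, (φ j).f (w i) = if i = j then (1 : ℚ) else 0) : (tup φ).QI := by
  have key : ∀ (c : Fin n → ℚ) j, (φ j).f (∑ i, c i • w i) = c j := fun c j => by simp_all
  constructor
  · intro x hx hb
    obtain ⟨c, hc⟩ := hg x hx
    have hc0 : c = 0 := funext fun j => by
      have h1 : (φ j).f x = 0 := QQ_bd (pow_bd.1 hb j)
      have h2 := QQ_bd ((φ j).bd hc)
      rw [map_sub, h1, key, zero_sub] at h2
      exact neg_eq_zero.1 h2
    simpa [hc0] using hc
  · intro y _
    refine ⟨∑ i, (y i : ℚ) • w i, by simp [h.d], ?_⟩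
    refine Bd_of_eq Bd.zero (funext fun j => ?_)
    change y j - (φ j).f (∑ i, (y i : ℚ) • w i) = 0
    rw [key, sub_self]

end Classes

/-! ### The homology of projective spaces -/

section CPn

/-- The matrix of an inclusion of coordinates. -/
def emb (f : J → K) : Matrix K J ℂ := (1 : Mat K).submatrix id f

lemma emb_mul (g : J → K) (f : I → J) : emb g * emb f = emb (g ∘ f) := by
  ext i j
  simp [emb, mmul_apply, mone_apply]

lemma emb_conj_mul {f : J → K} (hf : f.Injective) : (emb f)ᴴ * emb f = 1 := by
  ext i j
  simp [emb, mmul_apply, mone_apply, hf.eq_iff, eq_comm]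

lemma isSplit_castLE (n : ℕ) : IsSplit (emb (Fin.castLE (Nat.le_succ n)))
    (emb fun _ : Unit => Fin.last n) where
  II := emb_conj_mul (Fin.castLE_injective _)
  ee := emb_conj_mul (Function.injective_of_subsingleton _)
  Ie := by
    ext i j
    simp only [emb, mmul_apply, mone_apply, conjTranspose_apply, submatrix_apply, Matrix.zero_apply]
    refine Finset.sum_eq_zero fun k _ => ?_
    have : (Fin.castLE (Nat.le_succ n) i) ≠ Fin.last n := (Fin.castSucc_lt_last i).ne
    by_cases hk : k = Fin.last n <;> simp [hk, this.symm]
  one := by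
    rw [← mmul_one (1 : Matrix (Fin (n + 1)) (Fin (n + 1)) ℂ)]
    ext k l
    rw [madd_apply, mmul_apply, mmul_apply, mmul_apply, Fin.sum_univ_castSucc]
    simp only [emb, conjTranspose_apply, submatrix_apply, id, Finset.univ_unique, Finset.sum_const,
      Finset.card_singleton, one_smul]
    have hs : ∀ i j : Fin (n + 1), star ((1 : Matrix _ _ ℂ) i j) = (1 : Matrix _ _ ℂ) j i :=
      fun i j => by rw [← conjTranspose_apply, conjTranspose_one]
    simp only [hs]
    rfl

/-- The standard inclusions of projective spaces. -/
def cpEmb (f : J → K) (hf : f.Injective) : C(CP J, CP K) := actMap (emb f) (emb_conj_mul hf)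

lemma cpEmb_comp (g : J → K) (hg : g.Injective) (f : I → J) (hf : f.Injective) :
    (cpEmb g hg).comp (cpEmb f hf) = cpEmb (g ∘ f) (hg.comp hf) := by
  ext1 p
  refine sext ((act_act _ p.2 (isometry_mul_ne p.2 (emb_conj_mul hf))).trans ?_)
  rw [emb_mul]; rfl

lemma cpEmb_id : cpEmb (id : J → J) Function.injective_id = .id _ := by
  ext1 p
  refine sext (act_eq p.2 ?_)
  simp [emb]

/-- Compatible homology bases of the coordinate projective subspaces. -/
lemma exists_cp_basis (M : ℕ) : ∃ z : Fin M → (C (CP (Fin M))).X, IsEv z ∧ Gen z ∧ Ind z ∧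
    ∀ n (h : n ≤ M), ∃ w : Fin n → (C (CP (Fin n))).X, IsEv w ∧ Gen w ∧
      ∀ i, (Cm (cpEmb (Fin.castLE h) (Fin.castLE_injective h))).f (w i) = z (Fin.castLE h i) := by
  induction M with
  | zero =>
    have : IsEmpty (CP (Fin 0)) := ⟨fun p => by
      have := p.2.tr
      simp [Matrix.trace] at this⟩
    have hs : Subsingleton (C (CP (Fin 0))).X := C_subsingleton
    have e : IsEv (M := C (CP (Fin 0))) (fun i : Fin 0 => 0) := ⟨fun i => i.elim0, fun i => i.elim0⟩
    have g : Gen (M := C (CP (Fin 0))) (fun i : Fin 0 => 0) :=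
      fun x _ => ⟨0, Bd_of_eq Bd.zero (hs.elim _ _)⟩
    refine ⟨fun _ => 0, e, g, fun c _ => Subsingleton.elim _ _, fun n h => ?_⟩
    obtain rfl : n = 0 := by omega
    exact ⟨fun _ => 0, e, g, fun i => i.elim0⟩
  | succ M ih =>
    obtain ⟨z, hz, hg, hi, hw⟩ := ih
    obtain ⟨f, hf⟩ : ∃ f, f = cpEmb _ (Fin.castLE_injective (Nat.le_succ M)) := ⟨_, rfl⟩
    have hl : Line (cone (Cm f)) 1 := by rw [hf]; exact Line_actMap (isSplit_castLE M)
    obtain ⟨y, hdy, hεy, hy1, hy2⟩ := hl.basis_step (hz.ov hg)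
    obtain ⟨z', h1, h2⟩ : ∃ z' : Fin (M + 1) → (C (CP (Fin (M + 1)))).X,
        (∀ i, z' (Fin.castSucc i) = (Cm f).f (z i)) ∧ z' (Fin.last M) = y :=
      ⟨Fin.snoc (α := fun _ => (C (CP (Fin (M + 1)))).X) (fun i => (Cm f).f (z i)) y,
        fun i => Fin.snoc_castSucc (α := fun _ => (C (CP (Fin (M + 1)))).X) _ _ i,
        Fin.snoc_last (α := fun _ => (C (CP (Fin (M + 1)))).X) _ _⟩
    have hsum : ∀ c : Fin (M + 1) → ℚ, ∑ i, c i • z' i =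
        (Cm f).f (∑ i : Fin M, c i.castSucc • z i) + c (Fin.last M) • y := fun c => by
      rw [Fin.sum_univ_castSucc, h2, map_sum]; simp [h1]
    have hz' : IsEv z' := by
      constructor
      · refine Fin.lastCases (by rw [h2, hdy]) fun i => ?_
        rw [h1, ← (Cm f).hd, hz.d, map_zero]
      · refine Fin.lastCases (by rw [h2, hεy]) fun i => ?_
        rw [h1, ← (Cm f).hε, hz.ε]
    have hg' : Gen z' := fun x hx => by
      obtain ⟨a, q, ha, hb⟩ := hy2 x hx
      obtain ⟨c, hc⟩ := hg a ha
      refine ⟨Fin.snoc (α := fun _ => ℚ) c q, Bd_of_eq (hb.add ((Cm f).bd hc)) ?_⟩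
      rw [hsum]
      simp only [Fin.snoc_castSucc, Fin.snoc_last, map_sub]
      abel
    refine ⟨z', hz', hg', fun c hc => ?_, fun n h => ?_⟩
    · rw [hsum] at hc
      obtain ⟨h3, h4⟩ := hy1 _ _ (by simp [hz.d]) hc
      have h5 := hi _ h3
      funext i
      refine Fin.lastCases h4 (fun i => congrFun h5 i) i
    · rcases Nat.lt_or_ge n (M + 1) with hn | hn
      · obtain ⟨w, hw1, hw2, hw3⟩ := hw n (Nat.le_of_lt_succ hn)
        refine ⟨w, hw1, hw2, fun i => ?_⟩
        rw [show Fin.castLE h i = Fin.castSucc (Fin.castLE (Nat.le_of_lt_succ hn) i) from rfl, h1,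
          ← hw3, ← Cm_comp, hf, cpEmb_comp]
        rfl
      · obtain rfl : n = M + 1 := le_antisymm h hn
        refine ⟨z', hz', hg', fun i => ?_⟩
        rw [show cpEmb (Fin.castLE h) (Fin.castLE_injective h) = .id _ from cpEmb_id, Cm_id]
        rfl

/-- Cohomology classes restricting to bases on all small coordinate projective subspaces. -/
theorem exists_classes (N : ℕ) (K : Type) [Fintype K] [DecidableEq K] :
    ∃ φ : Fin N → DHom (C (CP (Fin N ⊕ K))) QQ, ∀ n (hn : n ≤ N),
      (tup fun i : Fin n => (φ (Fin.castLE hn i)).comp (Cm (cpEmb (inl ∘ Fin.castLE hn)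
        (inl_injective.comp (Fin.castLE_injective hn))))).QI := by
  obtain ⟨z, h1, h2, h3, h4⟩ := exists_cp_basis (N + Fintype.card K)
  obtain ⟨φ, hφ⟩ := h1.exists_dual h3
  let e : Fin N ⊕ K ≃ Fin (N + Fintype.card K) :=
    (Equiv.sumCongr (Equiv.refl _) (Fintype.equivFin K)).trans finSumFinEquiv
  refine ⟨fun i => (φ (Fin.castAdd _ i)).comp (Cm (cpEmb e e.injective)), fun n hn => ?_⟩
  obtain ⟨w, hw1, hw2, hw3⟩ := h4 n (hn.trans (Nat.le_add_right _ _))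
  refine QI_tup_QQ hw1 hw2 _ fun i j => ?_
  rw [comp_f, comp_f, ← Cm_comp, cpEmb_comp]
  have : (Cm (cpEmb (e ∘ inl ∘ Fin.castLE hn) (e.injective.comp
      (inl_injective.comp (Fin.castLE_injective hn))))).f (w i) =
      z (Fin.castLE (hn.trans (Nat.le_add_right _ _)) i) := hw3 i
  rw [this, hφ]
  simp [Fin.ext_iff]

end CPn

/-! ### The Künneth theorem for projective spaces -/

section KunCP
variable {E : Type} [AddCommGroup E] [Module ℝ E] [TopologicalSpace E]
  [IsTopologicalAddGroup E] [ContinuousSMul ℝ E] [T2Space E] [FiniteDimensional ℝ E]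

lemma Kun_convex {S : Set E} (hS : Convex ℝ S) : Kun S := by
  rcases S.eq_empty_or_nonempty with rfl | h
  · exact Kun_empty
  · have := hS.contractibleSpace h
    exact Kun_contractible

lemma Kun_univ {X : Type} [TopologicalSpace X] {S : Set X} (h : Kun S) (hS : S = Set.univ) :
    Kun X := by
  subst hS
  exact h.of_homeo (Homeomorph.Set.univ X)

lemma Kun_punc : Kun {x : E // x ≠ 0} := by
  let b := finBasis ℝ E
  let κ := Fin (finrank ℝ E) × Bool
  let l : κ → E →ₗ[ℝ] ℝ := fun k => if k.2 then b.coord k.1 else - b.coord k.1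
  have hc : ∀ k, Continuous (l k) := fun k => LinearMap.continuous_of_finiteDimensional _
  let W : κ → Set {x : E // x ≠ 0} := fun k => {x | 0 < l k x.1}
  refine Kun_univ (Kun_cover Finset.univ W (fun k => ?_) fun t _ ht => ?_) ?_
  · exact isOpen_lt continuous_const ((hc k).comp continuous_subtype_val)
  · let S : Set E := {x | ∀ k ∈ t, 0 < l k x}
    have hS : Convex ℝ S := by
      have : S = ⋂ k ∈ t, {x | 0 < l k x} := by ext; simp [S]
      rw [this]
      exact convex_iInter₂ fun k _ => convex_halfSpace_gt (l k).isLinear 0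
    have hS0 : ∀ x ∈ S, x ≠ 0 := by
      rintro x hx rfl
      obtain ⟨k, hk⟩ := ht
      simpa using hx k hk
    refine (Kun_convex hS).of_homeo
      { toFun := fun x => ⟨⟨x.1, hS0 _ x.2⟩, Set.mem_iInter₂.2 x.2⟩
        invFun := fun x => ⟨x.1.1, Set.mem_iInter₂.1 x.2⟩
        left_inv := fun x => rfl
        right_inv := fun x => rfl
        continuous_toFun := by fun_prop
        continuous_invFun := by fun_prop }
  · ext x
    simp only [mem_univ, Set.iUnion_true, Set.mem_iUnion, Set.mem_univ, iff_true]
    by_contra! hx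
    refine x.2 (b.ext_elem fun i => ?_)
    have h1 := hx (i, true)
    have h2 := hx (i, false)
    simp only [W, l, Set.mem_ofPred_eq] at h1 h2
    simp only [Basis.coord_apply, if_true, Bool.false_eq_true, if_false,
      LinearMap.neg_apply] at h1 h2
    simp only [map_zero, Finsupp.zero_apply]
    linarith

lemma IsSplit.kun {I : Matrix K J ℂ} {e : Matrix K Unit ℂ} (h : IsSplit I e) (hJ : Kun (CP J)) :
    Kun (CP K) := by
  refine Kun_univ (Kun_union (isOpen_nz eᴴ) (isOpen_nz Iᴴ) ?_ ?_ ?_) h.union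
  · have := contractible_cell h
    exact Kun_contractible
  · obtain ⟨g, h1, h2⟩ := toCell_equiv h
    exact hJ.of_equiv _ g h1 h2
  · exact (Kun_punc (E := Matrix J Unit ℂ)).of_homeo (chartPunc h)

lemma Kun_CP (n : ℕ) : Kun (CP (Fin n)) := by
  induction n with
  | zero =>
    have : IsEmpty (CP (Fin 0)) := ⟨fun p => by
      have := p.2.tr
      simp [Matrix.trace] at this⟩
    exact Kun_empty
  | succ n ih => exact (isSplit_castLE n).kun ih

end KunCP

/-! ### Slant products with cohomology classes -/

section Slant
variable {Y Y' : Type} [TopologicalSpace Y'] [TopologicalSpace Y]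

/-- Slant product with a cohomology class of the second factor. -/
def slant (B : Type) [TopologicalSpace B] (φ : DHom (C Y) QQ) : DHom (C (B × Y)) (C B) :=
  (tensUnit (C B)).comp ((tmap (hid _) φ).comp (AWp B Y))

lemma slant_left (φ : DHom (C Y) QQ) (f : C(B, B')) (x : (C (B × Y)).X) :
    (slant B' φ).f ((Cm (f.prodMap (.id Y))).f x) = (Cm f).f ((slant B φ).f x) := by
  rw [slant, slant, comp_f, comp_f, comp_f, comp_f, ← AWp_nat, tmap_comp]
  have h : ∀ z : (tens (C B) (C Y)).X,
      (tensUnit (C B')).f ((tmap ((hid _).comp (Cm f)) (φ.comp (Cm (.id Y)))).f z) =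
      (Cm f).f ((tensUnit (C B)).f ((tmap (hid _) φ).f z)) := fun z => by
    induction z using tensor_induction with
    | zero => simp only [map_zero]
    | tmul a b =>
      rw [tmap_tmul, tmap_tmul, comp_f, comp_f, Cm_id]
      exact ((Cm f).f.map_smul (φ.f b : ℚ) a).symm
    | add x y hx hy => simp only [map_add, hx, hy]
  exact h _

lemma slant_right (φ : DHom (C Y') QQ) (g : C(Y, Y')) (x : (C (B × Y)).X) :
    (slant B φ).f ((Cm ((cid B).prodMap g)).f x) =
      (slant B (φ.comp (Cm g))).f x := by
  rw [slant, slant, comp_f, comp_f, comp_f, comp_f, ← AWp_nat, tmap_comp]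
  congr 1
  exact tmap_congr (fun y => Cm_id y) (fun _ => rfl) _

/-- A component of a power. -/
def pproj (M : DMod) {n : ℕ} (i : Fin n) : DHom (M.pow n) M :=
  ⟨LinearMap.proj i, fun _ => rfl, fun _ => rfl⟩

lemma QI_tens_pow (N : DMod) (n : ℕ) :
    (tup fun i : Fin n => (tensUnit N).comp (tmap (hid N) (pproj QQ i))).QI := by
  refine QI_of_bijective ?_
  have : ⇑(tup fun i : Fin n => (tensUnit N).comp (tmap (hid N) (pproj QQ i))).f =
      ⇑(TensorProduct.piScalarRight ℚ ℚ N.X (Fin n)) := by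
    funext z
    induction z using tensor_induction with
    | zero => simp only [map_zero]
    | tmul a b => rfl
    | add x y hx hy => rw [map_add, map_add, hx, hy]
  rw [this]
  exact (TensorProduct.piScalarRight ℚ ℚ N.X (Fin n)).bijective

lemma QI_slant (hY : Kun Y) {n : ℕ} (φ : Fin n → DHom (C Y) QQ) (h : (tup φ).QI)
    (B : Type) [TopologicalSpace B] : (tup fun i => slant B (φ i)).QI := by
  refine QI.congr (HEqv.of_eq fun x => ?_)
    ((QI_tens_pow (C B) n).comp ((h.tmap_right (C B)).comp (hY B)))
  funext i
  rw [tup_f, comp_f, comp_f, tup_f, comp_f, tmap_comp]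
  rfl

end Slant

/-! ### Projective bundles -/

section Bundle

/-- Orthogonal projections. -/
structure IsProj (P : Mat K) : Prop where
  herm : Pᴴ = P
  idem : P * P = P

/-- A vector bundle of rank `n`, given as a continuous family of orthogonal projections. -/
structure Bun (B : Type) [TopologicalSpace B] (K : Type) [Fintype K] (n : ℕ) where
  P : B → Mat K
  cont : Continuous P
  proj : ∀ b, IsProj (P b)
  tr : ∀ b, (P b).trace = n

attribute [fun_prop] Bun.cont

/-- Pullback. -/
def Bun.comap {n : ℕ} (E : Bun B K n) (f : C(B', B)) : Bun B' K n :=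
  ⟨fun b => E.P (f b), E.cont.comp f.continuous, fun b => E.proj _, fun b => E.tr _⟩

/-- The projective bundle. -/
abbrev Bun.PB {n : ℕ} (E : Bun B K n) : Type := {x : B × CP K // E.P x.1 * x.2.1 = x.2.1}

lemma IsProj.eq_zero {P : Mat K} (h : IsProj P) (ht : P.trace = 0) : P = 0 := by
  rw [← h.idem, ← h.herm, h.herm] at ht
  nth_rw 2 [← h.herm] at ht
  exact mul_herm_trace_eq_zero.1 ht

lemma IsProj.sub {P Q : Mat K} (hP : IsProj P) (hQ : IsProj Q) (h : P * Q = Q) :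
    IsProj (P - Q) := by
  have h' : Q * P = Q := by
    have := congrArg conjTranspose h
    rwa [conjTranspose_mul, hP.herm, hQ.herm] at this
  refine ⟨by rw [conjTranspose_sub, hP.herm, hQ.herm], ?_⟩
  rw [msub_mul, mmul_sub, mmul_sub, hP.idem, hQ.idem, h, h']; abel

lemma IsProj.eq_of_le {P Q : Mat K} (hP : IsProj P) (hQ : IsProj Q) (h : P * Q = Q)
    (ht : P.trace = Q.trace) : P = Q :=
  sub_eq_zero.1 ((hP.sub hQ h).eq_zero (by rw [trace_sub, ht, sub_self]))

lemma IsPt.isProj {p : Mat K} (h : IsPt p) : IsProj p := ⟨h.herm, h.idem⟩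

open ComplexOrder in
lemma path_mul_ne {p : Mat K} (h : IsPt p) {A : Matrix J K ℂ} (hA : A * p ≠ 0) {t : ℝ}
    (h0 : 0 ≤ t) (h1 : t ≤ 1) : ((1 - t : ℂ) • (1 : Mat K) + (t : ℂ) • (Aᴴ * A)) * p ≠ 0 := by
  intro h2
  have h3 := congrArg (fun X => (p * X).trace) h2
  simp only [madd_mul, msmul_mul, mone_mul, mmul_add, mmul_smul,
    h.idem, mulA Aᴴ, h.smul_trace, mmul_zero, trace_zero, trace_add, trace_smul,
    h.tr, smul_eq_mul, mul_one] at h3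
  have h4 : 0 < (A * p * Aᴴ).trace := by
    refine lt_of_le_of_ne ?_ (h.trace_ne hA).symm
    rw [h.conj_eq]
    exact (posSemidef_self_mul_conjTranspose _).trace_nonneg
  obtain ⟨h5, h6⟩ := Complex.pos_iff.1 h4
  have h7 := congrArg Complex.re h3
  simp at h7
  rcases eq_or_lt_of_le h0 with rfl | h0
  · simp at h7
  · nlinarith [mul_pos h0 h5]

lemma IsProj.frame {n : ℕ} {P : Mat K} (hP : IsProj P) (ht : P.trace = n)
    {F : Matrix K (Fin n) ℂ} (h : (Fᴴ * P * F).det ≠ 0) :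
    P * F * (Fᴴ * P * F)⁻¹ * (Fᴴ * P) = P := by
  have hu : IsUnit (Fᴴ * P * F).det := isUnit_iff_ne_zero.2 h
  obtain ⟨G, hG⟩ : ∃ G, G = (Fᴴ * P * F)⁻¹ := ⟨_, rfl⟩
  have h1 : G * (Fᴴ * P * F) = 1 := by rw [hG]; exact nonsing_inv_mul _ hu
  have hGh : Gᴴ = G := by
    rw [hG, conjTranspose_nonsing_inv, conjTranspose_mul, conjTranspose_mul,
      conjTranspose_conjTranspose, hP.herm, mulA]
  rw [← hG]
  refine (hP.eq_of_le ⟨?_, ?_⟩ ?_ ?_).symm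
  · simp only [conjTranspose_mul, conjTranspose_conjTranspose, hP.herm, hGh, mulA]
  · calc P * F * G * (Fᴴ * P) * (P * F * G * (Fᴴ * P))
        = P * F * G * (Fᴴ * (P * P) * F) * (G * (Fᴴ * P)) := by simp only [mulA]
      _ = P * F * (G * (Fᴴ * P * F)) * (G * (Fᴴ * P)) := by
          rw [hP.idem]; simp only [mulA]
      _ = P * F * G * (Fᴴ * P) := by rw [h1, mmul_one]; simp only [mulA]
  · simp only [← mulA, hP.idem]
  · rw [ht, mulA (P * F), Matrix.trace_mul_comm,
      show G * (Fᴴ * P) * (P * F) = G * (Fᴴ * (P * P) * F) by simp only [mulA],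
      hP.idem, h1, trace_one, Fintype.card_fin]

lemma IsProj.frame_mul_ne {n : ℕ} {P : Mat K} (hP : IsProj P) (ht : P.trace = n)
    {F : Matrix K (Fin n) ℂ} (h : (Fᴴ * P * F).det ≠ 0) {p : Mat K} (hp : IsPt p)
    (hPp : P * p = p) : Fᴴ * p ≠ 0 := fun h0 => hp.ne (by
  rw [← hPp, ← hP.frame ht h, mulA, mulA Fᴴ P p, hPp, h0, mmul_zero])

lemma frame_mul_ne' {n : ℕ} {P : Mat K}
    {F : Matrix K (Fin n) ℂ} (h : (Fᴴ * P * F).det ≠ 0) {x : Mat (Fin n)}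
    (hx : IsPt x) : Fᴴ * (P * F) * x ≠ 0 := fun h0 => hx.ne (by
  have hu : IsUnit (Fᴴ * P * F).det := isUnit_iff_ne_zero.2 h
  rw [← mone_mul x, ← nonsing_inv_mul _ hu, mulA, mulA Fᴴ, h0, mmul_zero])

variable {n : ℕ}

/-- The trivialisation of a projective bundle given by a frame. -/
def trivTo (E : Bun B K n) (F : Matrix K (Fin n) ℂ) (h : ∀ b, (Fᴴ * E.P b * F).det ≠ 0) :
    C(B × CP (Fin n), E.PB) :=
  ⟨fun x => ⟨(x.1, ⟨act (E.P x.1 * F) x.2.1, x.2.2.act (mul_ne_of_mul_ne (frame_mul_ne' (h _) x.2.2))⟩),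
      mul_act_eq (by rw [← mulA, ← mulA, (E.proj _).idem])⟩,
    subtype_mk (continuous_fst.prodMk (subtype_mk
      (continuous_act (A := fun x : B × CP (Fin n) => E.P x.1 * F) (P := fun x => x.2.1)
        ((E.cont.comp continuous_fst).matrix_mul continuous_const) (by fun_prop)
        (fun x => x.2.2) fun x => mul_ne_of_mul_ne (frame_mul_ne' (h _) x.2.2)) _)) _⟩

lemma trivTo_qi (E : Bun B K n) (F : Matrix K (Fin n) ℂ) (h : ∀ b, (Fᴴ * E.P b * F).det ≠ 0) :
    (Cm (trivTo E F h)).QI := by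
  have n1 : ∀ x : E.PB, Fᴴ * x.1.2.1 ≠ 0 := fun x =>
    (E.proj _).frame_mul_ne (E.tr _) (h _) x.1.2.2 x.2
  have e1 : ∀ x : E.PB, Fᴴ * E.P x.1.1 * x.1.2.1 = Fᴴ * x.1.2.1 := fun x => by
    rw [mulA, x.2]
  have e2 : ∀ b, (E.P b * F)ᴴ * (E.P b * F) = Fᴴ * (E.P b * F) := fun b => by
    rw [conjTranspose_mul, (E.proj _).herm, mulA, ← mulA (E.P b), (E.proj _).idem]
  have e3 : ∀ b, (Fᴴ * E.P b)ᴴ * (Fᴴ * E.P b) = E.P b * F * Fᴴ * E.P b := fun b => by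
    rw [conjTranspose_mul, conjTranspose_conjTranspose, (E.proj _).herm]
    simp only [mulA]
  let g : C(E.PB, B × CP (Fin n)) := ⟨fun x => (x.1.1, ⟨act Fᴴ x.1.2.1, x.1.2.2.act (n1 x)⟩),
    (by fun_prop : Continuous fun x : E.PB => x.1.1).prodMk (subtype_mk
      (continuous_act (A := fun x : E.PB => Fᴴ) (P := fun x => x.1.2.1)
        continuous_const (by fun_prop) (fun x => x.1.2.2) n1) _)⟩
  have n2 : ∀ (t : UI) (x : B × CP (Fin n)), ((1 - t : ℂ) • (1 : Matrix _ _ ℂ) +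
      (t : ℂ) • ((E.P x.1 * F)ᴴ * (E.P x.1 * F))) * x.2.1 ≠ 0 := fun t x =>
    path_mul_ne x.2.2 (mul_ne_of_mul_ne (frame_mul_ne' (h _) x.2.2)) t.2.1 t.2.2
  have n3 : ∀ (t : UI) (x : E.PB), ((1 - t : ℂ) • (1 : Matrix _ _ ℂ) +
      (t : ℂ) • ((Fᴴ * E.P x.1.1)ᴴ * (Fᴴ * E.P x.1.1))) * x.1.2.1 ≠ 0 := fun t x =>
    path_mul_ne x.1.2.2 (by rw [e1]; exact n1 x) t.2.1 t.2.2
  have hPc : Continuous fun x : UI × (B × CP (Fin n)) => E.P x.2.1 := by fun_prop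
  have hPc' : Continuous fun x : UI × E.PB => E.P x.2.1.1 := by fun_prop
  refine QI_of_homotopy_inverse _ g (Homotopic.symm (homotopic_of (fun x => (x.2.1,
    ⟨act _ x.2.2.1, x.2.2.2.act (n2 x.1 x.2)⟩)) ?_ ?_ ?_)) (Homotopic.symm
    (homotopic_of (fun x => ⟨(x.2.1.1, ⟨act _ x.2.1.2.1, x.2.1.2.2.act (n3 x.1 x.2)⟩),
      mul_act_eq ?_⟩) ?_ ?_ ?_))
  · exact (by fun_prop : Continuous fun x : UI × (B × CP (Fin n)) => x.2.1).prodMk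
      (subtype_mk (continuous_act
      (A := fun x : UI × (B × CP (Fin n)) => ((1 - x.1 : ℂ) • (1 : Matrix _ _ ℂ) +
        (x.1 : ℂ) • ((E.P x.2.1 * F)ᴴ * (E.P x.2.1 * F))))
      (P := fun x => x.2.2.1) (by fun_prop) (by fun_prop)
      (fun x => x.2.2.2) fun x => n2 x.1 x.2) _)
  · rintro ⟨b, x⟩
    refine Prod.ext rfl (sext ?_)
    change act ((1 - ((0 : ℝ) : ℂ)) • (1 : Matrix _ _ ℂ) + ((0 : ℝ) : ℂ) • _) x.1 = x.1
    refine act_eq x.2 ?_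
    simp
  · rintro ⟨b, x⟩
    refine Prod.ext rfl (sext ?_)
    change act ((1 - ((1 : ℝ) : ℂ)) • (1 : Matrix _ _ ℂ) +
      ((1 : ℝ) : ℂ) • ((E.P b * F)ᴴ * (E.P b * F))) x.1 = act Fᴴ (act (E.P b * F) x.1)
    rw [act_act _ x.2 (mul_ne_of_mul_ne (frame_mul_ne' (h _) x.2)), e2]
    simp
  · change E.P x.2.1.1 * _ = _
    rw [e3]
    simp only [madd_mul, msmul_mul, mone_mul, mmul_add, mmul_smul, x.2.2, ← mulA, (E.proj _).idem]
  · exact subtype_mk ((by fun_prop : Continuous fun x : UI × E.PB => x.2.1.1).prodMk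
      (subtype_mk (continuous_act
      (A := fun x : UI × E.PB => ((1 - x.1 : ℂ) • (1 : Matrix _ _ ℂ) +
        (x.1 : ℂ) • ((Fᴴ * E.P x.2.1.1)ᴴ * (Fᴴ * E.P x.2.1.1))))
      (P := fun x => x.2.1.2.1) (by fun_prop) (by fun_prop)
      (fun x => x.2.1.2.2) fun x => n3 x.1 x.2) _)) _
  · rintro ⟨⟨b, x⟩, hx⟩
    refine sext (Prod.ext rfl (sext ?_))
    change act ((1 - ((0 : ℝ) : ℂ)) • (1 : Matrix _ _ ℂ) + ((0 : ℝ) : ℂ) • _) x.1 = x.1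
    refine act_eq x.2 ?_
    simp
  · rintro ⟨⟨b, x⟩, hx⟩
    refine sext (Prod.ext rfl (sext ?_))
    change act ((1 - ((1 : ℝ) : ℂ)) • (1 : Matrix _ _ ℂ) +
      ((1 : ℝ) : ℂ) • ((Fᴴ * E.P b)ᴴ * (Fᴴ * E.P b))) x.1 = act (E.P b * F) (act Fᴴ x.1)
    rw [act_act _ x.2 (n1 ⟨(b, x), hx⟩), e3]
    refine act_congr x.2 ?_
    simp only [Complex.ofReal_one, sub_self, zero_smul, zero_add, one_smul]
    rw [mulA _ (E.P b), hx]

end Bundle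

/-! ### The Leray–Hirsch theorem -/

section LH
variable {n N : ℕ}

lemma IsProj.rank {P : Mat K} (hP : IsProj P) (ht : P.trace = n) : P.rank = n := by
  have h : IsIdempotentElem (toLin' P) := by
    rw [IsIdempotentElem, Module.End.mul_eq_comp, ← toLin'_mul, hP.idem]
  have := (LinearMap.IsIdempotentElem.isProj_range _ h).trace
  rw [Matrix.trace_toLin'_eq, ht] at this
  exact (Nat.cast_injective this).symm

open ComplexOrder in
lemma IsProj.exists_frame {P : Mat K} (hP : IsProj P) (ht : P.trace = n) :
    ∃ f : Fin n → K, ((emb f)ᴴ * P * emb f).det ≠ 0 := by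
  obtain ⟨κ, a, ha, hs, hl⟩ := exists_linearIndependent' ℂ P.col
  have := Fintype.ofInjective a ha
  have hc : Fintype.card κ = n := by
    rw [← hP.rank ht, rank_eq_finrank_span_cols, ← hs, finrank_span_eq_card hl]
  let e : Fin n ≃ κ := (finCongr hc.symm).trans (Fintype.equivFin κ).symm
  refine ⟨a ∘ e, ?_⟩
  have h1 : (P * emb (a ∘ e)).col = (P.col ∘ a) ∘ e := by
    funext i j
    change _ = Pᵀ (a (e i)) j
    simp [emb, Matrix.col, mmul_apply, mone_apply]
  have h2 : LinearIndependent ℂ (P * emb (a ∘ e)).col := h1 ▸ hl.comp _ e.injective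
  have h3 := mulVec_injective_iff.2 h2
  have h4 : (emb (a ∘ e))ᴴ * P * emb (a ∘ e) = (P * emb (a ∘ e))ᴴ * (P * emb (a ∘ e)) := by
    rw [conjTranspose_mul, hP.herm, mulA, mulA, ← mulA P P, hP.idem]
  rw [h4, ← isUnit_iff_ne_zero, ← isUnit_iff_isUnit_det, ← mulVec_injective_iff_isUnit]
  refine (LinearMap.ker_eq_bot (f := ((P * emb (a ∘ e))ᴴ * (P * emb (a ∘ e))).mulVecLin)).1 ?_
  rw [ker_mulVecLin_conjTranspose_mul_self]
  exact LinearMap.ker_eq_bot.2 h3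

lemma emb_conj_mul_zero {f : J → K} {g : I → K} (h : ∀ a b, f a ≠ g b) : (emb f)ᴴ * emb g = 0 := by
  ext i j
  simp [emb, mmul_apply, mone_apply, h]

/-- The map of projective bundles induced by a map of base spaces. -/
def Bun.pmap (E : Bun B K n) (f : C(B', B)) : C((E.comap f).PB, E.PB) :=
  ⟨fun x => ⟨(f x.1.1, x.1.2), x.2⟩, by fun_prop⟩

lemma Bun.pmap_embedding (E : Bun B K n) {f : C(B', B)} (hf : IsEmbedding f) :
    IsEmbedding (E.pmap f) := by
  have h : IsEmbedding ((Subtype.val : E.PB → _) ∘ E.pmap f) :=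
    (hf.prodMap IsEmbedding.id).comp IsEmbedding.subtypeVal
  exact IsEmbedding.of_comp (E.pmap f).continuous continuous_subtype_val h

lemma Bun.range_pmap (E : Bun B K n) (f : C(B', B)) :
    Set.range (E.pmap f) = {x | x.1.1 ∈ Set.range f} := by
  ext ⟨⟨b, p⟩, h⟩
  constructor
  · rintro ⟨x, hx⟩
    exact ⟨x.1.1, congrArg (fun y => y.1.1) hx⟩
  · rintro ⟨b', rfl⟩
    exact ⟨⟨(b', p), h⟩, rfl⟩

lemma Bun.pmap_openEmbedding (E : Bun B K n) {f : C(B', B)} (hf : IsOpenEmbedding f) :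
    IsOpenEmbedding (E.pmap f) :=
  ⟨E.pmap_embedding hf.isEmbedding, by
    rw [E.range_pmap]
    exact hf.isOpen_range.preimage (by fun_prop)⟩

variable (φ : Fin N → DHom (C (CP (Fin N ⊕ K'))) QQ) (g : K → K') (hg : g.Injective) (hn : n ≤ N)

/-- The embedding of a projective bundle in a product. -/
def Bun.inc (E : Bun B K n) (N : ℕ) (g : K → K') (hg : g.Injective) :
    C(E.PB, B × CP (Fin N ⊕ K')) :=
  ⟨fun x => (x.1.1, cpEmb (inr ∘ g) (inr_injective.comp hg) x.1.2), by fun_prop⟩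

/-- The Leray–Hirsch comparison map. -/
def Bun.lh (E : Bun B K n) : DHom (C E.PB) ((C B).pow n) :=
  (tup fun i : Fin n => slant B (φ (Fin.castLE hn i))).comp (Cm (E.inc N g hg))

lemma Bun.lh_nat (E : Bun B K n) (f : C(B', B)) (x : (C (E.comap f).PB).X) :
    (E.lh φ g hg hn).f ((Cm (E.pmap f)).f x) =
      (powMap (Cm f) n).f (((E.comap f).lh φ g hg hn).f x) := by
  funext i
  rw [powMap_f, Bun.lh, Bun.lh, comp_f, comp_f, tup_f, tup_f, ← slant_left, ← Cm_comp, ← Cm_comp]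
  rfl

/-- The normalisation of the classes used in the Leray–Hirsch theorem. -/
def Normal (φ : Fin N → DHom (C (CP (Fin N ⊕ K'))) QQ) : Prop := ∀ n (hn : n ≤ N),
  (tup fun i : Fin n => (φ (Fin.castLE hn i)).comp (Cm (cpEmb (inl ∘ Fin.castLE hn)
    (inl_injective.comp (Fin.castLE_injective hn))))).QI

lemma Bun.lh_frame (E : Bun B K n) (hφ : Normal φ) (F : Matrix K (Fin n) ℂ)
    (h : ∀ b, (Fᴴ * E.P b * F).det ≠ 0) : (E.lh φ g hg hn).QI := by
  refine QI.of_comp_right ?_ (trivTo_qi E F h)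
  have H := QI_slant (Kun_CP n) _ (hφ n hn) B
  have hr : ∀ x : Mat (Fin n), ∀ b, IsPt x → E.P b * F * x ≠ 0 := fun x b hx =>
    mul_ne_of_mul_ne (frame_mul_ne' (h b) hx)
  obtain ⟨r, hr'⟩ : ∃ r : K → Fin N ⊕ K', r = inr ∘ g := ⟨_, rfl⟩
  obtain ⟨l, hl'⟩ : ∃ l : Fin n → Fin N ⊕ K', l = inl ∘ Fin.castLE hn := ⟨_, rfl⟩
  have hri : r.Injective := hr' ▸ inr_injective.comp hg
  have hli : l.Injective := hl' ▸ inl_injective.comp (Fin.castLE_injective hn)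
  have hd : ∀ a b, l a ≠ r b := fun a b => by rw [hr', hl']; exact Sum.inl_ne_inr
  have hne : ∀ (t : UI) (x : B × CP (Fin n)), ((1 - t : ℂ) • (emb r * (E.P x.1 * F)) +
      (t : ℂ) • emb l) * x.2.1 ≠ 0 := by
    intro t x h0
    have h1 := congrArg (fun y => (emb l)ᴴ * y) h0
    have h2 := congrArg (fun y => (emb r)ᴴ * y) h0
    simp only [← mulA, mmul_add, mmul_smul, emb_conj_mul hri,
      emb_conj_mul hli, emb_conj_mul_zero hd, emb_conj_mul_zero fun a b => (hd b a).symm,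
      mzero_mul, mone_mul, mmul_zero, smul_zero, add_zero, zero_add,
      msmul_mul, smul_eq_zero, x.2.2.ne, or_false] at h1 h2
    rw [h1, sub_zero] at h2
    exact h2.elim one_ne_zero (hr _ _ x.2.2)
  have hh : Homotopic ((E.inc N g hg).comp (trivTo E F h))
      ((cid B).prodMap (cpEmb l hli)) := by
    refine homotopic_of (fun x => (x.2.1, ⟨act _ x.2.2.1, x.2.2.2.act (hne x.1 x.2)⟩)) ?_ ?_ ?_
    · exact (by fun_prop : Continuous fun x : UI × (B × CP (Fin n)) => x.2.1).prodMk
        (subtype_mk (continuous_act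
        (A := fun x : UI × (B × CP (Fin n)) => ((1 - x.1 : ℂ) • (emb r * (E.P x.2.1 * F)) +
          (x.1 : ℂ) • emb l))
        (P := fun x => x.2.2.1) (by fun_prop) (by fun_prop)
        (fun x => x.2.2.2) fun x => hne x.1 x.2) _)
    · rintro ⟨b, x⟩
      refine Prod.ext rfl (sext ?_)
      subst hr'
      change act ((1 - ((0 : ℝ) : ℂ)) • (emb (inr ∘ g) * (E.P b * F)) + ((0 : ℝ) : ℂ) • emb l) x.1 =
        act (emb (inr ∘ g)) (act (E.P b * F) x.1)
      rw [act_act _ x.2 (hr _ _ x.2)]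
      simp
    · rintro ⟨b, x⟩
      refine Prod.ext rfl (sext ?_)
      change act ((1 - ((1 : ℝ) : ℂ)) • (emb r * (E.P b * F)) + ((1 : ℝ) : ℂ) • emb l) x.1 =
        act (emb l) x.1
      simp
  have h3 := homotopy_HEqv hh
  subst hl'
  refine QI.congr (fun x hx => ?_) H
  refine pow_bd.2 fun i => ?_
  have h4 := (slant B (φ (Fin.castLE hn i))).bd (h3 x hx)
  refine Bd_of_eq ((neg_one_smul ℚ (1 : ℚ)) ▸ h4.smul (-1)) ?_
  rw [Bun.lh, comp_f, comp_f, Pi.sub_apply, tup_f, tup_f, ← slant_right, map_sub, Cm_comp]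
  simp

/-- The restriction of a bundle to a subset. -/
def Bun.res (E : Bun B K n) (U : Set B) : Bun U K n := E.comap ⟨Subtype.val, continuous_subtype_val⟩

/-- The inclusion of restrictions of a projective bundle. -/
def Bun.resMap (E : Bun B K n) {S T : Set B} (h : S ⊆ T) : C((E.res S).PB, (E.res T).PB) :=
  (E.res T).pmap (incl h)

lemma Bun.range_resMap (E : Bun B K n) {S T : Set B} (h : S ⊆ T) :
    Set.range (E.resMap h) = {x | (x.1.1 : B) ∈ S} := by
  refine ((E.res T).range_pmap _).trans ?_
  ext x
  exact ⟨fun ⟨y, hy⟩ => by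
    change (x.1.1 : B) ∈ S
    rw [← hy]; exact y.2, fun hx => ⟨⟨_, hx⟩, rfl⟩⟩

lemma Bun.lh_res (E : Bun B K n) {S T : Set B} (h : S ⊆ T) (x : (C (E.res S).PB).X) :
    ((E.res T).lh φ g hg hn).f ((Cm (E.resMap h)).f x) =
      (powMap (Cm (incl h)) n).f (((E.res S).lh φ g hg hn).f x) :=
  Bun.lh_nat φ g hg hn (E.res T) (incl h) x

lemma Bun.resMap_embedding (E : Bun B K n) {S T : Set B} (h : S ⊆ T) :
    IsEmbedding (E.resMap h) :=
  (E.res T).pmap_embedding (f := incl h) (IsEmbedding.inclusion h)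

lemma Bun.resMap_openEmbedding (E : Bun B K n) {S T : Set B} (h : S ⊆ T) (hS : IsOpen S) :
    IsOpenEmbedding (E.resMap h) :=
  (E.res T).pmap_openEmbedding (f := incl h) (isOpenEmbedding_incl h hS)

lemma Bun.resMap_comp (E : Bun B K n) {S T U : Set B} (h : S ⊆ T) (h' : T ⊆ U) :
    (E.resMap h').comp (E.resMap h) = E.resMap (h.trans h') := rfl

lemma Bun.hoCart_res (E : Bun B K n) {U V : Set B} (hU : IsOpen U) (hV : IsOpen V) :
    HoCart (a₁ := Cm (E.resMap (Set.inter_subset_left (s := U) (t := V))))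
      (a₂ := Cm (E.resMap (Set.inter_subset_right (s := U) (t := V))))
      (c₁ := Cm (E.resMap (Set.subset_union_left (s := U) (t := V))))
      (c₂ := Cm (E.resMap (Set.subset_union_right (s := U) (t := V))))
      (fun x => by rw [← Cm_comp, ← Cm_comp]; rfl) := by
  refine hoCart_open (E.resMap (Set.inter_subset_left (s := U) (t := V)))
    (E.resMap (Set.inter_subset_right (s := U) (t := V)))
    (E.resMap (Set.subset_union_left (s := U) (t := V)))
    (E.resMap (Set.subset_union_right (s := U) (t := V))) rfl ?_
    (E.resMap_openEmbedding _ hU) (E.resMap_openEmbedding _ hV) ?_ ?_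
  · rw [E.resMap_comp]
    exact E.resMap_embedding _
  · rw [E.range_resMap, E.range_resMap]
    exact Set.eq_univ_of_forall fun x => x.1.1.2
  · rw [E.resMap_comp, E.range_resMap, E.range_resMap, E.range_resMap]
    exact fun x hx => hx

lemma Bun.lh_union (E : Bun B K n) {U V : Set B} (hU : IsOpen U) (hV : IsOpen V)
    (h1 : ((E.res U).lh φ g hg hn).QI) (h2 : ((E.res V).lh φ g hg hn).QI)
    (h3 : ((E.res (U ∩ V)).lh φ g hg hn).QI) : ((E.res (U ∪ V)).lh φ g hg hn).QI :=
  (E.hoCart_res hU hV).qi ((hoCart_sets hU hV).pow n) (E.lh_res φ g hg hn _)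
    (E.lh_res φ g hg hn _) (E.lh_res φ g hg hn _) (E.lh_res φ g hg hn _) h3 h1 h2

/-- The **Leray–Hirsch theorem** for projective bundles. -/
theorem Bun.lh_qi (E : Bun B K n) (hφ : Normal φ) : (E.lh φ g hg hn).QI := by
  let Pr : Set B → Prop := fun U => ((E.res U).lh φ g hg hn).QI
  have key : Pr (⋃ f ∈ (Finset.univ : Finset (Fin n → K)),
      {b | ((emb f)ᴴ * E.P b * emb f).det ≠ 0}) := by
    refine open_cover_induction Pr ?_ ?_ _ _ ?_ ?_
    · have : IsEmpty (E.res ∅).PB :=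
        ⟨fun x => x.1.1.2⟩
      have i1 := C_subsingleton (X := (E.res ∅).PB)
      have i2 := C_subsingleton (X := (∅ : Set B))
      have i3 : Subsingleton ((C (∅ : Set B)).pow n).X := Pi.instSubsingleton
      exact QI_of_bijective ⟨fun x y _ => i1.elim _ _, fun y => ⟨0, i3.elim _ _⟩⟩
    · exact fun U V hU hV => E.lh_union φ g hg hn hU hV
    · intro f
      exact isOpen_ne.preimage (Continuous.matrix_det (by fun_prop))
    · rintro t - ⟨f, hf⟩
      exact Bun.lh_frame φ g hg hn _ hφ (emb f) fun b => Set.mem_iInter₂.1 b.2 f hf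
  have hu : (⋃ f ∈ (Finset.univ : Finset (Fin n → K)),
      {b | ((emb f)ᴴ * E.P b * emb f).det ≠ 0}) = Set.univ :=
    Set.eq_univ_of_forall fun b => by
      obtain ⟨f, hf⟩ := (E.proj b).exists_frame (E.tr b)
      exact Set.mem_iUnion₂.2 ⟨f, mem_univ _, hf⟩
  rw [hu] at key
  have hb : Function.Bijective (powMap (Cm (X := (Set.univ : Set B)) (Y := B)
      ⟨Subtype.val, continuous_subtype_val⟩) n).f := by
    have h : ∀ y, (Cm (X := (Set.univ : Set B)) (Y := B) ⟨Subtype.val, continuous_subtype_val⟩).f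
        ((Cm (X := B) (Y := (Set.univ : Set B)) ⟨fun b => ⟨b, trivial⟩, by fun_prop⟩).f y) = y :=
      fun y => by
      rw [← Cm_comp]; exact Cm_id y
    refine ⟨fun x y hxy => ?_, fun y => ⟨fun i => _, funext fun i => h (y i)⟩⟩
    exact funext fun i => Cm_injective Subtype.val_injective (congrFun hxy i)
  have hq := QI.comp (QI_of_bijective hb) key
  have hp : (Cm (E.pmap (⟨Subtype.val, continuous_subtype_val⟩ : C((Set.univ : Set B), B)))).QI :=
    QI_of_bijective ⟨Cm_injective (E.pmap_embedding IsEmbedding.subtypeVal).injective,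
      fun y => ⟨(Cm (X := E.PB) (Y := (E.comap (⟨Subtype.val, continuous_subtype_val⟩ :
        C((Set.univ : Set B), B))).PB) ⟨fun x => ⟨(⟨x.1.1, trivial⟩, x.1.2), x.2⟩, by fun_prop⟩).f y,
        by rw [← Cm_comp]; exact Cm_id y⟩⟩
  exact QI.of_comp_right (QI.congr (HEqv.of_eq fun x => (Bun.lh_nat φ g hg hn E _ x).symm) hq) hp

end LH

/-! ### Consequences of the Leray–Hirsch theorem -/

section LHC
variable {n N : ℕ}

lemma Bun.ov_PB (E : Bun B K n) (h : (C B).OV) : (C E.PB).OV := by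
  obtain ⟨φ, hφ⟩ := exists_classes n K
  exact (E.lh_qi φ id Function.injective_id le_rfl hφ).ov_iff.2 (ov_pow h n)

lemma Bun.ov_base (E : Bun B K (n + 1)) (h : (C E.PB).OV) : (C B).OV := by
  obtain ⟨φ, hφ⟩ := exists_classes (n + 1) K
  have h1 := (E.lh_qi φ id Function.injective_id le_rfl hφ).ov_iff.1 h
  exact fun x hx => pow_bd.1 (h1 (fun _ => x) (pow_cycle.2 fun _ => hx)) 0

/-- The embedding of a projective bundle in a product with a projective space. -/
def Bun.toProd (E : Bun B K n) (g : K → K') (hg : g.Injective) : C(E.PB, B × CP K') :=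
  ⟨fun x => (x.1.1, cpEmb g hg x.1.2), by fun_prop⟩

lemma Bun.toProd_inj (E : Bun B K n) (g : K → K') (hg : g.Injective) :
    (Cm (E.toProd g hg)).Inj := by
  obtain ⟨φ, hφ⟩ := exists_classes n K'
  have h := (E.lh_qi φ g hg le_rfl hφ).1.of_comp
  refine Inj.of_comp (g := Cm ((cid B).prodMap
    (cpEmb (inr : K' → Fin n ⊕ K') inr_injective))) (Inj.congr (HEqv.of_eq fun x => ?_) h)
  rw [comp_f, ← Cm_comp]
  refine congrArg (fun h => (Cm h).f x) (ContinuousMap.ext fun y => Prod.ext rfl ?_)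
  exact (DFunLike.congr_fun (cpEmb_comp inr inr_injective g hg) y.1.2).symm

lemma ov_cone_of_split {M N D : DMod} (f : DHom M N) (Θ : DHom N (D.pow (n + 1)))
    (Θ' : DHom M (D.pow n)) (h : Θ.QI) (h' : Θ'.QI)
    (hc : ∀ x i, Θ.f (f.f x) (Fin.castSucc i) = Θ'.f x i) : (cone f).OV ↔ D.OV := by
  constructor
  · refine fun ho => OV.of_odd fun x hx hxo => ?_
    obtain ⟨X, hX⟩ : ∃ X : (D.pow (n + 1)).X, X = Fin.snoc (fun _ => 0) x := ⟨_, rfl⟩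
    have h1 : ∀ i, X (Fin.castSucc i) = 0 := fun i => by rw [hX, Fin.snoc_castSucc]
    have h2 : X (Fin.last n) = x := by rw [hX, Fin.snoc_last]
    have h3 : (D.pow (n + 1)).d X = 0 := pow_cycle.2 fun i => by
      induction i using Fin.lastCases with
      | last => rw [h2, hx]
      | cast i => rw [h1, map_zero]
    have h4 : (D.pow (n + 1)).ε X = -X := funext fun i => by
      rw [pow_ε, Pi.neg_apply]
      induction i using Fin.lastCases with
      | last => rw [h2, hxo]
      | cast i => rw [h1, map_zero, neg_zero]
    obtain ⟨y, hy, hb⟩ := h.2 X h3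
    obtain ⟨y', hy'⟩ : ∃ y', y' = (1 / 2 : ℚ) • (y - N.ε y) := ⟨_, rfl⟩
    have hyd : N.d y' = 0 := by rw [hy']; simp [hy]
    have hyo : N.ε y' = -y' := by rw [hy']; simp [← smul_neg]
    have hb' : (D.pow (n + 1)).Bd (X - Θ.f y') := by
      refine Bd_of_eq ((hb.sub hb.eps).smul (1 / 2)) ?_
      rw [map_sub, h4, hy', map_smul, map_sub, hε]
      module
    have hcone : (cone f).Bd (y', 0) := ho.odd (cone_cycle.2 ⟨by simp [hyd], by simp⟩) (by
      rw [cone_ε, hyo]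
      exact Prod.ext rfl (by simp))
    obtain ⟨u, v, e1, e2⟩ := cone_bd.1 hcone
    have hv : M.d v = 0 := neg_eq_zero.1 e2
    have h5 : (D.pow (n + 1)).Bd (X - Θ.f (f.f v)) := by
      refine Bd_of_eq (hb'.add (Θ.bd ⟨u, rfl⟩ : (D.pow (n + 1)).Bd (Θ.f (N.d u)))) ?_
      rw [← e1, map_add]; abel
    have h6 : M.Bd v := h'.1 v hv (pow_bd.2 fun i => by
      have := (pow_bd.1 h5 (Fin.castSucc i)).smul (-1)
      refine Bd_of_eq this ?_
      rw [Pi.sub_apply, h1, hc]; simp)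
    have h7 := pow_bd.1 (h5.add (Θ.bd (f.bd h6))) (Fin.last n)
    rwa [sub_add_cancel, h2] at h7
  · intro hD
    refine OV.cone_of_inj (h.ov_iff.2 (ov_pow hD _)) fun x hx hb => h'.1 x hx (pow_bd.2 fun i => ?_)
    rw [← hc]
    exact pow_bd.1 (Θ.bd hb) _

/-- The direct sum with a trivial line bundle. -/
def Bun.plus (E : Bun B K n) : Bun B (K ⊕ Unit) (n + 1) where
  P b := fromBlocks (E.P b) 0 0 1
  cont := E.cont.matrix_fromBlocks continuous_const continuous_const continuous_const
  proj b := ⟨by simp [fromBlocks_conjTranspose, (E.proj b).herm], by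
    simp [fromBlocks_multiply, (E.proj b).idem]⟩
  tr b := by simp [Matrix.trace, ← E.tr b]

lemma emb_inl (K : Type) [Fintype K] [DecidableEq K] :
    (emb (inl : K → K ⊕ Unit)) = fromRows 1 0 := by
  ext (i | i) j <;> simp [emb, mone_apply]

lemma Bun.inl_plus (E : Bun B K n) (b : B) :
    (emb (inl : K → K ⊕ Unit))ᴴ * E.plus.P b = E.P b * (emb (inl : K → K ⊕ Unit))ᴴ := by
  rw [emb_inl, conjTranspose_fromRows_eq_fromCols_conjTranspose]
  simp [Bun.plus, fromCols_mul_fromBlocks, mul_fromCols]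

lemma Bun.plus_inl (E : Bun B K n) (b : B) :
    E.plus.P b * emb (inl : K → K ⊕ Unit) = emb (inl : K → K ⊕ Unit) * E.P b := by
  rw [emb_inl]
  simp [Bun.plus, fromBlocks_mul_fromRows, fromRows_mul]

/-- The complement of the zero section in the projective completion of a vector bundle. -/
def Bun.off (E : Bun B K n) : Set E.plus.PB := {x | (emb (inl : K → K ⊕ Unit))ᴴ * x.1.2.1 ≠ 0}

/-- The hyperplane at infinity. -/
def Bun.infty (E : Bun B K n) : C(E.PB, E.off) :=
  ⟨fun x => ⟨⟨(x.1.1, cpEmb inl inl_injective x.1.2), mul_act_eq (by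
      change E.plus.P x.1.1 * (emb (inl : K → K ⊕ Unit) * x.1.2.1) = _
      rw [← mulA, E.plus_inl, mulA, x.2])⟩, by
    refine mul_act_ne x.1.2.2 ?_
    rw [emb_conj_mul inl_injective, mone_mul]
    exact x.1.2.2.ne⟩, by fun_prop⟩

lemma Bun.infty_qi (E : Bun B K n) : (Cm E.infty).QI := by
  have n1 : ∀ x : E.off, (emb (inl : K → K ⊕ Unit))ᴴ * x.1.1.2.1 ≠ 0 := fun x => x.2
  let g : C(E.off, E.PB) := ⟨fun x => ⟨(x.1.1.1, ⟨act (emb (inl : K → K ⊕ Unit))ᴴ x.1.1.2.1,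
      x.1.1.2.2.act (n1 x)⟩), mul_act_eq (by
        change E.P x.1.1.1 * ((emb (inl : K → K ⊕ Unit))ᴴ * x.1.1.2.1) = _
        rw [← mulA, ← E.inl_plus, mulA, x.1.2])⟩,
    subtype_mk ((by fun_prop : Continuous fun x : E.off => x.1.1.1).prodMk
      (subtype_mk (continuous_act (A := fun x : E.off => (emb (inl : K → K ⊕ Unit))ᴴ)
        (P := fun x => x.1.1.2.1) continuous_const (by fun_prop) (fun x => x.1.1.2.2) n1) _)) _⟩
  have e : ((emb (inl : K → K ⊕ Unit))ᴴ)ᴴ * (emb (inl : K → K ⊕ Unit))ᴴ = emb (inl : K → K ⊕ Unit) * (emb (inl : K → K ⊕ Unit))ᴴ := by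
    rw [conjTranspose_conjTranspose]
  have n2 : ∀ (t : UI) (x : E.off), ((1 - t : ℂ) • (1 : Matrix _ _ ℂ) +
      (t : ℂ) • (emb (inl : K → K ⊕ Unit) * (emb (inl : K → K ⊕ Unit))ᴴ)) * x.1.1.2.1 ≠ 0 := fun t x => by
    rw [← e]
    exact path_mul_ne x.1.1.2.2 (n1 x) t.2.1 t.2.2
  refine QI_of_homotopy_inverse _ g ?_ (Homotopic.symm
    (homotopic_of (fun x => ⟨⟨(x.2.1.1.1, ⟨act _ x.2.1.1.2.1, x.2.1.1.2.2.act (n2 x.1 x.2)⟩),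
      mul_act_eq ?_⟩, ?_⟩) ?_ ?_ ?_))
  · have : g.comp E.infty = .id _ := by
      refine ContinuousMap.ext fun x => sext (Prod.ext rfl (sext ?_))
      change act (emb (inl : K → K ⊕ Unit))ᴴ (act (emb (inl : K → K ⊕ Unit)) x.1.2.1) = x.1.2.1
      rw [act_act _ x.1.2.2 (isometry_mul_ne x.1.2.2 (emb_conj_mul inl_injective)),
        emb_conj_mul inl_injective]
      exact act_eq x.1.2.2 (mone_mul _)
    rw [this]
  · change E.plus.P x.2.1.1.1 * _ = _
    rw [← mulA, mmul_add, mmul_smul, mmul_smul, mmul_one,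
      ← mulA, E.plus_inl, mulA, ← E.inl_plus, madd_mul, madd_mul,
      msmul_mul, msmul_mul, msmul_mul, msmul_mul]
    simp only [mulA, mone_mul]
    rw [x.2.1.2]
  · change (emb (inl : K → K ⊕ Unit))ᴴ * _ ≠ 0
    refine mul_act_ne x.2.1.1.2.2 ?_
    rw [mmul_add, mmul_smul, mmul_smul, mmul_one, ← mulA,
      emb_conj_mul inl_injective, mone_mul, ← add_smul, sub_add_cancel, one_smul]
    exact n1 x.2
  · exact subtype_mk (subtype_mk
      ((by fun_prop : Continuous fun x : UI × E.off => x.2.1.1.1).prodMk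
      (subtype_mk (continuous_act
      (A := fun x : UI × E.off => ((1 - x.1 : ℂ) • (1 : Matrix _ _ ℂ) +
        (x.1 : ℂ) • (emb (inl : K → K ⊕ Unit) * (emb (inl : K → K ⊕ Unit))ᴴ)))
      (P := fun x => x.2.1.1.2.1) (by fun_prop) (by fun_prop)
      (fun x => x.2.1.1.2.2) fun x => n2 x.1 x.2) _)) _) _
  · intro x
    refine sext (sext (Prod.ext rfl (sext ?_)))
    change act ((1 - ((0 : ℝ) : ℂ)) • (1 : Matrix _ _ ℂ) + ((0 : ℝ) : ℂ) • _) x.1.1.2.1 = x.1.1.2.1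
    refine act_eq x.1.1.2.2 ?_
    simp
  · intro x
    refine sext (sext (Prod.ext rfl (sext ?_)))
    change act ((1 - ((1 : ℝ) : ℂ)) • (1 : Matrix _ _ ℂ) +
      ((1 : ℝ) : ℂ) • (emb (inl : K → K ⊕ Unit) * (emb (inl : K → K ⊕ Unit))ᴴ)) x.1.1.2.1 =
      act (emb (inl : K → K ⊕ Unit)) (act (emb (inl : K → K ⊕ Unit))ᴴ x.1.1.2.1)
    rw [act_act _ x.1.1.2.2 (n1 x)]
    simp

/-- The inclusion of the complement of the zero section in the projective completion. -/
def Bun.offIncl (E : Bun B K n) : C(E.off, E.plus.PB) := ⟨Subtype.val, continuous_subtype_val⟩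

lemma Bun.ov_offIncl (E : Bun B K n) : (cone (Cm E.offIncl)).OV ↔ (C B).OV := by
  obtain ⟨φ, hφ⟩ := exists_classes (n + 1) (K ⊕ Unit)
  obtain ⟨F, hF⟩ := pair_qi (f := E.offIncl.comp E.infty) (f' := E.offIncl) (α := E.infty)
    (β := .id _) (fun x => rfl) E.infty_qi (QI_of_homeo (Homeomorph.refl _))
  rw [← hF.ov_iff]
  refine ov_cone_of_split _ (E.plus.lh φ id Function.injective_id le_rfl)
    (E.lh φ inl inl_injective n.le_succ) (E.plus.lh_qi φ _ _ _ hφ) (E.lh_qi φ _ _ _ hφ) ?_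
  intro x i
  rw [Bun.lh, Bun.lh, comp_f, comp_f, tup_f, tup_f, ← Cm_comp]
  refine congrArg (fun h => (slant B _).f ((Cm h).f x)) (ContinuousMap.ext fun y => Prod.ext rfl ?_)
  exact (DFunLike.congr_fun (cpEmb_comp (inr ∘ id) (inr_injective.comp Function.injective_id)
    inl inl_injective) y.1.2)

end LHC

/-! ### The Thom isomorphism for zero loci of transversal sections -/

section Thom

lemma emb_conj_mul_zero' : (emb (inl : K → K ⊕ Unit))ᴴ * emb (inr : Unit → K ⊕ Unit) = 0 :=
  emb_conj_mul_zero fun _ _ => Sum.inl_ne_inr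

lemma isSplit_plus (K : Type) [Fintype K] [DecidableEq K] :
    IsSplit (emb (inl : K → K ⊕ Unit)) (emb (inr : Unit → K ⊕ Unit)) := by
  refine ⟨emb_conj_mul inl_injective, emb_conj_mul inr_injective, emb_conj_mul_zero', ?_⟩
  ext (i | i) (j | j) <;> simp [emb, mmul_apply, mone_apply, eq_comm]

lemma Bun.plus_inr {B : Type} [TopologicalSpace B] {n : ℕ} (E : Bun B K n) (b : B) :
    E.plus.P b * emb (inr : Unit → K ⊕ Unit) = emb (inr : Unit → K ⊕ Unit) := by
  have : emb (inr : Unit → K ⊕ Unit) = fromRows 0 1 := by aesop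
  rw [this]
  simp [Bun.plus, fromBlocks_mul_fromRows]

/-- The coordinate of a line in an affine chart. -/
def aff (p : Mat (K ⊕ Unit)) : Matrix K Unit ℂ :=
  ((emb (inr : Unit → K ⊕ Unit))ᴴ * p * emb (inr : Unit → K ⊕ Unit)).trace⁻¹ •
    ((emb (inl : K → K ⊕ Unit))ᴴ * p * emb (inr : Unit → K ⊕ Unit))

/-- The line with a given affine coordinate. -/
def aline (x : Matrix K Unit ℂ) : CP (K ⊕ Unit) := (chart (isSplit_plus K) x).1

lemma continuous_aline : Continuous (aline : Matrix K Unit ℂ → _) :=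
  continuous_subtype_val.comp (chart (isSplit_plus K)).continuous

lemma aff_aline (x : Matrix K Unit ℂ) : aff (aline x).1 = x := chart_inv (isSplit_plus K) x

/-- The lines in the affine chart. -/
abbrev NV (K : Type) [Fintype K] [DecidableEq K] : Set (CP (K ⊕ Unit)) :=
  nz (emb (inr : Unit → K ⊕ Unit))ᴴ

lemma aline_mem (x : Matrix K Unit ℂ) : aline x ∈ NV K := (chart (isSplit_plus K) x).2

lemma aline_aff {p : CP (K ⊕ Unit)} (hp : p ∈ NV K) : aline (aff p.1) = p :=
  congrArg Subtype.val (chart_surj (isSplit_plus K) ⟨p, hp⟩)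

lemma aline_mem_nz (x : Matrix K Unit ℂ) :
    aline x ∈ nz (emb (inl : K → K ⊕ Unit))ᴴ ↔ x ≠ 0 := chart_mem (isSplit_plus K) x

lemma continuousOn_aff : ContinuousOn (fun p : CP (K ⊕ Unit) => aff p.1) (NV K) := by
  rw [continuousOn_iff_continuous_domRestrict]
  have : Continuous fun p : NV K => ((emb (inr : Unit → K ⊕ Unit))ᴴ * p.1.1 *
    emb (inr : Unit → K ⊕ Unit)).trace := by fun_prop
  exact (this.inv₀ fun p => trace_cell_ne p.2).smul (by fun_prop)

lemma eq_of_notMem_nz {p : CP (K ⊕ Unit)} (hp : p ∉ nz (emb (inl : K → K ⊕ Unit))ᴴ) :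
    p ∈ NV K ∧ aff p.1 = 0 := by
  have h : p ∈ NV K :=
    ((Set.ext_iff.1 (isSplit_plus K).union p).2 trivial).resolve_right hp
  refine ⟨h, ?_⟩
  by_contra h0
  rw [← ne_eq, ← aline_mem_nz, aline_aff h] at h0
  exact hp h0

variable {F S : Type} [TopologicalSpace F] [AddCommGroup F] [IsTopologicalAddGroup F]
  [TopologicalSpace S] {n : ℕ}

/-- A family of open subsets of a topological vector space together with a section of a vector
bundle which is transversal to zero along constant directions. -/
structure Thom (F S K : Type) [TopologicalSpace F] [AddCommGroup F] [IsTopologicalAddGroup F]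
    [TopologicalSpace S] [Fintype K] (n : ℕ) where
  U : Set F
  hU : IsOpen U
  T : Set (F × S)
  E : Bun S K n
  ι : Matrix K Unit ℂ →+ F
  hι : Continuous ι
  σ : C(F × S, Matrix K Unit ℂ)
  mem : ∀ y ∈ T, y.1 ∈ U
  tr : ∀ y ∈ T, ∀ w : Matrix K Unit ℂ, E.P y.2 * w = w → y.1 + ι w ∈ U → (y.1 + ι w, y.2) ∈ T
  hσ : ∀ y ∈ T, E.P y.2 * σ y = σ y
  σ_tr : ∀ y ∈ T, ∀ w : Matrix K Unit ℂ, E.P y.2 * w = w → σ (y.1 + ι w, y.2) = σ y + w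

namespace Thom
variable (D : Thom F S K n)

/-- The zero locus. -/
abbrev Z : Type := {y : D.T // D.σ y.1 = 0}

/-- The inclusion of the complement of the zero locus. -/
def incl : C({y : D.T // D.σ y.1 ≠ 0}, D.T) := ⟨Subtype.val, continuous_subtype_val⟩

/-- The normal bundle. -/
def N : Bun D.Z K n := D.E.comap ⟨fun z => z.1.1.2, by fun_prop⟩

/-- The tubular neighbourhood. -/
abbrev W : Type := {y : D.T // y.1.1 - D.ι (D.σ y.1) ∈ D.U}

lemma isOpen_W : IsOpen {y : D.T | y.1.1 - D.ι (D.σ y.1) ∈ D.U} := by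
  have := D.hι
  exact D.hU.preimage (by fun_prop)

lemma neg_mem {y : F × S} (hy : y ∈ D.T) : D.E.P y.2 * (-D.σ y) = -D.σ y := by
  rw [mmul_neg, D.hσ y hy]

/-- The projection of the tubular neighbourhood. -/
def pr : C(D.W, D.Z) :=
  ⟨fun y => ⟨⟨(y.1.1.1 - D.ι (D.σ y.1.1), y.1.1.2), by
    have := D.tr y.1.1 y.1.2 _ (D.neg_mem y.1.2)
    rw [map_neg, ← sub_eq_add_neg] at this
    exact this y.2⟩, by
    have := D.σ_tr y.1.1 y.1.2 _ (D.neg_mem y.1.2)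
    rw [map_neg, ← sub_eq_add_neg, add_neg_cancel] at this
    exact this⟩, by
    have := D.hι
    fun_prop⟩

/-- The tubular neighbourhood as a subset of the projective completion of the normal bundle. -/
def j : C(D.W, D.N.plus.PB) :=
  ⟨fun y => ⟨(D.pr y, aline (D.σ y.1.1)), by
    refine mul_act_eq ?_
    rw [mmul_one, mmul_add, ← mulA, D.N.plus_inl, D.N.plus_inr, mulA]
    change emb (inl : K → K ⊕ Unit) * (D.E.P y.1.1.2 * D.σ y.1.1) + _ = _
    rw [D.hσ _ y.1.2]⟩, by
    have := continuous_aline (K := K)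
    fun_prop⟩

/-- The image of the tubular neighbourhood. -/
def img : Set D.N.plus.PB := {x | x.1.2 ∈ NV K ∧ x.1.1.1.1.1 + D.ι (aff x.1.2.1) ∈ D.U}

lemma isOpen_img : IsOpen D.img := by
  have := D.hι
  refine ContinuousOn.isOpen_inter_preimage (s := {x : D.N.plus.PB | x.1.2 ∈ NV K})
    (f := fun x => x.1.1.1.1.1 + D.ι (aff x.1.2.1)) ?_ ?_ D.hU
  · refine ContinuousOn.add (by fun_prop) (this.comp_continuousOn ?_)
    exact continuousOn_aff.comp (f := fun x : D.N.plus.PB => x.1.2) (by fun_prop) fun x hx => hx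
  · exact (isOpen_nz _).preimage (by fun_prop)

lemma aff_mem (x : D.img) : D.N.P x.1.1.1 * aff x.1.1.2.1 = aff x.1.1.2.1 := by
  rw [aff, mmul_smul]
  congr 1
  rw [← mulA, ← mulA, ← D.N.inl_plus, mulA _ _ x.1.1.2.1, x.1.2]

/-- The tubular neighbourhood is homeomorphic to its image. -/
def homeo : D.W ≃ₜ D.img where
  toFun y := ⟨D.j y, aline_mem _, by
    change y.1.1.1 - _ + D.ι (aff (aline _).1) ∈ D.U
    rw [aff_aline, sub_add_cancel]
    exact D.mem _ y.1.2⟩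
  invFun x := ⟨⟨(x.1.1.1.1.1.1 + D.ι (aff x.1.1.2.1), x.1.1.1.1.1.2),
      D.tr _ x.1.1.1.1.2 _ (D.aff_mem x) x.2.2⟩, by
    change x.1.1.1.1.1.1 + D.ι (aff x.1.1.2.1) - D.ι (D.σ _) ∈ D.U
    rw [D.σ_tr _ x.1.1.1.1.2 _ (D.aff_mem x), x.1.1.1.2, zero_add, add_sub_cancel_right]
    exact D.mem _ x.1.1.1.1.2⟩
  left_inv y := by
    refine sext (sext (Prod.ext ?_ rfl))
    change y.1.1.1 - _ + D.ι (aff (aline _).1) = _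
    rw [aff_aline, sub_add_cancel]
  right_inv x := by
    have h := D.σ_tr _ x.1.1.1.1.2 _ (D.aff_mem x)
    rw [x.1.1.1.2, zero_add] at h
    refine sext (sext (Prod.ext (sext (sext (Prod.ext ?_ rfl))) ?_))
    · change x.1.1.1.1.1.1 + D.ι (aff x.1.1.2.1) - D.ι (D.σ _) = _
      rw [h, add_sub_cancel_right]
    · change aline (D.σ _) = _
      rw [h, aline_aff x.2.1]
  continuous_toFun := D.j.continuous.subtype_mk _
  continuous_invFun := by
    have := D.hι
    have h : Continuous fun x : D.img => aff x.1.1.2.1 :=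
      continuousOn_aff.comp_continuous (f := fun x : D.img => x.1.1.2) (by fun_prop) fun x => x.2.1
    fun_prop

lemma j_openEmbedding : IsOpenEmbedding D.j :=
  D.isOpen_img.isOpenEmbedding_subtypeVal.comp D.homeo.isOpenEmbedding

lemma range_j : Set.range D.j = D.img := by
  have h : ⇑D.j = Subtype.val ∘ D.homeo := rfl
  rw [h, Set.range_comp, D.homeo.surjective.range_eq, Set.image_univ, Subtype.range_coe]

lemma j_off (y : D.W) : D.j y ∈ D.N.off ↔ D.σ y.1.1 ≠ 0 := aline_mem_nz _

/-- The punctured tubular neighbourhood. -/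
abbrev W₀ : Type := {y : D.W // D.σ y.1.1 ≠ 0}

/-- The inclusion of the punctured tubular neighbourhood. -/
def inclW : C(D.W₀, D.W) := ⟨Subtype.val, continuous_subtype_val⟩

lemma isOpen_ne : IsOpen {y : D.T | D.σ y.1 ≠ 0} :=
  isOpen_compl_singleton.preimage (by fun_prop)

lemma ov_incl : (cone (Cm D.incl)).OV ↔ (C D.Z).OV := by
  have h1 := hoCart_open D.inclW ⟨fun y => ⟨y.1.1, y.2⟩, by fun_prop⟩
    ⟨fun y : D.W => y.1, by fun_prop⟩ D.incl rfl
    (IsEmbedding.subtypeVal.comp IsEmbedding.subtypeVal)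
    D.isOpen_W.isOpenEmbedding_subtypeVal D.isOpen_ne.isOpenEmbedding_subtypeVal
    (Set.eq_univ_of_forall fun y => by
      by_cases h : D.σ y.1 = 0
      · refine Or.inl ⟨⟨y, ?_⟩, rfl⟩
        rw [h, map_zero, sub_zero]
        exact D.mem _ y.2
      · exact Or.inr ⟨⟨y, h⟩, rfl⟩)
    (by
      rintro _ ⟨⟨y, rfl⟩, ⟨z, hz⟩⟩
      refine ⟨⟨y, ?_⟩, rfl⟩
      have h : z.1 = y.1 := hz
      rw [← h]
      exact z.2)
  have h2 := hoCart_open D.inclW ⟨fun y => ⟨D.j y.1, (D.j_off y.1).2 y.2⟩, by fun_prop⟩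
    D.j D.N.offIncl rfl
    (D.j_openEmbedding.isEmbedding.comp IsEmbedding.subtypeVal)
    D.j_openEmbedding (IsOpen.isOpenEmbedding_subtypeVal
      ((isOpen_nz _).preimage (continuous_snd.comp continuous_subtype_val)))
    (Set.eq_univ_of_forall fun x => by
      by_cases h : x ∈ D.N.off
      · exact Or.inr ⟨⟨x, h⟩, rfl⟩
      · refine Or.inl ?_
        rw [D.range_j]
        obtain ⟨h1, h2⟩ := eq_of_notMem_nz h
        refine ⟨h1, ?_⟩
        rw [h2, map_zero, add_zero]
        exact D.mem _ x.1.1.1.2)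
    (by
      rintro _ ⟨⟨y, rfl⟩, ⟨z, hz⟩⟩
      refine ⟨⟨y, ?_⟩, rfl⟩
      have h : z.1 = D.j y := hz
      rw [← D.j_off, ← h]
      exact z.2)
  exact (QI.ov_iff h1).symm.trans ((QI.ov_iff h2).trans D.N.ov_offIncl)

end Thom
end Thom

/-! ### Transfer along a morphism of vector bundles -/

section Link
variable {n r : ℕ}

/-- A morphism of vector bundles. -/
structure Link (Q : Bun B K n) (R : Bun B J r) where
  A : C(B, Matrix J K ℂ)
  left : ∀ b, R.P b * A b = A b
  right : ∀ b, A b * Q.P b = A b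

variable {Q : Bun B K n} {R : Bun B J r}

/-- The adjoint morphism. -/
def Link.adj (D : Link Q R) : Link R Q where
  A := ⟨fun b => (D.A b)ᴴ, by fun_prop⟩
  left b := by
    have := congrArg conjTranspose (D.right b)
    rwa [conjTranspose_mul, (Q.proj b).herm] at this
  right b := by
    have := congrArg conjTranspose (D.left b)
    rwa [conjTranspose_mul, (R.proj b).herm] at this

lemma Link.adj_adj (D : Link Q R) (b : B) : D.adj.adj.A b = D.A b :=
  conjTranspose_conjTranspose _

/-- The lines on which a morphism does not vanish. -/
abbrev Link.X (D : Link Q R) : Type := {x : Q.PB // D.A x.1.1 * x.1.2.1 ≠ 0}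

/-- The inclusion of the lines on which a morphism does not vanish. -/
def Link.inc (D : Link Q R) : C(D.X, Q.PB) := ⟨Subtype.val, continuous_subtype_val⟩

lemma conj_mul_act_ne {p : Mat K} (h : IsPt p) {A : Matrix J K ℂ} (hA : A * p ≠ 0) :
    Aᴴ * act A p ≠ 0 := by
  have h1 : Aᴴ * A * p ≠ 0 := fun h0 => by
    have h2 : p * (Aᴴ * A * p) = 0 := by rw [h0, mmul_zero]
    rw [mulA Aᴴ A p, h.smul_trace A] at h2
    exact h.ne ((smul_eq_zero.1 h2).resolve_left (h.trace_ne hA))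
  exact mul_act_ne h h1

/-- The map of projective bundles induced by a morphism, where it is defined. -/
def Link.push (D : Link Q R) : C(D.X, D.adj.X) :=
  ⟨fun x => ⟨⟨(x.1.1.1, ⟨act (D.A x.1.1.1) x.1.1.2.1, x.1.1.2.2.act x.2⟩), mul_act_eq (by
      rw [← mulA]
      exact congrArg (fun X => X * x.1.1.2.1) (D.left x.1.1.1))⟩, conj_mul_act_ne x.1.1.2.2 x.2⟩,
    subtype_mk (subtype_mk (prodMk (by fun_prop)
      (subtype_mk (continuous_act (by fun_prop) (by fun_prop)
        (fun x : D.X => x.1.1.2.2) fun x => x.2) _)) _) _⟩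

lemma path_mul_act_ne {p : Mat K} (h : IsPt p) {A : Matrix J K ℂ} (hA : A * p ≠ 0) {t : ℝ}
    (h0 : 0 ≤ t) (h1 : t ≤ 1) :
    A * ((1 - t : ℂ) • (1 : Mat K) + (t : ℂ) • (Aᴴ * A)) * p ≠ 0 := by
  have h2 := path_mul_ne (A := Aᴴ) (h.act hA) (conj_mul_act_ne h hA) h0 h1
  rw [mul_act, conjTranspose_conjTranspose] at h2
  intro h3
  refine h2 ?_
  rw [show ((1 - t : ℂ) • (1 : Mat J) + (t : ℂ) • (A * Aᴴ)) * A * p * Aᴴ =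
    A * ((1 - t : ℂ) • (1 : Mat K) + (t : ℂ) • (Aᴴ * A)) * p * Aᴴ by
      simp only [madd_mul, mmul_add, msmul_mul, mmul_smul, mone_mul,
        mmul_one, mulA], h3, mzero_mul, smul_zero]

lemma Link.push_push (D : Link Q R) (h : C(D.adj.X, D.X))
    (hh : ∀ x, (h x).1.1.1 = x.1.1.1 ∧ (h x).1.1.2.1 = act (D.A x.1.1.1)ᴴ x.1.1.2.1) :
    (h.comp D.push).Homotopic (.id _) := by
  refine Homotopic.symm (homotopic_of (fun x => ⟨⟨(x.2.1.1.1, ⟨act ((1 - x.1 : ℂ) •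
    (1 : Mat K) + (x.1 : ℂ) • ((D.A x.2.1.1.1)ᴴ * D.A x.2.1.1.1)) x.2.1.1.2.1,
      x.2.1.1.2.2.act (path_mul_ne x.2.1.1.2.2 x.2.2 x.1.2.1 x.1.2.2)⟩),
      mul_act_eq ?_⟩, mul_act_ne x.2.1.1.2.2 ?_⟩) ?_ ?_ ?_)
  · have e : Q.P x.2.1.1.1 * (D.A x.2.1.1.1)ᴴ = (D.A x.2.1.1.1)ᴴ := D.adj.left _
    change Q.P x.2.1.1.1 * _ = _
    rw [← mulA, mmul_add, mmul_smul, mmul_smul, mmul_one,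
      ← mulA, e, madd_mul, madd_mul, msmul_mul, msmul_mul, msmul_mul, mone_mul, x.2.1.2]
  · exact path_mul_act_ne x.2.1.1.2.2 x.2.2 x.1.2.1 x.1.2.2
  · exact subtype_mk (subtype_mk (prodMk (by fun_prop)
      (subtype_mk (continuous_act (A := fun x : UI × D.X => (1 - x.1 : ℂ) •
        (1 : Mat K) + (x.1 : ℂ) • ((D.A x.2.1.1.1)ᴴ * D.A x.2.1.1.1))
        (P := fun x => x.2.1.1.2.1) (by fun_prop) (by fun_prop)
        (fun x => x.2.1.1.2.2) fun x => path_mul_ne x.2.1.1.2.2 x.2.2 x.1.2.1 x.1.2.2) _)) _) _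
  · intro x
    refine sext (sext (Prod.ext rfl (sext ?_)))
    change act ((1 - ((0 : ℝ) : ℂ)) • (1 : Mat K) + ((0 : ℝ) : ℂ) • _) x.1.1.2.1 = x.1.1.2.1
    rw [Complex.ofReal_zero, sub_zero, one_smul, zero_smul, add_zero]
    exact act_eq x.1.1.2.2 (mone_mul _)
  · intro x
    obtain ⟨h1, h2⟩ := hh (D.push x)
    refine sext (sext (Prod.ext h1.symm (sext ?_)))
    refine Eq.trans ?_ h2.symm
    change act ((1 - ((1 : ℝ) : ℂ)) • (1 : Mat K) + ((1 : ℝ) : ℂ) •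
      ((D.A x.1.1.1)ᴴ * D.A x.1.1.1)) x.1.1.2.1 =
      act (D.A x.1.1.1)ᴴ (act (D.A x.1.1.1) x.1.1.2.1)
    rw [Complex.ofReal_one, sub_self, zero_smul, zero_add, one_smul, act_act _ x.1.1.2.2 x.2]

lemma Link.ne_of_adj_adj (D : Link Q R) {b : B} {q : Mat K} (h : D.adj.adj.A b * q ≠ 0) :
    D.A b * q ≠ 0 := by
  rwa [D.adj_adj] at h

/-- The inverse up to homotopy. -/
def Link.pull (D : Link Q R) : C(D.adj.X, D.X) :=
  ⟨fun x => ⟨(D.adj.push x).1, D.ne_of_adj_adj (D.adj.push x).2⟩,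
    subtype_mk (continuous_subtype_val.comp D.adj.push.continuous) _⟩

lemma Link.push_qi (D : Link Q R) : (Cm D.push).QI := by
  refine QI_of_homotopy_inverse _ D.pull (D.push_push D.pull fun x => ⟨rfl, rfl⟩) ?_
  have h := D.adj.push_push (D.push.comp ⟨fun x => ⟨x.1, D.ne_of_adj_adj x.2⟩, by fun_prop⟩)
    fun x => ⟨rfl, congrArg (fun A => act A x.1.1.2.1) (D.adj_adj x.1.1.1).symm⟩
  exact h

lemma link_path_ne {p : Mat K} (h : IsPt p) {A : Matrix J K ℂ} (hA : A * p ≠ 0) (t : ℂ) :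
    ((1 - t) • emb (inr : K → J ⊕ K) + t • (emb (inl : J → J ⊕ K) * A)) * p ≠ 0 := by
  intro h0
  have e1 : (emb (inl : J → J ⊕ K))ᴴ * emb (inr : K → J ⊕ K) = 0 :=
    emb_conj_mul_zero fun _ _ => Sum.inl_ne_inr
  have e2 : (emb (inr : K → J ⊕ K))ᴴ * emb (inl : J → J ⊕ K) = 0 :=
    emb_conj_mul_zero fun _ _ => Sum.inr_ne_inl
  have h1 := congrArg (fun X => (emb (inr : K → J ⊕ K))ᴴ * X) h0
  have h2 := congrArg (fun X => (emb (inl : J → J ⊕ K))ᴴ * X) h0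
  simp only [madd_mul, mmul_add, msmul_mul, mmul_smul, mmul_zero,
    ← mulA, e1, e2, emb_conj_mul inl_injective, emb_conj_mul inr_injective,
    mzero_mul, mone_mul, smul_zero, add_zero, zero_add] at h1 h2
  have h3 := (smul_eq_zero.1 h1).resolve_right h.ne
  have h4 := (smul_eq_zero.1 h2).resolve_right hA
  rw [h4, sub_zero] at h3
  exact one_ne_zero h3

lemma Link.homotopic (D : Link Q R) :
    ((Q.toProd (inr : K → J ⊕ K) inr_injective).comp D.inc).Homotopic
      ((R.toProd (inl : J → J ⊕ K) inl_injective).comp (D.adj.inc.comp D.push)) := by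
  refine homotopic_of (fun x => (x.2.1.1.1, ⟨act ((1 - x.1 : ℂ) • emb (inr : K → J ⊕ K) +
    (x.1 : ℂ) • (emb (inl : J → J ⊕ K) * D.A x.2.1.1.1)) x.2.1.1.2.1,
      x.2.1.1.2.2.act (link_path_ne x.2.1.1.2.2 x.2.2 _)⟩)) ?_ ?_ ?_
  · exact prodMk (by fun_prop)
      (subtype_mk (continuous_act (A := fun x : UI × D.X => (1 - x.1 : ℂ) •
        emb (inr : K → J ⊕ K) + (x.1 : ℂ) • (emb (inl : J → J ⊕ K) * D.A x.2.1.1.1))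
        (P := fun x => x.2.1.1.2.1) (by fun_prop) (by fun_prop)
        (fun x => x.2.1.1.2.2) fun x => link_path_ne x.2.1.1.2.2 x.2.2 _) _)
  · intro x
    refine Prod.ext rfl (sext ?_)
    change act ((1 - ((0 : ℝ) : ℂ)) • emb (inr : K → J ⊕ K) + ((0 : ℝ) : ℂ) • _) x.1.1.2.1 =
      act (emb (inr : K → J ⊕ K)) x.1.1.2.1
    rw [Complex.ofReal_zero, sub_zero, one_smul, zero_smul, add_zero]
  · intro x
    refine Prod.ext rfl (sext ?_)
    change act ((1 - ((1 : ℝ) : ℂ)) • _ + ((1 : ℝ) : ℂ) •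
      (emb (inl : J → J ⊕ K) * D.A x.1.1.1)) x.1.1.2.1 =
      act (emb (inl : J → J ⊕ K)) (act (D.A x.1.1.1) x.1.1.2.1)
    rw [Complex.ofReal_one, sub_self, zero_smul, zero_add, one_smul, act_act _ x.1.1.2.2 x.2]

theorem Link.ov_transfer (D : Link Q R) (hB : (C B).OV) (h : (cone (Cm D.inc)).OV) :
    (cone (Cm D.adj.inc)).OV := by
  refine (R.ov_PB hB).cone_of_even_inj fun z hz he hb => ?_
  obtain ⟨y, hy, hyz⟩ := D.push_qi.2 z hz
  obtain ⟨y', hy'⟩ : ∃ y', y' = (1 / 2 : ℚ) • (y + (C D.X).ε y) := ⟨_, rfl⟩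
  have h1 : (C D.X).d y' = 0 := by rw [hy', map_smul, map_add, (C D.X).dε, hy]; simp
  have h2 : (C D.X).ε y' = y' := by rw [hy', map_smul, map_add, (C D.X).εε, add_comm]
  have h3 : (C D.adj.X).Bd (z - (Cm D.push).f y') := by
    have h4 := (hyz.add hyz.eps).smul (1 / 2)
    refine Bd_of_eq h4 ?_
    rw [hy', map_smul, map_add, (Cm D.push).hε, map_sub, he]
    module
  have h5 : (C R.PB).Bd ((Cm D.adj.inc).f ((Cm D.push).f y')) := by
    have := hb.sub ((Cm D.adj.inc).bd h3)
    rwa [map_sub, sub_sub_cancel] at this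
  have h6 : (C Q.PB).Bd ((Cm D.inc).f y') := by
    refine Q.toProd_inj (inr : K → J ⊕ K) inr_injective _ (by rw [← (Cm _).hd, h1, map_zero]) ?_
    have h7 := homotopy_HEqv D.homotopic y' h1
    have h8 := (Cm (R.toProd (inl : J → J ⊕ K) inl_injective)).bd h5
    rw [← Cm_comp, ← Cm_comp] at h8
    have h9 := h7.add h8
    rw [Cm_comp] at h9
    refine Bd_of_eq h9 ?_
    simp only [ContinuousMap.comp_assoc]
    abel
  have h10 := (Cm D.push).bd (h.even_inj h1 h2 h6)
  refine Bd_of_eq (h3.add h10) ?_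
  abel

end Link

/-! ### Degeneracy loci of transversal families of morphisms -/

section Step
variable {F S S' : Type} [TopologicalSpace F] [AddCommGroup F] [IsTopologicalAddGroup F]
  [TopologicalSpace S] [TopologicalSpace S'] {n r n₁ n₂ : ℕ}

/-- Matrices as column vectors. -/
def vecM (w : Matrix J K ℂ) : Matrix (J × K) Unit ℂ := fun x _ => w x.1 x.2

/-- Column vectors as matrices. -/
def unvecM : Matrix (J × K) Unit ℂ →+ Matrix J K ℂ where
  toFun v := fun i j => v (i, j) ()
  map_zero' := rfl
  map_add' _ _ := rfl

lemma vecM_eq_zero {w : Matrix J K ℂ} : vecM w = 0 ↔ w = 0 :=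
  ⟨fun h => congrArg unvecM h, fun h => congrArg vecM h⟩

open scoped Kronecker in
lemma kron_mul_vecM (α : Mat J) (β : Mat K) (w : Matrix J K ℂ) :
    (α ⊗ₖ βᵀ) * vecM w = vecM (α * w * β) := by
  ext ⟨i, j⟩ ⟨⟩
  simp only [mmul_apply, vecM, kroneckerMap_apply, transpose_apply, Fintype.sum_prod_type, sum_mul]
  rw [sum_comm]
  refine sum_congr rfl fun _ _ => sum_congr rfl fun _ _ => by ring

open scoped Kronecker in
/-- The bundle of morphisms. -/
def Bun.hom (β : Bun S K n₂) (α : Bun S J n₁) : Bun S (J × K) (n₁ * n₂) where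
  P b := α.P b ⊗ₖ (β.P b)ᵀ
  cont := by
    refine continuous_matrix fun i j => ?_
    simp only [kroneckerMap_apply, transpose_apply]
    exact (α.cont.matrix_elem _ _).mul (β.cont.matrix_elem _ _)
  proj b := by
    refine ⟨?_, ?_⟩
    · have h : ((β.P b)ᵀ)ᴴ = (β.P b)ᵀ := congrArg Matrix.transpose (β.proj b).herm
      rw [conjTranspose_kronecker, (α.proj b).herm, h]
    · rw [← mul_kronecker_mul, (α.proj b).idem, ← transpose_mul, (β.proj b).idem]
  tr b := by
    rw [trace_kronecker, α.tr, trace_transpose, β.tr, Nat.cast_mul]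

lemma Bun.hom_mul (β : Bun S K n₂) (α : Bun S J n₁) (b : S) (v : Matrix (J × K) Unit ℂ) :
    (β.hom α).P b * v = vecM (α.P b * unvecM v * β.P b) := kron_mul_vecM _ _ (unvecM v)

/-- The tautological line bundle. -/
def Bun.taut (Q : Bun S K n) : Bun Q.PB K 1 where
  P x := x.1.2.1
  cont := by fun_prop
  proj x := x.1.2.2.isProj
  tr x := by rw [x.1.2.2.tr, Nat.cast_one]

/-- A family of morphisms of vector bundles, varying in all directions. -/
structure Step (F S J K : Type) [TopologicalSpace F] [AddCommGroup F] [IsTopologicalAddGroup F]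
    [TopologicalSpace S] [Fintype J] [Fintype K] (n r : ℕ) where
  U : Set F
  hU : IsOpen U
  A : Set (F × S)
  Q : Bun S K n
  R : Bun S J r
  φ : C(F, Matrix J K ℂ)
  ι : Matrix J K ℂ →+ F
  hι : Continuous ι
  mem : ∀ y ∈ A, y.1 ∈ U
  tr : ∀ y ∈ A, ∀ w : Matrix J K ℂ, R.P y.2 * w = w → w * Q.P y.2 = w → y.1 + ι w ∈ U → (y.1 + ι w, y.2) ∈ A
  hφ : ∀ y ∈ A, R.P y.2 * (φ y.1 * Q.P y.2) = φ y.1 * Q.P y.2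
  φ_tr : ∀ y ∈ A, ∀ w : Matrix J K ℂ, R.P y.2 * w = w → w * Q.P y.2 = w → φ (y.1 + ι w) = φ y.1 + w

namespace Step
variable (D : Step F S J K n r)

/-- The transversal section given by the components of the morphism between subbundles. -/
def thom (f : C(S', S)) (β : Bun S' K n₂) (α : Bun S' J n₁)
    (hβ : ∀ s, D.Q.P (f s) * β.P s = β.P s) (hα : ∀ s, D.R.P (f s) * α.P s = α.P s) :
    Thom F S' (J × K) (n₁ * n₂) where
  U := D.U
  hU := D.hU
  T := {y | (y.1, f y.2) ∈ D.A}
  E := β.hom α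
  ι := D.ι.comp unvecM
  hι := D.hι.comp (continuous_matrix fun i j => by
    exact (continuous_apply ()).comp (continuous_apply (i, j)))
  σ := ⟨fun y => vecM (α.P y.2 * D.φ y.1 * β.P y.2), by
    refine continuous_matrix fun i j => ?_
    exact Continuous.matrix_elem (by fun_prop) i.1 i.2⟩
  mem y hy := D.mem _ hy
  tr y hy w hw hU := by
    rw [Bun.hom_mul] at hw
    have h : α.P y.2 * unvecM w * β.P y.2 = unvecM w := congrArg unvecM hw
    refine D.tr _ hy _ ?_ ?_ hU
    · rw [← h, ← mulA, ← mulA, hα]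
    · have hβ' := congrArg conjTranspose (hβ y.2)
      rw [conjTranspose_mul, (β.proj _).herm, (D.Q.proj _).herm] at hβ'
      rw [← h, mulA, hβ']
  hσ y hy := by
    rw [Bun.hom_mul]
    change vecM (α.P y.2 * (α.P y.2 * D.φ y.1 * β.P y.2) * β.P y.2) = _
    rw [mulA, mulA (α.P y.2 * _), (β.proj _).idem, ← mulA, ← mulA, (α.proj _).idem]
    rfl
  σ_tr y hy w hw := by
    rw [Bun.hom_mul] at hw
    have h : α.P y.2 * unvecM w * β.P y.2 = unvecM w := congrArg unvecM hw
    have h1 : D.φ (y.1 + D.ι (unvecM w)) = D.φ y.1 + unvecM w := by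
      refine D.φ_tr _ hy _ ?_ ?_
      · rw [← h, ← mulA, ← mulA, hα]
      · have hβ' := congrArg conjTranspose (hβ y.2)
        rw [conjTranspose_mul, (β.proj _).herm, (D.Q.proj _).herm] at hβ'
        rw [← h, mulA, hβ']
    change vecM (α.P y.2 * D.φ (y.1 + D.ι (unvecM w)) * β.P y.2) = _
    rw [h1, mmul_add, madd_mul, h]
    rfl

/-- The base. -/
abbrev Base : Type := {y : F × S // y ∈ D.A}

/-- The source bundle over the base. -/
def QB : Bun D.Base K n := D.Q.comap ⟨fun y => y.1.2, by fun_prop⟩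

/-- The target bundle over the base. -/
def RB : Bun D.Base J r := D.R.comap ⟨fun y => y.1.2, by fun_prop⟩

/-- The morphism of bundles over the base. -/
def link : Link D.QB D.RB where
  A := ⟨fun y => D.φ y.1.1 * D.Q.P y.1.2, by fun_prop⟩
  left y := D.hφ _ y.2
  right y := by
    change D.φ y.1.1 * D.Q.P y.1.2 * D.Q.P y.1.2 = D.φ y.1.1 * D.Q.P y.1.2
    rw [mulA, (D.Q.proj _).idem]

/-- The base projection of a projective bundle. -/
def bas (Q : Bun S K n) : C(Q.PB, S) := ⟨fun x => x.1.1, by fun_prop⟩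

/-- The components on lines in the source. -/
def thomQ : Thom F D.Q.PB (J × K) (r * 1) :=
  D.thom (bas D.Q) D.Q.taut (D.R.comap (bas D.Q)) (fun x => x.2) fun x => (D.R.proj _).idem

/-- The components on lines in the target. -/
def thomR : Thom F D.R.PB (J × K) (1 * n) :=
  D.thom (bas D.R) (D.Q.comap (bas D.R)) D.R.taut (fun x => (D.Q.proj _).idem) fun x => x.2

/-- The total spaces agree. -/
def homeoQ : D.thomQ.T ≃ₜ D.QB.PB where
  toFun y := ⟨(⟨(y.1.1, y.1.2.1.1), y.2⟩, y.1.2.1.2), y.1.2.2⟩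
  invFun x := ⟨(x.1.1.1.1, ⟨(x.1.1.1.2, x.1.2), x.2⟩), x.1.1.2⟩
  left_inv y := rfl
  right_inv y := rfl
  continuous_toFun := by fun_prop
  continuous_invFun := by fun_prop

/-- The total spaces agree. -/
def homeoR : D.thomR.T ≃ₜ D.RB.PB where
  toFun y := ⟨(⟨(y.1.1, y.1.2.1.1), y.2⟩, y.1.2.1.2), y.1.2.2⟩
  invFun x := ⟨(x.1.1.1.1, ⟨(x.1.1.1.2, x.1.2), x.2⟩), x.1.1.2⟩
  left_inv y := rfl
  right_inv y := rfl
  continuous_toFun := by fun_prop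
  continuous_invFun := by fun_prop

lemma thomQ_σ (y : D.thomQ.T) : D.thomQ.σ y.1 = 0 ↔ D.φ y.1.1 * y.1.2.1.2.1 = 0 := by
  have h : D.R.P y.1.2.1.1 * D.φ y.1.1 * y.1.2.1.2.1 = D.φ y.1.1 * y.1.2.1.2.1 := by
    have := congrArg (fun X => X * y.1.2.1.2.1) (D.hφ _ y.2)
    simp only [mulA] at this ⊢
    rw [show D.Q.P (bas D.Q y.1.2) * y.1.2.1.2.1 = y.1.2.1.2.1 from y.1.2.2] at this
    exact this
  rw [← h]
  exact vecM_eq_zero (w := D.R.P y.1.2.1.1 * D.φ y.1.1 * y.1.2.1.2.1)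

lemma thomR_σ (y : D.thomR.T) :
    D.thomR.σ y.1 = 0 ↔ y.1.2.1.2.1 * D.φ y.1.1 * D.Q.P y.1.2.1.1 = 0 :=
  vecM_eq_zero (w := y.1.2.1.2.1 * D.φ y.1.1 * D.Q.P y.1.2.1.1)

lemma link_ne (y : D.thomQ.T) : D.link.A (D.homeoQ y).1.1 * (D.homeoQ y).1.2.1 ≠ 0 ↔
    D.thomQ.σ y.1 ≠ 0 := by
  rw [ne_eq, ne_eq, thomQ_σ]
  change ¬ D.φ y.1.1 * D.Q.P y.1.2.1.1 * y.1.2.1.2.1 = 0 ↔ _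
  rw [mulA, y.1.2.2]

lemma link_adj_ne (y : D.thomR.T) : D.link.adj.A (D.homeoR y).1.1 * (D.homeoR y).1.2.1 ≠ 0 ↔
    D.thomR.σ y.1 ≠ 0 := by
  rw [ne_eq, ne_eq, thomR_σ]
  change ¬ (D.φ y.1.1 * D.Q.P y.1.2.1.1)ᴴ * y.1.2.1.2.1 = 0 ↔ _
  rw [← conjTranspose_eq_zero, conjTranspose_mul, conjTranspose_conjTranspose, y.1.2.1.2.2.herm,
    mulA]

lemma homeo_punct {X Y : Type} [TopologicalSpace X] [TopologicalSpace Y] (e : X ≃ₜ Y) {p : X → Prop}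
    {q : Y → Prop} (h : ∀ x, q (e x) ↔ p x) {f : C({x // p x}, X)} {g : C({y // q y}, Y)}
    (hf : ∀ x, f x = x.1) (hg : ∀ y, g y = y.1) : (cone (Cm f)).OV ↔ (cone (Cm g)).OV := by
  obtain ⟨F, hF⟩ := pair_homeo (f' := g) (e.subtype fun x => (h x).symm) e
    fun x => by rw [hf, hg]; rfl
  exact hF.ov_iff

/-- The locus where the morphism vanishes on a line. -/
abbrev ZQ : Type := {y : F × D.Q.PB // (y.1, y.2.1.1) ∈ D.A ∧ D.φ y.1 * y.2.1.2.1 = 0}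

/-- The locus where the image of the morphism is orthogonal to a line. -/
abbrev ZR : Type :=
  {y : F × D.R.PB // (y.1, y.2.1.1) ∈ D.A ∧ y.2.1.2.1 * D.φ y.1 * D.Q.P y.2.1.1 = 0}

/-- The zero loci agree. -/
def homeoZQ : D.thomQ.Z ≃ₜ D.ZQ where
  toFun y := ⟨y.1.1, y.1.2, (D.thomQ_σ y.1).1 y.2⟩
  invFun y := ⟨⟨y.1, y.2.1⟩, (D.thomQ_σ ⟨y.1, y.2.1⟩).2 y.2.2⟩
  left_inv y := rfl
  right_inv y := rfl
  continuous_toFun := by fun_prop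
  continuous_invFun := by fun_prop

/-- The zero loci agree. -/
def homeoZR : D.thomR.Z ≃ₜ D.ZR where
  toFun y := ⟨y.1.1, y.1.2, (D.thomR_σ y.1).1 y.2⟩
  invFun y := ⟨⟨y.1, y.2.1⟩, (D.thomR_σ ⟨y.1, y.2.1⟩).2 y.2.2⟩
  left_inv y := rfl
  right_inv y := rfl
  continuous_toFun := by fun_prop
  continuous_invFun := by fun_prop

theorem transfer (hB : (C D.Base).OV) (hQ : (C D.ZQ).OV) : (C D.ZR).OV := by
  have h1 := D.thomQ.ov_incl.2 ((QI_of_homeo D.homeoZQ).ov_iff.2 hQ)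
  have h2 := (homeo_punct (f := D.thomQ.incl) (g := D.link.inc) D.homeoQ D.link_ne
    (fun _ => rfl) fun _ => rfl).1 h1
  have h3 := D.link.ov_transfer hB h2
  have h4 := (homeo_punct (f := D.thomR.incl) (g := D.link.adj.inc) D.homeoR D.link_adj_ne
    (fun _ => rfl) fun _ => rfl).2 h3
  exact (QI_of_homeo D.homeoZR).ov_iff.1 (D.thomR.ov_incl.1 h4)

end Step
end Step

/-! ### The action of invertible matrices on projections -/

section Mv
variable {X : Type} [TopologicalSpace X]

lemma IsProj.trace_eq {P : Mat K} (hP : IsProj P) : P.trace = P.rank := by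
  have h : IsIdempotentElem (toLin' P) := by
    rw [IsIdempotentElem, Module.End.mul_eq_comp, ← toLin'_mul, hP.idem]
  have := (LinearMap.IsIdempotentElem.isProj_range _ h).trace
  rwa [Matrix.trace_toLin'_eq] at this

lemma IsProj.zero : IsProj (0 : Mat K) := ⟨conjTranspose_zero, mmul_zero _⟩

lemma IsProj.one : IsProj (1 : Mat K) := ⟨conjTranspose_one, mmul_one _⟩

lemma IsProj.symm {P : Mat K} {Q : Mat K} (hP : IsProj P) (hQ : IsProj Q) (h : P * Q = Q) :
    Q * P = Q := by
  have := congrArg conjTranspose h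
  rwa [conjTranspose_mul, hP.herm, hQ.herm] at this

lemma IsProj.add {P Q : Mat K} (hP : IsProj P) (hQ : IsProj Q) (h : P * Q = 0) :
    IsProj (P + Q) := by
  have h' : Q * P = 0 := by
    have := congrArg conjTranspose h
    rwa [conjTranspose_mul, hP.herm, hQ.herm, conjTranspose_zero] at this
  refine ⟨by rw [conjTranspose_add, hP.herm, hQ.herm], ?_⟩
  rw [madd_mul, mmul_add, mmul_add, hP.idem, hQ.idem, h, h']; abel

lemma continuous_inv_of_det {f : X → Mat K} (hf : Continuous f) (h : ∀ x, (f x).det ≠ 0) :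
    Continuous fun x => (f x)⁻¹ := by
  simp only [inv_def, Ring.inverse_eq_inv']
  exact (hf.matrix_det.inv₀ h).smul hf.matrix_adjugate

/-- An auxiliary positive definite matrix. -/
def sv (A : Matrix J K ℂ) (q : Mat K) : Mat K := q * Aᴴ * A * q + (1 - q)

/-- The projection onto the image of a projection. -/
def mv (A : Matrix J K ℂ) (q : Mat K) : Mat J := A * q * (sv A q)⁻¹ * q * Aᴴ

open ComplexOrder in
lemma sv_det {A : Matrix J K ℂ} {q : Mat K} (hq : IsProj q) {B : Matrix K J ℂ} (hB : B * A = 1) :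
    (sv A q).det ≠ 0 := by
  have h1 : sv A q = (fromRows (A * q) (1 - q))ᴴ * fromRows (A * q) (1 - q) := by
    rw [conjTranspose_fromRows_eq_fromCols_conjTranspose, fromCols_mul_fromRows, sv,
      conjTranspose_mul, hq.herm, ((IsProj.one).sub hq (mone_mul _)).herm,
      ((IsProj.one).sub hq (mone_mul _)).idem]
    simp only [mulA]
  rw [h1, ← isUnit_iff_ne_zero, ← isUnit_iff_isUnit_det, ← mulVec_injective_iff_isUnit]
  refine (LinearMap.ker_eq_bot (f := ((fromRows (A * q) (1 - q))ᴴ *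
    fromRows (A * q) (1 - q)).mulVecLin)).1 ?_
  rw [ker_mulVecLin_conjTranspose_mul_self, LinearMap.ker_eq_bot]
  have h2 : fromCols B (1 : Mat K) * fromRows (A * q) (1 - q) = 1 := by
    rw [fromCols_mul_fromRows, ← mulA, hB, mone_mul, mone_mul, add_sub_cancel]
  refine Function.LeftInverse.injective (g := (fromCols B (1 : Mat K)).mulVecLin) fun x => ?_
  rw [mulVecLin_apply, mulVecLin_apply, mulVec_mulVec, h2, one_mulVec]

lemma sv_mul {A : Matrix J K ℂ} {q : Mat K} (hq : IsProj q) :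
    sv A q * q = q * Aᴴ * A * q := by
  rw [sv, madd_mul, mulA _ q q, hq.idem, msub_mul, hq.idem, mone_mul, sub_self, add_zero]

variable {A : Matrix J K ℂ} {q : Mat K} {B : Matrix K J ℂ}

lemma sv_inv (hq : IsProj q) (hB : B * A = 1) : (sv A q)⁻¹ * (q * Aᴴ * A * q) = q := by
  rw [← sv_mul hq, ← mulA, nonsing_inv_mul _ (sv_det hq hB).isUnit, mone_mul]

lemma mv_mul (hq : IsProj q) (hB : B * A = 1) : mv A q * (A * q) = A * q := by
  have : mv A q * (A * q) = A * q * ((sv A q)⁻¹ * (q * Aᴴ * A * q)) := by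
    simp only [mv, mulA]
  rw [this, sv_inv hq hB, mulA, hq.idem]

lemma mv_eq : mv A q = A * q * ((sv A q)⁻¹ * q * Aᴴ) := by simp only [mv, mulA]

lemma mv_proj (hq : IsProj q) (hB : B * A = 1) : IsProj (mv A q) := by
  refine ⟨?_, ?_⟩
  · have h : (sv A q)ᴴ = sv A q := by
      rw [sv, conjTranspose_add, conjTranspose_sub, conjTranspose_mul, conjTranspose_mul,
        conjTranspose_mul, hq.herm, conjTranspose_one, conjTranspose_conjTranspose]
      simp only [mulA]
    rw [mv, conjTranspose_mul, conjTranspose_mul, conjTranspose_mul, conjTranspose_mul,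
      conjTranspose_nonsing_inv, h, hq.herm, conjTranspose_conjTranspose]
    simp only [mulA]
  · nth_rw 2 [mv_eq]
    rw [← mulA, mv_mul hq hB, ← mv_eq]

lemma mv_trace (hq : IsProj q) (hB : B * A = 1) : (mv A q).trace = q.trace := by
  rw [mv_eq, trace_mul_comm]
  have : (sv A q)⁻¹ * q * Aᴴ * (A * q) = (sv A q)⁻¹ * (q * Aᴴ * A * q) := by
    simp only [mulA]
  rw [this, sv_inv hq hB]

lemma mv_one (hq : IsProj q) : mv (1 : Mat K) q = q := by
  have h : sv (1 : Mat K) q = 1 := by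
    rw [sv, conjTranspose_one, mmul_one, mmul_one, hq.idem, add_sub_cancel]
  rw [mv, h, inv_one, conjTranspose_one, mone_mul, mmul_one, mmul_one, hq.idem]

/-- Conditions on vectors are transported by the action. -/
lemma mv_mul_of (hq : IsProj q) (hB : B * A = 1) {I : Type} [Fintype I] {T : Matrix I J ℂ}
    (h : T * (A * q) = 0) : T * mv A q = 0 := by
  rw [mv_eq, ← mulA, h, mzero_mul]

lemma mv_mul_fix (hq : IsProj q) (hB : B * A = 1) {T : Mat J}
    (h : T * (A * q) = A * q) : T * mv A q = mv A q := by
  rw [mv_eq, ← mulA, h]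

lemma continuous_mv {A : X → Matrix J K ℂ} {q : X → Mat K} (hA : Continuous A)
    (hq : Continuous q) (h : ∀ x, IsProj (q x)) {B : X → Matrix K J ℂ} (hB : ∀ x, B x * A x = 1) :
    Continuous fun x => mv (A x) (q x) := by
  have h1 : Continuous fun x => (sv (A x) (q x))⁻¹ :=
    continuous_inv_of_det (by unfold sv; fun_prop) fun x => sv_det (h x) (hB x)
  unfold mv
  fun_prop

end Mv

/-! ### Quiver Grassmannians with a partial reflection -/

section Row
variable {κ : Type} [Fintype κ] [DecidableEq κ]

/-- A block row. -/
def row (f : I → Matrix J κ ℂ) : Matrix J (κ × I) ℂ := fun x y => f y.2 x y.1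

lemma row_mul (f : I → Matrix J κ ℂ) (D : I → Mat κ) :
    row f * blockDiagonal D = row fun a => f a * D a := by
  ext x ⟨y, a⟩
  simp only [row, mmul_apply, blockDiagonal_apply, Fintype.sum_prod_type, mul_ite, mul_zero,
    Finset.sum_ite_eq', mem_univ, if_true]

lemma mul_row {J' : Type} (X : Matrix J' J ℂ) (f : I → Matrix J κ ℂ) :
    X * row f = row fun a => X * f a := rfl

end Row

variable {V A κ : Type} [Fintype V] [Fintype A] [Fintype κ] [DecidableEq V] [DecidableEq A]
  [DecidableEq κ]

section Gr
variable (s t : A → V) (P : V → Mat κ) (i : V)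

/-- The arrows ending in a vertex. -/
abbrev In : Type := {a : A // t a = i}

/-- The sum over the arrows ending in a vertex. -/
def Qb (q : V → Mat κ) : Mat (κ × In t i) :=
  blockDiagonal fun a => q (s a.1)

/-- The incoming map at a vertex. -/
def inc (m : A → Mat κ) : Matrix κ (κ × In t i) ℂ := row fun a => P i * m a.1

/-- Points of quiver Grassmannians with a partial reflection. -/
structure IsG (e : V → ℕ) (k : ℕ) (m : A → Mat κ) (q : V → Mat κ)
    (L : Mat (κ × In t i)) : Prop where
  proj : ∀ v, IsProj (q v)
  le : ∀ v, P v * q v = q v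
  tr : ∀ v, (q v).trace = e v
  inv : ∀ a, (P (t a) - q (t a)) * m a * q (s a) = 0
  lproj : IsProj L
  ltr : L.trace = k
  lle : Qb s t i q * L = L
  van : inc t P i m * L = 0

variable {s t P i}

lemma IsG.transport {e : V → ℕ} {k : ℕ} {m m' : A → Mat κ} {q : V → Mat κ}
    {L : Mat (κ × In t i)} (hP : ∀ v, IsProj (P v)) (h : IsG s t P i e k m q L)
    {g g' : V → Mat κ} (hg : ∀ v, g' v * g v = 1) (hc : ∀ v, P v * g v = g v * P v)
    (hm : ∀ a, P (t a) * m' a * P (s a) * g (s a) = g (t a) * (P (t a) * m a * P (s a))) :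
    IsG s t P i e k m' (fun v => mv (g v) (q v)) (mv (Qb s t i g) L) := by
  have hg2 : Qb s t i g' * Qb s t i g = 1 := by
    rw [Qb, Qb, ← blockDiagonal_mul, ← blockDiagonal_one]
    exact congrArg blockDiagonal (funext fun a => hg _)
  have hle : ∀ v, P v * mv (g v) (q v) = mv (g v) (q v) := fun v =>
    mv_mul_fix (h.proj v) (hg v) (by rw [← mulA, hc, mulA, h.le])
  have hpr : ∀ v, IsProj (mv (g v) (q v)) := fun v => mv_proj (h.proj v) (hg v)
  have hlle : Qb s t i (fun v => mv (g v) (q v)) * mv (Qb s t i g) L = mv (Qb s t i g) L := by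
    refine mv_mul_fix h.lproj hg2 ?_
    have h6 : Qb s t i (fun v => mv (g v) (q v)) * (Qb s t i g * Qb s t i q) =
        Qb s t i g * Qb s t i q := by
      rw [Qb, Qb, Qb, ← blockDiagonal_mul, ← blockDiagonal_mul]
      exact congrArg blockDiagonal (funext fun a => mv_mul (h.proj _) (hg _))
    calc Qb s t i (fun v => mv (g v) (q v)) * (Qb s t i g * L)
        = Qb s t i (fun v => mv (g v) (q v)) * (Qb s t i g * Qb s t i q) * L := by
          rw [mulA, mulA (Qb s t i g), h.lle]
      _ = Qb s t i g * L := by rw [h6, mulA, h.lle]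
  refine ⟨hpr, hle, fun v => by rw [mv_trace (h.proj v) (hg v), h.tr], fun a => ?_,
    mv_proj h.lproj hg2, by rw [mv_trace h.lproj hg2, h.ltr], hlle, ?_⟩
  · refine mv_mul_of (h.proj _) (hg _) ?_
    have h1 : (P (t a) - mv (g (t a)) (q (t a))) * P (t a) = P (t a) - mv (g (t a)) (q (t a)) := by
      rw [msub_mul, (hP _).idem, (hP _).symm (hpr _) (hle _)]
    have h2 : P (s a) * g (s a) * q (s a) = g (s a) * q (s a) := by
      rw [hc, mulA, h.le]
    have h3 : P (t a) * m a * q (s a) = q (t a) * m a * q (s a) := by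
      have := h.inv a
      rwa [msub_mul, msub_mul, sub_eq_zero] at this
    calc (P (t a) - mv (g (t a)) (q (t a))) * m' a * (g (s a) * q (s a))
        = (P (t a) - mv (g (t a)) (q (t a))) * P (t a) * m' a * (P (s a) * g (s a) * q (s a)) := by
          rw [h1, h2]
      _ = (P (t a) - mv (g (t a)) (q (t a))) * (P (t a) * m' a * P (s a) * g (s a)) * q (s a) := by
          simp only [mulA]
      _ = (P (t a) - mv (g (t a)) (q (t a))) * g (t a) * (P (t a) * m a * (P (s a) * q (s a))) := by
          rw [hm]; simp only [mulA]
      _ = (P (t a) * g (t a) * q (t a) - mv (g (t a)) (q (t a)) * (g (t a) * q (t a))) *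
            (m a * q (s a)) := by
          rw [h.le, h3]
          simp only [mulA, msub_mul]
      _ = 0 := by
          rw [mv_mul (h.proj _) (hg _), hc, mulA, h.le, sub_self, mzero_mul]
  · have h0 : ∀ a : In t i, P i * m' a.1 * P (s a.1) * g (s a.1) = g i * (P i * m a.1 * P (s a.1)) := by
      rintro ⟨a, rfl⟩
      exact hm a
    have h4 : Qb s t i P * Qb s t i (fun v => mv (g v) (q v)) = Qb s t i fun v => mv (g v) (q v) := by
      rw [Qb, Qb, ← blockDiagonal_mul]
      exact congrArg blockDiagonal (funext fun a => hle _)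
    have h5 : Qb s t i P * L = L := by
      rw [← h.lle, ← mulA]
      refine congrArg (· * L) ?_
      rw [Qb, Qb, ← blockDiagonal_mul]
      exact congrArg blockDiagonal (funext fun a => h.le _)
    rw [← hlle, ← h4, mulA, hlle, ← mulA]
    refine mv_mul_of h.lproj hg2 ?_
    rw [← mulA, inc, Qb, Qb, row_mul, row_mul]
    rw [show (fun a : In t i => P i * m' a.1 * P (s a.1) * g (s a.1)) =
      fun a : In t i => g i * (P i * m a.1 * P (s a.1)) from funext h0, ← mul_row, ← row_mul]
    have := h.van
    rw [inc] at this
    change g i * (row (fun a : In t i => P i * m a.1) * Qb s t i P) * L = 0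
    rw [mulA, mulA, h5, this, mmul_zero]

variable (s t P i)

/-- The total space over a set of representations. -/
abbrev GU (U : Set (A → Mat κ)) (e : V → ℕ) (k : ℕ) : Type :=
  {y : (A → Mat κ) × (V → Mat κ) × Mat (κ × In t i) //
    y.1 ∈ U ∧ IsG s t P i e k y.1 y.2.1 y.2.2}

variable {s t P i}

/-- Total spaces over slices. -/
theorem ov_slice (hP : ∀ v, IsProj (P v)) {U : Set (A → Mat κ)} {M : A → Mat κ}
    (hM : M ∈ U) (hU : ∀ m ∈ U, ∀ τ : UI, M + (τ : ℝ) • (m - M) ∈ U)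
    (g : (A → Mat κ) → V → Mat κ) (hg : ∀ v, ContinuousOn (fun m => g m v) U)
    (hd : ∀ m ∈ U, ∀ v, (g m v).det ≠ 0) (hc : ∀ m ∈ U, ∀ v, P v * g m v = g m v * P v)
    (hm : ∀ m ∈ U, ∀ a, P (t a) * m a * P (s a) * g m (s a) = g m (t a) * (P (t a) * M a * P (s a)))
    (e : V → ℕ) (k : ℕ) : (C (GU s t P i U e k)).OV ↔ (C (GU s t P i {M} e k)).OV := by
  let T := {p : (A → Mat κ) × (A → Mat κ) // p.1 ∈ U ∧ p.2 ∈ U}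
  let G : T → V → Mat κ := fun p v => g p.1.2 v * (g p.1.1 v)⁻¹
  let G' : T → V → Mat κ := fun p v => g p.1.1 v * (g p.1.2 v)⁻¹
  have hG1 : ∀ p v, G' p v * G p v = 1 := fun p v => by
    change g p.1.1 v * (g p.1.2 v)⁻¹ * (g p.1.2 v * (g p.1.1 v)⁻¹) = 1
    rw [mulA, nonsing_inv_mul_cancel_left _ _ (hd _ p.2.2 v).isUnit,
      mul_nonsing_inv _ (hd _ p.2.1 v).isUnit]
  have hG2 : ∀ p v, P v * G p v = G p v * P v := fun p v => by
    have h2 : (g p.1.1 v)⁻¹ * P v = P v * (g p.1.1 v)⁻¹ := by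
      have hu := (hd _ p.2.1 v).isUnit
      calc (g p.1.1 v)⁻¹ * P v = (g p.1.1 v)⁻¹ * (P v * g p.1.1 v) * (g p.1.1 v)⁻¹ := by
            rw [mulA, mulA, mul_nonsing_inv _ hu, mmul_one]
        _ = P v * (g p.1.1 v)⁻¹ := by
            rw [hc _ p.2.1, ← mulA, nonsing_inv_mul _ hu, mone_mul]
    change P v * (g p.1.2 v * (g p.1.1 v)⁻¹) = g p.1.2 v * (g p.1.1 v)⁻¹ * P v
    rw [mulA, h2, ← mulA, ← mulA, hc _ p.2.2]
  have hG3 : ∀ (p : T) a, P (t a) * p.1.2 a * P (s a) * G p (s a) =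
      G p (t a) * (P (t a) * p.1.1 a * P (s a)) := fun p a => by
    have hu := (hd _ p.2.1 (s a)).isUnit
    have hu' := (hd _ p.2.1 (t a)).isUnit
    change P (t a) * p.1.2 a * P (s a) * (g p.1.2 (s a) * (g p.1.1 (s a))⁻¹) =
      g p.1.2 (t a) * (g p.1.1 (t a))⁻¹ * (P (t a) * p.1.1 a * P (s a))
    rw [← mulA, hm _ p.2.2, mulA, mulA (g p.1.2 (t a))]
    refine congrArg (g p.1.2 (t a) * ·) ?_
    rw [← mmul_one (P (t a) * p.1.1 a * P (s a)), ← mul_nonsing_inv _ hu,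
      ← mulA (P (t a) * p.1.1 a * P (s a)), hm _ p.2.1, mulA (g p.1.1 (t a)),
      nonsing_inv_mul_cancel_left _ _ hu']
  have hGc : ∀ v, Continuous fun p => G p v := fun v => by
    have c1 : Continuous fun p : T => g p.1.1 v :=
      (hg v).comp_continuous (by fun_prop) fun p => p.2.1
    have c2 : Continuous fun p : T => g p.1.2 v :=
      (hg v).comp_continuous (by fun_prop) fun p => p.2.2
    exact c2.mul (continuous_inv_of_det c1 fun p => hd _ p.2.1 v)
  have hQb : ∀ {X : Type} [TopologicalSpace X] (f : X → V → Mat κ),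
      (∀ v, Continuous fun x => f x v) → Continuous fun x => Qb s t i (f x) := fun f hf => by
    exact Continuous.matrix_blockDiagonal (continuous_pi fun a => hf _)
  let H : UI × GU s t P i U e k → T := fun x =>
    ⟨(x.2.1.1, M + (x.1 : ℝ) • (x.2.1.1 - M)), x.2.2.1, hU _ x.2.2.1 _⟩
  have hH : Continuous H := by fun_prop
  let Φ : UI × GU s t P i U e k → GU s t P i U e k := fun x =>
    ⟨(M + (x.1 : ℝ) • (x.2.1.1 - M), fun v => mv (G (H x) v) (x.2.1.2.1 v),
      mv (Qb s t i (G (H x))) x.2.1.2.2), hU _ x.2.2.1 _,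
      x.2.2.2.transport hP (hG1 _) (hG2 _) (hG3 (H x))⟩
  have hQ1 : ∀ p, Qb s t i (G' p) * Qb s t i (G p) = 1 := fun p => by
    rw [Qb, Qb, ← blockDiagonal_mul, ← blockDiagonal_one]
    exact congrArg blockDiagonal (funext fun a => hG1 p _)
  have hΦ : Continuous Φ := by
    refine subtype_mk ((by fun_prop : Continuous fun x : UI × GU s t P i U e k =>
      M + (x.1 : ℝ) • (x.2.1.1 - M)).prodMk ((continuous_pi fun v => ?_).prodMk ?_)) _
    · exact continuous_mv ((hGc v).comp hH) (by fun_prop) (fun x => x.2.2.2.proj v)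
        fun x => hG1 (H x) v
    · exact continuous_mv (hQb (fun x => G (H x)) fun v => (hGc v).comp hH) (by fun_prop)
        (fun x => x.2.2.2.lproj) fun x => hQ1 (H x)
  have hGd : ∀ (p : T), p.1.2 = p.1.1 → G p = 1 := fun p hp => funext fun v => by
    change g p.1.2 v * (g p.1.1 v)⁻¹ = 1
    rw [hp, mul_nonsing_inv _ (hd _ p.2.1 v).isUnit]
  have hQ2 : Qb s t i (1 : V → Mat κ) = 1 := blockDiagonal_one
  have hΦ1 : ∀ x : UI × GU s t P i U e k, M + (x.1 : ℝ) • (x.2.1.1 - M) = x.2.1.1 → Φ x = x.2 :=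
      fun x hx => by
    have := hGd (H x) hx
    refine sext (Prod.ext hx (Prod.ext (funext fun v => ?_) ?_))
    · change mv (G (H x) v) (x.2.1.2.1 v) = _
      rw [this]
      exact mv_one (x.2.2.2.proj v)
    · change mv (Qb s t i (G (H x))) x.2.1.2.2 = _
      rw [this, hQ2]
      exact mv_one x.2.2.2.lproj
  let j : C(GU s t P i {M} e k, GU s t P i U e k) :=
    ⟨fun x => ⟨x.1, by rw [show x.1.1 = M from x.2.1]; exact hM, x.2.2⟩, by fun_prop⟩
  let r : C(GU s t P i U e k, GU s t P i {M} e k) :=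
    ⟨fun x => ⟨(Φ (0, x)).1, by
      change M + ((0 : UI) : ℝ) • (x.1.1 - M) = M
      rw [Set.Icc.coe_zero, zero_smul, add_zero], (Φ (0, x)).2.2⟩, by fun_prop⟩
  have hj : Homotopic (r.comp j) (cid _) := by
    have hx : ∀ x : GU s t P i {M} e k, Φ (0, j x) = j x := fun x => hΦ1 (0, j x) <| by
      change M + ((0 : UI) : ℝ) • (x.1.1 - M) = x.1.1
      rw [Set.Icc.coe_zero, zero_smul, add_zero, show x.1.1 = M from x.2.1]
    have h2 : r.comp j = cid _ :=
      ContinuousMap.ext fun x => by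
        have h3 : (Φ (0, j x)).1 = (j x).1 := by rw [hx x]
        exact sext h3
    rw [h2]
  have hr : Homotopic (j.comp r) (cid _) := by
    refine homotopic_of Φ hΦ (fun x => rfl) fun x => hΦ1 (1, x) ?_
    change M + ((1 : UI) : ℝ) • (x.1.1 - M) = x.1.1
    rw [Set.Icc.coe_one, one_smul, add_sub_cancel]
  exact ((QI_of_homotopy_inverse j r hj hr).ov_iff).symm

end Gr

variable {s t : A → V} {P : V → Mat κ} {M : A → Mat κ} {i : V}

/-! ### Slices at rigid representations -/

section Solve
variable {E X : Type} [AddCommGroup E] [Module ℂ E] [TopologicalSpace E] [IsTopologicalAddGroup E]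
    [ContinuousSMul ℂ E] [T2Space E] [FiniteDimensional ℂ E] [TopologicalSpace X]

/-- Linear equations depending on parameters can be solved continuously. -/
lemma exists_solution (Θ : X → E →ₗ[ℂ] E) (hΘ : ∀ y, Continuous fun x => Θ x y) (f : X → E)
    (hf : Continuous f) (x₀ : X) (h0 : Θ x₀ = lid) :
    ∃ U : Set X, IsOpen U ∧ x₀ ∈ U ∧ ∃ y : X → E, ContinuousOn y U ∧ (∀ x ∈ U, Θ x (y x) = f x) ∧
      y x₀ = f x₀ := by
  let b := finBasis ℂ E
  let N : X → Matrix (Fin (finrank ℂ E)) (Fin (finrank ℂ E)) ℂ :=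
    fun x => LinearMap.toMatrix b b (Θ x)
  have hr : Continuous fun v : E => b.equivFun v :=
    LinearMap.continuous_of_finiteDimensional b.equivFun.toLinearMap
  have hs : Continuous fun v : Fin (finrank ℂ E) → ℂ => b.equivFun.symm v :=
    LinearMap.continuous_of_finiteDimensional b.equivFun.symm.toLinearMap
  have hN : Continuous N := by
    refine continuous_matrix fun i j => ?_
    have h1 : ∀ x, N x i j = b.equivFun (Θ x (b j)) i := fun x => by
      simp only [N, LinearMap.toMatrix_apply, Basis.equivFun_apply]
    simp only [h1]
    exact (continuous_apply i).comp (hr.comp (hΘ _))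
  have hN0 : N x₀ = 1 := by simp only [N, h0, LinearMap.toMatrix_id]
  refine ⟨{x | (N x).det ≠ 0}, isOpen_ne_fun hN.matrix_det continuous_const, ?_,
    fun x => b.equivFun.symm ((N x)⁻¹ *ᵥ b.equivFun (f x)), ?_, fun x hx => ?_, ?_⟩
  · rw [Set.mem_ofPred_eq, hN0, det_one]; exact one_ne_zero
  · rw [continuousOn_iff_continuous_domRestrict]
    have h2 : Continuous fun x : {x | (N x).det ≠ 0} => (N x.1)⁻¹ :=
      continuous_inv_of_det (hN.comp continuous_subtype_val) fun x => x.2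
    exact hs.comp (h2.matrix_mulVec (hr.comp (hf.comp continuous_subtype_val)))
  · refine b.equivFun.injective ?_
    have h3 := LinearMap.toMatrix_mulVec_repr b b (Θ x)
      (b.equivFun.symm ((N x)⁻¹ *ᵥ b.equivFun (f x)))
    have h4 : ⇑(b.repr (b.equivFun.symm ((N x)⁻¹ *ᵥ b.equivFun (f x)))) =
        (N x)⁻¹ *ᵥ b.equivFun (f x) := b.equivFun.apply_symm_apply _
    rw [h4, mulVec_mulVec, mul_nonsing_inv _ (isUnit_iff_ne_zero.2 hx), one_mulVec] at h3
    exact h3.symm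
  · simp only [hN0, inv_one, one_mulVec, LinearEquiv.symm_apply_apply]

end Solve

lemma exists_star {E : Type} [AddCommGroup E] [Module ℝ E] [TopologicalSpace E]
    [IsTopologicalAddGroup E] [ContinuousSMul ℝ E] {W : Set E} (hW : IsOpen W) {M : E} (hM : M ∈ W) :
    ∃ U ⊆ W, IsOpen U ∧ M ∈ U ∧ ∀ m ∈ U, ∀ τ : UI, M + (τ : ℝ) • (m - M) ∈ U := by
  have hc : Continuous fun y : UI × E => M + (y.1 : ℝ) • (y.2 - M) := by fun_prop
  refine ⟨{m | ∀ τ : UI, M + (τ : ℝ) • (m - M) ∈ W}, fun m hm => ?_, ?_, fun τ => ?_,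
    fun m hm τ σ => ?_⟩
  · have := hm 1
    rwa [Set.Icc.coe_one, one_smul, add_sub_cancel] at this
  · have h1 := isClosedMap_snd_of_compactSpace _ (hW.isClosed_compl.preimage hc)
    rw [← isClosed_compl_iff]
    convert h1 using 1
    ext m
    simp [and_assoc]
  · rwa [sub_self, smul_zero, add_zero]
  · have := hm (σ * τ)
    rwa [add_sub_cancel_left, smul_smul]

section Slice

/-- The linearized action. -/
def inf (s t : A → V) (P : V → Mat κ) (M m : A → Mat κ) :
    (V → Mat κ) →ₗ[ℂ] (A → Mat κ) where
  toFun X a := P (t a) * m a * P (s a) * X (s a) * P (s a) - P (t a) * X (t a) * M a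
  map_add' X Y := funext fun a => by
    simp only [Pi.add_apply, mmul_add, madd_mul]; abel
  map_smul' c X := funext fun a => by
    simp only [Pi.smul_apply, mmul_smul, msmul_mul, smul_sub, RingHom.id_apply]

/-- Sandwiching between the projections. -/
def sand (s t : A → V) (P : V → Mat κ) : (A → Mat κ) →ₗ[ℂ] (A → Mat κ) where
  toFun m a := P (t a) * m a * P (s a)
  map_add' X Y := funext fun a => by
    simp only [Pi.add_apply, mmul_add, madd_mul]
  map_smul' c X := funext fun a => by simp_all

theorem exists_slice (hP : ∀ v, IsProj (P v)) {M : A → Mat κ}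
    (hM : ∀ a, P (t a) * M a * P (s a) = M a)
    (hR : ∀ Y : A → Mat κ, ∃ X : V → Mat κ, ∀ a,
      M a * X (s a) * P (s a) - P (t a) * X (t a) * M a = P (t a) * Y a * P (s a)) :
    ∃ U : Set (A → Mat κ), IsOpen U ∧ M ∈ U ∧
      (∀ m ∈ U, ∀ τ : UI, M + (τ : ℝ) • (m - M) ∈ U) ∧
      ∃ g : (A → Mat κ) → V → Mat κ, (∀ v, ContinuousOn (fun m => g m v) U) ∧
        (∀ m ∈ U, ∀ v, (g m v).det ≠ 0) ∧ (∀ m ∈ U, ∀ v, P v * g m v = g m v * P v) ∧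
        ∀ m ∈ U, ∀ a, P (t a) * m a * P (s a) * g m (s a) =
          g m (t a) * (P (t a) * M a * P (s a)) := by
  let b := finBasis ℂ (A → Mat κ)
  have hR' : ∀ Y, ∃ X, inf s t P M M X = sand s t P Y := fun Y => by
    obtain ⟨X, hX⟩ := hR Y
    refine ⟨X, funext fun a => ?_⟩
    refine Eq.trans ?_ (hX a)
    change P (t a) * M a * P (s a) * X (s a) * P (s a) - _ = _
    rw [hM]
  choose Xf hXf using hR'
  obtain ⟨S, hS⟩ : ∃ S : (A → Mat κ) →ₗ[ℂ] (V → Mat κ),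
      ∀ y, inf s t P M M (S y) = sand s t P y := by
    refine ⟨b.constr ℂ fun j => Xf (b j), fun y => ?_⟩
    refine lcongr_fun (f := (inf s t P M M).comp (b.constr ℂ fun j => Xf (b j)))
      (b.ext fun j => ?_) y
    rw [lcomp_apply, Basis.constr_basis, hXf]
  have hss : ∀ m, sand s t P (sand s t P m) = sand s t P m := fun m => funext fun a => by
    change P (t a) * (P (t a) * m a * P (s a)) * P (s a) = P (t a) * m a * P (s a)
    rw [← mulA, ← mulA, (hP _).idem, mulA _ _ (P (s a)), (hP _).idem]
  have hsM : sand s t P M = M := funext hM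
  have hsi : ∀ m X, sand s t P (inf s t P M m X) = inf s t P M m X := fun m X => funext fun a => by
    change P (t a) * (P (t a) * m a * P (s a) * X (s a) * P (s a) - P (t a) * X (t a) * M a) * P (s a)
      = P (t a) * m a * P (s a) * X (s a) * P (s a) - P (t a) * X (t a) * M a
    rw [← hM a]
    simp only [mmul_sub, msub_mul, mulA, (hP (s a)).idem]
    simp only [← mulA, (hP (t a)).idem]
  have hic : ∀ X, Continuous fun m => inf s t P M m X := fun X => by
    refine continuous_pi fun a => ?_
    change Continuous fun m : A → Mat κ =>
      P (t a) * m a * P (s a) * X (s a) * P (s a) - P (t a) * X (t a) * M a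
    fun_prop
  have hsc : Continuous fun m => sand s t P m := by
    refine continuous_pi fun a => ?_
    change Continuous fun m : A → Mat κ => P (t a) * m a * P (s a)
    fun_prop
  have hSc : Continuous fun y => S y := LinearMap.continuous_of_finiteDimensional S
  obtain ⟨U₀, hU₀, hM₀, y, hyc, hy, hyM⟩ := exists_solution
    (fun m => lid + (inf s t P M m - inf s t P M M).comp S)
    (fun y => by
      change Continuous fun m => y + (inf s t P M m (S y) - inf s t P M M (S y))
      exact continuous_const.add ((hic _).sub continuous_const))
    (fun m => M - sand s t P m) (continuous_const.sub hsc) M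
    (by rw [sub_self, LinearMap.zero_comp, add_zero])
  have hy1 : ∀ m ∈ U₀, y m + (inf s t P M m (S (y m)) - sand s t P (y m)) = M - sand s t P m :=
    fun m hm => by rw [← hS]; exact hy m hm
  have hy2 : ∀ m ∈ U₀, inf s t P M m (S (y m)) = M - sand s t P m := fun m hm => by
    have h1 := congrArg (sand s t P) (hy1 m hm)
    rw [map_add, map_sub, hss, hsi, map_sub, hsM, hss, add_sub_cancel] at h1
    exact h1
  let g : (A → Mat κ) → V → Mat κ := fun m v => 1 + P v * S (y m) v * P v
  have hgc : ∀ v, ContinuousOn (fun m => g m v) U₀ := fun v => by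
    have h1 : ContinuousOn (fun m => S (y m) v) U₀ :=
      ((continuous_apply v).comp hSc).comp_continuousOn hyc
    rw [continuousOn_iff_continuous_domRestrict] at h1 ⊢
    change Continuous fun m : U₀ => 1 + P v * S (y m) v * P v
    have h2 : Continuous fun m : U₀ => S (y m) v := h1
    exact continuous_const.add ((continuous_const.mul h2).mul continuous_const)
  have hgM : g M = 1 := funext fun v => by
    change 1 + P v * S (y M) v * P v = 1
    rw [hyM, hsM, sub_self, map_zero, Pi.zero_apply, mmul_zero, mzero_mul, add_zero]
  have hW : IsOpen {m | m ∈ U₀ ∧ ∀ v, (g m v).det ≠ 0} := by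
    have h1 : ∀ v, IsOpen (U₀ ∩ (fun m => (g m v).det) ⁻¹' {0}ᶜ) := fun v => by
      refine ContinuousOn.isOpen_inter_preimage ?_ hU₀ isOpen_compl_singleton
      exact (continuous_id.matrix_det).comp_continuousOn (hgc v)
    convert hU₀.inter (isOpen_iInter_of_finite h1) using 1
    ext m
    simp only [Set.mem_ofPred_eq, Set.mem_inter_iff, Set.mem_iInter, Set.mem_preimage,
      Set.mem_compl_iff, Set.mem_singleton_iff, ne_eq]
    exact ⟨fun h => ⟨h.1, fun v => ⟨h.1, h.2 v⟩⟩, fun h => ⟨h.1, fun v => (h.2 v).2⟩⟩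
  obtain ⟨U, hUW, hU, hMU, hst⟩ := exists_star hW
    ⟨hM₀, fun v => by rw [hgM, Pi.one_apply, det_one]; exact one_ne_zero⟩
  refine ⟨U, hU, hMU, hst, g, fun v => (hgc v).mono fun m hm => (hUW hm).1, fun m hm => (hUW hm).2,
    fun m hm v => ?_, fun m hm a => ?_⟩
  · change P v * (1 + P v * S (y m) v * P v) = (1 + P v * S (y m) v * P v) * P v
    rw [mmul_add, madd_mul, ← mulA, ← mulA, (hP v).idem,
      mulA _ (P v) (P v), (hP v).idem, mone_mul, mmul_one]
  · have h1 := congrFun (hy2 m (hUW hm).1) a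
    change P (t a) * m a * P (s a) * S (y m) (s a) * P (s a) - P (t a) * S (y m) (t a) * M a =
      M a - P (t a) * m a * P (s a) at h1
    change P (t a) * m a * P (s a) * (1 + P (s a) * S (y m) (s a) * P (s a)) =
      (1 + P (t a) * S (y m) (t a) * P (t a)) * (P (t a) * M a * P (s a))
    have h2 : P (t a) * m a * P (s a) * (P (s a) * S (y m) (s a) * P (s a)) =
        P (t a) * m a * P (s a) * S (y m) (s a) * P (s a) := by
      rw [← mulA, ← mulA, mulA _ (P (s a)) (P (s a)), (hP _).idem]
    have h3 : P (t a) * S (y m) (t a) * P (t a) * (P (t a) * M a * P (s a)) =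
        P (t a) * S (y m) (t a) * M a := by
      have : P (t a) * (P (t a) * M a * P (s a)) = M a := by
        rw [← mulA, ← mulA, (hP _).idem, hM]
      rw [mulA _ (P (t a)), this]
    rw [mmul_add, madd_mul, mmul_one, mone_mul, h2, h3, hM]
    rw [sub_eq_sub_iff_add_eq_add] at h1
    rw [add_comm, h1, add_comm]

end Slice

/-! ### Lowering the dimension at a sink -/

section Lower

lemma isProj_Qb {q : V → Mat κ} (h : ∀ v, IsProj (q v)) : IsProj (Qb s t i q) := by
  refine ⟨?_, ?_⟩
  · rw [Qb, blockDiagonal_conjTranspose]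
    exact congrArg blockDiagonal (funext fun a => (h _).herm)
  · rw [Qb, ← blockDiagonal_mul]
    exact congrArg blockDiagonal (funext fun a => (h _).idem)

lemma inc_Qb (m : A → Mat κ) (q : V → Mat κ) :
    inc t P i m * Qb s t i q = row fun a => P i * m a.1 * q (s a.1) := row_mul _ _

lemma row_congr {I J : Type} {f g : I → Matrix J κ ℂ} (h : ∀ a, f a = g a) : row f = row g :=
  congrArg row (funext h)

lemma row_zero {I J : Type} {f : I → Matrix J κ ℂ} (h : ∀ a, f a = 0) : row f = 0 :=
  row_congr (g := fun _ => 0) h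

lemma zero_of_row {I J : Type} {f : I → Matrix J κ ℂ} (h : row f = 0) (a : I) : f a = 0 := by
  ext x y
  exact congrFun (congrFun h x) (y, a)

variable (s t P i)

/-- The parameter space of configurations of subspaces. -/
structure IsS (e : V → ℕ) (k : ℕ) (q : V → Mat κ)
    (L : Mat (κ × In t i)) : Prop where
  proj : ∀ v, IsProj (q v)
  le : ∀ v, P v * q v = q v
  tr : ∀ v, (q v).trace = e v
  lproj : IsProj L
  ltr : L.trace = k
  lle : Qb s t i q * L = L

/-- The parameter space of configurations of subspaces. -/
abbrev SS (e : V → ℕ) (k : ℕ) : Type :=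
  {x : (V → Mat κ) × Mat (κ × In t i) // IsS s t P i e k x.1 x.2}

variable {s t P i}

lemma IsS.bun {e : V → ℕ} {k : ℕ} {q : V → Mat κ} {L : Mat (κ × In t i)}
    (h : IsS s t P i e k q L) : IsProj (Qb s t i q - L) := (isProj_Qb h.proj).sub h.lproj h.lle

lemma IsS.bun_tr {e : V → ℕ} {k : ℕ} {q : V → Mat κ}
    {L : Mat (κ × In t i)} (h : IsS s t P i e k q L) :
    (Qb s t i q - L).trace = ((∑ a : In t i, e (s a.1)) - k : ℕ) := by
  have h1 := h.bun.trace_eq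
  have h2 : (Qb s t i q).trace = ((∑ a : In t i, e (s a.1) : ℕ) : ℂ) := by
    rw [Qb, trace_blockDiagonal, Nat.cast_sum]
    exact sum_congr rfl fun a _ => h.tr _
  rw [trace_sub, h2, h.ltr, sub_eq_iff_eq_add] at h1
  have h3 : (∑ a : In t i, e (s a.1)) = (Qb s t i q - L).rank + k := by exact_mod_cast h1
  rw [h.bun.trace_eq, h3, Nat.add_sub_cancel]

/-- A block of a block row. -/
def blk {I J : Type} (w : Matrix J (κ × I) ℂ) (a : I) : Matrix J κ ℂ := fun x y => w x (y, a)

variable (t i) in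
/-- Families of maps supported at the arrows ending in a vertex. -/
def inj : Matrix κ (κ × In t i) ℂ →+ (A → Mat κ) where
  toFun w a := if h : t a = i then blk w ⟨a, h⟩ else 0
  map_zero' := funext fun a => by aesop
  map_add' v w := funext fun a => by aesop

variable {e : V → ℕ} {k : ℕ} {m : A → Mat κ} {q : V → Mat κ} {L : Mat (κ × In t i)}

lemma inj_eq (w : Matrix κ (κ × In t i) ℂ) (a : In t i) : inj t i w a.1 = blk w a := dif_pos a.2

lemma inj_ne (w : Matrix κ (κ × In t i) ℂ) {a : A} (h : t a ≠ i) : inj t i w a = 0 := dif_neg h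

lemma inc_inj (w : Matrix κ (κ × In t i) ℂ) : inc t P i (inj t i w) = P i * w := by
  have h : w = row fun a : In t i => inj t i w a.1 := by
    ext x ⟨y, a⟩
    rw [row, inj_eq]; rfl
  rw [inc]
  nth_rw 2 [h]
  rfl

lemma inc_add (m m' : A → Mat κ) : inc t P i (m + m') = inc t P i m + inc t P i m' := by
  have h : (fun a : In t i => P i * (m + m') a.1) =
      fun a : In t i => P i * m a.1 + P i * m' a.1 := funext fun a => by
    rw [Pi.add_apply, mmul_add]
  rw [inc, h]
  rfl

lemma continuous_Qb {X : Type} [TopologicalSpace X] {f : X → V → Mat κ}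
    (hf : Continuous f) : Continuous fun x => Qb s t i (f x) :=
  Continuous.matrix_blockDiagonal (continuous_pi fun a => (continuous_apply _).comp hf)

lemma IsG.toS (h : IsG s t P i e k m q L) : IsS s t P i e k q L :=
  ⟨h.proj, h.le, h.tr, h.lproj, h.ltr, h.lle⟩

lemma IsG.inc_eq (hP : ∀ v, IsProj (P v)) (h : IsG s t P i e k m q L) :
    q i * (inc t P i m * (Qb s t i q - L)) = inc t P i m * (Qb s t i q - L) := by
  rw [mmul_sub, h.van, sub_zero, inc_Qb, mul_row]
  refine row_congr ?_
  rintro ⟨a, rfl⟩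
  have := h.inv a
  rw [msub_mul, msub_mul, sub_eq_zero] at this
  change q (t a) * (P (t a) * m a * q (s a)) = P (t a) * m a * q (s a)
  rw [this, ← mulA, ← mulA, (h.proj _).idem]

lemma IsG.inj_add (hP : ∀ v, IsProj (P v)) (h : IsG s t P i e k m q L)
    {w : Matrix κ (κ × In t i) ℂ} (h1 : q i * w = w) (h2 : w * (Qb s t i q - L) = w) :
    IsG s t P i e k (m + inj t i w) q L := by
  refine ⟨h.proj, h.le, h.tr, fun a => ?_, h.lproj, h.ltr, h.lle, ?_⟩
  · rw [Pi.add_apply, mmul_add, madd_mul, h.inv, zero_add]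
    by_cases ha : t a = i
    · subst ha
      have h3 : (P (t a) - q (t a)) * inj t (t a) w a = 0 := by
        have h4 : (P (t a) - q (t a)) * w = 0 := by
          rw [← h1, ← mulA, msub_mul, h.le, (h.proj _).idem, sub_self, mzero_mul]
        have h5 : inj t (t a) w a = blk w ⟨a, rfl⟩ := inj_eq w ⟨a, rfl⟩
        rw [h5]
        ext x y
        exact congrFun (congrFun h4 x) (y, ⟨a, rfl⟩)
      rw [h3, mzero_mul]
    · rw [inj_ne w ha, mmul_zero, mzero_mul]
  · rw [inc_add, madd_mul, h.van, zero_add, inc_inj, ← h2, mulA, mulA,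
      msub_mul, h.lle, h.lproj.idem, sub_self, mmul_zero, mmul_zero]

lemma inc_inj_add (h : IsG s t P i e k m q L)
    {w : Matrix κ (κ × In t i) ℂ} (h1 : q i * w = w) :
    inc t P i (m + inj t i w) = inc t P i m + w := by
  rw [inc_add, inc_inj, ← h1, ← mulA, h.le]

lemma continuous_inj : Continuous (inj t i : Matrix κ (κ × In t i) ℂ →+ (A → Mat κ)) := by
  refine continuous_pi fun a => continuous_matrix fun x y => ?_
  by_cases h : t a = i
  · have : ∀ w : Matrix κ (κ × In t i) ℂ, inj t i w a x y = w x (y, ⟨a, h⟩) := fun w => by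
      rw [inj_eq w ⟨a, h⟩]; rfl
    simp only [this]
    exact continuous_id.matrix_elem _ _
  · simp only [inj_ne _ h]
    exact continuous_const

lemma continuous_inc : Continuous fun m : A → Mat κ => inc t P i m := by
  refine continuous_matrix fun x y => ?_
  exact Continuous.matrix_elem (A := fun m : A → Mat κ => P i * m y.2.1) (by fun_prop) x y.1

variable (s t i) in
/-- The degeneracy situation at a sink. -/
def step (hP : ∀ v, IsProj (P v)) {U : Set (A → Mat κ)} (hU : IsOpen U) (e : V → ℕ) (k : ℕ) :
    Step (A → Mat κ) (SS s t P i e k) κ (κ × In t i) ((∑ a : In t i, e (s a.1)) - k) (e i) where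
  U := U
  hU := hU
  A := {y | y.1 ∈ U ∧ IsG s t P i e k y.1 y.2.1.1 y.2.1.2}
  Q := ⟨fun x => Qb s t i x.1.1 - x.1.2,
    (continuous_Qb (continuous_fst.comp continuous_subtype_val)).sub
      (continuous_snd.comp continuous_subtype_val), fun x => x.2.bun, fun x => x.2.bun_tr⟩
  R := ⟨fun x => x.1.1 i, by fun_prop, fun x => x.2.proj i, fun x => x.2.tr i⟩
  φ := ⟨fun m => inc t P i m, continuous_inc⟩
  ι := inj t i
  hι := continuous_inj
  mem y hy := hy.1
  tr y hy w h1 h2 hU := ⟨hU, hy.2.inj_add hP h1 h2⟩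
  hφ y hy := hy.2.inc_eq hP
  φ_tr y hy w h1 h2 := inc_inj_add hy.2 h1

/-- The base. -/
def homeoB (hP : ∀ v, IsProj (P v)) {U : Set (A → Mat κ)} (hU : IsOpen U) (e : V → ℕ)
    (k : ℕ) : GU s t P i U e k ≃ₜ (step s t i hP hU e k).Base where
  toFun y := ⟨(y.1.1, ⟨y.1.2, y.2.2.toS⟩), y.2⟩
  invFun y := ⟨(y.1.1, y.1.2.1), y.2⟩
  left_inv _ := rfl
  right_inv _ := rfl
  continuous_toFun := by fun_prop
  continuous_invFun := by fun_prop

lemma IsG.add_line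
    {L p : Mat (κ × In t i)} (h : IsG s t P i e k m q L)
    (hp : IsPt p) (h1 : (Qb s t i q - L) * p = p) (h2 : inc t P i m * p = 0) :
    IsG s t P i e (k + 1) m q (L + p) ∧ (L + p) * p = p := by
  have h3 : L * Qb s t i q = L := (isProj_Qb h.proj).symm h.lproj h.lle
  have h4 : L * p = 0 := by
    rw [← h1, ← mulA, mmul_sub, h3, h.lproj.idem, sub_self, mzero_mul]
  have h5 : Qb s t i q * p = p := by
    rwa [msub_mul, h4, sub_zero] at h1
  refine ⟨⟨h.proj, h.le, h.tr, h.inv, h.lproj.add hp.isProj h4, ?_, ?_, ?_⟩, ?_⟩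
  · rw [trace_add, h.ltr, hp.tr, Nat.cast_add, Nat.cast_one]
  · rw [mmul_add, h.lle, h5]
  · rw [mmul_add, h.van, h2, add_zero]
  · rw [madd_mul, h4, hp.idem, zero_add]

lemma IsG.sub_line
    {L p : Mat (κ × In t i)}
    (h : IsG s t P i e (k + 1) m q L) (hp : IsPt p) (h1 : L * p = p) :
    IsG s t P i e k m q (L - p) ∧ (Qb s t i q - (L - p)) * p = p ∧ inc t P i m * p = 0 := by
  have h5 : Qb s t i q * p = p := by
    rw [← h1, ← mulA, h.lle]
  have h6 : inc t P i m * p = 0 := by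
    rw [← h1, ← mulA, h.van, mzero_mul]
  refine ⟨⟨h.proj, h.le, h.tr, h.inv, h.lproj.sub hp.isProj h1, ?_, ?_, ?_⟩, ?_, h6⟩
  · rw [trace_sub, h.ltr, hp.tr, Nat.cast_add, Nat.cast_one, add_sub_cancel_right]
  · rw [mmul_sub, h.lle, h5]
  · rw [mmul_sub, h.van, h6, sub_zero]
  · rw [msub_mul, msub_mul, h1, h5, hp.idem, sub_self, sub_zero]

/-- The bundle of relations. -/
def bunL (U : Set (A → Mat κ)) (e : V → ℕ) (k : ℕ) :
    Bun (GU s t P i U e k) (κ × In t i) k :=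
  ⟨fun x => x.1.2.2, by fun_prop, fun x => x.2.2.lproj, fun x => x.2.2.ltr⟩

/-- Lines on which the map vanishes. -/
def homeoL (hP : ∀ v, IsProj (P v)) {U : Set (A → Mat κ)} (hU : IsOpen U) (e : V → ℕ)
    (k : ℕ) : (bunL (s := s) (t := t) (P := P) (i := i) U e (k + 1)).PB ≃ₜ
      (step s t i hP hU e k).ZQ where
  toFun x := ⟨(x.1.1.1.1, ⟨(⟨(x.1.1.1.2.1, x.1.1.1.2.2 - x.1.2.1),
    (x.1.1.2.2.sub_line x.1.2.2 x.2).1.toS⟩, x.1.2), (x.1.1.2.2.sub_line x.1.2.2 x.2).2.1⟩),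
    ⟨x.1.1.2.1, (x.1.1.2.2.sub_line x.1.2.2 x.2).1⟩, (x.1.1.2.2.sub_line x.1.2.2 x.2).2.2⟩
  invFun y := ⟨(⟨(y.1.1, y.1.2.1.1.1.1, y.1.2.1.1.1.2 + y.1.2.1.2.1), y.2.1.1,
    (y.2.1.2.add_line y.1.2.1.2.2 y.1.2.2 y.2.2).1⟩, y.1.2.1.2),
    (y.2.1.2.add_line y.1.2.1.2.2 y.1.2.2 y.2.2).2⟩
  left_inv x := by simp_all
  right_inv y := by simp_all
  continuous_toFun := by fun_prop
  continuous_invFun := by fun_prop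

lemma Qb_update (hl : ∀ a, t a = i → s a ≠ i) (q : V → Mat κ) (x : Mat κ) :
    Qb s t i (update q i x) = Qb s t i q :=
  congrArg blockDiagonal (funext fun a => update_of_ne (hl _ a.2) _ _)

lemma IsG.dead (h : IsG s t P i e k m q L) {v : V} (hv : P v = 0) :
    q v = 0 := by rw [← h.le, hv, mzero_mul]

lemma IsG.lower (hP : ∀ v, IsProj (P v)) (hl : ∀ a, t a = i → s a ≠ i)
    (ho : ∀ a, s a = i → P (t a) = 0)
    (h : IsG s t P i (update e i (e i + 1)) k m q L) {p : Mat κ}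
    (hp : IsPt p) (h1 : q i * p = p) (h2 : p * inc t P i m * (Qb s t i q - L) = 0) :
    IsG s t P i e k m (update q i (q i - p)) L ∧ (P i - (q i - p)) * p = p := by
  have hPp : P i * p = p := by rw [← h1, ← mulA, h.le]
  have hpP : p * P i = p := (hP i).symm hp.isProj hPp
  rw [mmul_sub, mulA p _ L, h.van, mmul_zero, sub_zero, mulA, inc_Qb, mul_row] at h2
  refine ⟨⟨fun v => ?_, fun v => ?_, fun v => ?_, fun a => ?_, h.lproj, h.ltr, ?_, h.van⟩, ?_⟩
  · by_cases hv : v = i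
    · subst hv; rw [update_self]; exact (h.proj v).sub hp.isProj h1
    · rw [update_of_ne hv]; exact h.proj v
  · by_cases hv : v = i
    · subst hv; rw [update_self, mmul_sub, h.le, hPp]
    · rw [update_of_ne hv]; exact h.le v
  · by_cases hv : v = i
    · subst hv
      rw [update_self, trace_sub, h.tr, update_self, hp.tr, Nat.cast_add,
        Nat.cast_one, add_sub_cancel_right]
    · rw [update_of_ne hv, h.tr, update_of_ne hv]
  · by_cases ha : t a = i
    · subst ha
      have h3 : p * (P (t a) * m a * q (s a)) = 0 := zero_of_row h2 (⟨a, rfl⟩ : In t (t a))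
      rw [update_self, update_of_ne (hl a rfl), sub_sub_eq_add_sub, add_sub_right_comm, madd_mul,
        madd_mul, h.inv, zero_add, ← hpP]
      simpa only [mulA] using h3
    · rw [update_of_ne ha]
      by_cases hs : s a = i
      · rw [h.dead (ho a hs), ho a hs, sub_zero, mzero_mul, mzero_mul]
      · rw [update_of_ne hs, h.inv]
  · rw [Qb_update hl, h.lle]
  · rw [msub_mul, msub_mul, h1, hPp, hp.idem, sub_self, sub_zero]

lemma IsG.raise (hP : ∀ v, IsProj (P v)) (hl : ∀ a, t a = i → s a ≠ i)
    (ho : ∀ a, s a = i → P (t a) = 0)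
    (h : IsG s t P i e k m q L) {p : Mat κ}
    (hp : IsPt p) (h1 : (P i - q i) * p = p) :
    IsG s t P i (update e i (e i + 1)) k m (update q i (q i + p)) L ∧
      (q i + p) * p = p ∧ p * inc t P i m * (Qb s t i (update q i (q i + p)) - L) = 0 := by
  have hqP : q i * P i = q i := (hP i).symm (h.proj i) (h.le i)
  have hqp : q i * p = 0 := by
    rw [← h1, ← mulA, mmul_sub, hqP, (h.proj i).idem, sub_self, mzero_mul]
  have hPp : P i * p = p := by
    rwa [msub_mul, hqp, sub_zero] at h1
  have hpp : p * (P i - q i) = p := ((hP i).sub (h.proj i) (h.le i)).symm hp.isProj h1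
  have h3 : ∀ a, t a = i → p * (m a * q (s a)) = 0 := by
    rintro a rfl
    have h4 := h.inv a
    rw [← hpp, mulA, ← mulA (P _ - _), h4, mmul_zero]
  have hpP : p * P i = p := (hP i).symm hp.isProj hPp
  refine ⟨⟨fun v => ?_, fun v => ?_, fun v => ?_, fun a => ?_, h.lproj, h.ltr, ?_, h.van⟩, ?_, ?_⟩
  · by_cases hv : v = i
    · subst hv; rw [update_self]; exact (h.proj v).add hp.isProj hqp
    · rw [update_of_ne hv]; exact h.proj v
  · by_cases hv : v = i
    · subst hv; rw [update_self, mmul_add, h.le, hPp]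
    · rw [update_of_ne hv]; exact h.le v
  · by_cases hv : v = i
    · subst hv
      rw [update_self, trace_add, h.tr, update_self, hp.tr, Nat.cast_add, Nat.cast_one]
    · rw [update_of_ne hv, h.tr, update_of_ne hv]
  · by_cases ha : t a = i
    · have h5 := h3 a ha
      subst ha
      rw [update_self, update_of_ne (hl a rfl), ← sub_sub, msub_mul,
        msub_mul, h.inv, mulA, h5, sub_self]
    · rw [update_of_ne ha]
      by_cases hs : s a = i
      · rw [h.dead (ho a hs), ho a hs, sub_zero, mzero_mul, mzero_mul]
      · rw [update_of_ne hs, h.inv]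
  · rw [Qb_update hl, h.lle]
  · rw [madd_mul, hqp, hp.idem, zero_add]
  · rw [Qb_update hl, mmul_sub, mulA p _ L, h.van, mmul_zero, sub_zero, mulA, inc_Qb, mul_row]
    refine row_zero fun a => ?_
    rw [mulA, ← mulA, hpP, h3 a.1 a.2]

/-- The bundle of quotients. -/
def bunP (hP : ∀ v, IsProj (P v)) (U : Set (A → Mat κ)) (e : V → ℕ) (k n : ℕ)
    (hn : (P i).trace = e i + n) : Bun (GU s t P i U e k) κ n :=
  ⟨fun x => P i - x.1.2.1 i, by fun_prop, fun x => (hP i).sub (x.2.2.proj i) (x.2.2.le i),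
    fun x => by rw [trace_sub, hn, x.2.2.tr, add_sub_cancel_left]⟩

lemma continuous_update_self {X : Type} [TopologicalSpace X] {f : X → V → Mat κ}
    {g : X → Mat κ} (hf : Continuous f) (hg : Continuous g) :
    Continuous fun x => update (f x) i (g x) := hf.update i hg

lemma update_sub_add (q : V → Mat κ) (p : Mat κ) :
    update (update q i (q i - p)) i (update q i (q i - p) i + p) = q := by grind

lemma update_add_sub (q : V → Mat κ) (p : Mat κ) :
    update (update q i (q i + p)) i (update q i (q i + p) i - p) = q := by grind

/-- Lines orthogonal to the image. -/
def homeoP (hP : ∀ v, IsProj (P v)) (hl : ∀ a, t a = i → s a ≠ i)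
    (ho : ∀ a, s a = i → P (t a) = 0) {U : Set (A → Mat κ)} (hU : IsOpen U) (e : V → ℕ)
    (k n : ℕ) (hn : (P i).trace = e i + n) :
    (step s t i hP hU (update e i (e i + 1)) k).ZR ≃ₜ
      (bunP (s := s) (t := t) hP U e k n hn).PB where
  toFun y := ⟨(⟨(y.1.1, update y.1.2.1.1.1.1 i (y.1.2.1.1.1.1 i - y.1.2.1.2.1),
      y.1.2.1.1.1.2), y.2.1.1, (y.2.1.2.lower hP hl ho y.1.2.1.2.2 y.1.2.2 y.2.2).1⟩, y.1.2.1.2), by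
    change (P i - update y.1.2.1.1.1.1 i (y.1.2.1.1.1.1 i - y.1.2.1.2.1) i) * y.1.2.1.2.1 =
      y.1.2.1.2.1
    rw [update_self]
    exact (y.2.1.2.lower hP hl ho y.1.2.1.2.2 y.1.2.2 y.2.2).2⟩
  invFun x := ⟨(x.1.1.1.1, ⟨(⟨(update x.1.1.1.2.1 i (x.1.1.1.2.1 i + x.1.2.1),
      x.1.1.1.2.2), (x.1.1.2.2.raise hP hl ho x.1.2.2 x.2).1.toS⟩, x.1.2), by
    change update x.1.1.1.2.1 i (x.1.1.1.2.1 i + x.1.2.1) i * x.1.2.1 = x.1.2.1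
    rw [update_self]
    exact (x.1.1.2.2.raise hP hl ho x.1.2.2 x.2).2.1⟩),
    ⟨x.1.1.2.1, (x.1.1.2.2.raise hP hl ho x.1.2.2 x.2).1⟩,
    (x.1.1.2.2.raise hP hl ho x.1.2.2 x.2).2.2⟩
  left_inv y := by simp_all
  right_inv x := by simp_all
  continuous_toFun := by fun_prop
  continuous_invFun := by fun_prop

theorem ov_lower (hP : ∀ v, IsProj (P v)) (hl : ∀ a, t a = i → s a ≠ i)
    (ho : ∀ a, s a = i → P (t a) = 0) {U : Set (A → Mat κ)} (hU : IsOpen U) (e : V → ℕ)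
    (k n : ℕ) (hn : (P i).trace = e i + (n + 1 : ℕ))
    (h0 : (C (GU s t P i U (update e i (e i + 1)) k)).OV)
    (h1 : (C (GU s t P i U (update e i (e i + 1)) (k + 1))).OV) :
    (C (GU s t P i U e k)).OV := by
  have hB := (QI_of_homeo (homeoB hP hU
    (update e i (e i + 1)) k)).ov_iff.1 h0
  have hQ := (QI_of_homeo (homeoL hP hU
    (update e i (e i + 1)) k)).ov_iff.1 ((bunL U _ _).ov_PB h1)
  have hR := (QI_of_homeo (homeoP hP hl ho hU e k (n + 1) hn)).ov_iff.1
    ((step _ _ _ hP hU (update e i (e i + 1)) k).transfer hB hQ)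
  exact (bunP hP U e k (n + 1) hn).ov_base hR

/-- Lowering the dimension at a sink all the way. -/
theorem ov_sink (hP : ∀ v, IsProj (P v)) (hl : ∀ a, t a = i → s a ≠ i)
    (ho : ∀ a, s a = i → P (t a) = 0) {M : A → Mat κ}
    (hM : ∀ a, P (t a) * M a * P (s a) = M a)
    (hR : ∀ Y : A → Mat κ, ∃ X : V → Mat κ, ∀ a,
      M a * X (s a) * P (s a) - P (t a) * X (t a) * M a = P (t a) * Y a * P (s a))
    (h : ∀ e k, (P i).trace = e i → (C (GU s t P i {M} e k)).OV) (e : V → ℕ) (k : ℕ) :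
    (C (GU s t P i {M} e k)).OV := by
  obtain ⟨U, hU, hMU, hst, g, hg, hd, hc, hm⟩ := exists_slice hP hM hR
  have hsl := ov_slice (i := i) hP hMU hst g hg hd hc hm
  have key : ∀ n e k, (P i).trace = e i + (n : ℕ) → (C (GU s t P i U e k)).OV := by
    intro n
    induction n with
    | zero =>
      intro e k hn
      exact (hsl e k).2 (h e k (by rwa [Nat.cast_zero, add_zero] at hn))
    | succ n ih =>
      intro e k hn
      have hn' : (P i).trace = update e i (e i + 1) i + (n : ℕ) := by
        rw [hn, update_self]; push_cast; ring
      exact ov_lower hP hl ho hU e k n hn (ih _ _ hn') (ih _ _ hn')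
  by_cases he : e i ≤ (P i).rank
  · refine (hsl e k).1 (key ((P i).rank - e i) e k ?_)
    rw [(hP i).trace_eq, ← Nat.cast_add, Nat.add_sub_cancel' he]
  · have : IsEmpty (GU s t P i {M} e k) := ⟨fun x => he <| by
      have h1 := ((hP i).sub (x.2.2.proj i) (x.2.2.le i)).trace_eq
      rw [trace_sub, (hP i).trace_eq, x.2.2.tr, sub_eq_iff_eq_add] at h1
      have h2 : (P i).rank = (P i - x.1.2.1 i).rank + e i := by exact_mod_cast h1
      omega⟩
    exact OV_empty

end Lower

section Iso
variable {ν : Type} [Fintype ν] [DecidableEq ν]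

/-- Conjugation by an isometry. -/
def cj (α : Matrix ν κ ℂ) (x : Mat κ) : Mat ν := α * x * αᴴ

variable {α : Matrix ν κ ℂ}

lemma cj_mul (hα : αᴴ * α = 1) (x y : Mat κ) : cj α x * cj α y = cj α (x * y) := by
  rw [cj, cj, cj, mulA, ← mulA αᴴ, ← mulA αᴴ, hα, mone_mul]
  simp only [mulA]

lemma cj_back (hα : αᴴ * α = 1) (x : Mat κ) : cj αᴴ (cj α x) = x := by
  rw [cj, cj, conjTranspose_conjTranspose, mulA, mulA, hα, mmul_one, ← mulA, hα, mone_mul]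

lemma cj_inj (hα : αᴴ * α = 1) {x y : Mat κ} (h : cj α x = cj α y) : x = y := by
  rw [← cj_back hα x, h, cj_back hα]

lemma cj_trace (hα : αᴴ * α = 1) (x : Mat κ) : (cj α x).trace = x.trace := by
  rw [cj, trace_mul_comm, ← mulA, hα, mone_mul]

lemma cj_zero : cj α 0 = 0 := by rw [cj, mmul_zero, mzero_mul]

lemma cj_sub (x y : Mat κ) : cj α (x - y) = cj α x - cj α y := by
  rw [cj, cj, cj, mmul_sub, msub_mul]

lemma cj_smul (c : ℂ) (x : Mat κ) : cj α (c • x) = c • cj α x := by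
  rw [cj, cj, mmul_smul, msmul_mul]

lemma cj_proj (hα : αᴴ * α = 1) {x : Mat κ} (hx : IsProj x) : IsProj (cj α x) :=
  ⟨by rw [cj, conjTranspose_mul, conjTranspose_mul, conjTranspose_conjTranspose, hx.herm,
    mulA], by rw [cj_mul hα, hx.idem]⟩

/-- A matrix supported in the image of `α` comes from a matrix. -/
lemma cj_forth {P : Mat κ} {y : Mat ν}
    (h : cj α P * y * cj α P = y) : cj α (P * cj αᴴ y * P) = y := by
  conv_rhs => rw [← h]
  rw [cj, cj, cj, conjTranspose_conjTranspose]
  simp only [mulA]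

lemma comp_inj {J : Type} [Fintype J] [DecidableEq J] {β : Matrix ν J ℂ} (hα : αᴴ * α = 1)
    (hβ : βᴴ * β = 1) {w w' : Matrix κ J ℂ} (h : α * w * βᴴ = α * w' * βᴴ) : w = w' := by
  have h1 : ∀ w : Matrix κ J ℂ, αᴴ * (α * w * βᴴ) * β = w := fun w => by
    rw [mulA, mulA, hβ, mmul_one, ← mulA, hα, mone_mul]
  rw [← h1 w, h, h1]

end Iso

section Amb

/-- Points of a quiver Grassmannian, as tuples of orthogonal projections. -/
structure IsGr (s t : A → V) (P : V → Mat κ) (M : A → Mat κ) (e : V → ℕ)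
    (q : V → Mat κ) : Prop where
  proj : ∀ v, IsProj (q v)
  le : ∀ v, P v * q v = q v
  tr : ∀ v, (q v).trace = e v
  inv : ∀ a, (P (t a) - q (t a)) * M a * q (s a) = 0

/-- The quiver Grassmannian. -/
abbrev Gr (s t : A → V) (P : V → Mat κ) (M : A → Mat κ) (e : V → ℕ) : Type :=
  {q : V → Mat κ // IsGr s t P M e q}

/-- Forgetting a zero subspace. -/
def homeoGr (e : V → ℕ) : GU s t P i {M} e 0 ≃ₜ Gr s t P M e where
  toFun y := ⟨y.1.2.1, y.2.2.proj, y.2.2.le, y.2.2.tr, fun a => by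
    have h := y.2.2.inv a
    rwa [Set.mem_singleton_iff.1 y.2.1] at h⟩
  invFun q := ⟨(M, q.1, 0), rfl, q.2.proj, q.2.le, q.2.tr, q.2.inv, .zero, by
    rw [trace_zero, Nat.cast_zero], mmul_zero _, mmul_zero _⟩
  left_inv y := by
    refine sext (Prod.ext (Set.mem_singleton_iff.1 y.2.1).symm (Prod.ext rfl ?_))
    exact (y.2.2.lproj.eq_zero (by rw [y.2.2.ltr, Nat.cast_zero])).symm
  right_inv q := rfl
  continuous_toFun := by fun_prop
  continuous_invFun := by fun_prop

end Amb

/-! ### Reflections -/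

section Block

/-- A block of a block column. -/
def bl (X : Matrix (κ × I) J ℂ) (a : I) : Matrix κ J ℂ := fun x y => X (x, a) y

lemma bl_mul {J' : Type} (X : Matrix (κ × I) J ℂ) (Y : Matrix J J' ℂ) (a : I) :
    bl (X * Y) a = bl X a * Y := rfl

lemma bl_diag (D : I → Mat κ) (X : Matrix (κ × I) J ℂ) (a : I) :
    bl (blockDiagonal D * X) a = D a * bl X a := by
  ext x y
  simp only [bl, mmul_apply, blockDiagonal_apply, Fintype.sum_prod_type, ite_mul, zero_mul,
    Finset.sum_ite_eq, mem_univ, if_true]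

lemma bl_ext {X Y : Matrix (κ × I) J ℂ} (h : ∀ a, bl X a = bl Y a) : X = Y := by
  ext ⟨x, a⟩ y
  exact congrFun (congrFun (h a) x) y

end Block

section Reflect
variable {ν : Type} [Fintype ν] [DecidableEq ν]

section Def
variable (s t : A → V) (i : V) (P : V → Mat κ) (M : A → Mat κ)
  (K : Mat (κ × In t i)) (σ : Matrix (κ × In t i) κ ℂ)
  (α : Matrix ν κ ℂ) (β : Matrix ν (κ × In t i) ℂ)

/-- Sources of the reflected quiver. -/
def rs (a : A) : V := if t a = i then i else s a

/-- Targets of the reflected quiver. -/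
def rt (a : A) : V := if t a = i then s a else t a

/-- Spaces of the reflected representation. -/
def rP (v : V) : Mat ν := if v = i then cj β K else cj α (P v)

/-- Maps of the reflected representation. -/
def rM (a : A) : Mat ν := if h : t a = i then α * bl K ⟨a, h⟩ * βᴴ else cj α (M a)

/-- The kernel and a section of the incoming map. -/
structure IsRefl : Prop where
  proj : IsProj K
  eq : K = Qb s t i P - σ * inc t P i M
  sec : inc t P i M * σ = P i
  le : Qb s t i P * σ = σ
  right : σ * P i = σ

end Def

variable {K : Mat (κ × In t i)} {σ : Matrix (κ × In t i) κ ℂ}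
  {α : Matrix ν κ ℂ} {β : Matrix ν (κ × In t i) ℂ}

lemma Qb_mul (q q' : V → Mat κ) : Qb s t i q * Qb s t i q' = Qb s t i fun v => q v * q' v :=
  (blockDiagonal_mul _ _).symm

lemma inc_mul_Qb (hM : ∀ a, P (t a) * M a * P (s a) = M a) (hP : ∀ v, IsProj (P v)) :
    inc t P i M * Qb s t i P = inc t P i M := by
  rw [inc_Qb]
  refine row_congr fun a => ?_
  conv_rhs => rw [← hM a.1]
  conv_lhs => rw [← hM a.1, mulA, mulA, (hP _).idem]

lemma mul_inc (hP : ∀ v, IsProj (P v)) : P i * inc t P i M = inc t P i M := by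
  rw [inc, mul_row]
  exact row_congr fun a => by rw [← mulA, (hP i).idem]

lemma IsRefl.le_K (hK : IsRefl s t i P M K σ) (hP : ∀ v, IsProj (P v)) : Qb s t i P * K = K := by
  rw [hK.eq, mmul_sub, ← mulA, hK.le, (isProj_Qb hP).idem]

lemma IsRefl.van (hK : IsRefl s t i P M K σ) (hP : ∀ v, IsProj (P v))
    (hM : ∀ a, P (t a) * M a * P (s a) = M a) : inc t P i M * K = 0 := by
  rw [hK.eq, mmul_sub, ← mulA, hK.sec, inc_mul_Qb hM hP, mul_inc hP, sub_self]

lemma IsRefl.mul_eq (hK : IsRefl s t i P M K σ) {J : Type} {X : Matrix (κ × In t i) J ℂ}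
    (h1 : Qb s t i P * X = X) (h2 : inc t P i M * X = 0) : K * X = X := by
  rw [hK.eq, msub_mul, h1, mulA, h2, mmul_zero, sub_zero]

variable (s t P M) in
/-- A representation. -/
structure IsRep : Prop where
  proj : ∀ v, IsProj (P v)
  map : ∀ a, P (t a) * M a * P (s a) = M a

variable (s t P M) in
/-- An endomorphism. -/
structure IsEnd (φ : V → Mat κ) : Prop where
  le : ∀ v, P v * φ v * P v = φ v
  comm : ∀ a, M a * φ (s a) = φ (t a) * M a

variable (s t P M) in
/-- Indecomposability. -/
structure IsInd : Prop where
  ne : ∃ v, P v ≠ 0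
  idem : ∀ φ, IsEnd s t P M φ → (∀ v, φ v * φ v = φ v) → (∀ v, φ v = 0) ∨ ∀ v, φ v = P v

variable (s t P M) in
/-- All endomorphisms are scalars. -/
def IsBrick : Prop := ∀ φ, IsEnd s t P M φ → ∃ c : ℂ, ∀ v, φ v = c • P v

lemma IsRep.left (h : IsRep s t P M) (a : A) : P (t a) * M a = M a := by
  conv_lhs => rw [← h.map a, mulA, ← mulA, (h.proj _).idem]
  rw [← mulA, h.map]

lemma IsRep.right (h : IsRep s t P M) (a : A) : M a * P (s a) = M a := by
  conv_lhs => rw [← h.map a, mulA, (h.proj _).idem]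
  rw [h.map]

lemma IsRep.dead (h : IsRep s t P M) {a : A} (ha : P (t a) = 0) : M a = 0 := by
  rw [← h.left, ha, mzero_mul]

lemma IsEnd.left {φ : V → Mat κ} (h : IsRep s t P M) (hφ : IsEnd s t P M φ) (v : V) :
    P v * φ v = φ v := by
  conv_lhs => rw [← hφ.le v, mulA, ← mulA, (h.proj _).idem]
  rw [← mulA, hφ.le]

lemma IsEnd.right {φ : V → Mat κ} (h : IsRep s t P M) (hφ : IsEnd s t P M φ) (v : V) :
    φ v * P v = φ v := by
  conv_lhs => rw [← hφ.le v, mulA, (h.proj _).idem]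
  rw [hφ.le]

lemma comp_cj (hβ : βᴴ * β = 1) (w : Matrix κ (κ × In t i) ℂ)
    (y : Mat (κ × In t i)) : α * w * βᴴ * cj β y = α * (w * y) * βᴴ := by
  have h2 : α * w * βᴴ * cj β y = α * w * (βᴴ * β) * y * βᴴ := by
    rw [cj]; simp only [mulA]
  rw [h2, hβ, mmul_one]
  simp only [mulA]

lemma cj_comp (hα : αᴴ * α = 1) (x : Mat κ) (w : Matrix κ (κ × In t i) ℂ) :
    cj α x * (α * w * βᴴ) = α * (x * w) * βᴴ := by
  have h1 : cj α x * (α * w * βᴴ) = α * x * (αᴴ * α) * w * βᴴ := by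
    rw [cj]; simp only [mulA]
  rw [h1, hα, mmul_one]
  simp only [mulA]

lemma rP_self : rP t i P K α β i = cj β K := if_pos rfl
lemma rP_ne {v : V} (h : v ≠ i) : rP t i P K α β v = cj α (P v) := if_neg h
lemma rM_pos {a : A} (h : t a = i) : rM t i M K α β a = α * bl K ⟨a, h⟩ * βᴴ := dif_pos h
lemma rM_neg {a : A} (h : t a ≠ i) : rM t i M K α β a = cj α (M a) := dif_neg h
lemma rs_pos {a : A} (h : t a = i) : rs s t i a = i := if_pos h
lemma rs_neg {a : A} (h : t a ≠ i) : rs s t i a = s a := if_neg h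
lemma rt_pos {a : A} (h : t a = i) : rt s t i a = s a := if_pos h
lemma rt_neg {a : A} (h : t a ≠ i) : rt s t i a = t a := if_neg h

lemma bl_K (hK : IsRefl s t i P M K σ) (hP : ∀ v, IsProj (P v)) {a : A} (h : t a = i) :
    P (s a) * bl K ⟨a, h⟩ = bl K ⟨a, h⟩ := by
  conv_rhs => rw [← hK.le_K hP, Qb, bl_diag]

lemma rep_refl (hr : IsRep s t P M) (hK : IsRefl s t i P M K σ) (hα : αᴴ * α = 1) (hβ : βᴴ * β = 1)
    (hl : ∀ a, t a = i → s a ≠ i) (ho : ∀ a, s a = i → P (t a) = 0) :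
    IsRep (rs s t i) (rt s t i) (rP t i P K α β) (rM t i M K α β) := by
  refine ⟨fun v => ?_, fun a => ?_⟩
  · by_cases h : v = i
    · subst h; rw [rP_self]; exact cj_proj hβ hK.proj
    · rw [rP_ne h]; exact cj_proj hα (hr.proj v)
  · by_cases h : t a = i
    · rw [rs_pos h, rt_pos h, rP_self, rP_ne (hl a h), rM_pos h, cj_comp hα, comp_cj hβ,
        bl_K hK hr.proj, ← bl_mul, hK.proj.idem]
    · rw [rs_neg h, rt_neg h, rP_ne h, rM_neg h]
      by_cases h2 : s a = i
      · rw [hr.dead (ho a h2), cj_zero, mmul_zero, mzero_mul]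
      · rw [rP_ne h2, cj_mul hα, cj_mul hα, hr.map]

/-- Endomorphisms of the reflected representation. -/
lemma end_to_refl (hr : IsRep s t P M) (hK : IsRefl s t i P M K σ) (hα : αᴴ * α = 1)
    (hβ : βᴴ * β = 1) (hl : ∀ a, t a = i → s a ≠ i) (ho : ∀ a, s a = i → P (t a) = 0)
    {φ : V → Mat κ} (hφ : IsEnd s t P M φ) :
    IsEnd (rs s t i) (rt s t i) (rP t i P K α β) (rM t i M K α β)
      (fun v => if v = i then cj β (Qb s t i φ * K) else cj α (φ v)) := by
  have h1 : inc t P i M * Qb s t i φ = φ i * inc t P i M := by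
    rw [inc_Qb, inc, mul_row]
    refine row_congr ?_
    rintro ⟨a, rfl⟩
    change P (t a) * M a * φ (s a) = φ (t a) * (P (t a) * M a)
    rw [hr.left, hφ.comm]
  have h2 : K * (Qb s t i φ * K) = Qb s t i φ * K := by
    refine hK.mul_eq ?_ ?_
    · rw [← mulA, Qb_mul]
      exact congrArg (fun X => Qb s t i X * K) (funext fun v => hφ.left hr v)
    · rw [← mulA, h1, mulA, hK.van hr.proj hr.map, mmul_zero]
  refine ⟨fun v => ?_, fun a => ?_⟩
  · by_cases h : v = i
    · subst h
      rw [rP_self, if_pos rfl, cj_mul hβ, cj_mul hβ, h2, mulA, hK.proj.idem]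
    · rw [rP_ne h, if_neg h, cj_mul hα, cj_mul hα, hφ.le]
  · by_cases h : t a = i
    · rw [rs_pos h, rt_pos h, if_pos rfl, if_neg (hl a h), rM_pos h, cj_comp hα, comp_cj hβ,
        ← bl_mul, h2, Qb, bl_diag]
    · rw [rs_neg h, rt_neg h, if_neg h, rM_neg h]
      by_cases h3 : s a = i
      · rw [hr.dead (ho a h3), cj_zero, mmul_zero, mzero_mul]
      · rw [if_neg h3, cj_mul hα, cj_mul hα, hφ.comm]

lemma end_of_refl (hr : IsRep s t P M) (hK : IsRefl s t i P M K σ) (hα : αᴴ * α = 1)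
    (hβ : βᴴ * β = 1) (hl : ∀ a, t a = i → s a ≠ i) (ho : ∀ a, s a = i → P (t a) = 0)
    {ψ : V → Mat ν}
    (hψ : IsEnd (rs s t i) (rt s t i) (rP t i P K α β) (rM t i M K α β) ψ) :
    ∃ φ, IsEnd s t P M φ ∧ (∀ v, v ≠ i → ψ v = cj α (φ v)) ∧ ψ i = cj β (Qb s t i φ * K) ∧
      φ i = inc t P i M * Qb s t i φ * σ := by
  obtain ⟨x, hx⟩ : ∃ x : V → Mat κ, ∀ v, x v = P v * cj αᴴ (ψ v) * P v := ⟨_, fun _ => rfl⟩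
  obtain ⟨y, hy⟩ : ∃ y : Mat (κ × In t i), y = K * cj βᴴ (ψ i) * K := ⟨_, rfl⟩
  have hx1 : ∀ v, v ≠ i → ψ v = cj α (x v) := fun v hv => by
    have := hψ.le v
    rw [rP_ne hv] at this
    rw [hx, cj_forth this]
  have hy1 : ψ i = cj β y := by
    have := hψ.le i
    rw [rP_self] at this
    rw [hy, cj_forth this]
  have hPx : ∀ v, P v * x v = x v := fun v => by
    rw [hx, ← mulA, ← mulA, (hr.proj v).idem]
  have hxP : ∀ v, x v * P v = x v := fun v => by
    rw [hx, mulA, (hr.proj v).idem]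
  have hKy : K * y = y := by
    rw [hy, ← mulA, ← mulA, hK.proj.idem]
  have h1 : y = Qb s t i x * K := by
    rw [← hKy]
    refine bl_ext ?_
    rintro ⟨a, ha⟩
    have h2 := hψ.comm a
    rw [rs_pos ha, rt_pos ha, rM_pos ha, hy1, hx1 _ (hl a ha), cj_comp hα, comp_cj hβ] at h2
    have h3 := comp_inj hα hβ h2
    rw [bl_mul, h3, Qb, bl_diag]
  have hRK := hK.van hr.proj hr.map
  have h4 : inc t P i M * Qb s t i x = inc t P i M * Qb s t i x * σ * inc t P i M := by
    have h5 : inc t P i M * Qb s t i x * K = 0 := by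
      rw [mulA, ← h1, ← hKy, ← mulA, hRK, mzero_mul]
    rw [hK.eq, mmul_sub, sub_eq_zero, mulA, Qb_mul, ← mulA] at h5
    rw [← h5]
    exact congrArg (fun X => inc t P i M * Qb s t i X) (funext fun v => (hxP v).symm)
  obtain ⟨φ, hφ⟩ : ∃ φ, φ = update x i (inc t P i M * Qb s t i x * σ) := ⟨_, rfl⟩
  have hQ : Qb s t i φ = Qb s t i x := by rw [hφ, Qb_update hl]
  have hi : φ i = inc t P i M * Qb s t i x * σ := by rw [hφ, update_self]
  have hne : ∀ v, v ≠ i → φ v = x v := fun v hv => by rw [hφ, update_of_ne hv]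
  refine ⟨φ, ⟨fun v => ?_, fun a => ?_⟩, fun v hv => by rw [hne v hv, hx1 v hv], by rw [hQ, hy1, h1],
    by rw [hQ, hi]⟩
  · by_cases hv : v = i
    · subst hv
      rw [hi, mulA, mulA, hK.right, ← mulA, ← mulA, mul_inc hr.proj]
    · rw [hne v hv, hPx, hxP]
  · by_cases ha : t a = i
    · subst ha
      rw [inc_Qb, inc, mul_row] at h4
      have h5 := congrFun (congrArg blk h4) ⟨a, rfl⟩
      change P (t a) * M a * x (s a) = _ * (P (t a) * M a) at h5
      rw [hr.left] at h5
      rw [hne _ (hl a rfl), h5, hi, inc_Qb]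
    · by_cases h3 : s a = i
      · rw [hr.dead (ho a h3), mmul_zero, mzero_mul]
      · have h2 := hψ.comm a
        rw [rs_neg ha, rt_neg ha, rM_neg ha, hx1 _ ha, hx1 _ h3, cj_mul hα, cj_mul hα] at h2
        rw [hne _ ha, hne _ h3, cj_inj hα h2]

lemma Qb_congr {q q' : V → Mat κ} (hl : ∀ a, t a = i → s a ≠ i)
    (h : ∀ v, v ≠ i → q v = q' v) : Qb s t i q = Qb s t i q' :=
  congrArg blockDiagonal (funext fun a => h _ (hl _ a.2))

lemma Qb_smul (c : ℂ) (q : V → Mat κ) : Qb s t i (fun v => c • q v) = c • Qb s t i q :=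
  blockDiagonal_smul c fun a : In t i => q (s a.1)

lemma Qb_zero : Qb s t i (fun _ => (0 : Mat κ)) = 0 := blockDiagonal_zero

theorem brick_of_refl (hr : IsRep s t P M) (hK : IsRefl s t i P M K σ) (hα : αᴴ * α = 1)
    (hβ : βᴴ * β = 1) (hl : ∀ a, t a = i → s a ≠ i) (ho : ∀ a, s a = i → P (t a) = 0)
    (h : IsBrick (rs s t i) (rt s t i) (rP t i P K α β) (rM t i M K α β)) : IsBrick s t P M := by
  intro φ hφ
  obtain ⟨c, hc⟩ := h _ (end_to_refl hr hK hα hβ hl ho hφ)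
  have h1 : ∀ v, v ≠ i → φ v = c • P v := fun v hv => by
    have := hc v
    rw [if_neg hv, rP_ne hv, ← cj_smul] at this
    exact cj_inj hα this
  refine ⟨c, fun v => ?_⟩
  by_cases hv : v = i
  · subst hv
    have h2 : inc t P v M * Qb s t v φ = φ v * inc t P v M := by
      rw [inc_Qb, inc, mul_row]
      refine row_congr ?_
      rintro ⟨a, rfl⟩
      change P (t a) * M a * φ (s a) = φ (t a) * (P (t a) * M a)
      rw [hr.left, hφ.comm]
    rw [← hφ.right hr, ← hK.sec, ← mulA, ← h2, Qb_congr hl h1, Qb_smul,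
      mulA, msmul_mul, hK.le, mmul_smul]
  · exact h1 v hv

theorem ind_refl (hr : IsRep s t P M) (hK : IsRefl s t i P M K σ) (hα : αᴴ * α = 1)
    (hβ : βᴴ * β = 1) (hl : ∀ a, t a = i → s a ≠ i) (ho : ∀ a, s a = i → P (t a) = 0)
    (h : IsInd s t P M) : IsInd (rs s t i) (rt s t i) (rP t i P K α β) (rM t i M K α β) := by
  refine ⟨?_, fun ψ hψ hid => ?_⟩
  · by_contra h0
    push Not at h0
    obtain ⟨w, hw⟩ := h.ne
    have h1 : ∀ v, v ≠ i → P v = 0 := fun v hv => by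
      have := h0 v
      rw [rP_ne hv, ← cj_zero (α := α)] at this
      exact cj_inj hα this
    have h2 : σ = 0 := by
      rw [← hK.le, Qb_congr hl h1, Qb_zero, mzero_mul]
    have h3 : P i = 0 := by rw [← hK.sec, h2, mmul_zero]
    by_cases hwi : w = i
    · exact hw (hwi ▸ h3)
    · exact hw (h1 w hwi)
  · obtain ⟨φ, hφ, hne, hi, hφi⟩ := end_of_refl hr hK hα hβ hl ho hψ
    have hs : ∀ v, v ≠ i → φ v * φ v = φ v := fun v hv => by
      have := hid v
      rw [hne v hv, cj_mul hα] at this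
      exact cj_inj hα this
    have h2 : inc t P i M * Qb s t i φ = φ i * inc t P i M := by
      rw [inc_Qb, inc, mul_row]
      refine row_congr ?_
      rintro ⟨a, rfl⟩
      change P (t a) * M a * φ (s a) = φ (t a) * (P (t a) * M a)
      rw [hr.left, hφ.comm]
    have hsi : φ i * φ i = φ i := by
      have h4 : φ i * (inc t P i M * Qb s t i φ * σ) = inc t P i M * Qb s t i φ * σ := by
        rw [← mulA, ← mulA, ← h2, mulA (inc t P i M), Qb_mul, Qb_congr hl hs]
      rwa [← hφi] at h4
    rcases h.idem φ hφ (fun v => if hv : v = i then hv ▸ hsi else hs v hv) with h3 | h3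
    · refine Or.inl fun v => ?_
      by_cases hv : v = i
      · subst hv
        rw [hi, Qb_congr hl fun v _ => h3 v, Qb_zero, mzero_mul, cj_zero]
      · rw [hne v hv, h3, cj_zero]
    · refine Or.inr fun v => ?_
      by_cases hv : v = i
      · subst hv
        rw [hi, Qb_congr hl fun v _ => h3 v, hK.le_K hr.proj, rP_self]
      · rw [hne v hv, h3, rP_ne hv]

/-- Either the incoming map is onto, or a point splits off. -/
theorem exists_refl (hr : IsRep s t P M) :
    (∃ K σ, IsRefl s t i P M K σ) ∨
      ∃ p : Mat κ, IsPt p ∧ P i * p = p ∧ p * inc t P i M = 0 := by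
  obtain ⟨R, hR⟩ : ∃ R, R = inc t P i M := ⟨_, rfl⟩
  obtain ⟨D, hD⟩ : ∃ D, D = R * Rᴴ + (1 - P i) := ⟨_, rfl⟩
  have hPR : P i * R = R := by rw [hR, mul_inc hr.proj]
  have hRQ : R * Qb s t i P = R := by rw [hR, inc_mul_Qb hr.map hr.proj]
  have hPi := hr.proj i
  have hRP : Rᴴ * P i = Rᴴ := by
    conv_rhs => rw [← hPR, conjTranspose_mul, hPi.herm]
  have hDh : Dᴴ = D := by
    rw [hD, conjTranspose_add, conjTranspose_mul, conjTranspose_conjTranspose, conjTranspose_sub,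
      conjTranspose_one, hPi.herm]
  have hDP : D * P i = R * Rᴴ := by
    rw [hD, madd_mul, mulA, hRP, msub_mul, mone_mul, hPi.idem, sub_self, add_zero]
  have hPD : P i * D = R * Rᴴ := by
    rw [hD, mmul_add, ← mulA, hPR, mmul_sub, mmul_one, hPi.idem, sub_self, add_zero]
  by_cases hdet : D.det = 0
  · right
    obtain ⟨v, hv, hDv⟩ := exists_mulVec_eq_zero_iff.2 hdet
    obtain ⟨w, hw⟩ : ∃ w : Matrix κ Unit ℂ, w = replicateCol Unit v := ⟨_, rfl⟩
    have hw0 : w ≠ 0 := fun h0 => hv (funext fun x => by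
      have := congrFun (congrFun h0 x) ()
      rwa [hw] at this)
    have hDw : D * w = 0 := by
      rw [hw, ← replicateCol_mulVec, hDv]; rfl
    have hRw : R * Rᴴ * w = 0 := by rw [← hPD, mulA, hDw, mmul_zero]
    have hPw : P i * w = w := by
      rw [hD, madd_mul, hRw, zero_add, msub_mul, mone_mul, sub_eq_zero] at hDw
      exact hDw.symm
    have hwR : wᴴ * R = 0 := by
      refine mul_herm_trace_eq_zero.1 ?_
      rw [conjTranspose_mul, conjTranspose_conjTranspose, mulA, ← mulA R,
        hRw, mmul_zero, trace_zero]
    refine ⟨act w 1, isPt_one.act (by rwa [mmul_one]), ?_, ?_⟩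
    · rw [act, mmul_smul, ← mulA, ← mulA, hPw]
    · rw [act, msmul_mul, ← hR, mmul_one, mulA, hwR, mmul_zero, smul_zero]
  · left
    have hu : IsUnit D.det := isUnit_iff_ne_zero.2 hdet
    obtain ⟨E, hE⟩ : ∃ E, E = D⁻¹ := ⟨_, rfl⟩
    have hED : E * D = 1 := by rw [hE, nonsing_inv_mul _ hu]
    have hDE : D * E = 1 := by rw [hE, mul_nonsing_inv _ hu]
    have hEh : Eᴴ = E := by rw [hE, conjTranspose_nonsing_inv, hDh]
    have hEP : E * P i = P i * E := by
      calc E * P i = E * (P i * D) * E := by grind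
        _ = P i * E := by rw [hPD, ← hDP, ← mulA, hED, mone_mul]
    have hsec : R * (Rᴴ * E * P i) = P i := by
      rw [mulA, hEP, ← mulA, ← mulA, ← hDP, mulA D, hPi.idem, mulA, ← hEP, ← mulA, hDE, mone_mul]
    have hle : Qb s t i P * (Rᴴ * E * P i) = Rᴴ * E * P i := by
      have : Qb s t i P * Rᴴ = Rᴴ := by
        conv_rhs => rw [← hRQ, conjTranspose_mul, (isProj_Qb hr.proj).herm]
      rw [← mulA, ← mulA, this]
    refine ⟨Qb s t i P - Rᴴ * E * P i * R, Rᴴ * E * P i, ?_, by rw [hR], by rw [← hR, hsec], hle,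
      by rw [mulA, hPi.idem]⟩
    refine (isProj_Qb hr.proj).sub ⟨?_, ?_⟩ (by rw [← mulA, hle])
    · rw [mulA, hPR, conjTranspose_mul, conjTranspose_mul, conjTranspose_conjTranspose, hEh, mulA]
    · rw [mulA, ← mulA R, hsec, hPR]

lemma IsRefl.trace (hr : IsRep s t P M) (hK : IsRefl s t i P M K σ) :
    K.trace = (∑ a : In t i, (P (s a.1)).trace) - (P i).trace := by
  rw [hK.eq, trace_sub, trace_mul_comm, hK.sec, Qb, trace_blockDiagonal]

lemma continuous_cj {X : Type} [TopologicalSpace X] {f : X → Mat κ} (hf : Continuous f) :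
    Continuous fun x => cj α (f x) :=
  (continuous_const.matrix_mul hf).matrix_mul continuous_const

lemma Qb_mul_iff (L : Mat (κ × In t i)) (q : V → Mat κ) :
    Qb s t i q * L = L ↔ ∀ a : In t i, q (s a.1) * bl L a = bl L a := by
  constructor
  · intro h a
    conv_rhs => rw [← h, Qb, bl_diag]
  · intro h
    refine bl_ext fun a => ?_
    rw [Qb, bl_diag, h]

lemma isGr_refl (hr : IsRep s t P M) (hK : IsRefl s t i P M K σ) (hα : αᴴ * α = 1)
    (hβ : βᴴ * β = 1) (hl : ∀ a, t a = i → s a ≠ i) (ho : ∀ a, s a = i → P (t a) = 0)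
    {e : V → ℕ} {k : ℕ} {q : V → Mat κ} {L : Mat (κ × In t i)}
    (h : IsG s t P i e k M q L) :
    IsGr (rs s t i) (rt s t i) (rP t i P K α β) (rM t i M K α β) (update e i k)
      (fun v => if v = i then cj β L else cj α (q v)) := by
  have hPL : Qb s t i P * L = L := by
    rw [← h.lle, ← mulA, Qb_mul]
    exact congrArg (fun X => Qb s t i X * L) (funext fun v => h.le v)
  have hKL := hK.mul_eq hPL h.van
  have hqL := (Qb_mul_iff L q).1 h.lle
  have hPL' := (Qb_mul_iff L P).1 hPL
  refine ⟨fun v => ?_, fun v => ?_, fun v => ?_, fun a => ?_⟩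
  · by_cases hv : v = i
    · rw [if_pos hv]; exact cj_proj hβ h.lproj
    · rw [if_neg hv]; exact cj_proj hα (h.proj v)
  · by_cases hv : v = i
    · subst hv; rw [if_pos rfl, rP_self, cj_mul hβ, hKL]
    · rw [if_neg hv, rP_ne hv, cj_mul hα, h.le]
  · by_cases hv : v = i
    · subst hv; rw [if_pos rfl, update_self, cj_trace hβ, h.ltr]
    · rw [if_neg hv, update_of_ne hv, cj_trace hα, h.tr]
  · by_cases ha : t a = i
    · rw [rs_pos ha, rt_pos ha, if_pos rfl, if_neg (hl a ha), rM_pos ha, rP_ne (hl a ha), ← cj_sub,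
        cj_comp hα, comp_cj hβ, mulA (P _ - _), ← bl_mul, hKL, msub_mul,
        hqL ⟨a, ha⟩, hPL' ⟨a, ha⟩, sub_self, mmul_zero, mzero_mul]
    · rw [rs_neg ha, rt_neg ha, if_neg ha, rM_neg ha, rP_ne ha, ← cj_sub]
      by_cases hs : s a = i
      · rw [hr.dead (ho a hs), cj_zero, mmul_zero, mzero_mul]
      · rw [if_neg hs, cj_mul hα, cj_mul hα, h.inv, cj_zero]

lemma isG_of_refl (hr : IsRep s t P M) (hK : IsRefl s t i P M K σ) (hα : αᴴ * α = 1)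
    (hβ : βᴴ * β = 1) (hl : ∀ a, t a = i → s a ≠ i) (ho : ∀ a, s a = i → P (t a) = 0)
    {e : V → ℕ} {k : ℕ} (he : (P i).trace = e i) {q : V → Mat ν}
    (h : IsGr (rs s t i) (rt s t i) (rP t i P K α β) (rM t i M K α β) (update e i k) q) :
    IsG s t P i e k M (update (fun v => cj αᴴ (q v)) i (P i)) (cj βᴴ (q i)) ∧
      (∀ v, v ≠ i → cj α (cj αᴴ (q v)) = q v) ∧ cj β (cj βᴴ (q i)) = q i := by
  have hqP : ∀ v, q v * rP t i P K α β v = q v := fun v =>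
    ((rep_refl hr hK hα hβ hl ho).proj v).symm (h.proj v) (h.le v)
  obtain ⟨x, hx⟩ : ∃ x : V → Mat κ, ∀ v, x v = cj αᴴ (q v) := ⟨_, fun _ => rfl⟩
  obtain ⟨y, hy⟩ : ∃ y : Mat (κ × In t i), y = cj βᴴ (q i) := ⟨_, rfl⟩
  have hx1 : ∀ v, v ≠ i → cj α (P v * x v * P v) = q v := fun v hv => by
    rw [hx, cj_forth]
    rw [← rP_ne (K := K) (β := β) hv, h.le, hqP]
  have hy1 : cj β (K * y * K) = q i := by
    rw [hy, cj_forth]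
    rw [← rP_self, h.le, hqP]
  have hx2 : ∀ v, v ≠ i → P v * x v * P v = x v := fun v hv => by
    rw [hx v]
    conv_rhs => rw [← hx1 v hv, cj_back hα, hx]
  have hy2 : K * y * K = y := by
    conv_rhs => rw [hy, ← hy1, cj_back hβ]
  have hx3 : ∀ v, v ≠ i → cj α (x v) = q v := fun v hv => by rw [← hx1 v hv, hx2 v hv]
  have hy3 : cj β y = q i := by rw [← hy1, hy2]
  have hxp : ∀ v, v ≠ i → IsProj (x v) := fun v hv => by
    refine ⟨?_, ?_⟩
    · rw [hx, cj, conjTranspose_mul, conjTranspose_mul, conjTranspose_conjTranspose, (h.proj v).herm,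
        mulA]
    · refine cj_inj hα ?_
      rw [← cj_mul hα, hx3 v hv, (h.proj v).idem]
  have hyp : IsProj y := by
    refine ⟨?_, ?_⟩
    · rw [hy, cj, conjTranspose_mul, conjTranspose_mul, conjTranspose_conjTranspose, (h.proj i).herm,
        mulA]
    · refine cj_inj hβ ?_
      rw [← cj_mul hβ, hy3, (h.proj i).idem]
  have hKy : K * y = y := by
    rw [← hy2, ← mulA, ← mulA, hK.proj.idem]
  obtain ⟨z, hz⟩ : ∃ z, z = update x i (P i) := ⟨_, rfl⟩
  have hzi : z i = P i := by rw [hz, update_self]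
  have hzn : ∀ v, v ≠ i → z v = x v := fun v hv => by rw [hz, update_of_ne hv]
  have hz' : update (fun v => cj αᴴ (q v)) i (P i) = z := by grind
  refine ⟨?_, fun v hv => by rw [← hx, hx3 v hv], by rw [← hy, hy3]⟩
  rw [hz', ← hy]
  refine ⟨fun v => ?_, fun v => ?_, fun v => ?_, fun a => ?_, hyp, ?_, ?_, ?_⟩
  · by_cases hv : v = i
    · subst hv; rw [hzi]; exact hr.proj _
    · rw [hzn v hv]; exact hxp v hv
  · by_cases hv : v = i
    · subst hv; rw [hzi, (hr.proj _).idem]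
    · rw [hzn v hv, ← hx2 v hv, ← mulA, ← mulA, (hr.proj v).idem]
  · by_cases hv : v = i
    · subst hv; rw [hzi, he]
    · rw [hzn v hv, ← cj_trace hα, hx3 v hv, h.tr, update_of_ne hv]
  · by_cases ha : t a = i
    · rw [ha, hzi, sub_self, mzero_mul, mzero_mul]
    · by_cases hs : s a = i
      · rw [hr.dead (ho a hs), mmul_zero, mzero_mul]
      · have h2 := h.inv a
        rw [rs_neg ha, rt_neg ha, rM_neg ha, rP_ne ha, ← hx3 _ ha, ← hx3 _ hs, ← cj_sub, cj_mul hα,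
          cj_mul hα, ← cj_zero (α := α)] at h2
        rw [hzn _ ha, hzn _ hs, cj_inj hα h2]
  · rw [← cj_trace hβ, hy3, h.tr, update_self]
  · refine (Qb_mul_iff y z).2 ?_
    rintro ⟨a, ha⟩
    have h2 := h.inv a
    rw [rs_pos ha, rt_pos ha, rM_pos ha, rP_ne (hl a ha), ← hx3 _ (hl a ha), ← hy3, ← cj_sub,
      cj_comp hα, comp_cj hβ, mulA (P _ - _), ← bl_mul, hKy] at h2
    have h3 : (P (s a) - x (s a)) * bl y ⟨a, ha⟩ = 0 := by
      refine comp_inj hα hβ (h2.trans ?_)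
      rw [mmul_zero, mzero_mul]
    have h4 : P (s a) * bl y ⟨a, ha⟩ = bl y ⟨a, ha⟩ :=
      (Qb_mul_iff y P).1 (by rw [← hKy, ← mulA, hK.le_K hr.proj]) ⟨a, ha⟩
    rw [msub_mul, h4, sub_eq_zero] at h3
    rw [hzn _ (hl a ha)]
    exact h3.symm
  · rw [← hKy, ← mulA, hK.van hr.proj hr.map, mzero_mul]

/-- Full dimension at the sink: the Grassmannian of the reflected representation. -/
def homeoRefl (hr : IsRep s t P M) (hK : IsRefl s t i P M K σ) (hα : αᴴ * α = 1)
    (hβ : βᴴ * β = 1) (hl : ∀ a, t a = i → s a ≠ i) (ho : ∀ a, s a = i → P (t a) = 0)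
    (e : V → ℕ) (k : ℕ) (he : (P i).trace = e i) :
    GU s t P i {M} e k ≃ₜ Gr (rs s t i) (rt s t i) (rP t i P K α β) (rM t i M K α β)
      (update e i k) where
  toFun y := ⟨fun v => if v = i then cj β y.1.2.2 else cj α (y.1.2.1 v), by
    have h := y.2.2
    rw [Set.mem_singleton_iff.1 y.2.1] at h
    exact isGr_refl hr hK hα hβ hl ho h⟩
  invFun q := ⟨(M, update (fun v => cj αᴴ (q.1 v)) i (P i), cj βᴴ (q.1 i)), rfl,
    (isG_of_refl hr hK hα hβ hl ho he q.2).1⟩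
  left_inv y := by
    refine sext (Prod.ext (Set.mem_singleton_iff.1 y.2.1).symm (Prod.ext ?_ ?_))
    · funext v
      change update (fun v => cj αᴴ (if v = i then cj β y.1.2.2 else cj α (y.1.2.1 v))) i
        (P i) v = y.1.2.1 v
      by_cases hv : v = i
      · subst hv
        rw [update_self]
        exact (hr.proj v).eq_of_le (y.2.2.proj v) (y.2.2.le v) (by rw [he, y.2.2.tr])
      · rw [update_of_ne hv, if_neg hv, cj_back hα]
    · change cj βᴴ (if i = i then cj β y.1.2.2 else cj α (y.1.2.1 i)) = y.1.2.2
      rw [if_pos rfl, cj_back hβ]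
  right_inv q := by
    refine sext (funext fun v => ?_)
    change (if v = i then cj β (cj βᴴ (q.1 i)) else
      cj α (update (fun v => cj αᴴ (q.1 v)) i (P i) v)) = q.1 v
    have h := isG_of_refl hr hK hα hβ hl ho he q.2
    by_cases hv : v = i
    · subst hv; rw [if_pos rfl, h.2.2]
    · rw [if_neg hv, update_of_ne hv, h.2.1 v hv]
  continuous_toFun := by
    refine subtype_mk (continuous_pi fun v => ?_) _
    by_cases hv : v = i
    · simp only [if_pos hv]; exact continuous_cj (by fun_prop)
    · simp only [if_neg hv]; exact continuous_cj (by fun_prop)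
  continuous_invFun := by
    refine subtype_mk (prodMk continuous_const (prodMk ?_ ?_)) _
    · exact Continuous.update (continuous_pi fun v => continuous_cj
        ((continuous_apply v).comp continuous_subtype_val)) i continuous_const
    · exact continuous_cj ((continuous_apply i).comp continuous_subtype_val)

/-- Reflections and quiver Grassmannians. -/
theorem ov_of_refl (hr : IsRep s t P M) (hK : IsRefl s t i P M K σ) (hα : αᴴ * α = 1)
    (hβ : βᴴ * β = 1) (hl : ∀ a, t a = i → s a ≠ i) (ho : ∀ a, s a = i → P (t a) = 0)
    (hR : ∀ Y : A → Mat κ, ∃ X : V → Mat κ, ∀ a,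
      M a * X (s a) * P (s a) - P (t a) * X (t a) * M a = P (t a) * Y a * P (s a))
    (h : ∀ e, (C (Gr (rs s t i) (rt s t i) (rP t i P K α β) (rM t i M K α β) e)).OV) (e : V → ℕ) :
    (C (Gr s t P M e)).OV :=
  (QI_of_homeo (homeoGr e)).ov_iff.1 <| ov_sink hr.proj hl ho hr.map hR
    (fun e k he => (QI_of_homeo (homeoRefl hr hK hα hβ hl ho e k he)).ov_iff.2 (h _)) e 0

end Reflect

section Rigid

/-- The linear map `X ↦ P X Q`. -/
def sw (P Q : Mat κ) : Mat κ →ₗ[ℂ] Mat κ :=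
  LinearMap.mulLeft ℂ P ∘ₗ LinearMap.mulRight ℂ Q

lemma sw_apply (P Q X : Mat κ) : sw P Q X = P * (X * Q) := rfl

lemma trace_sw (P Q : Mat κ) : LinearMap.trace ℂ _ (sw P Q) = P.trace * Q.trace := by
  rw [LinearMap.trace_eq_matrix_trace ℂ (Matrix.stdBasis ℂ κ κ), Matrix.trace,
    Fintype.sum_prod_type, Matrix.trace, Matrix.trace, Finset.sum_mul_sum]
  refine sum_congr rfl fun j _ => sum_congr rfl fun k _ => ?_
  rw [Matrix.diag_apply, LinearMap.toMatrix_apply, Matrix.stdBasis_eq_single, sw_apply]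
  change (P * (Matrix.single j k (1 : ℂ) * Q) : Mat κ) j k = _
  rw [← mulA]
  simp [mmul_apply, Matrix.single_apply, ite_and]

lemma finrank_sw {P Q : Mat κ} (hP : IsProj P) (hQ : IsProj Q) :
    finrank ℂ (lrange (sw P Q)) = P.rank * Q.rank := by
  have h : IsIdempotentElem (sw P Q) := by
    refine LinearMap.ext fun X => ?_
    change P * (P * (X * Q) * Q) = P * (X * Q)
    rw [mulA P, mulA X, hQ.idem, ← mulA, hP.idem]
  have h1 := (LinearMap.IsIdempotentElem.isProj_range _ h).trace
  rw [trace_sw, hP.trace_eq, hQ.trace_eq, ← Nat.cast_mul] at h1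
  exact (Nat.cast_injective h1).symm

lemma mem_sw {P Q : Mat κ} (hP : IsProj P) (hQ : IsProj Q) {X : Mat κ} :
    X ∈ lrange (sw P Q) ↔ P * X * Q = X := by
  constructor
  · rintro ⟨Y, rfl⟩
    rw [sw_apply, ← mulA, ← mulA, hP.idem, mulA, hQ.idem, mulA]
  · intro h
    exact ⟨X, by rw [sw_apply, ← mulA, h]⟩

/-- The standard map computing extensions. -/
def extMap (hr : IsRep s t P M) : (∀ v, lrange (sw (P v) (P v))) →ₗ[ℂ]
    ∀ a, lrange (sw (P (t a)) (P (s a))) where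
  toFun X a := ⟨M a * (X (s a)).1 - (X (t a)).1 * M a, by
    have h1 := (mem_sw (hr.proj _) (hr.proj _)).1 (X (s a)).2
    have h2 := (mem_sw (hr.proj _) (hr.proj _)).1 (X (t a)).2
    refine (mem_sw (hr.proj _) (hr.proj _)).2 ?_
    have h3 : (X (s a)).1 * P (s a) = (X (s a)).1 := by
      conv_lhs => rw [← h1, mulA, (hr.proj _).idem, h1]
    have h4 : P (t a) * (X (t a)).1 = (X (t a)).1 := by
      conv_lhs => rw [← h2, mulA, ← mulA, (hr.proj _).idem, ← mulA, h2]
    rw [mmul_sub, msub_mul, ← mulA, hr.left, ← mulA, h4, mulA, h3, mulA _ _ (P (s a)), hr.right]⟩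
  map_add' X Y := funext fun a => sext (by
    change M a * ((X (s a)).1 + (Y (s a)).1) - ((X (t a)).1 + (Y (t a)).1) * M a =
      M a * (X (s a)).1 - (X (t a)).1 * M a + (M a * (Y (s a)).1 - (Y (t a)).1 * M a)
    rw [mmul_add, madd_mul]; abel)
  map_smul' c X := funext fun a => sext (by
    change M a * (c • (X (s a)).1) - (c • (X (t a)).1) * M a =
      c • (M a * (X (s a)).1 - (X (t a)).1 * M a)
    rw [mmul_smul, msmul_mul, smul_sub])

theorem rigid_of_brick (hr : IsRep s t P M) (hb : IsBrick s t P M)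
    (hq : (∑ a, (P (t a)).rank * (P (s a)).rank) + 1 ≤ ∑ v, (P v).rank * (P v).rank)
    (Y : A → Mat κ) : ∃ X : V → Mat κ, ∀ a,
      M a * X (s a) * P (s a) - P (t a) * X (t a) * M a = P (t a) * Y a * P (s a) := by
  have h1 := LinearMap.finrank_range_add_finrank_ker (extMap hr)
  have h2 : finrank ℂ (lker (extMap hr)) ≤ 1 := by
    refine finrank_le_one (⟨fun v => ⟨P v, (mem_sw (hr.proj v) (hr.proj v)).2 (by
      rw [(hr.proj v).idem, (hr.proj v).idem])⟩, ?_⟩ : lker (extMap hr)) ?_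
    · refine funext fun a => sext ?_
      change M a * P (s a) - P (t a) * M a = 0
      rw [hr.left, hr.right, sub_self]
    · intro X
      obtain ⟨c, hc⟩ := hb (fun v => (X.1 v).1)
        ⟨fun v => (mem_sw (hr.proj v) (hr.proj v)).1 (X.1 v).2, fun a => by
          have := congrArg Subtype.val (congrFun X.2 a)
          exact sub_eq_zero.1 this⟩
      exact ⟨c, sext (funext fun v => sext (hc v).symm)⟩
  have h3 : finrank ℂ (∀ v, lrange (sw (P v) (P v))) =
      ∑ v, (P v).rank * (P v).rank := by
    rw [Module.finrank_pi_fintype]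
    exact sum_congr rfl fun v _ => finrank_sw (hr.proj v) (hr.proj v)
  have h4 : finrank ℂ (∀ a, lrange (sw (P (t a)) (P (s a)))) =
      ∑ a, (P (t a)).rank * (P (s a)).rank := by
    rw [Module.finrank_pi_fintype]
    exact sum_congr rfl fun a _ => finrank_sw (hr.proj _) (hr.proj _)
  have h5 : lrange (extMap hr) = ⊤ :=
    Submodule.eq_top_of_finrank_eq (le_antisymm (Submodule.finrank_le _) (by omega))
  obtain ⟨X, hX⟩ := LinearMap.range_eq_top.1 h5
    fun a => ⟨P (t a) * (Y a * P (s a)), ⟨Y a, rfl⟩⟩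
  refine ⟨fun v => (X v).1, fun a => ?_⟩
  have h6 : M a * (X (s a)).1 - (X (t a)).1 * M a = P (t a) * (Y a * P (s a)) :=
    congrArg Subtype.val (congrFun hX a)
  have h7 := (mem_sw (hr.proj _) (hr.proj _)).1 (X (s a)).2
  have h8 := (mem_sw (hr.proj _) (hr.proj _)).1 (X (t a)).2
  have h9 : (X (s a)).1 * P (s a) = (X (s a)).1 := by
    conv_lhs => rw [← h7, mulA, (hr.proj _).idem, h7]
  have h10 : P (t a) * (X (t a)).1 = (X (t a)).1 := by
    conv_lhs => rw [← h8, mulA, ← mulA, (hr.proj _).idem, ← mulA, h8]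
  rw [mulA (M a), h9, h10, h6, mulA]

/-- The case where a point splits off. -/
theorem simple_case (hr : IsRep s t P M) (h : IsInd s t P M) (hl : ∀ a, t a = i → s a ≠ i)
    (ho : ∀ a, s a = i → P (t a) = 0) {p : Mat κ} (hp : IsPt p) (hPp : P i * p = p)
    (hpR : p * inc t P i M = 0) : IsBrick s t P M ∧ ∀ e, (C (Gr s t P M e)).OV := by
  have hpP : p * P i = p := (hr.proj i).symm hp.isProj hPp
  obtain ⟨φ, hφ⟩ : ∃ φ : V → Mat κ, φ = update (fun _ => 0) i p := ⟨_, rfl⟩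
  have hφi : φ i = p := by rw [hφ, update_self]
  have hφn : ∀ v, v ≠ i → φ v = 0 := fun v hv => by rw [hφ, update_of_ne hv]
  have hend : IsEnd s t P M φ := by
    refine ⟨fun v => ?_, fun a => ?_⟩
    · by_cases hv : v = i
      · subst hv; rw [hφi, hPp, hpP]
      · rw [hφn v hv, mmul_zero, mzero_mul]
    · by_cases ha : t a = i
      · rw [hφn _ (hl a ha), mmul_zero, ha, hφi]
        rw [inc, mul_row] at hpR
        have h1 : p * (P i * M a) = 0 := zero_of_row hpR (⟨a, ha⟩ : In t i)
        rw [← mulA, hpP] at h1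
        exact h1.symm
      · rw [hφn _ ha, mzero_mul]
        by_cases hs : s a = i
        · rw [hr.dead (ho a hs), mzero_mul]
        · rw [hφn _ hs, mmul_zero]
  have hP : ∀ v, φ v = P v := by
    refine (h.idem φ hend fun v => ?_).resolve_left fun h0 => hp.ne (hφi ▸ h0 i)
    by_cases hv : v = i
    · subst hv; rw [hφi, hp.idem]
    · rw [hφn v hv, mmul_zero]
  have hPi : P i = p := by rw [← hP, hφi]
  have hPn : ∀ v, v ≠ i → P v = 0 := fun v hv => by rw [← hP, hφn v hv]
  refine ⟨fun ψ hψ => ⟨(p * ψ i).trace, fun v => ?_⟩, fun e => ?_⟩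
  · by_cases hv : v = i
    · subst hv
      rw [hPi, ← hp.rank, ← hPi, hψ.le]
    · rw [← hψ.le, hPn v hv, mzero_mul, mzero_mul, smul_zero]
  · rcases isEmpty_or_nonempty (Gr s t P M e) with h0 | ⟨⟨q0⟩⟩
    · exact OV_empty
    · have hs : Subsingleton (Gr s t P M e) := by
        refine ⟨fun q q' => sext (funext fun v => ?_)⟩
        by_cases hv : v = i
        · subst hv
          have key : ∀ q : Gr s t P M e, q.1 v = 0 ∨ q.1 v = P v := by
            intro q
            have hsub := (hr.proj v).sub (q.2.proj v) (q.2.le v)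
            have h1 := hsub.trace_eq
            have h3 := (q.2.proj v).trace_eq
            rw [trace_sub, h3, hPi, hp.tr, sub_eq_iff_eq_add] at h1
            have h2 : 1 = (p - q.1 v).rank + (q.1 v).rank := by exact_mod_cast h1
            rcases Nat.eq_zero_or_pos (q.1 v).rank with h4 | h4
            · left
              exact (q.2.proj v).eq_zero (by rw [h3, h4, Nat.cast_zero])
            · right
              refine ((hr.proj v).eq_of_le (q.2.proj v) (q.2.le v) ?_).symm
              rw [hPi, hp.tr, h3, show (q.1 v).rank = 1 by omega, Nat.cast_one]
          have htr : (q.1 v).trace = (q'.1 v).trace := by rw [q.2.tr, q'.2.tr]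
          have hne : (P v).trace ≠ 0 := by rw [hPi, hp.tr]; exact one_ne_zero
          rcases key q with h1 | h1 <;> rcases key q' with h2 | h2 <;> rw [h1, h2] at htr ⊢
          · exact absurd (htr.symm.trans (trace_zero _ _)) hne
          · exact absurd (htr.trans (trace_zero _ _)) hne
        · rw [← q.2.le, ← q'.2.le, hPn v hv, mzero_mul, mzero_mul]
      have : Unique (Gr s t P M e) := ⟨⟨q0⟩, fun q => Subsingleton.elim _ _⟩
      have hc : ContractibleSpace (Gr s t P M e) := inferInstance
      exact OV_contractible

end Rigid

/-! ### The Tits form -/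

section Tits

/-- The symmetrized Tits form. -/
def bf (s t : A → V) : LinearMap.BilinForm ℚ (V → ℚ) :=
  LinearMap.mk₂ ℚ (fun x y => ∑ v, 2 * (x v * y v) - ∑ a, (x (s a) * y (t a) + x (t a) * y (s a)))
    (fun x x' y => by
      rw [sub_add_sub_comm, ← sum_add_distrib, ← sum_add_distrib]
      congr 1 <;> exact sum_congr rfl fun _ _ => by simp only [Pi.add_apply]; ring)
    (fun c x y => by
      rw [smul_eq_mul, mul_sub, mul_sum, mul_sum]
      congr 1 <;> exact sum_congr rfl fun _ _ => by
        simp only [Pi.smul_apply, smul_eq_mul]; ring)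
    (fun x y y' => by
      rw [sub_add_sub_comm, ← sum_add_distrib, ← sum_add_distrib]
      congr 1 <;> exact sum_congr rfl fun _ _ => by simp only [Pi.add_apply]; ring)
    (fun c x y => by
      rw [smul_eq_mul, mul_sub, mul_sum, mul_sum]
      congr 1 <;> exact sum_congr rfl fun _ _ => by
        simp only [Pi.smul_apply, smul_eq_mul]; ring)

lemma bf_apply (x y : V → ℚ) : bf s t x y =
    ∑ v, 2 * (x v * y v) - ∑ a, (x (s a) * y (t a) + x (t a) * y (s a)) := rfl

lemma bf_self (x : V → ℚ) : bf s t x x = 2 * (∑ v, x v * x v - ∑ a, x (s a) * x (t a)) := by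
  rw [bf_apply, mul_sub, mul_sum, mul_sum]
  congr 1
  exact sum_congr rfl fun _ _ => by ring

lemma bf_comm (x y : V → ℚ) : bf s t x y = bf s t y x := by
  rw [bf_apply, bf_apply]
  congr 1 <;> exact sum_congr rfl fun _ _ => by ring

lemma bf_single (x : V → ℚ) (i : V) : bf s t x (Pi.single i 1) =
    2 * x i - ((∑ a, if t a = i then x (s a) else 0) + ∑ a, if s a = i then x (t a) else 0) := by
  rw [bf_apply, ← sum_add_distrib]
  congr 1
  · simp [Pi.single_apply]
  · refine sum_congr rfl fun a _ => ?_
    simp [Pi.single_apply]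

variable (s t) in
/-- Positive definiteness. -/
def IsPos : Prop := ∀ x : V → ℚ, x ≠ 0 → 0 < bf s t x x

lemma isPos_of_isDynkin (h : IsDynkin s t) : IsPos s t := by
  intro x hx
  obtain ⟨b, hb⟩ := IsLocalization.exist_integer_multiples_of_finite (nonZeroDivisors ℤ) x
  choose y hy using hb
  have hb0 : (b : ℤ) ≠ 0 := nonZeroDivisors.coe_ne_zero b
  have hy' : ∀ v, (y v : ℚ) = (b : ℤ) * x v := fun v => by simp_all
  have hbq : ((b : ℤ) : ℚ) ≠ 0 := Int.cast_ne_zero.2 hb0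
  have h1 := h y fun h0 => hx (funext fun v => by
    have := hy' v
    rw [h0, Pi.zero_apply, Int.cast_zero] at this
    exact (mul_eq_zero.1 this.symm).resolve_left hbq)
  have h2 : (eulerForm s t y y : ℚ) = (b : ℤ) ^ 2 * (∑ v, x v * x v - ∑ a, x (s a) * x (t a)) := by
    rw [eulerForm]
    push_cast
    rw [mul_sub, mul_sum, mul_sum]
    congr 1 <;> exact sum_congr rfl fun _ _ => by simp only [hy']; ring
  have h3 : (0 : ℚ) < eulerForm s t y y := Int.cast_pos.2 h1
  rw [h2] at h3
  rw [bf_self]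
  have := pos_of_mul_pos_right h3 (sq_nonneg _)
  linarith

lemma IsPos.ne_loop (h : IsPos s t) (a : A) : s a ≠ t a := by
  intro ha
  have h1 := h (Pi.single (t a) 1) (by simp)
  rw [bf_single, Pi.single_eq_same] at h1
  have h2 : ∀ f g : A → V, g a = t a → f a = t a →
      (1 : ℚ) ≤ ∑ b, if g b = t a then (Pi.single (t a) 1 : V → ℚ) (f b) else 0 := by
    intro f g hg hf
    refine le_trans ?_ (Finset.single_le_sum (fun b _ => ?_) (mem_univ a))
    · rw [if_pos hg, hf, Pi.single_eq_same]
    · split_ifs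
      · rw [Pi.single_apply]; split_ifs <;> norm_num
      · exact le_rfl
  have h3 := h2 s t rfl ha
  have h4 := h2 t s ha rfl
  linarith

lemma IsPos.exists_sink (h : IsPos s t) (p : V → Prop) (hp : ∃ v, p v) :
    ∃ i, p i ∧ ∀ a, s a = i → ¬ p (t a) := by
  classical
  by_contra h0
  push Not at h0
  obtain ⟨v, hv⟩ := hp
  have : Nonempty A := ⟨(h0 v hv).choose⟩
  choose! f hf1 hf2 using h0
  have h1 := h (fun v => if p v then 1 else 0) fun h0 => by
    have := congrFun h0 v
    simp [hv] at this
  rw [bf_self] at h1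
  have h2 : ∑ v, (if p v then (1 : ℚ) else 0) * (if p v then 1 else 0) =
      (Finset.univ.filter p).card := by simp_all
  have h3 : ∑ a, (if p (s a) then (1 : ℚ) else 0) * (if p (t a) then 1 else 0) =
      (Finset.univ.filter fun a => p (s a) ∧ p (t a)).card := by
    rw [Finset.card_filter]
    push_cast
    refine sum_congr rfl fun v _ => ?_
    by_cases h4 : p (s v) <;> by_cases h5 : p (t v) <;> simp [h4, h5]
  have h4 : (Finset.univ.filter p).card ≤ (Finset.univ.filter fun a => p (s a) ∧ p (t a)).card := by
    refine Finset.card_le_card_of_injOn f (fun w hw => ?_) fun w hw w' hw' hww => ?_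
    · have hw := (Finset.mem_filter.1 hw).2
      exact Finset.mem_filter.2 ⟨mem_univ _, by rw [hf1 w hw]; exact hw, hf2 w hw⟩
    · rw [← hf1 w (Finset.mem_filter.1 hw).2, ← hf1 w' (Finset.mem_filter.1 hw').2, hww]
  have h5 : ((Finset.univ.filter p).card : ℚ) ≤
    (Finset.univ.filter fun a => p (s a) ∧ p (t a)).card := by exact_mod_cast h4
  rw [h2, h3] at h1
  linarith

lemma IsPos.nondeg (h : IsPos s t) (f : Module.Dual ℚ (V → ℚ)) : ∃ u, ∀ y, bf s t u y = f y := by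
  have hi : Injective (bf s t) := by
    rw [← LinearMap.ker_eq_bot, LinearMap.ker_eq_bot']
    intro x hx
    by_contra hne
    have := h x hne
    rw [hx] at this
    exact lt_irrefl _ this
  have hs : Function.Surjective (bf s t) :=
    (LinearMap.injective_iff_surjective_of_finrank_eq_finrank
      (Subspace.dual_finrank_eq (K := ℚ) (V := V → ℚ)).symm).1 hi
  obtain ⟨u, hu⟩ := hs f
  exact ⟨u, fun y => by rw [hu]⟩

lemma IsPos.nonneg (h : IsPos s t) (x : V → ℚ) : 0 ≤ bf s t x x := by
  by_cases hx : x = 0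
  · rw [hx, map_zero]
  · exact (h x hx).le

lemma IsPos.finite (h : IsPos s t) (c : ℚ) :
    {d : V → ℤ | bf s t (fun v => (d v : ℚ)) (fun v => (d v : ℚ)) = c}.Finite := by
  choose ω hω using fun v => h.nondeg (LinearMap.proj v)
  obtain ⟨N, hN⟩ : ∃ N : V → ℤ, ∀ v, N v = ⌈bf s t (ω v) (ω v) * c⌉ := ⟨_, fun _ => rfl⟩
  refine (Set.finite_Icc (-N) N).subset fun d hd => ?_
  have hd : bf s t (fun v => (d v : ℚ)) (fun v => (d v : ℚ)) = c := hd
  have key : ∀ v, |d v| ≤ N v := fun v => by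
    have h1 := LinearMap.BilinForm.apply_sq_le_of_symm (bf s t) h.nonneg ⟨fun x y => bf_comm x y⟩
      (ω v) (fun v => (d v : ℚ))
    rw [hω v, hd, LinearMap.proj_apply] at h1
    have h2 : ((d v ^ 2 : ℤ) : ℚ) ≤ N v := by
      rw [hN]; push_cast; exact h1.trans (Int.le_ceil _)
    have h3 : d v ^ 2 ≤ N v := by exact_mod_cast h2
    refine le_trans ?_ h3
    rw [← sq_abs]
    nlinarith [abs_nonneg (d v), Int.one_le_abs (z := d v), sq_nonneg (|d v|),
      (abs_nonneg (d v)).eq_or_lt.imp id Int.add_one_le_iff.2]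
  exact ⟨fun v => neg_le_of_abs_le (key v), fun v => le_of_abs_le (key v)⟩

lemma IsPos.exists_weight (h : IsPos s t) :
    ∃ u : V → ℚ, (∀ i, bf s t u (Pi.single i 1) = 1) ∧ ∀ i, 0 ≤ u i := by
  obtain ⟨u, hu⟩ := h.nondeg (∑ v, LinearMap.proj v)
  have hu' : ∀ y, bf s t u y = ∑ v, y v := fun y => by
    rw [hu, LinearMap.sum_apply]; rfl
  refine ⟨u, fun i => by rw [hu', Finset.sum_pi_single']; simp, ?_⟩
  obtain ⟨w, hw⟩ : ∃ w : V → ℚ, ∀ v, w v = max (-u v) 0 := ⟨_, fun _ => rfl⟩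
  obtain ⟨p, hp⟩ : ∃ p : V → ℚ, ∀ v, p v = max (u v) 0 := ⟨_, fun _ => rfl⟩
  have hupw : u = p - w := funext fun v => by simp_all
  have hw0 : ∀ v, 0 ≤ w v := fun v => by rw [hw]; exact le_max_right _ _
  have hp0 : ∀ v, 0 ≤ p v := fun v => by rw [hp]; exact le_max_right _ _
  have h1 : bf s t p w ≤ 0 := by
    rw [bf_apply]
    have : ∀ v, 2 * (p v * w v) = 0 := fun v => by
      rw [hp, hw]
      rcases le_total (u v) 0 with h1 | h1
      · rw [max_eq_right h1]; ring
      · rw [max_eq_right (by linarith : -u v ≤ 0)]; ring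
    rw [sum_congr rfl fun v _ => this v, Finset.sum_const_zero, zero_sub, neg_nonpos]
    exact sum_nonneg fun a _ => add_nonneg (mul_nonneg (hp0 _) (hw0 _))
      (mul_nonneg (hp0 _) (hw0 _))
  have h2 : 0 ≤ bf s t u w := by rw [hu']; exact sum_nonneg fun v _ => hw0 v
  have h3 : w = 0 := by
    by_contra hne
    have h4 := h w hne
    rw [hupw, map_sub, lsub_apply] at h2
    linarith
  intro i
  rw [hupw, h3, sub_zero]
  exact hp0 i

end Tits

section TitsRefl

lemma bf_refl : bf (rs s t i) (rt s t i) = bf s t := by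
  refine LinearMap.ext fun x => LinearMap.ext fun y => ?_
  rw [bf_apply, bf_apply]
  congr 1
  refine sum_congr rfl fun a _ => ?_
  by_cases h : t a = i
  · rw [rs, rt, if_pos h, if_pos h, h, add_comm]
  · rw [rs, rt, if_neg h, if_neg h]

lemma sum_In (f : A → ℚ) : ∑ a : In t i, f a.1 = ∑ a, if t a = i then f a else 0 := by
  rw [← Finset.sum_filter]
  exact (Finset.sum_subtype _ (fun a => by simp) f).symm

/-- `y` is the reflection of `x` at the sink `i`. -/
structure IsTR (s t : A → V) (i : V) (x y : V → ℚ) : Prop where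
  ne : ∀ v, v ≠ i → y v = x v
  self : y i = (∑ a : In t i, x (s a.1)) - x i

lemma IsTR.bf_eq {x y : V → ℚ} (h : IsTR s t i x y) (hl : ∀ a, t a = i → s a ≠ i)
    (ho : ∀ a, s a = i → x (t a) = 0) : bf s t y y = bf s t x x := by
  have h1 : bf s t x (Pi.single i 1) = x i - y i := by
    rw [bf_single, h.self, sum_In fun a => x (s a)]
    have : (∑ a, if s a = i then x (t a) else 0) = 0 :=
      Finset.sum_eq_zero fun a _ => by split_ifs with h2; exacts [ho a h2, rfl]
    rw [this]
    ring
  have h2 : bf s t (Pi.single i 1) (Pi.single i 1) = 2 := by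
    rw [bf_single, Pi.single_eq_same]
    have h3 : ∀ a, (if t a = i then (Pi.single i 1 : V → ℚ) (s a) else 0) = 0 := fun a => by grind
    have h4 : ∀ a, (if s a = i then (Pi.single i 1 : V → ℚ) (t a) else 0) = 0 := fun a => by grind
    simp only [h3, h4, Finset.sum_const_zero]
    norm_num
  have h3 : y = x - (x i - y i) • Pi.single i (1 : ℚ) := by
    funext v
    by_cases hv : v = i
    · subst hv; simp
    · simp [Pi.single_eq_of_ne hv, h.ne v hv]
  rw [h3]
  simp only [map_sub, map_smul, lsub_apply, lsmul_apply, smul_eq_mul]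
  rw [bf_comm (Pi.single i 1) x, h1, h2]
  ring

/-- A potential increasing under reflections. -/
def pot (u : V → ℚ) (s t : A → V) (x : V → ℚ) : ℚ := ∑ v, x v * u v - ∑ a, x (s a) * u (t a)

lemma IsTR.pot_eq {x y u : V → ℚ} (h : IsTR s t i x y) (hl : ∀ a, t a = i → s a ≠ i)
    (hu : bf s t u (Pi.single i 1) = 1) : pot u (rs s t i) (rt s t i) y =
      pot u s t x + y i + x i * ∑ a, if s a = i then u (t a) else 0 := by
  have h1 : ∑ v, y v * u v = ∑ v, x v * u v + (y i - x i) * u i := by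
    rw [← Finset.add_sum_erase _ _ (mem_univ i),
      ← Finset.add_sum_erase (a := i) _ (fun v => x v * u v) (mem_univ i),
      sum_congr rfl fun v hv => by rw [h.ne v (Finset.ne_of_mem_erase hv)]]
    ring
  have h2 : ∑ a, y (rs s t i a) * u (rt s t i a) = ∑ a, x (s a) * u (t a) +
      y i * (∑ a, if t a = i then u (s a) else 0) - (∑ a, if t a = i then x (s a) else 0) * u i +
      (y i - x i) * ∑ a, if s a = i then u (t a) else 0 := by
    rw [mul_sum, mul_sum, sum_mul, ← sum_add_distrib, ← Finset.sum_sub_distrib, ← sum_add_distrib]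
    refine sum_congr rfl fun a _ => ?_
    by_cases ha : t a = i
    · rw [rs, rt, if_pos ha, if_pos ha, if_pos ha, if_pos ha, if_neg (hl a ha), ha]
      ring
    · rw [rs, rt, if_neg ha, if_neg ha, if_neg ha, if_neg ha]
      by_cases hs : s a = i
      · rw [if_pos hs, hs]; ring
      · rw [if_neg hs, h.ne _ hs]; ring
  have h3 := h.self
  rw [sum_In fun a => x (s a)] at h3
  rw [bf_single] at hu
  rw [pot, pot, h1, h2]
  have h4 : (∑ a, if t a = i then x (s a) else 0) = y i + x i := by rw [h3]; ring
  rw [h4]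
  linear_combination y i * hu

lemma IsTR.sum_eq {x y : V → ℚ} (h : IsTR s t i x y) : ∑ v, y v = ∑ v, x v + (y i - x i) := by
  rw [← Finset.add_sum_erase _ _ (mem_univ i), ← Finset.add_sum_erase (a := i) _ x (mem_univ i),
    sum_congr rfl fun v hv => by rw [h.ne v (Finset.ne_of_mem_erase hv)]]
  ring

end TitsRefl

section Main

/-- Dimension vectors on reorientations with prescribed value of the Tits form. -/
abbrev TS (s t : A → V) (c : ℚ) : Type := {z : (A → V) × (A → V) × (V → ℤ) //
  bf z.1 z.2.1 = bf s t ∧ bf s t (fun v => (z.2.2 v : ℚ)) (fun v => (z.2.2 v : ℚ)) = c}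

lemma IsPos.finite_TS (h : IsPos s t) (c : ℚ) : Finite (TS s t c) :=
  ((Set.finite_univ (α := A → V)).prod
    ((Set.finite_univ (α := A → V)).prod (h.finite c))).subset fun z hz =>
      ⟨Set.mem_univ _, Set.mem_univ _, hz.2⟩

/-- The quantity decreasing under reflections. -/
def TS.val {c : ℚ} (u : V → ℚ) (z : TS s t c) : ℚ ×ₗ ℤ :=
  toLex (-pot u z.1.1 z.1.2.1 (fun v => (z.1.2.2 v : ℚ)), ∑ v, z.1.2.2 v)

lemma IsPos.wf (h : IsPos s t) (c : ℚ) (u : V → ℚ) :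
    WellFounded (InvImage (· < ·) (TS.val (s := s) (t := t) (c := c) u)) := by
  have := h.finite_TS c
  have : IsTrans _ (InvImage (· < ·) (TS.val (s := s) (t := t) (c := c) u)) :=
    ⟨fun _ _ _ h1 h2 => lt_trans (a := TS.val u _) h1 h2⟩
  have : Std.Irrefl (InvImage (· < ·) (TS.val (s := s) (t := t) (c := c) u)) :=
    ⟨fun _ h1 => lt_irrefl (TS.val u _) h1⟩
  exact Finite.wellFounded_of_trans_of_irrefl _

lemma IsRefl.isTR {i : V} {κ ν : Type} [Fintype κ] [DecidableEq κ] [Fintype ν] [DecidableEq ν]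
    {P : V → Mat κ} {M : A → Mat κ}
    {K : Mat (κ × In t i)} {σ : Matrix (κ × In t i) κ ℂ}
    {α : Matrix ν κ ℂ} {β : Matrix ν (κ × In t i) ℂ} (hr : IsRep s t P M)
    (hK : IsRefl s t i P M K σ) (hα : αᴴ * α = 1)
    (hβ : βᴴ * β = 1) (hr' : ∀ v, IsProj (rP t i P K α β v)) :
    IsTR s t i (fun v => ((P v).rank : ℚ)) fun v => ((rP t i P K α β v).rank : ℚ) := by
  refine ⟨fun v hv => ?_, ?_⟩
  · have h1 := (hr' v).trace_eq
    rw [rP_ne hv, cj_trace hα, (hr.proj v).trace_eq] at h1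
    rw [rP_ne hv]
    exact_mod_cast h1.symm
  · have h1 := (hr' i).trace_eq
    rw [rP_self, cj_trace hβ, hK.trace hr, (hr.proj i).trace_eq,
      sum_congr rfl fun (a : In t i) _ => (hr.proj (s a.1)).trace_eq] at h1
    rw [rP_self]
    have h2 : (((cj β K).rank : ℚ) : ℂ) =
        (((∑ a : In t i, ((P (s a.1)).rank : ℚ)) - ((P i).rank : ℚ) : ℚ) : ℂ) := by
      push_cast
      exact h1.symm
    exact_mod_cast h2

theorem brick_and_ov_aux (h : IsPos s t) (c : ℚ) {u : V → ℚ}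
    (hu : ∀ i, bf s t u (Pi.single i 1) = 1) (hu0 : ∀ i, 0 ≤ u i) (z : TS s t c) :
    ∀ (κ : Type) [Fintype κ] [DecidableEq κ] (P : V → Mat κ) (M : A → Mat κ),
      IsRep z.1.1 z.1.2.1 P M → IsInd z.1.1 z.1.2.1 P M → (∀ v, z.1.2.2 v = (P v).rank) →
      IsBrick z.1.1 z.1.2.1 P M ∧ ∀ e, (C (Gr z.1.1 z.1.2.1 P M e)).OV := by
  induction z using (h.wf c u).induction with
  | _ z ih =>
  intro κ _ _ P M hr hind hd
  obtain ⟨⟨s', t', d⟩, hz1, hz2⟩ := z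
  change bf s' t' = bf s t at hz1
  change bf s t (fun v => (d v : ℚ)) (fun v => (d v : ℚ)) = c at hz2
  change IsRep s' t' P M at hr
  change IsInd s' t' P M at hind
  change ∀ v, d v = (P v).rank at hd
  change IsBrick s' t' P M ∧ ∀ e, (C (Gr s' t' P M e)).OV
  have hdq : (fun v => (d v : ℚ)) = fun v => ((P v).rank : ℚ) := funext fun v => by
    rw [hd]; exact Int.cast_natCast _
  have hpos : IsPos s' t' := fun x hx => by rw [hz1]; exact h x hx
  obtain ⟨i, hi, ho⟩ := hpos.exists_sink (fun v => P v ≠ 0) hind.ne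
  have ho : ∀ a, s' a = i → P (t' a) = 0 := fun a ha => not_not.1 (ho a ha)
  have hl : ∀ a, t' a = i → s' a ≠ i := fun a ha hs => hpos.ne_loop a (hs.trans ha.symm)
  rcases exists_refl hr with ⟨K, σ, hK⟩ | ⟨p, hp, hPp, hpR⟩
  swap
  · exact simple_case hr hind hl ho hp hPp hpR
  obtain ⟨α, hα0⟩ : ∃ α : Matrix (κ ⊕ (κ × In t' i)) κ ℂ, α = fromRows 1 0 := ⟨_, rfl⟩
  obtain ⟨β, hβ0⟩ : ∃ β : Matrix (κ ⊕ (κ × In t' i)) (κ × In t' i) ℂ, β = fromRows 0 1 :=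
    ⟨_, rfl⟩
  have hα : αᴴ * α = 1 := by
    rw [hα0, conjTranspose_fromRows_eq_fromCols_conjTranspose, fromCols_mul_fromRows]
    simp
  have hβ : βᴴ * β = 1 := by
    rw [hβ0, conjTranspose_fromRows_eq_fromCols_conjTranspose, fromCols_mul_fromRows]
    simp
  have hr' := rep_refl hr hK hα hβ hl ho
  have hind' := ind_refl hr hK hα hβ hl ho hind
  have hTR := hK.isTR hr hα hβ hr'.proj
  have ho' : ∀ a, s' a = i → ((P (t' a)).rank : ℚ) = 0 := fun a ha => by simp_all
  have hi' : 0 < (P i).rank := Nat.pos_of_ne_zero fun h0 => hi <| by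
    have h1 := (hr.proj i).trace_eq
    rw [h0, Nat.cast_zero] at h1
    rw [← mul_herm_trace_eq_zero, (hr.proj i).herm, (hr.proj i).idem, h1]
  have hbb := hTR.bf_eq hl ho'
  have hz' : bf (rs s' t' i) (rt s' t' i) = bf s t := bf_refl.trans hz1
  have ih' := ih ⟨⟨rs s' t' i, rt s' t' i, fun v => ((rP t' i P K α β v).rank : ℤ)⟩, hz', by
    change bf s t (fun v => (((rP t' i P K α β v).rank : ℤ) : ℚ))
      (fun v => (((rP t' i P K α β v).rank : ℤ) : ℚ)) = c
    simp only [Int.cast_natCast]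
    rw [← hz2, hdq, ← hz1]
    exact hbb⟩ (by
    change toLex (-pot u (rs s' t' i) (rt s' t' i)
        (fun v => (((rP t' i P K α β v).rank : ℤ) : ℚ)), ∑ v, ((rP t' i P K α β v).rank : ℤ)) <
      toLex (-pot u s' t' (fun v => (d v : ℚ)), ∑ v, d v)
    rw [hdq]
    simp only [Int.cast_natCast]
    rw [Prod.Lex.toLex_lt_toLex]
    have h1 := hTR.pot_eq hl (by rw [hz1]; exact hu i)
    have h2 : 0 ≤ ((P i).rank : ℚ) * ∑ a, if s' a = i then u (t' a) else 0 :=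
      mul_nonneg (Nat.cast_nonneg _) (sum_nonneg fun a _ => by
        split_ifs; exacts [hu0 _, le_rfl])
    have h3 := hTR.sum_eq
    rcases Nat.eq_zero_or_pos (rP t' i P K α β i).rank with h4 | h4
    · have h5 : (((rP t' i P K α β i).rank : ℕ) : ℚ) = 0 := by rw [h4]; exact Nat.cast_zero
      have h6 : (0 : ℚ) < (P i).rank := Nat.cast_pos.2 hi'
      have h7 : (∑ v, ((rP t' i P K α β v).rank : ℤ)) < ∑ v, d v := by
        rw [sum_congr rfl fun v _ => hd v]
        have : ((∑ v, ((rP t' i P K α β v).rank : ℤ) : ℤ) : ℚ) <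
            ((∑ v, ((P v).rank : ℤ) : ℤ) : ℚ) := by
          push_cast
          linarith
        exact_mod_cast this
      rcases h2.eq_or_lt with h8 | h8
      · right
        refine ⟨?_, h7⟩
        change -_ = -_
        linarith
      · left
        change -_ < -_
        linarith
    · left
      have h5 : (0 : ℚ) < (((rP t' i P K α β i).rank : ℕ) : ℚ) := Nat.cast_pos.2 h4
      change -_ < -_
      linarith) _ _ _ hr' hind' (fun v => rfl)
  have hb := brick_of_refl hr hK hα hβ hl ho ih'.1
  refine ⟨hb, fun e => ov_of_refl hr hK hα hβ hl ho (rigid_of_brick hr hb ?_) ih'.2 e⟩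
  have h1 := hpos (fun v => ((P v).rank : ℚ)) fun h0 => hi'.ne' (by
    have h2 : ((P i).rank : ℚ) = 0 := congrFun h0 i
    exact_mod_cast h2)
  rw [bf_self] at h1
  have h2 : ((∑ a, (P (t' a)).rank * (P (s' a)).rank : ℕ) : ℚ) <
      ((∑ v, (P v).rank * (P v).rank : ℕ) : ℚ) := by
    push_cast
    rw [sum_congr rfl fun a _ => mul_comm ((P (t' a)).rank : ℚ) ((P (s' a)).rank : ℚ)]
    linarith
  exact_mod_cast h2

theorem ov_of_isInd (h : IsPos s t) {κ : Type} [Fintype κ] [DecidableEq κ] {P : V → Mat κ}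
    {M : A → Mat κ} (hr : IsRep s t P M) (hi : IsInd s t P M) (e : V → ℕ) :
    (C (Gr s t P M e)).OV := by
  obtain ⟨u, hu, hu0⟩ := h.exists_weight
  exact (brick_and_ov_aux h _ hu hu0 ⟨⟨s, t, fun v => ((P v).rank : ℤ)⟩, rfl, rfl⟩ κ P M hr hi
    fun v => rfl).2 e

end Main

/-! ### Comparison with singular cohomology -/

section Sing

lemma LC.d_ofFn {S : Type} : ∀ (n : ℕ) (v : Fin (n + 1) → S),
    LC.d (L (ofFn v)) = ∑ i : Fin (n + 1), (-1 : ℚ) ^ (i : ℕ) •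
      L (ofFn fun j => v (i.succAbove j))
  | 0, v => by
    rw [List.ofFn_succ, LC.d_L_cons, List.ofFn_zero, LC.d_nil, map_zero, sub_zero, Fin.sum_univ_one]
    simp
  | n + 1, v => by
    rw [List.ofFn_succ, LC.d_L_cons, LC.d_ofFn n, Fin.sum_univ_succ (n := n + 1), map_sum,
      sub_eq_add_neg, ← Finset.sum_neg_distrib]
    congr 1
    · simp
    · refine sum_congr rfl fun i _ => ?_
      rw [map_smul, LC.cons_L, List.ofFn_succ (f := fun j => v (i.succ.succAbove j))]
      simp only [Fin.succ_succAbove_zero, Fin.succ_succAbove_succ, Fin.val_succ, pow_succ]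
      simp

lemma affT_vert_comp {m n : ℕ} (f : Fin m → Fin n) :
    (affT fun j => Δ.vert (f j) : C(Δ m, Δ n)) =
      ⟨stdSimplex.map f, stdSimplex.continuous_map f⟩ := by
  classical
  ext t j
  change ∑ i, t.1 i * (Δ.vert (f i)).1 j = FunOnFinite.linearMap ℝ ℝ f t.1 j
  rw [FunOnFinite.linearMap_apply_apply, Finset.sum_filter]
  refine sum_congr rfl fun i _ => ?_
  simp [Δ.vert, Pi.single_apply, eq_comm]

variable {X : Type} [TopologicalSpace X]

lemma dC_succ (n : ℕ) (σ : C(Δ (n + 2), X)) :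
    dC (fsingle (⟨n + 1, σ⟩ : Simp X) 1) = ∑ i : Fin (n + 2), (-1 : ℚ) ^ (i : ℕ) •
      fsingle (⟨n, σ.comp ⟨stdSimplex.map i.succAbove, stdSimplex.continuous_map _⟩⟩ :
        Simp X) 1 := by
  rw [dC, ext, lin_L, ι, LC.d_ofFn, map_sum]
  refine sum_congr rfl fun i _ => ?_
  rw [map_smul, R_ofFn, realT, affT_vert_comp]

lemma dC_zero (σ : C(Δ 1, X)) : dC (fsingle (⟨0, σ⟩ : Simp X) 1) = 0 := by
  rw [dC, ext, lin_L, ι, List.ofFn_succ, LC.d_L_cons, List.ofFn_zero, LC.d_nil, map_zero, sub_zero,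
    R_nil]

open CategoryTheory Opposite Simplicial

variable (X) in
/-- Singular simplices of a fixed dimension. -/
def simpI (n : ℕ) (g : (TopCat.toSSet.obj (TopCat.of X)) _⦋n⦌) : Simp X :=
  ⟨n, TopCat.toSSetObjEquiv (TopCat.of X) (op ⦋n⦌) g⟩

lemma simpI_inj (n : ℕ) : Injective (simpI X n) := fun g g' h => by
  have h2 := eq_of_heq (Sigma.mk.inj h).2
  exact (TopCat.toSSetObjEquiv (TopCat.of X) (op ⦋n⦌)).injective h2

lemma simpI_surj (n : ℕ) (σ : C(Δ (n + 1), X)) : ∃ g, simpI X n g = ⟨n, σ⟩ :=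
  ⟨(TopCat.toSSetObjEquiv (TopCat.of X) (op ⦋n⦌)).symm σ, by
    rw [simpI, Equiv.apply_symm_apply]⟩

variable (X) in
/-- Singular chains of a fixed degree. -/
abbrev SC (n : ℕ) : Type := (TopCat.toSSet.obj (TopCat.of X)) _⦋n⦌ →₀ ℚ

variable (X) in
/-- The inclusion of chains of fixed degree. -/
def scI (n : ℕ) : SC X n →ₗ[ℚ] (Simp X →₀ ℚ) := lmapDomain ℚ ℚ (simpI X n)

variable (X) in
/-- The projection to chains of fixed degree. -/
def scP (n : ℕ) : (Simp X →₀ ℚ) →ₗ[ℚ] SC X n := Finsupp.lcomapDomain (simpI X n) (simpI_inj n)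

lemma scP_scI (n : ℕ) (x : SC X n) : scP X n (scI X n x) = x :=
  Finsupp.comapDomain_mapDomain _ (simpI_inj n) x

lemma scP_single_ne {n m : ℕ} (h : m ≠ n) (σ : C(Δ (m + 1), X)) :
    scP X n (fsingle (⟨m, σ⟩ : Simp X) 1) = 0 := by
  ext g
  change fsingle (⟨m, σ⟩ : Simp X) (1 : ℚ) (simpI X n g) = 0
  exact Finsupp.single_eq_of_ne fun h1 => h (congrArg Sigma.fst h1).symm

variable (X) in
/-- The simplicial module of singular chains. -/
abbrev SCm : SimplicialObject (ModuleCat ℚ) :=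
  ((SimplicialObject.whiskering _ _).obj (ModuleCat.free ℚ)).obj (TopCat.toSSet.obj (TopCat.of X))

variable (X) in
/-- The boundary operator. -/
def scD (n : ℕ) : SC X (n + 1) →ₗ[ℚ] SC X n :=
  (AlgebraicTopology.AlternatingFaceMapComplex.objD (SCm X) n).hom

lemma singComplex_d (n : ℕ) : (singComplex X).d (n + 1) n =
    AlgebraicTopology.AlternatingFaceMapComplex.objD (SCm X) n :=
  AlgebraicTopology.alternatingFaceMapComplex_obj_d _ _

lemma objD_apply (Y : SimplicialObject (ModuleCat ℚ)) (n : ℕ) (y : Y _⦋n + 1⦌) :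
    (AlgebraicTopology.AlternatingFaceMapComplex.objD Y n).hom y =
      ∑ i : Fin (n + 2), (-1 : ℚ) ^ (i : ℕ) • (Y.δ i).hom y := by
  rw [AlgebraicTopology.AlternatingFaceMapComplex.objD, ModuleCat.hom_sum, LinearMap.sum_apply]
  refine sum_congr rfl fun i _ => ?_
  rw [ModuleCat.hom_zsmul, lsmul_apply, ← Int.cast_smul_eq_zsmul ℚ]
  push_cast
  rfl

lemma scD_single (n : ℕ) (g : (TopCat.toSSet.obj (TopCat.of X)) _⦋n + 1⦌) :
    scD X n (fsingle g 1) = ∑ i : Fin (n + 2), (-1 : ℚ) ^ (i : ℕ) •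
      fsingle ((TopCat.toSSet.obj (TopCat.of X)).δ i g) 1 := by
  have h1 : ∀ i, ((SCm X).δ i).hom (fsingle g 1) =
      fsingle ((TopCat.toSSet.obj (TopCat.of X)).δ i g) (1 : ℚ) :=
    fun i => mapDomain_single
  refine (objD_apply (SCm X) n (fsingle g 1)).trans (sum_congr rfl fun i _ => ?_)
  rw [h1]
  rfl

lemma scI_scD (n : ℕ) (x : SC X (n + 1)) : scI X n (scD X n x) = dC (scI X (n + 1) x) := by
  have : scI X n ∘ₗ scD X n = dC ∘ₗ scI X (n + 1) := lin_ext fun g => by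
    rw [lcomp_apply, lcomp_apply, scD_single, map_sum]
    have h : ∀ m g, scI X m (fsingle g 1) = fsingle (simpI X m g) 1 :=
      fun m g => mapDomain_single
    rw [h, simpI, dC_succ]
    exact sum_congr rfl fun i _ => by rw [map_smul, h]; rfl
  exact lcongr_fun this x

lemma scP_dC (n : ℕ) (x : Simp X →₀ ℚ) : scP X n (dC x) = scD X n (scP X (n + 1) x) := by
  have : scP X n ∘ₗ dC = scD X n ∘ₗ scP X (n + 1) := lin_ext fun ⟨m, σ⟩ => by
    rw [lcomp_apply, lcomp_apply]
    by_cases h : m = n + 1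
    · subst h
      obtain ⟨g, hg⟩ := simpI_surj _ σ
      have h1 : fsingle (⟨n + 1, σ⟩ : Simp X) (1 : ℚ) =
          scI X (n + 1) (fsingle g 1) := by
        rw [← hg]; exact mapDomain_single.symm
      rw [h1, ← scI_scD, scP_scI, scP_scI]
    · rw [scP_single_ne h, map_zero]
      cases m with
      | zero => rw [dC_zero, map_zero]
      | succ m =>
        rw [dC_succ, map_sum]
        refine Finset.sum_eq_zero fun i _ => ?_
        rw [map_smul, scP_single_ne (fun h1 => h (by rw [h1])), smul_zero]
  exact lcongr_fun this x

lemma εC_scI (n : ℕ) (x : SC X n) : εC (scI X n x) = (-1 : ℚ) ^ n • scI X n x := by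
  have : εC ∘ₗ scI X n = (-1 : ℚ) ^ n • scI X n := lin_ext fun g => by
    have h : scI X n (fsingle g 1) = fsingle (simpI X n g) 1 :=
      mapDomain_single
    rw [lcomp_apply, lsmul_apply, h, εC, ext, lin_L]
    rfl
  exact lcongr_fun this x

theorem subsingleton_Hsing (h : (C X).OV) {n : ℕ} (hn : Odd n) : Subsingleton (Hsing n X) := by
  obtain ⟨k, rfl⟩ : ∃ k, n = k + 1 := ⟨n - 1, by have := hn.pos; omega⟩
  refine ModuleCat.subsingleton_of_isZero ?_
  refine ((HomologicalComplex.exactAt_iff_isZero_homology _ _).1 ?_)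
  rw [HomologicalComplex.exactAt_iff' _ (k + 1 + 1) (k + 1) k (by simp) (by simp),
    ShortComplex.moduleCat_exact_iff]
  intro (x : SC X (k + 1)) hx
  replace hx : scD X k x = 0 := (congrArg (fun f => f.hom x) (singComplex_d k)).symm.trans hx
  suffices h2 : ∃ y, scD X (k + 1) y = x by
    obtain ⟨y, hy⟩ := h2
    exact ⟨y, (congrArg (fun f => f.hom y) (singComplex_d (k + 1))).trans hy⟩
  obtain ⟨y, hy⟩ := h.odd (x := scI X (k + 1) x) (by
    change dC (scI X (k + 1) x) = 0
    rw [← scI_scD, hx, map_zero]) (by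
    change εC (scI X (k + 1) x) = _
    rw [εC_scI, hn.neg_one_pow, neg_smul, one_smul])
  refine ⟨scP X (k + 1 + 1) y, ?_⟩
  rw [← scP_dC]
  change scP X (k + 1) ((C X).d y) = x
  rw [hy, scP_scI]

theorem cohomology_of_ov (h : (C X).OV) :
    (∀ n : ℕ, Odd n → Subsingleton (Hcoh n X)) ∧ 0 ≤ eulerChar X := by
  have h1 : ∀ n : ℕ, Odd n → Subsingleton (Hcoh n X) := fun n hn => by
    have := subsingleton_Hsing h hn
    exact ⟨fun f g => LinearMap.ext fun x => by rw [Subsingleton.elim x 0, map_zero, map_zero]⟩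
  refine ⟨h1, finsum_nonneg fun n => ?_⟩
  rcases Nat.even_or_odd n with hn | hn
  · rw [hn.neg_one_pow, one_mul]
    exact Int.natCast_nonneg _
  · have := h1 n hn
    rw [Module.finrank_zero_of_subsingleton, Nat.cast_zero, mul_zero]

end Sing

/-! ### Quiver Grassmannians as spaces of projections -/

section Ranges

lemma range_le_iff {F : Matrix I J ℂ} {G : Matrix I K ℂ} :
    lrange F.mulVecLin ≤ lrange G.mulVecLin ↔ ∃ X : Matrix K J ℂ, F = G * X := by
  constructor
  · intro h
    have h1 : ∀ j, ∃ x, G *ᵥ x = F *ᵥ Pi.single j 1 := fun j => h ⟨Pi.single j 1, rfl⟩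
    choose x hx using h1
    refine ⟨of fun k j => x j k, ?_⟩
    ext i j
    have := congrFun (hx j) i
    rw [mulVec_single_one] at this
    exact this.symm
  · rintro ⟨X, rfl⟩ _ ⟨y, rfl⟩
    exact ⟨X *ᵥ y, by simp [mulVec_mulVec]⟩

lemma exists_left_inv {F : Matrix I J ℂ} (h : Injective F.mulVecLin) :
    ∃ B : Matrix J I ℂ, B * F = 1 := by
  obtain ⟨g, hg⟩ := LinearMap.exists_leftInverse_of_injective F.mulVecLin
    (LinearMap.ker_eq_bot.2 h)
  refine ⟨LinearMap.toMatrix' g, ?_⟩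
  rw [← LinearMap.toMatrix'_id, ← hg, LinearMap.toMatrix'_comp]
  congr 1
  exact (LinearMap.toMatrix'_toLin' F).symm

lemma inj_of_left_inv {F : Matrix I J ℂ} {B : Matrix J I ℂ} (h : B * F = 1) :
    Injective F.mulVecLin := fun x y hxy => by
  have := congrArg (B *ᵥ ·) hxy
  simpa [mulVec_mulVec, h] using this

lemma IsProj.eq_of_trace {p q : Mat K} (hp : IsProj p) (hq : IsProj q) (h : q * p = p)
    (ht : p.trace = q.trace) : p = q := by
  have h' := hq.symm hp h
  have h1 : IsProj (q - p) := ⟨by rw [conjTranspose_sub, hp.herm, hq.herm], by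
    rw [msub_mul, mmul_sub, mmul_sub, hp.idem, hq.idem, h, h']; abel⟩
  have h2 := h1.trace_eq
  rw [trace_sub, ht, sub_self, eq_comm, Nat.cast_eq_zero] at h2
  replace h2 := toLin'.map_eq_zero_iff.1 (LinearMap.range_eq_bot.1 (Submodule.finrank_eq_zero.1 h2))
  exact (sub_eq_zero.1 h2).symm

/-- Projections factor through their range. -/
lemma IsProj.factor {q : Mat K} (hq : IsProj q) {n : ℕ} (h : q.trace = n) :
    ∃ (G : Matrix K (Fin n) ℂ) (H : Matrix (Fin n) K ℂ), G * H = q ∧ H * G = 1 := by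
  have h1 : finrank ℂ (lrange q.mulVecLin) = n := by
    have := hq.trace_eq
    rw [h, Nat.cast_inj] at this
    exact this.symm
  have b := LinearEquiv.ofFinrankEq (lrange q.mulVecLin) (Fin n → ℂ)
    (h1.trans (Module.finrank_fin_fun ℂ).symm)
  obtain ⟨G, hG⟩ : ∃ G, G = LinearMap.toMatrix' ((lrange q.mulVecLin).subtype ∘ₗ
    b.symm.toLinearMap) := ⟨_, rfl⟩
  have hi : Injective G.mulVecLin := by
    rw [hG, ← toLin'_apply', toLin'_toMatrix']
    exact (Subtype.val_injective).comp b.symm.injective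
  obtain ⟨B, hB⟩ := exists_left_inv hi
  have h2 : lrange q.mulVecLin ≤ lrange G.mulVecLin := fun x hx =>
    ⟨b ⟨x, hx⟩, by
      rw [hG, ← toLin'_apply', toLin'_toMatrix']
      simp⟩
  have h3 : lrange G.mulVecLin ≤ lrange q.mulVecLin := by
    rintro _ ⟨x, rfl⟩
    have h5 : G.mulVecLin x = (b.symm x : K → ℂ) := by simp_all
    exact h5 ▸ (b.symm x).2
  obtain ⟨H, hH⟩ := range_le_iff.1 h2
  obtain ⟨X, hX⟩ := range_le_iff.1 h3
  refine ⟨G, H, hH.symm, ?_⟩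
  have h4 : q * G = G := by
    have h5 : q * (q * X) = q * X := by rw [← mulA, hq.idem]
    rwa [← hX] at h5
  calc H * G = B * G * (H * G) := by rw [hB, mone_mul]
    _ = B * (G * H * G) := by simp only [mulA]
    _ = 1 := by rw [← hH, h4, hB]

lemma mv_one_factor {F : Matrix I J ℂ} : mv F 1 = F * ((sv F 1)⁻¹ * Fᴴ) := by
  rw [mv_eq, mmul_one, mmul_one]

lemma mv_one_mul {F : Matrix I J ℂ} {B : Matrix J I ℂ} (hB : B * F = 1) : mv F 1 * F = F := by
  have := mv_mul (q := 1) IsProj.one hB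
  rwa [mmul_one] at this

lemma mul_mv_one {F : Matrix I J ℂ} {T : Mat I}
    (h : T * F = F) : T * mv F 1 = mv F 1 := by
  rw [mv_one_factor, ← mulA, h]

lemma mv_one_trace {n : ℕ} {F : Matrix I (Fin n) ℂ} {B : Matrix (Fin n) I ℂ} (hB : B * F = 1) :
    (mv F 1).trace = n := by
  rw [mv_trace IsProj.one hB, trace_one, Fintype.card_fin]

end Ranges

section Link
variable {V A : Type} {s t : A → V} {d : V → ℕ} {κ : Type} [Fintype κ] [DecidableEq κ]
  {E : ∀ v, Matrix κ (Fin (d v)) ℂ} {M : QRep s t d} {e : V → ℕ}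

/-- The projections onto the images of isometries. -/
abbrev pE (E : ∀ v, Matrix κ (Fin (d v)) ℂ) (v : V) : Mat κ := E v * (E v)ᴴ

/-- The representation transported along isometries. -/
abbrev mE (E : ∀ v, Matrix κ (Fin (d v)) ℂ) (M : QRep s t d) (a : A) : Mat κ :=
  E (t a) * M a * (E (s a))ᴴ

lemma pE_mul (hE : ∀ v, (E v)ᴴ * E v = 1) (v : V) : pE E v * E v = E v := by
  rw [mulA, hE, mmul_one]

lemma pE_mul_mul (hE : ∀ v, (E v)ᴴ * E v = 1) (v : V) {n : ℕ} (X : Matrix (Fin (d v)) (Fin n) ℂ) :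
    pE E v * (E v * X) = E v * X := by rw [← mulA, pE_mul hE]

lemma isProj_pE (hE : ∀ v, (E v)ᴴ * E v = 1) (v : V) : IsProj (pE E v) := by
  refine ⟨by rw [conjTranspose_mul, conjTranspose_conjTranspose], ?_⟩
  rw [← mulA, pE_mul hE]

lemma mE_mul (hE : ∀ v, (E v)ᴴ * E v = 1) (a : A) : mE E M a * E (s a) = E (t a) * M a := by
  rw [mulA, hE, mmul_one]

lemma mE_mul_mul (hE : ∀ v, (E v)ᴴ * E v = 1) (a : A) {n : ℕ}
    (X : Matrix (Fin (d (s a))) (Fin n) ℂ) :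
    mE E M a * (E (s a) * X) = E (t a) * (M a * X) := by
  rw [← mulA, mE_mul hE, mulA]

lemma isRep_mE (hE : ∀ v, (E v)ᴴ * E v = 1) : IsRep s t (pE E) (mE E M) := by
  refine ⟨isProj_pE hE, fun a => ?_⟩
  rw [← mulA, mulA _ (mE E M a), mE_mul hE, ← mulA, pE_mul hE]

lemma isInd_mE (hE : ∀ v, (E v)ᴴ * E v = 1) (hM : Indec s t M) :
    IsInd s t (pE E) (mE E M) := by
  obtain ⟨⟨i, hi⟩, hM⟩ := hM
  refine ⟨⟨i, fun h => ?_⟩, fun φ hφ h2 => ?_⟩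
  · have h1 := pE_mul hE i
    rw [h, mzero_mul] at h1
    have h2 := hE i
    rw [← h1, mmul_zero] at h2
    have := congrFun (congrFun h2 ⟨0, hi⟩) ⟨0, hi⟩
    simp at this
  · have hr : ∀ v, φ v * pE E v = φ v := fun v => by
      conv_lhs => rw [← hφ.le v]
      rw [mulA, (isProj_pE hE v).idem, hφ.le]
    have key : ∀ v, E v * ((E v)ᴴ * φ v * E v) * (E v)ᴴ = φ v := fun v => by
      conv_rhs => rw [← hφ.le v]
      simp only [mulA]
    obtain h | h := hM ⟨fun v => (E v)ᴴ * φ v * E v, fun a => by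
        have h1 := congrArg (fun x => (E (t a))ᴴ * x * E (s a)) (hφ.comm a)
        have h3 : (E (t a))ᴴ * (mE E M a * φ (s a)) * E (s a) =
            (E (t a))ᴴ * E (t a) * (M a * ((E (s a))ᴴ * φ (s a) * E (s a))) := by
          simp only [mulA]
        have h4 : (E (t a))ᴴ * (φ (t a) * mE E M a) * E (s a) =
            (E (t a))ᴴ * φ (t a) * E (t a) * M a * ((E (s a))ᴴ * E (s a)) := by
          simp only [mulA]
        beta_reduce at h1
        rw [h3, h4, hE, hE, mone_mul, mmul_one] at h1
        exact h1⟩ (fun v => by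
        change (E v)ᴴ * φ v * E v * ((E v)ᴴ * φ v * E v) = (E v)ᴴ * φ v * E v
        have h1 : (E v)ᴴ * φ v * E v * ((E v)ᴴ * φ v * E v) =
            (E v)ᴴ * (φ v * pE E v * φ v) * E v := by simp only [mulA]
        rw [h1, hr, h2])
    · refine .inl fun v => ?_
      have h1 : (E v)ᴴ * φ v * E v = 0 := h v
      rw [← key, h1, mmul_zero, mzero_mul]
    · refine .inr fun v => ?_
      have h1 : (E v)ᴴ * φ v * E v = 1 := h v
      rw [← key, h1, mmul_one]

lemma stq_left_inv (F : StQ s t M e) (v : V) :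
    ∃ B : Matrix (Fin (e v)) (Fin (d v)) ℂ, B * matOf F.1 v = 1 :=
  exists_left_inv (F.2.1 v)

lemma left_inv_E (hE : ∀ v, (E v)ᴴ * E v = 1) {v : V} {n : ℕ} {F : Matrix (Fin (d v)) (Fin n) ℂ}
    {B : Matrix (Fin n) (Fin (d v)) ℂ} (hB : B * F = 1) : B * (E v)ᴴ * (E v * F) = 1 := by
  rw [mulA, ← mulA _ (E v), hE, mone_mul, hB]

lemma stq_iff (F : Coord (V := V) d e) :
    (∀ a : A, (lrange (matOf F (s a)).mulVecLin).map (M a).mulVecLin ≤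
      lrange (matOf F (t a)).mulVecLin) ↔
    ∀ a, ∃ X : Matrix (Fin (e (t a))) (Fin (e (s a))) ℂ, M a * matOf F (s a) = matOf F (t a) * X := by
  refine forall_congr' fun a => ?_
  rw [← LinearMap.range_comp, ← mulVecLin_mul, range_le_iff]

/-- The projections onto the images of the maps. -/
def toGr (hE : ∀ v, (E v)ᴴ * E v = 1) (F : StQ s t M e) : Gr s t (pE E) (mE E M) e :=
  ⟨fun v => mv (E v * matOf F.1 v) 1, by
    choose B hB using stq_left_inv F
    obtain hX := (stq_iff F.1).1 F.2.2
    refine ⟨fun v => mv_proj IsProj.one (left_inv_E hE (hB v)), fun v => mul_mv_one ?_,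
      fun v => mv_one_trace (left_inv_E hE (hB v)), fun a => ?_⟩
    · rw [← mulA, pE_mul hE]
    · obtain ⟨X, hX⟩ := hX a
      rw [mv_one_factor (F := E (s a) * _), ← mulA, mulA _ (mE E M a),
        mE_mul_mul hE, hX, ← mulA (E (t a)), ← mulA _ _ X, msub_mul,
        mv_one_mul (left_inv_E hE (hB _)), pE_mul_mul hE, sub_self, mzero_mul, mzero_mul]⟩

/-- A tuple of injective maps with prescribed images. -/
lemma stq_of_gr (hE : ∀ v, (E v)ᴴ * E v = 1) (q : Gr s t (pE E) (mE E M) e)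
    (F : ∀ v, Matrix (Fin (d v)) (Fin (e v)) ℂ) (h : ∀ v, ∃ B : Matrix (Fin (e v)) (Fin (d v)) ℂ, B * F v = 1)
    (hq : ∀ v, q.1 v * (E v * F v) = E v * F v) :
    ∃ F' : StQ s t M e, toGr hE F' = q ∧ F'.1 = fun x => F x.1 x.2.1 x.2.2 := by
  choose B hB using h
  have h1 : ∀ v, mv (E v * F v) 1 = q.1 v := fun v =>
    (mv_proj IsProj.one (left_inv_E hE (hB v))).eq_of_trace (q.2.proj v) (mul_mv_one (hq v))
      ((mv_one_trace (left_inv_E hE (hB v))).trans (q.2.tr v).symm)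
  refine ⟨⟨fun x => F x.1 x.2.1 x.2.2, fun v => inj_of_left_inv (F := F v) (hB v),
    (stq_iff _).2 fun a => ?_⟩, sext (funext h1), rfl⟩
  change ∃ X : Matrix (Fin (e (t a))) (Fin (e (s a))) ℂ, M a * F (s a) = F (t a) * X
  have h2 := congrArg (· * (E (s a) * F (s a))) (q.2.inv a)
  have h3 : (pE E (t a) - q.1 (t a)) * mE E M a * q.1 (s a) * (E (s a) * F (s a)) =
      E (t a) * (M a * F (s a)) - q.1 (t a) * (E (t a) * (M a * F (s a))) := by
    rw [mulA, hq, mulA, mE_mul_mul hE, msub_mul, pE_mul_mul hE]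
  beta_reduce at h2
  rw [h3, mzero_mul, sub_eq_zero, ← h1, mv_one_factor] at h2
  have h4 := congrArg ((E (t a))ᴴ * ·) h2
  beta_reduce at h4
  simp only [← mulA] at h4
  rw [hE, mone_mul, mone_mul] at h4
  simp only [mulA] at h4
  exact ⟨_, h4⟩

lemma toGr_surj (hE : ∀ v, (E v)ᴴ * E v = 1) :
    Function.Surjective (toGr (M := M) (e := e) hE) := fun q => by
  choose G H h1 h2 using fun v => (q.2.proj v).factor (q.2.tr v)
  have h3 : ∀ v, q.1 v * G v = G v := fun v => by
    rw [← h1, mulA, h2, mmul_one]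
  have h4 : ∀ v, E v * ((E v)ᴴ * G v) = G v := fun v => by
    rw [← mulA]
    conv_lhs => rw [← h3, ← mulA, q.2.le]
    rw [h3]
  obtain ⟨F, hF, _⟩ := stq_of_gr hE q (fun v => (E v)ᴴ * G v)
    (fun v => ⟨H v * E v, by rw [mulA, h4, h2]⟩) (fun v => by rw [h4, h3])
  exact ⟨F, hF⟩

instance : TopologicalSpace (StQ s t M e) := TopologicalSpace.induced Subtype.val inferInstance

lemma continuous_matOf (v : V) : Continuous fun F : StQ s t M e => matOf F.1 v :=
  continuous_pi fun p => continuous_pi fun q =>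
    (continuous_apply (⟨v, (p, q)⟩ : Σ i : V, Fin (d i) × Fin (e i))).comp continuous_induced_dom

lemma continuous_toGr (hE : ∀ v, (E v)ᴴ * E v = 1) : Continuous (toGr (M := M) (e := e) hE) := by
  refine subtype_mk (continuous_pi fun v => ?_) _
  choose B hB using fun F : StQ s t M e => stq_left_inv F v
  exact continuous_mv (continuous_const.matrix_mul (continuous_matOf v)) continuous_const
    (fun _ => IsProj.one) fun F => left_inv_E hE (hB F)

lemma isOpenMap_toGr [Finite V] (hE : ∀ v, (E v)ᴴ * E v = 1) :
    IsOpenMap (toGr (M := M) (e := e) hE) := by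
  refine IsOpenMap.of_sections fun F => ?_
  choose B hB using stq_left_inv F
  have hloc : ∀ q : Gr s t (pE E) (mE E M) e, ∃ F' : StQ s t M e, toGr hE F' = q ∧
      ((∀ v, (B v * ((E v)ᴴ * q.1 v * (E v * matOf F.1 v))).det ≠ 0) →
        F'.1 = fun x => ((E x.1)ᴴ * q.1 x.1 * (E x.1 * matOf F.1 x.1)) x.2.1 x.2.2) := fun q => by
    by_cases h : ∀ v, (B v * ((E v)ᴴ * q.1 v * (E v * matOf F.1 v))).det ≠ 0
    · obtain ⟨F', h1, h2⟩ := stq_of_gr hE q (fun v => (E v)ᴴ * q.1 v * (E v * matOf F.1 v))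
        (fun v => ⟨(B v * ((E v)ᴴ * q.1 v * (E v * matOf F.1 v)))⁻¹ * B v, by
          rw [mulA, nonsing_inv_mul _ (isUnit_iff_ne_zero.2 (h v))]⟩) (fun v => by
          rw [← mulA (E v), ← mulA (E v), q.2.le, ← mulA, (q.2.proj v).idem])
      exact ⟨F', h1, fun _ => h2⟩
    · obtain ⟨F', h1⟩ := toGr_surj hE q
      exact ⟨F', h1, fun h' => absurd h' h⟩
  choose g hg1 hg2 using hloc
  have hF : ∀ v, (E v)ᴴ * (toGr hE F).1 v * (E v * matOf F.1 v) = matOf F.1 v := fun v => by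
    rw [mulA]
    change (E v)ᴴ * (mv (E v * matOf F.1 v) 1 * (E v * matOf F.1 v)) = matOf F.1 v
    rw [mv_one_mul (left_inv_E hE (hB v)), ← mulA, hE, mone_mul]
  have hd : ∀ v, (B v * ((E v)ᴴ * (toGr hE F).1 v * (E v * matOf F.1 v))).det ≠ 0 := fun v => by
    simp_all
  have hc : ∀ v, Continuous fun q : Gr s t (pE E) (mE E M) e =>
      (E v)ᴴ * q.1 v * (E v * matOf F.1 v) := fun v =>
    (continuous_const.matrix_mul ((continuous_apply v).comp continuous_subtype_val)).matrix_mul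
      continuous_const
  refine ⟨g, ?_, ?_, hg1⟩
  · refine Topology.IsInducing.continuousAt_iff (Topology.IsInducing.mk rfl) |>.2 ?_
    have h1 : Continuous fun (q : Gr s t (pE E) (mE E M) e) (x : Σ i : V, Fin (d i) × Fin (e i)) =>
        ((E x.1)ᴴ * q.1 x.1 * (E x.1 * matOf F.1 x.1)) x.2.1 x.2.2 :=
      continuous_pi fun x => (hc x.1).matrix_elem _ _
    refine h1.continuousAt.congr ?_
    have h2 : ∀ᶠ q in nhds (toGr hE F),
        ∀ v, (B v * ((E v)ᴴ * q.1 v * (E v * matOf F.1 v))).det ≠ 0 :=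
      Filter.eventually_all.2 fun v =>
        (continuous_const.matrix_mul (hc v)).matrix_det.continuousAt.eventually_ne (hd v)
    filter_upwards [h2] with q hq
    exact (hg2 q hq).symm
  · refine sext ((hg2 _ hd).trans ?_)
    funext x
    rw [hF]
    rfl

lemma toSub_surj : Function.Surjective (toSub s t M e) := fun N => by
  have b : ∀ v, (Fin (e v) → ℂ) ≃ₗ[ℂ] N.1 v := fun v =>
    LinearEquiv.ofFinrankEq _ _ ((Module.finrank_fin_fun ℂ).trans (N.2.1 v).symm)
  obtain ⟨F, hF⟩ : ∃ F : ∀ v, Matrix (Fin (d v)) (Fin (e v)) ℂ, ∀ v, (F v).mulVecLin =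
      (N.1 v).subtype ∘ₗ (b v).toLinearMap :=
    ⟨fun v => LinearMap.toMatrix' ((N.1 v).subtype ∘ₗ (b v).toLinearMap), fun v => by
      rw [← toLin'_apply', toLin'_toMatrix']⟩
  have h1 : ∀ v, lrange (F v).mulVecLin = N.1 v := fun v => by simp_all
  refine ⟨⟨fun x => F x.1 x.2.1 x.2.2, fun v => ?_, fun a => ?_⟩, sext (funext h1)⟩
  · change Injective (F v).mulVecLin
    rw [hF]
    exact Subtype.val_injective.comp (b v).injective
  · change (lrange (F (s a)).mulVecLin).map _ ≤ lrange (F (t a)).mulVecLin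
    rw [h1, h1]
    exact N.2.2 a

lemma toSub_eq_iff (hE : ∀ v, (E v)ᴴ * E v = 1) (F G : StQ s t M e) :
    toSub s t M e F = toSub s t M e G ↔ toGr hE F = toGr hE G := by
  choose B hB using stq_left_inv F
  choose B' hB' using stq_left_inv G
  refine Subtype.ext_iff.trans (Iff.trans ?_ Subtype.ext_iff.symm)
  rw [funext_iff, funext_iff]
  refine forall_congr' fun v => ?_
  change lrange (matOf F.1 v).mulVecLin = lrange (matOf G.1 v).mulVecLin ↔
    mv (E v * matOf F.1 v) 1 = mv (E v * matOf G.1 v) 1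
  have h1 := left_inv_E hE (hB v)
  have h2 := left_inv_E hE (hB' v)
  have key : ∀ F G : Matrix (Fin (d v)) (Fin (e v)) ℂ, mv (E v * G) 1 * (E v * F) = E v * F →
      ∃ X : Matrix (Fin (e v)) (Fin (e v)) ℂ, F = G * X := fun F G h => by
    rw [mv_one_factor, mulA, mulA] at h
    have h4 := congrArg ((E v)ᴴ * ·) h
    beta_reduce at h4
    rw [← mulA, hE, mone_mul, ← mulA (E v)ᴴ (E v) F, hE, mone_mul] at h4
    exact ⟨_, h4.symm⟩
  constructor
  · intro h
    obtain ⟨X, hX⟩ := range_le_iff.1 h.le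
    refine (mv_proj IsProj.one h1).eq_of_trace (mv_proj IsProj.one h2) (mul_mv_one ?_)
      ((mv_one_trace h1).trans (mv_one_trace h2).symm)
    conv_lhs => rw [hX, ← mulA (E v), ← mulA, mv_one_mul h2]
    rw [hX, mulA]
  · intro h
    refine le_antisymm (range_le_iff.2 (key _ _ ?_)) (range_le_iff.2 (key _ _ ?_))
    · rw [← h, mv_one_mul h1]
    · rw [h, mv_one_mul h2]

/-- The quiver Grassmannian is homeomorphic to a space of projections. -/
lemma nonempty_homeo [Finite V] (hE : ∀ v, (E v)ᴴ * E v = 1) :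
    Nonempty (SubRep s t M e ≃ₜ Gr s t (pE E) (mE E M) e) := by
  obtain ⟨f, hf⟩ : ∃ f : C(StQ s t M e, SubRep s t M e), ⇑f = toSub s t M e :=
    ⟨⟨toSub s t M e, continuous_coinduced_rng⟩, rfl⟩
  obtain ⟨g, hg⟩ : ∃ g : C(StQ s t M e, Gr s t (pE E) (mE E M) e), ⇑g = toGr hE :=
    ⟨⟨toGr hE, continuous_toGr hE⟩, rfl⟩
  have h1 : Topology.IsQuotientMap f := hf ▸ ⟨⟨rfl⟩, toSub_surj⟩
  have h2 : Topology.IsQuotientMap g := hg ▸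
    (isOpenMap_toGr hE).isQuotientMap (continuous_toGr hE) (toGr_surj hE)
  have h3 : Setoid.ker f = Setoid.ker g := by
    rw [hf, hg]
    exact Setoid.ext fun F G => toSub_eq_iff hE F G
  have h4 := h2.homeomorph
  rw [← h3] at h4
  exact ⟨h1.homeomorph.symm.trans h4⟩

/-- The coordinate inclusions. -/
def cI (d : V → ℕ) [DecidableEq V] (v : V) : Matrix (Σ v, Fin (d v)) (Fin (d v)) ℂ :=
  (1 : Matrix (Σ v, Fin (d v)) (Σ v, Fin (d v)) ℂ).submatrix id fun p : Fin (d v) => (⟨v, p⟩ : Σ v, Fin (d v))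

lemma cI_mul [Fintype V] [DecidableEq V] (v : V) : (cI d v)ᴴ * cI d v = 1 := by
  rw [cI, conjTranspose_submatrix, conjTranspose_one,
    ← submatrix_mul _ _ _ _ _ Function.bijective_id, mone_mul]
  exact submatrix_one _ fun p q h => eq_of_heq (Sigma.mk.inj h).2

end Link

end QG

/-- `Gr_e(M)` has no odd cohomology and `χ(Gr_e(M)) ≥ 0` for
indecomposable `M` over a Dynkin quiver. -/
theorem no_odd_cohomology_indec [Fintype V] [Fintype A] (s t : A → V)
    (hQ : IsDynkin s t) (d : V → ℕ) (M : QRep s t d) (hM : Indec s t M)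
    (e : V → ℕ) :
    (∀ n : ℕ, Odd n → Subsingleton (Hcoh n (SubRep s t M e))) ∧
    0 ≤ eulerChar (SubRep s t M e) := by
  classical
  obtain ⟨f⟩ := QG.nonempty_homeo (E := QG.cI d) QG.cI_mul
  exact QG.cohomology_of_ov ((QG.QI_of_homeo f).ov_iff.2 (QG.ov_of_isInd
    (QG.isPos_of_isDynkin hQ) (QG.isRep_mE QG.cI_mul) (QG.isInd_mE QG.cI_mul hM) e))

end
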